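/- Let p be a prime with p ≡ 9 (mod 16) such that 2 is a fourth power residue modulo p, and write p = u² - 2v² with positive integers u, v and u ≡ 1 (mod 8). Then for every n ≥ 1, the 2-class group of L_{n,p} is isomorphic to (ℤ/2ℤ) × (ℤ/2^{n+1}ℤ) if and only if u is a quadratic residue modulo p but not a fourth power residue modulo p. -/

import Mathlib

open IntermediateField NumberField

/-- The quadratic field `ℚ(√m)` realized inside `ℂ` (for `m` of either sign). -/
noncomputable def quadField (m : ℤ) : IntermediateField ℚ ℂ :=
  IntermediateField.adjoin ℚ {z : ℂ | z ^ 2 = (m : ℂ)}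

/-- The 2-class group of a number field `K ⊆ ℂ`: the 2-primary component
(= 2-Sylow subgroup) of the ideal class group of its ring of integers. -/
noncomputable def twoClassGroup (K : IntermediateField ℚ ℂ) :
    Subgroup (ClassGroup (𝓞 K)) :=
  CommGroup.primaryComponent _ 2

/-- `h₂(m)`: the 2-class number of the quadratic field `ℚ(√m)`. -/
noncomputable def h2 (m : ℤ) : ℕ := Nat.card (twoClassGroup (quadField m))

/-- `L_{n,d} = ℚ(ζ_{2^{n+2}}, √d)`, the `n`-th layer of the cyclotomic
`ℤ₂`-extension of `ℚ(√d, √-1)`. -/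
noncomputable def Lfield (n : ℕ) (d : ℤ) : IntermediateField ℚ ℂ :=
  IntermediateField.adjoin ℚ
    ({z : ℂ | z ^ 2 ^ (n + 2) = 1} ∪ {z : ℂ | z ^ 2 = (d : ℂ)})

/-- `ℚ(ζ_{2^{n+2}} + ζ_{2^{n+2}}⁻¹, √d) = ℚ(2cos(2π/2^{n+2}), √d)`.
For `d > 0` this is the maximal real subfield `L_{n,d}⁺` of `L_{n,d}`;
for `d < 0` it is the `n`-th layer `K_{n,|d|}` of the cyclotomic
`ℤ₂`-extension of the imaginary quadratic field `ℚ(√d)`. -/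
noncomputable def LplusField (n : ℕ) (d : ℤ) : IntermediateField ℚ ℂ :=
  IntermediateField.adjoin ℚ
    ({((2 * Real.cos (2 * Real.pi / 2 ^ (n + 2)) : ℝ) : ℂ)} ∪ {z : ℂ | z ^ 2 = (d : ℂ)})



/-! ### Group lemmas -/

/-- `x` has odd order. -/
def OddOrd {C : Type*} [Group C] (x : C) : Prop := ∃ k : ℕ, Odd k ∧ x ^ k = 1

section OddOrd
variable {C D : Type*} [CommGroup C] [CommGroup D]

theorem OddOrd.one : OddOrd (1 : C) := ⟨1, odd_one, by simp⟩

theorem OddOrd.mul {x y : C} (hx : OddOrd x) (hy : OddOrd y) : OddOrd (x * y) := by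
  obtain ⟨k, hk, h1⟩ := hx
  obtain ⟨l, hl, h2⟩ := hy
  refine ⟨k * l, hk.mul hl, ?_⟩
  rw [mul_pow, pow_mul, h1, mul_comm k l, pow_mul, h2]; simp

theorem OddOrd.inv {x : C} (hx : OddOrd x) : OddOrd x⁻¹ := by
  obtain ⟨k, hk, h1⟩ := hx
  exact ⟨k, hk, by rw [inv_pow, h1, inv_one]⟩

theorem OddOrd.pow {x : C} (hx : OddOrd x) (n : ℕ) : OddOrd (x ^ n) := by
  obtain ⟨k, hk, h1⟩ := hx
  exact ⟨k, hk, by rw [← pow_mul, mul_comm, pow_mul, h1, one_pow]⟩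

theorem OddOrd.of_pow {x : C} {n : ℕ} (hn : Odd n) (hx : OddOrd (x ^ n)) : OddOrd x := by
  obtain ⟨k, hk, h1⟩ := hx
  exact ⟨n * k, hn.mul hk, by rw [pow_mul, h1]⟩

theorem OddOrd.map {x : C} (hx : OddOrd x) (f : C →* D) : OddOrd (f x) := by
  obtain ⟨k, hk, h1⟩ := hx
  exact ⟨k, hk, by rw [← map_pow, h1, map_one]⟩

theorem OddOrd.of_card {x : C} (h : Odd (Nat.card C)) : OddOrd x :=
  ⟨_, h, pow_card_eq_one'⟩

theorem OddOrd.eq_one {x : C} (hx : OddOrd x) {n : ℕ} (h : x ^ 2 ^ n = 1) : x = 1 := by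
  obtain ⟨k, hk, h1⟩ := hx
  have hc : Nat.Coprime k (2 ^ n) := Nat.Coprime.pow_right _ (Nat.coprime_two_right.2 hk)
  have := orderOf_dvd_of_pow_eq_one h1
  have h2 := orderOf_dvd_of_pow_eq_one h
  have := Nat.dvd_gcd this h2
  rw [hc] at this
  exact orderOf_eq_one_iff.1 (Nat.dvd_one.1 this)

theorem OddOrd.eq_one' {x : C} (hx : OddOrd x) (h : x ^ 2 = 1) : x = 1 :=
  hx.eq_one (n := 1) (by simpa using h)

theorem oddOrd_exists_pow [Finite C] (x : C) : ∃ N : ℕ, OddOrd (x ^ 2 ^ N) := by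
  have h0 : Nat.card C ≠ 0 := Nat.card_pos.ne'
  obtain ⟨N, m, hm, h⟩ := Nat.exists_eq_two_pow_mul_odd h0
  refine ⟨N, m, hm, ?_⟩
  rw [← pow_mul, ← h, pow_card_eq_one']

theorem OddOrd.mono {x : C} {a b : ℕ} (hab : a ≤ b) (h : OddOrd (x ^ 2 ^ a)) :
    OddOrd (x ^ 2 ^ b) := by
  obtain ⟨c, rfl⟩ := Nat.exists_eq_add_of_le hab
  rw [pow_add, pow_mul]; exact h.pow _

/-- `x` and `y` agree up to odd order. -/
theorem OddOrd.div_pow {x y : C} (h : OddOrd (x / y)) (n : ℕ) : OddOrd (x ^ n / y ^ n) := by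
  rw [← _root_.div_pow]; exact h.pow n

theorem OddOrd.of_div {x y : C} (h : OddOrd (x / y)) (hy : OddOrd y) : OddOrd x := by
  simpa using h.mul hy

theorem OddOrd.of_div' {x y : C} (h : OddOrd (x / y)) (hx : OddOrd x) : OddOrd y := by
  simpa using h.inv.mul hx

theorem OddOrd.trans_div {x y z : C} (h : OddOrd (x / y)) (h' : OddOrd (y / z)) :
    OddOrd (x / z) := by
  simpa using h.mul h'

/-- Frattini type argument -/
theorem oddOrd_gen [Finite C] (H : Subgroup C) (h : ∀ x : C, ∃ y ∈ H, ∃ w : C, x = y * w ^ 2)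
    (x : C) : ∃ y ∈ H, OddOrd (x / y) := by
  have key : ∀ N : ℕ, ∃ y ∈ H, ∃ w : C, x = y * w ^ 2 ^ N := by
    intro N
    induction N with
    | zero => exact ⟨1, H.one_mem, x, by simp⟩
    | succ N ih =>
      obtain ⟨y, hy, w, hw⟩ := ih
      obtain ⟨y', hy', w', hw'⟩ := h w
      refine ⟨y * y' ^ 2 ^ N, H.mul_mem hy (H.pow_mem hy' _), w', ?_⟩
      rw [hw, hw', mul_pow, ← pow_mul, pow_succ 2 N, mul_comm 2, mul_assoc]
  have h0 : Nat.card C ≠ 0 := Nat.card_pos.ne'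
  obtain ⟨N, m, hm, hN⟩ := Nat.exists_eq_two_pow_mul_odd h0
  obtain ⟨y, hy, w, hw⟩ := key N
  refine ⟨y, hy, m, hm, ?_⟩
  rw [hw, mul_div_cancel_left, ← pow_mul, ← hN, pow_card_eq_one']

end OddOrd

/-- squares have index the number of 2-torsion elements -/
theorem index_sq_eq {C : Type*} [CommGroup C] [Finite C] :
    (powMonoidHom 2 : C →* C).range.index = Nat.card (powMonoidHom 2 : C →* C).ker := by
  have h1 := (powMonoidHom 2 : C →* C).ker.card_mul_index
  have h2 := (powMonoidHom 2 : C →* C).range.card_mul_index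
  rw [Subgroup.index_ker] at h1
  have : 0 < Nat.card (powMonoidHom 2 : C →* C).range := Nat.card_pos
  rw [← h1, mul_comm] at h2
  exact Nat.eq_of_mul_eq_mul_right this h2

theorem odd_card_of_ker {C : Type*} [CommGroup C] [Finite C]
    (h : Nat.card (powMonoidHom 2 : C →* C).ker ≤ 1) : Odd (Nat.card C) := by
  by_contra hc
  rw [Nat.not_odd_iff_even, even_iff_two_dvd] at hc
  obtain ⟨x, hx⟩ := exists_prime_orderOf_dvd_card' 2 hc
  have : Finite (powMonoidHom 2 : C →* C).ker := inferInstance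
  have := (Finite.card_le_one_iff_subsingleton.1 h).elim
    (⟨x, by simp [← hx, pow_orderOf_eq_one]⟩ : (powMonoidHom 2 : C →* C).ker) 1
  rw [Subtype.ext_iff] at this
  simp at this
  subst this; simp at hx

/-- Abstract Herbrand quotient inequality. -/
theorem herbrand_ineq {E : Type*} [CommGroup E] (g : E →* E) (hg : ∀ x, g (g x) = x)
    (EK Em : Subgroup E) (hK : ∀ x, x ∈ EK ↔ g x = x) (hm : ∀ x, x ∈ Em ↔ x * g x = 1)
    (N D : E →* E) (hN : ∀ x, N x = x * g x) (hD : ∀ x, D x = x / g x)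
    (e : E) (he1 : e ≠ 1) (hge : g e = e) (he : ∀ x : E, x ^ 2 = 1 ↔ x = 1 ∨ x = e)
    (rM rK : ℕ) (hM : (powMonoidHom 2 : E →* E).range.index = 2 ^ (rM + 1))
    (hKi : (powMonoidHom 2 : EK →* EK).range.index = 2 ^ (rK + 1))
    (hD0 : D.range.relIndex Em ≠ 0) :
    N.range.relIndex EK * 2 ^ rM ≤ D.range.relIndex Em * 2 ^ (2 * rK) ∧
      N.range.relIndex EK ≠ 0 := by
  set sq : E →* E := powMonoidHom 2 with hsq
  have hsqa : ∀ x, sq x = x ^ 2 := fun x => rfl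
  set C := EK ⊔ Em with hC
  have hee : e ^ 2 = 1 := (he e).2 (Or.inr rfl)
  have heK : e ∈ EK := (hK e).2 hge
  have hem : e ∈ Em := (hm e).2 (by rw [hge, ← _root_.sq]; exact hee)
  have hNK : N.range ≤ EK := by
    rintro _ ⟨x, rfl⟩; rw [hK, hN, map_mul, hg, mul_comm]
  have hDm : D.range ≤ Em := by
    rintro _ ⟨x, rfl⟩; rw [hm, hD, map_div, hg]; simp
  have hNC : C.map N = EK.map sq := by
    rw [hC, Subgroup.map_sup]
    have : Em.map N = ⊥ := by
      rw [eq_bot_iff]; rintro _ ⟨x, hx, rfl⟩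
      rw [hN, (hm x).1 hx]; exact Subgroup.one_mem _
    rw [this, sup_bot_eq]
    ext y; constructor
    · rintro ⟨x, hx, rfl⟩; exact ⟨x, hx, by rw [hN, (hK x).1 hx, hsqa, _root_.sq]⟩
    · rintro ⟨x, hx, rfl⟩; exact ⟨x, hx, by rw [hN, (hK x).1 hx, hsqa, _root_.sq]⟩
  have hDC : C.map D = Em.map sq := by
    rw [hC, Subgroup.map_sup]
    have : EK.map D = ⊥ := by
      rw [eq_bot_iff]; rintro _ ⟨x, hx, rfl⟩
      rw [hD, (hK x).1 hx, div_self']; exact Subgroup.one_mem _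
    rw [this, bot_sup_eq]
    have hinv : ∀ x ∈ Em, D x = sq x := by
      intro x hx
      have := (hm x).1 hx
      rw [hD, hsqa, ← inv_eq_of_mul_eq_one_right this, div_inv_eq_mul, _root_.sq]
    ext y; constructor
    · rintro ⟨x, hx, rfl⟩; exact ⟨x, hx, (hinv x hx).symm⟩
    · rintro ⟨x, hx, rfl⟩; exact ⟨x, hx, hinv x hx⟩
  have hNi : (C.map N).relIndex N.range = C.index := by
    rw [MonoidHom.range_eq_map, Subgroup.relIndex_map_map, top_sup_eq, Subgroup.relIndex_top_right]
    congr 1; rw [sup_eq_left]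
    intro x hx; rw [MonoidHom.mem_ker, hN] at hx
    exact Subgroup.mem_sup_right ((hm x).2 hx)
  have hDi : (C.map D).relIndex D.range = C.index := by
    rw [MonoidHom.range_eq_map, Subgroup.relIndex_map_map, top_sup_eq, Subgroup.relIndex_top_right]
    congr 1; rw [sup_eq_left]
    intro x hx; rw [MonoidHom.mem_ker, hD, div_eq_one] at hx
    exact Subgroup.mem_sup_left ((hK x).2 hx.symm)
  have hSi : (C.map sq).relIndex sq.range = C.index := by
    rw [MonoidHom.range_eq_map, Subgroup.relIndex_map_map, top_sup_eq, Subgroup.relIndex_top_right]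
    congr 1; rw [sup_eq_left]
    intro x hx; rw [MonoidHom.mem_ker, hsqa, he] at hx
    rcases hx with rfl | rfl
    · exact C.one_mem
    · exact Subgroup.mem_sup_left heK
  have hmapsub : ∀ H : Subgroup E, (H.map sq).relIndex H = (powMonoidHom 2 : H →* H).range.index := by
    intro H
    rw [Subgroup.relIndex]
    congr 1
    ext ⟨y, hy⟩
    simp only [Subgroup.mem_subgroupOf, Subgroup.mem_map, MonoidHom.mem_range]
    constructor
    · rintro ⟨x, hx, h⟩; exact ⟨⟨x, hx⟩, Subtype.ext h⟩
    · rintro ⟨⟨x, hx⟩, h⟩; exact ⟨x, hx, congrArg Subtype.val h⟩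
  have hsqle : sq.range ≤ C := by
    rintro _ ⟨x, rfl⟩
    have : sq x = N x * D x := by rw [hsqa, hN, hD]; simp [_root_.sq]
    rw [this]
    exact Subgroup.mul_mem_sup (hNK ⟨x, rfl⟩) (hDm ⟨x, rfl⟩)
  have hCfin : C.index ≠ 0 := by
    have := Subgroup.index_dvd_of_le hsqle
    rw [hM] at this
    intro h0; rw [h0] at this; simp at this
  have hmapsqle : ∀ H : Subgroup E, H.map sq ≤ H := by
    rintro H _ ⟨x, hx, rfl⟩; exact H.pow_mem hx 2
  have e1 : N.range.relIndex EK * C.index = 2 ^ (rK + 1) := by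
    rw [← hNi, mul_comm, Subgroup.relIndex_mul_relIndex _ _ _ (Subgroup.map_le_range _ _) hNK, hNC,
      hmapsub, hKi]
  have e2 : D.range.relIndex Em * C.index = (Em.map sq).relIndex Em := by
    rw [← hDi, mul_comm, Subgroup.relIndex_mul_relIndex _ _ _ (Subgroup.map_le_range _ _) hDm, hDC]
  have e3 : (C.map sq).relIndex C = 2 ^ (rM + 1) := by
    have h1 := Subgroup.relIndex_mul_index (hmapsqle C)
    have h2 := Subgroup.relIndex_mul_index (Subgroup.map_le_range sq C)
    rw [hSi, hM, ← h1] at h2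
    rw [mul_comm] at h2
    exact (Nat.eq_of_mul_eq_mul_right (Nat.pos_of_ne_zero hCfin) h2).symm
  -- the main inequality
  let f : EK × Em →* E := MonoidHom.coprod EK.subtype Em.subtype
  have hfr : f.range = C := by
    ext y
    rw [hC, Subgroup.mem_sup]
    constructor
    · rintro ⟨⟨a, b⟩, rfl⟩; exact ⟨a, a.2, b, b.2, by simp [f]⟩
    · rintro ⟨a, ha, b, hb, rfl⟩; exact ⟨(⟨a, ha⟩, ⟨b, hb⟩), by simp [f]⟩
  have hker : (Subgroup.comap f (C.map sq)).index = 2 ^ (rM + 1) := by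
    rw [Subgroup.index_comap, hfr, e3]
  let H : Subgroup (EK × Em) := (powMonoidHom 2 : EK →* EK).range.prod (powMonoidHom 2 : Em →* Em).range
  have hHi : H.index = 2 ^ (rK + 1) * (Em.map sq).relIndex Em := by
    rw [Subgroup.index_prod, hKi, hmapsub]
  have hHle : H ≤ Subgroup.comap f (C.map sq) := by
    rintro ⟨a, b⟩ ⟨⟨x, hx⟩, ⟨y, hy⟩⟩
    simp only at hx hy
    refine ⟨x * y, Subgroup.mul_mem_sup x.2 y.2, ?_⟩
    rw [← hx, ← hy]
    simp [f, hsqa, mul_pow]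
  have hne : H.relIndex (Subgroup.comap f (C.map sq)) ≠ 1 := by
    intro h1
    rw [Subgroup.relIndex_eq_one] at h1
    have hmem : ((⟨e, heK⟩, ⟨e, hem⟩) : EK × Em) ∈ Subgroup.comap f (C.map sq) := by
      rw [Subgroup.mem_comap]
      have : f (⟨e, heK⟩, ⟨e, hem⟩) = 1 := by simp [f, ← _root_.sq, hee]
      rw [this]; exact Subgroup.one_mem _
    obtain ⟨⟨a, ha⟩, ⟨b, hb⟩⟩ := h1 hmem
    have ha' : (a : E) ^ 2 = e := congrArg Subtype.val ha
    have hb' : (b : E) ^ 2 = e := congrArg Subtype.val hb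
    have hab : ((b : E) / a) ^ 2 = 1 := by rw [div_pow, ha', hb', div_self']
    have hbK : (b : E) ∈ EK := by
      rcases (he _).1 hab with h | h
      · rw [div_eq_one] at h; rw [h]; exact a.2
      · rw [div_eq_iff_eq_mul] at h; rw [h]; exact EK.mul_mem heK a.2
    have := (hm b).1 b.2
    rw [(hK b).1 hbK, ← _root_.sq, hb'] at this
    exact he1 this
  have hidx := Subgroup.relIndex_mul_index hHle
  rw [hker, hHi] at hidx
  have hEmpos : (Em.map sq).relIndex Em ≠ 0 := by
    rw [← e2]; exact mul_ne_zero hD0 hCfin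
  have hr0 : H.relIndex (Subgroup.comap f (C.map sq)) ≠ 0 := by
    intro h0
    rw [h0, zero_mul] at hidx
    exact mul_ne_zero (by positivity) hEmpos hidx.symm
  have hr2 : 2 ≤ H.relIndex (Subgroup.comap f (C.map sq)) := by omega
  have hc := Nat.pos_of_ne_zero hCfin
  refine ⟨?_, fun h0 => ?_⟩
  · have h1 : 2 * 2 ^ (rM + 1) ≤ 2 ^ (rK + 1) * (D.range.relIndex Em * C.index) := by
      rw [e2, ← hidx]; exact Nat.mul_le_mul_right _ hr2
    have h2 : (N.range.relIndex EK * 2 ^ rM) * (4 * C.index) ≤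
        (D.range.relIndex Em * 2 ^ (2 * rK)) * (4 * C.index) := by
      calc (N.range.relIndex EK * 2 ^ rM) * (4 * C.index)
          = (N.range.relIndex EK * C.index) * (2 * 2 ^ (rM + 1)) := by ring
        _ ≤ 2 ^ (rK + 1) * (2 ^ (rK + 1) * (D.range.relIndex Em * C.index)) := by
          rw [e1]; exact Nat.mul_le_mul_left _ h1
        _ = (D.range.relIndex Em * 2 ^ (2 * rK)) * (4 * C.index) := by ring
    exact Nat.le_of_mul_le_mul_right h2 (by omega)
  · rw [h0, zero_mul] at e1
    exact absurd e1.symm (by positivity)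


/-! ### Index of squares in unit groups -/

theorem units_sq_eq_one_iff {R : Type*} [CommRing R] [IsDomain R] (x : Rˣ) :
    x ^ 2 = 1 ↔ x = 1 ∨ x = -1 := by
  rw [Units.ext_iff, Units.ext_iff, Units.ext_iff]; push_cast
  exact sq_eq_one_iff

theorem index_sq_congr {G H : Type*} [CommGroup G] [CommGroup H] (f : G ≃* H) :
    (powMonoidHom 2 : G →* G).range.index = (powMonoidHom 2 : H →* H).range.index := by
  have : (powMonoidHom 2 : H →* H).range = (powMonoidHom 2 : G →* G).range.map (f : G →* H) := by
    ext y; constructor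
    · rintro ⟨x, rfl⟩; exact ⟨(f.symm x) ^ 2, ⟨f.symm x, rfl⟩, by simp⟩
    · rintro ⟨_, ⟨x, rfl⟩, rfl⟩; exact ⟨f x, by simp⟩
  rw [this, Subgroup.index_map_equiv]

theorem index_sq_prod {G H : Type*} [CommGroup G] [CommGroup H] :
    (powMonoidHom 2 : G × H →* G × H).range.index =
    (powMonoidHom 2 : G →* G).range.index * (powMonoidHom 2 : H →* H).range.index := by
  rw [← Subgroup.index_prod]
  congr 1
  ext ⟨a, b⟩; constructor
  · rintro ⟨⟨x, y⟩, h⟩; rw [Prod.ext_iff] at h; exact ⟨⟨x, h.1⟩, ⟨y, h.2⟩⟩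
  · rintro ⟨⟨x, hx⟩, ⟨y, hy⟩⟩; exact ⟨⟨x, y⟩, Prod.ext hx hy⟩

theorem index_sq_free (r : ℕ) :
    (powMonoidHom 2 : Multiplicative (Fin r → ℤ) →* Multiplicative (Fin r → ℤ)).range.index
      = 2 ^ r := by
  let f : (Fin r → ℤ) →+ (Fin r → ZMod 2) := (Int.castAddHom (ZMod 2)).compLeft (Fin r)
  have hs : Function.Surjective f := by
    intro y
    exact ⟨fun i => (y i).val, by ext i; simp [f]⟩
  have hk : (powMonoidHom 2 : Multiplicative (Fin r → ℤ) →* Multiplicative (Fin r → ℤ)).range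
      = (AddMonoidHom.toMultiplicative f).ker := by
    ext x; constructor
    · rintro ⟨y, rfl⟩
      rw [MonoidHom.mem_ker]
      apply Multiplicative.toAdd.injective
      ext i
      simp only [f, powMonoidHom_apply]
      change ((2 • (y.toAdd i) : ℤ) : ZMod 2) = 0
      have : (2 : ZMod 2) = 0 := rfl
      simp [this]
    · intro h
      have h' : ∀ i, ((x.toAdd i : ℤ) : ZMod 2) = 0 := fun i =>
        congrFun (congrArg Multiplicative.toAdd h) i
      have h2 : ∀ i, ∃ k, x.toAdd i = 2 * k := fun i => (ZMod.intCast_zmod_eq_zero_iff_dvd _ 2).1 (h' i)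
      choose k hk using h2
      refine ⟨Multiplicative.ofAdd k, ?_⟩
      apply Multiplicative.toAdd.injective
      ext i
      change 2 • k i = _
      rw [hk i]; simp
  rw [hk, Subgroup.index_ker, MonoidHom.range_eq_top.2, Subgroup.card_top]
  · simp [Nat.card_eq_fintype_card]
  · exact hs

theorem units_index_sq (K : Type*) [Field K] [NumberField K] :
    (powMonoidHom 2 : (𝓞 K)ˣ →* (𝓞 K)ˣ).range.index = 2 ^ (Units.rank K + 1) := by
  let f : Units.torsion K × Multiplicative (Fin (Units.rank K) → ℤ) →* (𝓞 K)ˣ :=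
    { toFun := fun x => x.1 * ∏ i, (Units.fundSystem K i) ^ (x.2.toAdd i)
      map_one' := by simp
      map_mul' := by
        intro x y
        simp only [Prod.fst_mul, Subgroup.coe_mul, Prod.snd_mul, toAdd_mul, Pi.add_apply, zpow_add,
          Finset.prod_mul_distrib]
        exact mul_mul_mul_comm _ _ _ _ }
  have hf : Function.Bijective f := by
    rw [Function.bijective_iff_existsUnique]
    intro y
    obtain ⟨⟨a, b⟩, h1, h2⟩ := Units.exist_unique_eq_mul_prod K y
    refine ⟨(a, Multiplicative.ofAdd b), h1.symm, ?_⟩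
    rintro ⟨c, d⟩ hcd
    have := h2 (c, d.toAdd) hcd.symm
    rw [Prod.ext_iff] at this ⊢
    exact ⟨this.1, congrArg Multiplicative.ofAdd this.2⟩
  rw [← index_sq_congr (MulEquiv.ofBijective f hf), index_sq_prod, index_sq_free, index_sq_eq, pow_succ,
    mul_comm]
  congr 1
  rw [Nat.card_eq_two_iff]
  refine ⟨1, ⟨⟨-1, ?_⟩, ?_⟩, ?_, ?_⟩
  · rw [Units.torsion, CommGroup.mem_torsion]
    exact isOfFinOrder_iff_pow_eq_one.2 ⟨2, by norm_num, by simp⟩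
  · rw [MonoidHom.mem_ker]; apply Subtype.ext; simp
  · intro h
    have h1 := congrArg (fun x => ((x.1.1 : (𝓞 K)ˣ) : 𝓞 K)) h
    simp only [OneMemClass.coe_one, Units.val_one, Units.val_neg] at h1
    have h2 : (2 : 𝓞 K) = 0 := by linear_combination h1
    exact two_ne_zero h2
  · rw [Set.eq_univ_iff_forall]
    rintro ⟨⟨x, hx⟩, hx2⟩
    have h1 : x ^ 2 = 1 := congrArg Subtype.val hx2
    rcases (units_sq_eq_one_iff x).1 h1 with rfl | rfl
    · left; rfl
    · right; rfl

set_option linter.unusedSectionVars false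

/-! ### Ideal classes -/
section classes
variable {K M : Type*} [Field K] [NumberField K] [Field M] [NumberField M]

open Classical in
/-- The class of an ideal (with value `1` on the zero ideal). -/
noncomputable def cl (I : Ideal (𝓞 M)) : ClassGroup (𝓞 M) :=
  if h : I ≠ ⊥ then ClassGroup.mk0 ⟨I, mem_nonZeroDivisors_of_ne_zero h⟩ else 1

theorem cl_def {I : Ideal (𝓞 M)} (h : I ≠ ⊥) :
    cl I = ClassGroup.mk0 ⟨I, mem_nonZeroDivisors_of_ne_zero h⟩ := by
  rw [cl, dif_pos h]

theorem cl_mul {I J : Ideal (𝓞 M)} (hI : I ≠ ⊥) (hJ : J ≠ ⊥) : cl (I * J) = cl I * cl J := by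
  have h : I * J ≠ ⊥ := mul_ne_zero hI hJ
  rw [cl_def hI, cl_def hJ, cl_def h, ← map_mul]
  rfl

theorem cl_top : cl (⊤ : Ideal (𝓞 M)) = 1 := by
  rw [cl_def (by simp), ClassGroup.mk0_eq_one_iff]
  exact ⟨1, by simp⟩

theorem cl_eq_one_iff {I : Ideal (𝓞 M)} (h : I ≠ ⊥) : cl I = 1 ↔ ∃ x, x ≠ 0 ∧ I = Ideal.span {x} := by
  rw [cl_def h, ClassGroup.mk0_eq_one_iff]
  constructor
  · rintro ⟨x, hx⟩
    refine ⟨x, ?_, hx⟩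
    rintro rfl
    exact h (by rw [hx]; simp)
  · rintro ⟨x, -, hx⟩
    exact ⟨x, hx⟩

theorem cl_span (x : 𝓞 M) : cl (Ideal.span {x}) = 1 := by
  by_cases hx : x = 0
  · subst hx; rw [cl, dif_neg (by simp)]
  · exact (cl_eq_one_iff (by simpa using hx)).2 ⟨x, hx, rfl⟩

theorem cl_pow {I : Ideal (𝓞 M)} (hI : I ≠ ⊥) (n : ℕ) : cl (I ^ n) = cl I ^ n := by
  induction n with
  | zero => simpa using cl_top
  | succ n ih => rw [pow_succ, pow_succ, cl_mul (pow_ne_zero n hI) hI, ih]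

theorem cl_surj (c : ClassGroup (𝓞 M)) : ∃ I : Ideal (𝓞 M), I ≠ ⊥ ∧ cl I = c := by
  obtain ⟨⟨I, hI⟩, rfl⟩ := ClassGroup.mk0_surjective c
  exact ⟨I, nonZeroDivisors.ne_zero hI, cl_def (nonZeroDivisors.ne_zero hI)⟩

theorem cl_eq_iff {I J : Ideal (𝓞 M)} (hI : I ≠ ⊥) (hJ : J ≠ ⊥) :
    cl I = cl J ↔ ∃ x y : 𝓞 M, x ≠ 0 ∧ y ≠ 0 ∧ Ideal.span {x} * I = Ideal.span {y} * J := by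
  rw [cl_def hI, cl_def hJ, ClassGroup.mk0_eq_mk0_iff]
  constructor
  · rintro ⟨x, y, hx, hy, h⟩; exact ⟨x, y, hx, hy, h⟩
  · rintro ⟨x, y, hx, hy, h⟩; exact ⟨x, y, hx, hy, h⟩

/-- Homomorphisms from the class group. -/
noncomputable def clHom {G : Type*} [CommGroup G] (φ : Ideal (𝓞 M) → G)
    (h1 : ∀ I J, I ≠ ⊥ → J ≠ ⊥ → φ (I * J) = φ I * φ J)
    (h2 : ∀ x, x ≠ 0 → φ (Ideal.span {x}) = 1) : ClassGroup (𝓞 M) →* G :=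
  MonoidHom.mk' (fun c => φ (cl_surj c).choose) (by
    intro a b
    obtain ⟨ha, ha'⟩ := (cl_surj a).choose_spec
    obtain ⟨hb, hb'⟩ := (cl_surj b).choose_spec
    obtain ⟨hc, hc'⟩ := (cl_surj (a * b)).choose_spec
    rw [← h1 _ _ ha hb]
    have : cl (cl_surj (a * b)).choose = cl ((cl_surj a).choose * (cl_surj b).choose) := by
      rw [cl_mul ha hb, ha', hb', hc']
    rw [cl_eq_iff hc (mul_ne_zero ha hb)] at this
    obtain ⟨x, y, hx, hy, h⟩ := this
    have h' := congrArg φ h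
    rw [h1 _ _ (by simpa using hx) hc, h1 _ _ (by simpa using hy) (mul_ne_zero ha hb), h2 x hx, h2 y hy,
      one_mul, one_mul] at h'
    exact h')

theorem clHom_cl {G : Type*} [CommGroup G] (φ : Ideal (𝓞 M) → G)
    (h1 : ∀ I J, I ≠ ⊥ → J ≠ ⊥ → φ (I * J) = φ I * φ J)
    (h2 : ∀ x, x ≠ 0 → φ (Ideal.span {x}) = 1) {I : Ideal (𝓞 M)} (hI : I ≠ ⊥) :
    clHom φ h1 h2 (cl I) = φ I := by
  obtain ⟨hc, hc'⟩ := (cl_surj (cl I)).choose_spec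
  change φ (cl_surj (cl I)).choose = _
  rw [cl_eq_iff hc hI] at hc'
  obtain ⟨x, y, hx, hy, h⟩ := hc'
  have h' := congrArg φ h
  rw [h1 _ _ (by simpa using hx) hc, h1 _ _ (by simpa using hy) hI, h2 x hx, h2 y hy,
      one_mul, one_mul] at h'
  exact h'

/-! ### Action of ring automorphisms -/

/-- The action of an automorphism on integers. -/
noncomputable def oi (g : M ≃+* M) : 𝓞 M ≃+* 𝓞 M := RingOfIntegers.mapRingEquiv g

@[simp] theorem oi_coe (g : M ≃+* M) (x : 𝓞 M) : ((oi g x : 𝓞 M) : M) = g x := rfl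

/-- The action of an automorphism on ideals. -/
noncomputable def act (g : M ≃+* M) (I : Ideal (𝓞 M)) : Ideal (𝓞 M) := I.map (oi g)

theorem act_mul (g : M ≃+* M) (I J : Ideal (𝓞 M)) : act g (I * J) = act g I * act g J :=
  Ideal.map_mul _ _ _

theorem act_pow (g : M ≃+* M) (I : Ideal (𝓞 M)) (n : ℕ) : act g (I ^ n) = act g I ^ n :=
  Ideal.map_pow _ _ _

theorem act_span (g : M ≃+* M) (x : 𝓞 M) : act g (Ideal.span {x}) = Ideal.span {oi g x} := by
  rw [act, Ideal.map_span, Set.image_singleton]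

theorem act_span_set (g : M ≃+* M) (S : Set (𝓞 M)) : act g (Ideal.span S) = Ideal.span (oi g '' S) :=
  Ideal.map_span _ _

theorem mem_act (g : M ≃+* M) {I : Ideal (𝓞 M)} {x : 𝓞 M} (hx : x ∈ I) : oi g x ∈ act g I :=
  Ideal.mem_map_of_mem _ hx

theorem act_act (g h : M ≃+* M) (I : Ideal (𝓞 M)) : act g (act h I) = act (h.trans g) I := by
  exact Ideal.map_map (oi h : 𝓞 M →+* 𝓞 M) (oi g : 𝓞 M →+* 𝓞 M)

theorem act_refl {g : M ≃+* M} (hg : ∀ x, g x = x) (I : Ideal (𝓞 M)) : act g I = I := by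
  have : oi g = RingEquiv.refl _ := by ext x; simp [hg]
  rw [act, this]
  exact Ideal.map_id I

theorem act_inj (g : M ≃+* M) {I J : Ideal (𝓞 M)} (h : act g I = act g J) : I = J := by
  have := congrArg (act g.symm) h
  rwa [act_act, act_act, act_refl (by simp), act_refl (by simp)] at this

theorem act_bot (g : M ≃+* M) : act g (⊥ : Ideal (𝓞 M)) = ⊥ := Ideal.map_bot

theorem act_top (g : M ≃+* M) : act g (⊤ : Ideal (𝓞 M)) = ⊤ := Ideal.map_top _

theorem act_ne_bot (g : M ≃+* M) {I : Ideal (𝓞 M)} (h : I ≠ ⊥) : act g I ≠ ⊥ := fun h' =>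
  h (act_inj g (by rw [h', act_bot]))

theorem act_absNorm (g : M ≃+* M) (I : Ideal (𝓞 M)) : Ideal.absNorm (act g I) = Ideal.absNorm I := by
  rw [Ideal.absNorm_apply, Ideal.absNorm_apply, Submodule.cardQuot_apply, Submodule.cardQuot_apply]
  exact Nat.card_congr (Ideal.quotientEquiv I (act g I) (oi g) rfl).symm.toEquiv

theorem mem_act_iff (g : M ≃+* M) {I : Ideal (𝓞 M)} {x : 𝓞 M} : oi g x ∈ act g I ↔ x ∈ I := by
  constructor
  · intro h
    have := mem_act g.symm h
    rw [act_act, act_refl (by simp)] at this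
    convert this using 1
    ext; simp
  · exact mem_act g

theorem act_isPrime (g : M ≃+* M) {I : Ideal (𝓞 M)} (h : I.IsPrime) : (act g I).IsPrime := by
  exact Ideal.map_isPrime_of_equiv (oi g)

/-- The action of an automorphism on classes. -/
noncomputable def clAct (g : M ≃+* M) : ClassGroup (𝓞 M) →* ClassGroup (𝓞 M) :=
  clHom (fun I => cl (act g I)) (fun I J hI hJ => by
      rw [act_mul, cl_mul (act_ne_bot g hI) (act_ne_bot g hJ)])
    (fun x _ => by rw [act_span, cl_span])

theorem clAct_cl (g : M ≃+* M) {I : Ideal (𝓞 M)} (hI : I ≠ ⊥) : clAct g (cl I) = cl (act g I) :=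
  clHom_cl _ _ _ hI

variable [Algebra K M]

/-- extension of ideals -/
noncomputable def exi (M : Type*) [Field M] [NumberField M] [Algebra K M] (a : Ideal (𝓞 K)) :
    Ideal (𝓞 M) := a.map (algebraMap (𝓞 K) (𝓞 M))

theorem exi_mul (a b : Ideal (𝓞 K)) : exi M (a * b) = exi M a * exi M b := Ideal.map_mul _ _ _
theorem exi_pow (a : Ideal (𝓞 K)) (n : ℕ) : exi M (a ^ n) = exi M a ^ n := Ideal.map_pow _ _ _
theorem exi_top : exi M (⊤ : Ideal (𝓞 K)) = ⊤ := Ideal.map_top _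
theorem exi_span (x : 𝓞 K) : exi M (Ideal.span {x}) = Ideal.span {algebraMap (𝓞 K) (𝓞 M) x} := by
  rw [exi, Ideal.map_span, Set.image_singleton]
theorem exi_ne_bot {a : Ideal (𝓞 K)} (h : a ≠ ⊥) : exi M a ≠ ⊥ := by
  rw [exi, Ne, Ideal.map_eq_bot_iff_of_injective (FaithfulSMul.algebraMap_injective _ _)]
  exact h

/-- extension on classes -/
noncomputable def lft (M : Type*) [Field M] [NumberField M] [Algebra K M] :
    ClassGroup (𝓞 K) →* ClassGroup (𝓞 M) :=
  clHom (fun I => cl (exi M I)) (fun I J hI hJ => by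
      rw [exi_mul, cl_mul (exi_ne_bot hI) (exi_ne_bot hJ)])
    (fun x _ => by rw [exi_span, cl_span])

theorem lft_cl {I : Ideal (𝓞 K)} (hI : I ≠ ⊥) : lft M (cl I) = cl (exi M I) :=
  clHom_cl _ _ _ hI

theorem absNorm_exi (a : Ideal (𝓞 K)) :
    Ideal.absNorm (exi M a) = Ideal.absNorm a ^ Module.finrank K M := by
  rw [exi, Ideal.absNorm_algebraMap, ← IsFractionRing.finrank_eq (𝓞 K) K (𝓞 M) M]

/-- relative norm of ideals -/
noncomputable def nm (K : Type*) [Field K] [NumberField K] [Algebra K M] (I : Ideal (𝓞 M)) :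
    Ideal (𝓞 K) := Ideal.relNorm (𝓞 K) I

theorem nm_mul (I J : Ideal (𝓞 M)) : nm K (I * J) = nm K I * nm K J := map_mul _ _ _
theorem nm_pow (I : Ideal (𝓞 M)) (n : ℕ) : nm K (I ^ n) = nm K I ^ n := map_pow _ _ _
theorem nm_ne_bot {I : Ideal (𝓞 M)} (h : I ≠ ⊥) : nm K I ≠ ⊥ := by
  rw [nm, Ne, Ideal.relNorm_eq_bot_iff]; exact h
theorem nm_span (x : 𝓞 M) : nm K (Ideal.span {x}) = Ideal.span {RingOfIntegers.norm K x} := by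
  rw [nm, Ideal.relNorm_singleton]
  congr 2
  apply RingOfIntegers.coe_injective
  exact Algebra.algebraMap_intNorm (A := 𝓞 K) (K := K) (L := M) (B := 𝓞 M) x
theorem nm_absNorm (I : Ideal (𝓞 M)) : Ideal.absNorm (nm K I) = Ideal.absNorm I :=
  Ideal.absNorm_relNorm _ _ I
theorem nm_exi (a : Ideal (𝓞 K)) : nm K (exi M a) = a ^ Module.finrank K M := by
  rw [nm, exi, Ideal.relNorm_algebraMap, ← IsFractionRing.finrank_eq (𝓞 K) K (𝓞 M) M]

/-- norm on classes -/
noncomputable def clNm (K : Type*) [Field K] [NumberField K] [Algebra K M] :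
    ClassGroup (𝓞 M) →* ClassGroup (𝓞 K) :=
  clHom (fun I => cl (nm K I)) (fun I J hI hJ => by
      rw [nm_mul, cl_mul (nm_ne_bot hI) (nm_ne_bot hJ)])
    (fun x _ => by rw [nm_span, cl_span])

theorem clNm_cl {I : Ideal (𝓞 M)} (hI : I ≠ ⊥) : clNm K (cl I) = cl (nm K I) :=
  clHom_cl _ _ _ hI

theorem ideal_eq_of_le_of_absNorm {I J : Ideal (𝓞 M)} (h : I ≤ J) (hI : I ≠ ⊥)
    (hn : Ideal.absNorm I = Ideal.absNorm J) : I = J := by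
  obtain ⟨X, hX⟩ := Ideal.dvd_iff_le.2 h
  have hJ : J ≠ ⊥ := fun h' => hI (by rw [hX, h']; simp)
  rw [hX, map_mul] at hn
  have h0 : Ideal.absNorm J ≠ 0 := by rwa [Ne, Ideal.absNorm_eq_zero_iff]
  have : Ideal.absNorm X = 1 := by
    have h1 : Ideal.absNorm J * Ideal.absNorm X = Ideal.absNorm J * 1 := by omega
    exact Nat.eq_of_mul_eq_mul_left (Nat.pos_of_ne_zero h0) h1
  rw [Ideal.absNorm_eq_one_iff] at this
  rw [hX, this, Ideal.mul_top]

theorem exi_nm [IsGalois K M] {I : Ideal (𝓞 M)} (hI : I ≠ ⊥) :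
    exi M (nm K I) = ∏ g : Gal(M/K), act g.toRingEquiv I := by
  have hle : exi M (nm K I) ≤ ∏ g : Gal(M/K), act g.toRingEquiv I := by
    rw [exi, nm, Ideal.relNorm_apply, Ideal.map_span, Ideal.span_le]
    rintro _ ⟨_, ⟨x, hx, rfl⟩, rfl⟩
    have : algebraMap (𝓞 K) (𝓞 M) (Algebra.intNorm (𝓞 K) (𝓞 M) x) =
        ∏ g : Gal(M/K), oi g.toRingEquiv x := by
      apply RingOfIntegers.coe_injective
      have h1 := Algebra.algebraMap_intNorm (A := 𝓞 K) (K := K) (L := M) (B := 𝓞 M) x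
      have h2 := Algebra.norm_eq_prod_automorphisms K (x : M)
      rw [map_prod]
      change algebraMap K M (algebraMap (𝓞 K) K _) = _
      rw [h1]
      exact h2
    rw [this]
    exact Ideal.prod_mem_prod fun g _ => mem_act _ hx
  refine ideal_eq_of_le_of_absNorm hle (exi_ne_bot (nm_ne_bot hI)) ?_
  rw [absNorm_exi, nm_absNorm, map_prod]
  simp only [act_absNorm]
  rw [Finset.prod_const, Finset.card_univ, ← Nat.card_eq_fintype_card, IsGalois.card_aut_eq_finrank]

theorem nm_le {I : Ideal (𝓞 M)} {x : 𝓞 K} (h : x ∈ nm K I) : algebraMap (𝓞 K) (𝓞 M) x ∈ I :=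
  Ideal.relNorm_le_comap (𝓞 K) I h

end classes

set_option linter.unusedSectionVars false

/-! ### Quadratic extensions -/

/-- `M/K` is a quadratic extension with nontrivial automorphism `g`. -/
structure QuadExt (K M : Type*) [Field K] [Field M] [Algebra K M] (g : M ≃+* M) : Prop where
  fix : ∀ x, g x = x ↔ x ∈ Set.range (algebraMap K M)
  inv : ∀ x, g (g x) = x
  ne : ∃ x, g x ≠ x

namespace QuadExt
variable {K M : Type*} [Field K] [NumberField K] [Field M] [NumberField M] [Algebra K M]
  {g : M ≃+* M}

theorem alg (Q : QuadExt K M g) (a : K) : g (algebraMap K M a) = algebraMap K M a := (Q.fix _).2 ⟨a, rfl⟩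

theorem exists_algEquiv (Q : QuadExt K M g) : ∃ G : Gal(M/K), G.toRingEquiv = g :=
  ⟨AlgEquiv.ofRingEquiv (f := g) Q.alg, by ext; rfl⟩

theorem isGalois (Q : QuadExt K M g) : IsGalois K M := by
  obtain ⟨G, hG⟩ := Q.exists_algEquiv
  refine IsGalois.of_fixedField_eq_bot K M ?_
  rw [eq_bot_iff]
  intro x hx
  rw [IntermediateField.mem_fixedField_iff] at hx
  have := hx G (Subgroup.mem_top _)
  rw [IntermediateField.mem_bot]
  rw [← Q.fix, ← hG]
  exact this

theorem finrank (Q : QuadExt K M g) : Module.finrank K M = 2 := by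
  obtain ⟨G, hG⟩ := Q.exists_algEquiv
  have hG' : ∀ x, G x = g x := fun x => by rw [← hG]; rfl
  have ho : orderOf G = 2 := by
    apply orderOf_eq_prime
    · ext x
      rw [pow_two, AlgEquiv.mul_apply, hG', hG', Q.inv]; rfl
    · intro h
      obtain ⟨x, hx⟩ := Q.ne
      exact hx (by rw [← hG', h]; rfl)
  have h1 : IntermediateField.fixedField (Subgroup.zpowers G) = ⊥ := by
    rw [eq_bot_iff]
    intro x hx
    rw [IntermediateField.mem_fixedField_iff] at hx
    have := hx G (Subgroup.mem_zpowers _)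
    rw [IntermediateField.mem_bot]
    rw [← Q.fix, ← hG']
    exact this
  have h2 := IntermediateField.finrank_fixedField_eq_card (Subgroup.zpowers G)
  rw [h1, IntermediateField.finrank_bot', Nat.card_zpowers, ho] at h2
  exact h2

theorem isTotal (Q : QuadExt K M g) (G : Gal(M/K)) (hG : G.toRingEquiv = g) (h : Gal(M/K)) : h = 1 ∨ h = G := by
  classical
  have := Q.isGalois
  have hc : Fintype.card Gal(M/K) = 2 := by
    rw [← Nat.card_eq_fintype_card, IsGalois.card_aut_eq_finrank, Q.finrank]
  have hne : (1 : Gal(M/K)) ≠ G := by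
    intro h
    obtain ⟨x, hx⟩ := Q.ne
    exact hx (by rw [← hG, ← h]; rfl)
  have : ({1, G} : Finset Gal(M/K)) = Finset.univ := by
    apply Finset.eq_univ_of_card
    rw [Finset.card_pair hne, hc]
  have h2 := Finset.mem_univ h
  rw [← this] at h2
  simpa using h2

theorem mul_act (Q : QuadExt K M g) {I : Ideal (𝓞 M)} (hI : I ≠ ⊥) : I * act g I = exi M (nm K I) := by
  obtain ⟨G, hG⟩ := Q.exists_algEquiv
  classical
  have := Q.isGalois
  have hne : (1 : Gal(M/K)) ≠ G := by
    intro h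
    obtain ⟨x, hx⟩ := Q.ne
    exact hx (by rw [← hG, ← h]; rfl)
  have hu : (Finset.univ : Finset Gal(M/K)) = {1, G} := by
    ext h
    simpa using Q.isTotal G hG h
  rw [exi_nm hI, hu, Finset.prod_pair hne, hG,
    act_refl (g := (1 : Gal(M/K)).toRingEquiv) (fun x => rfl)]

theorem norm_eq (Q : QuadExt K M g) (x : M) : algebraMap K M (Algebra.norm K x) = x * g x := by
  obtain ⟨G, hG⟩ := Q.exists_algEquiv
  classical
  have := Q.isGalois
  have hne : (1 : Gal(M/K)) ≠ G := by
    intro h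
    obtain ⟨x, hx⟩ := Q.ne
    exact hx (by rw [← hG, ← h]; rfl)
  have hu : (Finset.univ : Finset Gal(M/K)) = {1, G} := by
    ext h
    simpa using Q.isTotal G hG h
  rw [Algebra.norm_eq_prod_automorphisms, hu, Finset.prod_pair hne, ← hG]; rfl

theorem alg_int (Q : QuadExt K M g) (a : 𝓞 K) : oi g (algebraMap (𝓞 K) (𝓞 M) a) = algebraMap (𝓞 K) (𝓞 M) a :=
  RingOfIntegers.coe_injective (Q.alg (a : K))

theorem fix_int (Q : QuadExt K M g) {x : 𝓞 M} (h : oi g x = x) : ∃ a : 𝓞 K, algebraMap (𝓞 K) (𝓞 M) a = x := by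
  have h1 : g (x : M) = x := congrArg (algebraMap (𝓞 M) M) h
  obtain ⟨a, ha⟩ := (Q.fix _).1 h1
  have : IsIntegral ℤ a := by
    have h2 : IsIntegral ℤ (x : M) := x.2
    rw [← ha] at h2
    exact (isIntegral_algebraMap_iff (algebraMap K M).injective).1 h2
  exact ⟨⟨a, this⟩, RingOfIntegers.coe_injective ha⟩

theorem inv_int (Q : QuadExt K M g) (x : 𝓞 M) : oi g (oi g x) = x :=
  RingOfIntegers.coe_injective (Q.inv (x : M))

theorem act_inv (Q : QuadExt K M g) (I : Ideal (𝓞 M)) : act g (act g I) = I := by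
  rw [act_act, act_refl]; exact Q.inv

theorem act_exi (Q : QuadExt K M g) (a : Ideal (𝓞 K)) : act g (exi M a) = exi M a := by
  have : (oi g : 𝓞 M →+* 𝓞 M).comp (algebraMap (𝓞 K) (𝓞 M)) = algebraMap (𝓞 K) (𝓞 M) := by
    ext1 x; exact Q.alg_int x
  have h := Ideal.map_map (I := a) (algebraMap (𝓞 K) (𝓞 M)) (oi g : 𝓞 M →+* 𝓞 M)
  rw [this] at h
  exact h

theorem absNorm_exi' (Q : QuadExt K M g) (a : Ideal (𝓞 K)) : Ideal.absNorm (exi M a) = Ideal.absNorm a ^ 2 := by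
  rw [absNorm_exi, Q.finrank]

/-- Classes extended from `K` and the norm. -/
theorem cl_mul_act (Q : QuadExt K M g) (h : Odd (Nat.card (ClassGroup (𝓞 K)))) (c : ClassGroup (𝓞 M)) :
    OddOrd (c * clAct g c) := by
  obtain ⟨I, hI, rfl⟩ := cl_surj c
  rw [clAct_cl g hI, ← cl_mul hI (act_ne_bot g hI), Q.mul_act hI, ← lft_cl (nm_ne_bot hI)]
  exact (OddOrd.of_card h).map _

/-- A `g`-invariant prime not containing all `w - g w` is extended from `K`. -/
theorem prime_ext (Q : QuadExt K M g) {P : Ideal (𝓞 M)} (hP : P.IsPrime) (hP0 : P ≠ ⊥) (hg : act g P = P)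
    (w : 𝓞 M) (hw : w - oi g w ∉ P) : ∃ a : Ideal (𝓞 K), a ≠ ⊥ ∧ P = exi M a := by
  set q : Ideal (𝓞 K) := P.comap (algebraMap (𝓞 K) (𝓞 M)) with hq
  have hle : exi M q ≤ P := Ideal.map_comap_le
  have hnm : nm K P ≤ q := fun x hx => nm_le hx
  have hq0 : q ≠ ⊥ := fun h => nm_ne_bot (K := K) hP0 (le_bot_iff.1 (h ▸ hnm))
  have h2 : P * P ≤ exi M q := by
    conv_lhs => rw [← hg]
    have := Q.mul_act hP0
    rw [hg] at this
    rw [hg, this]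
    exact Ideal.map_mono hnm
  have key : ∀ x ∈ P, x * (w - oi g w) ∈ exi M q := by
    intro x hx
    have tr : ∀ y ∈ P, y + oi g y ∈ exi M q := by
      intro y hy
      obtain ⟨a, ha⟩ := Q.fix_int (x := y + oi g y) (by rw [map_add, Q.inv_int, add_comm])
      rw [← ha]
      apply Ideal.mem_map_of_mem
      rw [hq, Ideal.mem_comap, ha]
      refine P.add_mem hy ?_
      have := mem_act g hy
      rwa [hg] at this
    have e : x * (w - oi g w) = (x * w + oi g (x * w)) - oi g w * (x + oi g x) := by
      rw [map_mul]; ring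
    rw [e]
    exact Ideal.sub_mem _ (tr _ (P.mul_mem_right _ hx)) (Ideal.mul_mem_left _ _ (tr x hx))
  refine ⟨q, hq0, ?_⟩
  -- `exi q` is `P * X` with `X ∣ P`
  obtain ⟨X, hX⟩ := Ideal.dvd_iff_le.2 hle
  have hPm : P.IsMaximal := hP.isMaximal hP0
  have h3 : P ≤ X := by
    have : P * X ∣ P * P := by rw [← hX]; exact Ideal.dvd_iff_le.2 h2
    exact Ideal.dvd_iff_le.1 ((mul_dvd_mul_iff_left hP0).1 this)
  by_cases hXt : X = ⊤
  · rw [hX, hXt, Ideal.mul_top]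
  exfalso
  have hXP : P = X := hPm.eq_of_le hXt h3
  apply hw
  have h4 : P * Ideal.span {w - oi g w} ≤ P * P := by
    rw [Ideal.mul_le]
    intro r hr s hs
    obtain ⟨t, rfl⟩ := Ideal.mem_span_singleton'.1 hs
    have h5 := key r hr
    rw [hX, ← hXP] at h5
    have : r * (t * (w - oi g w)) = t * (r * (w - oi g w)) := by ring
    rw [this]
    exact Ideal.mul_mem_left _ _ h5
  have h6 := Ideal.dvd_iff_le.1 ((mul_dvd_mul_iff_left hP0).1 (Ideal.dvd_iff_le.2 h4))
  exact h6 (Ideal.mem_span_singleton_self _)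

end QuadExt

set_option linter.unusedSectionVars false

/-! ### Parity of invariant ideals -/
namespace QuadExt
variable {K M : Type*} [Field K] [NumberField K] [Field M] [NumberField M] [Algebra K M]
  {g : M ≃+* M}

open Classical in
/-- parity vector of an ideal -/
noncomputable def par (T : Finset (Ideal (𝓞 M))) (I : Ideal (𝓞 M)) : T → ZMod 2 :=
  fun P => ((UniqueFactorizationMonoid.normalizedFactors I).count P.1 : ZMod 2)

theorem par_mul (T : Finset (Ideal (𝓞 M))) {I J : Ideal (𝓞 M)} (hI : I ≠ ⊥) (hJ : J ≠ ⊥) :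
    par T (I * J) = par T I + par T J := by
  ext P
  simp only [par, Pi.add_apply]
  rw [UniqueFactorizationMonoid.normalizedFactors_mul hI hJ, Multiset.count_add, Nat.cast_add]

theorem par_prime (T : Finset (Ideal (𝓞 M))) {P : Ideal (𝓞 M)} (hP : P.IsPrime) (hP0 : P ≠ ⊥)
    (hPT : P ∉ T) : par T P = 0 := by
  ext R
  simp only [par, Pi.zero_apply]
  rw [UniqueFactorizationMonoid.normalizedFactors_irreducible
    (Ideal.prime_of_isPrime hP0 hP).irreducible, normalize_eq, Multiset.count_eq_zero_of_notMem]
  · simp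
  · intro h
    rw [Multiset.mem_singleton] at h
    exact hPT (h ▸ R.2)

theorem par_self (T : Finset (Ideal (𝓞 M))) {I : Ideal (𝓞 M)} (hI : I ≠ ⊥) :
    par T (I * I) = 0 := by
  rw [par_mul T hI hI]
  ext P; exact CharTwo.add_self_eq_zero (par T I P)


theorem even_ext (Q : QuadExt K M g) (T : Finset (Ideal (𝓞 M))) (hTi : ∀ P ∈ T, act g P = P)
    (hT : ∀ P : Ideal (𝓞 M), P.IsPrime → P ≠ ⊥ → act g P = P →
      P ∈ T ∨ ∃ a : Ideal (𝓞 K), a ≠ ⊥ ∧ P = exi M a) (n : ℕ) :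
    ∀ I : Ideal (𝓞 M), I ≠ ⊥ → Ideal.absNorm I ≤ n → act g I = I → par T I = 0 →
      ∃ a : Ideal (𝓞 K), a ≠ ⊥ ∧ I = exi M a := by
  classical
  induction n with
  | zero =>
    intro I hI hn
    exact absurd (Ideal.absNorm_eq_zero_iff.1 (Nat.le_zero.1 hn)) hI
  | succ n ih =>
    intro I hI hn hg hpar
    by_cases hIt : I = ⊤
    · exact ⟨⊤, by simp, by rw [hIt, exi_top]⟩
    -- find a factor
    suffices h : ∃ a : Ideal (𝓞 K), a ≠ ⊥ ∧ exi M a ≠ ⊤ ∧ exi M a ∣ I ∧ par T (exi M a) = 0 by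
      obtain ⟨a, ha, hat, ⟨J, hJ⟩, hap⟩ := h
      have hA := exi_ne_bot (M := M) ha
      have hJ0 : J ≠ ⊥ := fun h => hI (by rw [hJ, h]; simp)
      have hJg : act g J = J := by
        have h1 : exi M a * act g J = exi M a * J := by
          rw [← hJ, ← hg, hJ, act_mul, Q.act_exi]
        exact mul_left_cancel₀ hA h1
      have hJp : par T J = 0 := by
        rw [hJ, par_mul T hA hJ0, hap, zero_add] at hpar; exact hpar
      have hJn : Ideal.absNorm J ≤ n := by
        rw [hJ, map_mul] at hn
        have h1 : Ideal.absNorm (exi M a) ≠ 0 := by rwa [Ne, Ideal.absNorm_eq_zero_iff]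
        have h2 : Ideal.absNorm (exi M a) ≠ 1 := by rwa [Ne, Ideal.absNorm_eq_one_iff]
        have h3 : Ideal.absNorm J ≠ 0 := by rwa [Ne, Ideal.absNorm_eq_zero_iff]
        have : 2 * Ideal.absNorm J ≤ Ideal.absNorm (exi M a) * Ideal.absNorm J :=
          Nat.mul_le_mul_right _ (by omega)
        omega
      obtain ⟨b, hb, hb'⟩ := ih J hJ0 hJn hJg hJp
      exact ⟨a * b, mul_ne_zero ha hb, by rw [exi_mul, ← hb', hJ]⟩
    obtain ⟨P, hPm, hIP⟩ := Ideal.exists_le_maximal I hIt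
    have hP := hPm.isPrime
    have hP0 : P ≠ ⊥ := fun h => hI (le_bot_iff.1 (h ▸ hIP))
    have hPd : P ∣ I := Ideal.dvd_iff_le.2 hIP
    have hmt : P * act g P ≠ ⊤ := fun h => hP.ne_top (top_le_iff.1 (h ▸ Ideal.mul_le_left))
    by_cases hgP : act g P = P
    · by_cases hPT : P ∈ T
      · obtain ⟨J, hJ⟩ := hPd
        have hJ0 : J ≠ ⊥ := fun h => hI (by rw [hJ, h]; simp)
        refine ⟨nm K P, nm_ne_bot hP0, ?_, ?_, ?_⟩
        · rwa [← Q.mul_act hP0]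
        · rw [← Q.mul_act hP0, hgP, hJ]
          apply mul_dvd_mul_left
          have h1 := congrFun hpar ⟨P, hPT⟩
          rw [hJ, par_mul T hP0 hJ0] at h1
          simp only [par, Pi.add_apply, Pi.zero_apply] at h1
          rw [UniqueFactorizationMonoid.normalizedFactors_irreducible
            (Ideal.prime_of_isPrime hP0 hP).irreducible, normalize_eq,
            Multiset.count_singleton_self] at h1
          apply UniqueFactorizationMonoid.dvd_of_mem_normalizedFactors
          by_contra hc
          rw [Multiset.count_eq_zero_of_notMem hc] at h1
          simp at h1
        · rw [← Q.mul_act hP0, hgP, par_self T hP0]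
      · rcases hT P hP hP0 hgP with h | ⟨a, ha, hPa⟩
        · exact absurd h hPT
        · exact ⟨a, ha, hPa ▸ hP.ne_top, hPa ▸ hPd, hPa ▸ par_prime T hP hP0 hPT⟩
    · have hPT : P ∉ T := fun h => hgP (hTi P h)
      have hPT' : act g P ∉ T := fun h => hgP (act_inj g (hTi _ h))
      refine ⟨nm K P, nm_ne_bot hP0, ?_, ?_, ?_⟩
      · rwa [← Q.mul_act hP0]
      · rw [← Q.mul_act hP0]
        obtain ⟨J, hJ⟩ := hPd
        have h2 : act g P ∣ I := by rw [← hg, hJ, act_mul]; exact Dvd.intro _ rfl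
        have hpr := Ideal.prime_of_isPrime (act_ne_bot g hP0) (act_isPrime g hP)
        rw [hJ] at h2 ⊢
        rcases hpr.dvd_or_dvd h2 with h3 | h3
        · exfalso
          have h4 := Ideal.dvd_iff_le.1 h3
          exact hgP (hPm.eq_of_le (act_isPrime g hP).ne_top h4).symm
        · exact mul_dvd_mul_left _ h3
      · rw [← Q.mul_act hP0, par_mul T hP0 (act_ne_bot g hP0), par_prime T hP hP0 hPT,
          par_prime T (act_isPrime g hP) (act_ne_bot g hP0) hPT', add_zero]

theorem exists_neg (Q : QuadExt K M g) : ∃ d : 𝓞 M, d ≠ 0 ∧ oi g d = -d := by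
  obtain ⟨x, hx⟩ := Q.ne
  obtain ⟨⟨a, b⟩, h⟩ := IsLocalization.surj (nonZeroDivisors (𝓞 M)) x
  have hb : (b : 𝓞 M) ≠ 0 := nonZeroDivisors.ne_zero b.2
  by_cases h1 : oi g a = a
  · by_cases h2 : oi g b = b
    · exfalso
      apply hx
      have hb' : ((b : 𝓞 M) : M) ≠ 0 := by
        intro h; exact hb (RingOfIntegers.coe_injective (by simpa using h))
      have h3 : g x * g (b : 𝓞 M) = g (a : M) := by rw [← map_mul]; exact congrArg g h
      have e1 : g ((b : 𝓞 M) : M) = (b : 𝓞 M) := congrArg (algebraMap (𝓞 M) M) h2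
      have e2 : g (a : M) = a := congrArg (algebraMap (𝓞 M) M) h1
      rw [e1, e2] at h3
      exact mul_right_cancel₀ hb' (h3.trans h.symm)
    · exact ⟨b - oi g b, sub_ne_zero.2 (Ne.symm h2), by rw [map_sub, Q.inv_int]; ring⟩
  · exact ⟨a - oi g a, sub_ne_zero.2 (Ne.symm h1), by rw [map_sub, Q.inv_int]; ring⟩

/-- Hilbert 90 in integral form. -/
theorem hilbert90 (Q : QuadExt K M g) {A B : 𝓞 M} (hB : B ≠ 0) (h : A * oi g A = B * oi g B) :
    ∃ w : 𝓞 M, w ≠ 0 ∧ A * oi g w = B * w := by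
  by_cases hs : A + B = 0
  · obtain ⟨d, hd, hd'⟩ := Q.exists_neg
    refine ⟨d, hd, ?_⟩
    rw [hd', eq_neg_of_add_eq_zero_left hs]; ring
  · refine ⟨oi g B * (A + B), mul_ne_zero (by simpa using hB) hs, ?_⟩
    rw [map_mul, Q.inv_int, map_add]
    linear_combination B * h

end QuadExt

set_option linter.unusedSectionVars false

/-! ### Ambiguous class number inequality -/
theorem comm_grp_aux {G : Type*} [CommGroup G] (e e' y : G) (r : ℕ) :
    e' * (y⁻¹ * ((e * e')⁻¹) ^ r * e'⁻¹) =
      e * (((e * e') ^ (2 * r + 1) * y)⁻¹ * (e * e') ^ r * e') := by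
  have h : (e * e') ^ (2 * r + 1) = (e * e') * ((e * e') ^ r * (e * e') ^ r) := by
    rw [← pow_add, ← pow_succ']; ring_nf
  rw [h, inv_pow]
  generalize (e * e') ^ r = F
  apply Additive.ofMul.injective
  simp only [ofMul_mul, ofMul_inv]
  abel

namespace QuadExt
variable {K M : Type*} [Field K] [NumberField K] [Field M] [NumberField M] [Algebra K M]
  {g : M ≃+* M}

theorem inv_par (Q : QuadExt K M g)
    (T : Finset (Ideal (𝓞 M))) (hTi : ∀ P ∈ T, act g P = P)
    (hT : ∀ P : Ideal (𝓞 M), P.IsPrime → P ≠ ⊥ → act g P = P →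
      P ∈ T ∨ ∃ a : Ideal (𝓞 K), a ≠ ⊥ ∧ P = exi M a)
    {I J : Ideal (𝓞 M)} (hI : I ≠ ⊥) (hJ : J ≠ ⊥) (hgI : act g I = I) (hgJ : act g J = J)
    (hp : par T I = par T J) :
    cl I ^ (Nat.card (ClassGroup (𝓞 K))) = cl J ^ (Nat.card (ClassGroup (𝓞 K))) := by
  have h1 : par T (I * J) = 0 := by
    rw [par_mul T hI hJ, hp]; ext P; exact CharTwo.add_self_eq_zero (par T J P)
  obtain ⟨a, ha, haI⟩ := Q.even_ext T hTi hT _ (I * J) (mul_ne_zero hI hJ) le_rfl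
    (by rw [act_mul, hgI, hgJ]) h1
  have h2 : (cl I * cl J) ^ (Nat.card (ClassGroup (𝓞 K))) = 1 := by
    rw [← cl_mul hI hJ, haI, ← lft_cl ha, ← map_pow, pow_card_eq_one', map_one]
  have h3 : (cl J * cl J) ^ (Nat.card (ClassGroup (𝓞 K))) = 1 := by
    have h4 : J * J = exi M (nm K J) := by rw [← Q.mul_act hJ, hgJ]
    rw [← cl_mul hJ hJ, h4, ← lft_cl (nm_ne_bot hJ), ← map_pow, pow_card_eq_one', map_one]
  rw [mul_pow] at h2 h3
  exact mul_right_cancel (h2.trans h3.symm)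

theorem unit_par (Q : QuadExt K M g) (hK : Odd (Nat.card (ClassGroup (𝓞 K))))
    (T : Finset (Ideal (𝓞 M))) (hTi : ∀ P ∈ T, act g P = P)
    (hT : ∀ P : Ideal (𝓞 M), P.IsPrime → P ≠ ⊥ → act g P = P →
      P ∈ T ∨ ∃ a : Ideal (𝓞 K), a ≠ ⊥ ∧ P = exi M a)
    {e e' : (𝓞 M)ˣ} {z z' : 𝓞 M} (hz : z ≠ 0) (hz' : z' ≠ 0) (h : e * oi g z = z)
    (h' : e' * oi g z' = z') (he : (e : 𝓞 M) * oi g e = 1) (he' : (e' : 𝓞 M) * oi g e' = 1)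
    (hp : par T (Ideal.span {z}) = par T (Ideal.span {z'})) :
    ∃ x : (𝓞 M)ˣ, e' * x = e * Units.map (oi g : 𝓞 M →* 𝓞 M) x := by
  have hI : Ideal.span {z} ≠ ⊥ := by simpa using hz
  have hJ : Ideal.span {z'} ≠ ⊥ := by simpa using hz'
  have hinv : ∀ {e : (𝓞 M)ˣ} {z : 𝓞 M}, e * oi g z = z → act g (Ideal.span {z}) = Ideal.span {z} := by
    intro e z h
    rw [act_span, Ideal.span_singleton_eq_span_singleton]
    exact ⟨e, by rw [mul_comm]; exact h⟩
  have h1 : par T (Ideal.span {z} * Ideal.span {z'}) = 0 := by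
    rw [par_mul T hI hJ, hp]; ext P; exact CharTwo.add_self_eq_zero (par T (Ideal.span {z'}) P)
  obtain ⟨a, ha, haI⟩ := Q.even_ext T hTi hT _ (Ideal.span {z} * Ideal.span {z'})
    (mul_ne_zero hI hJ) le_rfl (by rw [act_mul, hinv h, hinv h']) h1
  set n := Nat.card (ClassGroup (𝓞 K)) with hn
  have h2 : cl (a ^ n) = 1 := by rw [cl_pow ha, pow_card_eq_one']
  obtain ⟨k, hk0, hk⟩ := (cl_eq_one_iff (pow_ne_zero n ha)).1 h2
  have h3 : Ideal.span {(z * z') ^ n} = Ideal.span {algebraMap (𝓞 K) (𝓞 M) k} := by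
    rw [← exi_span, ← hk, exi_pow, ← haI, Ideal.span_singleton_mul_span_singleton,
      Ideal.span_singleton_pow]
  obtain ⟨y, hy⟩ := Ideal.span_singleton_eq_span_singleton.1 h3
  -- `(z z')^n * y = k`
  set gu : (𝓞 M)ˣ →* (𝓞 M)ˣ := Units.map (oi g : 𝓞 M →* 𝓞 M) with hgu
  have hguc : ∀ x : (𝓞 M)ˣ, ((gu x : (𝓞 M)ˣ) : 𝓞 M) = oi g x := fun x => rfl
  have h4 : oi g ((z * z') ^ n) * oi g y = (z * z') ^ n * y := by
    rw [← map_mul, hy, Q.alg_int]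
  have hzz : oi g ((z * z') ^ n) ≠ 0 := by
    simpa using fun h : z = 0 ∨ z' = 0 => absurd h (by tauto)
  have h5 : ((e : 𝓞 M) * e') ^ n * y = oi g y := by
    apply mul_left_cancel₀ hzz
    rw [h4]
    conv_rhs => rw [← h, ← h']
    simp only [map_mul, map_pow]
    ring
  have h5' : (e * e') ^ n * y = gu y := Units.ext (by push_cast; rw [hguc]; exact h5)
  have he1 : gu e = e⁻¹ := by
    rw [eq_inv_iff_mul_eq_one, mul_comm]; exact Units.ext (by push_cast; rw [hguc]; exact he)
  have he1' : gu e' = e'⁻¹ := by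
    rw [eq_inv_iff_mul_eq_one, mul_comm]; exact Units.ext (by push_cast; rw [hguc]; exact he')
  obtain ⟨r, hr⟩ := hK
  -- `(e e')^(2r+1) = gu y / y`
  refine ⟨y⁻¹ * (e * e')⁻¹ ^ r * e'⁻¹, ?_⟩
  have h6 : gu (y⁻¹ * (e * e')⁻¹ ^ r * e'⁻¹) = ((e * e') ^ (2 * r + 1) * y)⁻¹ * (e * e') ^ r * e' := by
    simp only [map_mul, map_inv, map_pow, he1, he1', ← h5', hr]
    simp only [mul_inv, inv_inv]
  rw [h6]
  exact comm_grp_aux e e' y r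

/-- The relation between 2-torsion classes and norm units. -/
theorem two_tors (Q : QuadExt K M g) (hK : Odd (Nat.card (ClassGroup (𝓞 K)))) (c : ClassGroup (𝓞 M)) (hc : c ^ 2 = 1) :
    ∃ (I : Ideal (𝓞 M)) (a b : 𝓞 M) (η : (𝓞 M)ˣ), I ≠ ⊥ ∧ cl I = c ∧ a ≠ 0 ∧ b ≠ 0 ∧
      Ideal.span {a} * I = Ideal.span {b} * act g I ∧ a * oi g a = η * (b * oi g b) := by
  have h1 : c * clAct g c = 1 := by
    refine (Q.cl_mul_act hK c).eq_one' ?_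
    rw [mul_pow, ← map_pow, hc, map_one, one_mul]
  obtain ⟨I, hI, rfl⟩ := cl_surj c
  have h2 : cl I = cl (act g I) := by
    rw [← clAct_cl g hI]
    rw [pow_two] at hc
    exact mul_left_cancel (hc.trans h1.symm)
  obtain ⟨a, b, ha, hb, hab⟩ := (cl_eq_iff hI (act_ne_bot g hI)).1 h2
  have h3 := congrArg (act g) hab
  rw [act_mul, act_mul, act_span, act_span, Q.act_inv] at h3
  have h4 : Ideal.span {b * oi g b} = Ideal.span {a * oi g a} := by
    apply mul_right_cancel₀ (mul_ne_zero hI (act_ne_bot g hI))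
    rw [← Ideal.span_singleton_mul_span_singleton, ← Ideal.span_singleton_mul_span_singleton]
    calc _ = (Ideal.span {b} * act g I) * (Ideal.span {oi g b} * I) := by ring
      _ = (Ideal.span {a} * I) * (Ideal.span {oi g a} * act g I) := by rw [hab, h3]
      _ = _ := by ring
  obtain ⟨η, hη⟩ := Ideal.span_singleton_eq_span_singleton.1 h4
  exact ⟨I, a, b, η, hI, rfl, ha, hb, hab, by rw [← hη]; ring⟩

theorem two_tors_same (Q : QuadExt K M g) {I I' : Ideal (𝓞 M)} {a b a' b' : 𝓞 M} {η η' e : (𝓞 M)ˣ} (hI : I ≠ ⊥)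
    (hI' : I' ≠ ⊥) (hb : b ≠ 0) (hb' : b' ≠ 0)
    (h1 : Ideal.span {a} * I = Ideal.span {b} * act g I)
    (h2 : a * oi g a = η * (b * oi g b))
    (h1' : Ideal.span {a'} * I' = Ideal.span {b'} * act g I')
    (h2' : a' * oi g a' = η' * (b' * oi g b')) (he : (η : 𝓞 M) = η' * (e * oi g e))
    (hg' : oi g (η' : 𝓞 M) = η') :
    ∃ V : Ideal (𝓞 M), V ≠ ⊥ ∧ act g V = V ∧ cl V = cl I * cl I' := by
  set B : 𝓞 M := b * b' * (η' * e) with hB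
  set A : 𝓞 M := a * a' with hA
  have hB0 : B ≠ 0 := by
    rw [hB]; exact mul_ne_zero (mul_ne_zero hb hb') (mul_ne_zero η'.ne_zero e.ne_zero)
  have h3 : A * oi g A = B * oi g B := by
    rw [hA, hB]
    simp only [map_mul, hg']
    calc a * a' * (oi g a * oi g a') = (a * oi g a) * (a' * oi g a') := by ring
      _ = (η * (b * oi g b)) * (η' * (b' * oi g b')) := by rw [h2, h2']
      _ = _ := by rw [he]; ring
  obtain ⟨w, hw, hw'⟩ := Q.hilbert90 hB0 h3
  have hws : Ideal.span {w} ≠ ⊥ := by simpa using hw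
  have hu : Ideal.span {(η' * e : 𝓞 M)} = ⊤ := by
    rw [Ideal.span_singleton_eq_top]; exact (η' * e).isUnit
  have h4 : Ideal.span {A} * (I * I') = Ideal.span {B} * act g (I * I') := by
    rw [hA, hB, ← Ideal.span_singleton_mul_span_singleton, ← Ideal.span_singleton_mul_span_singleton,
      ← Ideal.span_singleton_mul_span_singleton, hu, Ideal.mul_top, act_mul]
    calc _ = (Ideal.span {a} * I) * (Ideal.span {a'} * I') := by ring
      _ = _ := by rw [h1, h1']; ring
  refine ⟨Ideal.span {w} * (I * I'), mul_ne_zero hws (mul_ne_zero hI hI'), ?_, ?_⟩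
  · have hBs : Ideal.span {B} ≠ ⊥ := by simpa using hB0
    apply mul_left_cancel₀ hBs
    rw [act_mul, act_span]
    calc _ = Ideal.span {oi g w} * (Ideal.span {B} * act g (I * I')) := by ring
      _ = Ideal.span {A * oi g w} * (I * I') := by
        rw [← h4, ← Ideal.span_singleton_mul_span_singleton A]; ring
      _ = _ := by rw [hw', ← Ideal.span_singleton_mul_span_singleton B]; ring
  · rw [cl_mul hws (mul_ne_zero hI hI'), cl_span, one_mul, cl_mul hI hI']

end QuadExt

set_option linter.unusedSectionVars false

namespace QuadExt
variable {K M : Type*} [Field K] [NumberField K] [Field M] [NumberField M] [Algebra K M]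
  {g : M ≃+* M}

theorem unitEK_equiv (Q : QuadExt K M g) (EK : Subgroup (𝓞 M)ˣ)
    (hEK : ∀ x : (𝓞 M)ˣ, x ∈ EK ↔ oi g (x : 𝓞 M) = x) : ∃ f : (𝓞 K)ˣ ≃* EK,
    ∀ x, (((f x : EK) : (𝓞 M)ˣ) : 𝓞 M) = algebraMap (𝓞 K) (𝓞 M) x := by
  let f : (𝓞 K)ˣ →* EK :=
    (Units.map (algebraMap (𝓞 K) (𝓞 M) : 𝓞 K →* 𝓞 M)).codRestrict EK
      (fun x => (hEK _).2 (Q.alg_int _))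
  refine ⟨MulEquiv.ofBijective f ⟨?_, ?_⟩, fun x => rfl⟩
  · intro x y hxy
    have h1 : algebraMap (𝓞 K) (𝓞 M) x = algebraMap (𝓞 K) (𝓞 M) y :=
      congrArg (fun t : EK => ((t : (𝓞 M)ˣ) : 𝓞 M)) hxy
    exact Units.ext (FaithfulSMul.algebraMap_injective _ _ h1)
  · rintro ⟨x, hx⟩
    obtain ⟨a, ha⟩ := Q.fix_int ((hEK x).1 hx)
    have hxi : oi g ((x⁻¹ : (𝓞 M)ˣ) : 𝓞 M) = ((x⁻¹ : (𝓞 M)ˣ) : 𝓞 M) :=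
      (hEK _).1 (EK.inv_mem hx)
    obtain ⟨b, hb⟩ := Q.fix_int hxi
    have hab : a * b = 1 := by
      apply FaithfulSMul.algebraMap_injective (𝓞 K) (𝓞 M)
      rw [map_mul, ha, hb, map_one, Units.mul_inv]
    refine ⟨⟨a, b, hab, by rw [mul_comm]; exact hab⟩, ?_⟩
    apply Subtype.ext
    apply Units.ext
    exact ha

/-- The ambiguous class number inequality. -/
theorem lemmaU (Q : QuadExt K M g) (hK : Odd (Nat.card (ClassGroup (𝓞 K)))) (T : Finset (Ideal (𝓞 M)))
    (hT : ∀ P : Ideal (𝓞 M), P.IsPrime → P ≠ ⊥ → (∀ w, w - oi g w ∈ P) → P ∈ T)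
    (d : ℕ) (hd : d = 1 ∨ (d = 2 ∧ ∃ ε : (𝓞 K)ˣ, ∀ y : M, algebraMap K M ε ≠ y * g y)) :
    Nat.card (powMonoidHom 2 : ClassGroup (𝓞 M) →* ClassGroup (𝓞 M)).ker * d *
      2 ^ (Units.rank M) ≤ 2 ^ (T.card + 2 * Units.rank K) := by
  classical
  -- reduce to an invariant set
  set T' := T.filter (fun P => act g P = P) with hT'
  have hTi : ∀ P ∈ T', act g P = P := fun P hP => (Finset.mem_filter.1 hP).2
  have hTT : ∀ P : Ideal (𝓞 M), P.IsPrime → P ≠ ⊥ → act g P = P →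
      P ∈ T' ∨ ∃ a : Ideal (𝓞 K), a ≠ ⊥ ∧ P = exi M a := by
    intro P hP hP0 hg
    by_cases h : ∀ w, w - oi g w ∈ P
    · exact Or.inl (Finset.mem_filter.2 ⟨hT P hP hP0 h, hg⟩)
    · push Not at h
      obtain ⟨w, hw⟩ := h
      exact Or.inr (Q.prime_ext hP hP0 hg w hw)
  have hcard : T'.card ≤ T.card := Finset.card_filter_le _ _
  set gu : (𝓞 M)ˣ →* (𝓞 M)ˣ := Units.map (oi g : 𝓞 M →* 𝓞 M) with hgu
  have hguc : ∀ x : (𝓞 M)ˣ, ((gu x : (𝓞 M)ˣ) : 𝓞 M) = oi g x := fun x => rfl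
  have hgg : ∀ x, gu (gu x) = x := fun x => Units.ext (Q.inv_int _)
  let N : (𝓞 M)ˣ →* (𝓞 M)ˣ := MonoidHom.id _ * gu
  let D : (𝓞 M)ˣ →* (𝓞 M)ˣ := MonoidHom.id _ / gu
  have hN : ∀ x, N x = x * gu x := fun x => rfl
  have hD : ∀ x, D x = x / gu x := fun x => rfl
  let EK : Subgroup (𝓞 M)ˣ := D.ker
  have hEK : ∀ x, x ∈ EK ↔ gu x = x := fun x => by
    rw [MonoidHom.mem_ker, hD, div_eq_one]; exact eq_comm
  let Em : Subgroup (𝓞 M)ˣ := N.ker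
  have hEm : ∀ x, x ∈ Em ↔ x * gu x = 1 := fun x => by
    rw [MonoidHom.mem_ker, hN]
  let EN : Subgroup (𝓞 M)ˣ :=
    { carrier := {x | ∃ y : M, y ≠ 0 ∧ ((x : 𝓞 M) : M) = y * g y}
      one_mem' := ⟨1, one_ne_zero, by simp⟩
      mul_mem' := by
        rintro a b ⟨y, hy, h⟩ ⟨y', hy', h'⟩
        refine ⟨y * y', mul_ne_zero hy hy', ?_⟩
        have h1 : algebraMap (𝓞 M) M (a : 𝓞 M) = y * g y := h
        have h2 : algebraMap (𝓞 M) M (b : 𝓞 M) = y' * g y' := h'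
        change algebraMap (𝓞 M) M ((a * b : (𝓞 M)ˣ) : 𝓞 M) = _
        rw [Units.val_mul, map_mul, map_mul, h1, h2]; ring
      inv_mem' := by
        rintro a ⟨y, hy, h⟩
        refine ⟨y⁻¹, inv_ne_zero hy, ?_⟩
        rw [map_inv₀, ← mul_inv, ← h]
        apply eq_inv_of_mul_eq_one_left
        rw [← map_mul, Units.inv_mul, map_one] }
  have hENm : ∀ x : (𝓞 M)ˣ, x ∈ EN ↔ ∃ y : M, y ≠ 0 ∧ ((x : 𝓞 M) : M) = y * g y := fun x => Iff.rfl
  have hENK : EN ≤ EK := by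
    rintro x ⟨y, hy, h⟩
    rw [hEK]
    apply Units.ext
    apply RingOfIntegers.coe_injective
    have h' : algebraMap (𝓞 M) M (x : 𝓞 M) = y * g y := h
    change g (algebraMap (𝓞 M) M (x : 𝓞 M)) = algebraMap (𝓞 M) M (x : 𝓞 M)
    rw [h', map_mul, Q.inv, mul_comm]
  have hNEN : N.range ≤ EN := by
    rintro _ ⟨x, rfl⟩
    refine ⟨((x : 𝓞 M) : M), ?_, by rw [hN]; push_cast; rfl⟩
    simp
  -- choices for 2-torsion classes
  set C2 := (powMonoidHom 2 : ClassGroup (𝓞 M) →* ClassGroup (𝓞 M)).ker with hC2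
  have hc2 : ∀ c : C2, (c : ClassGroup (𝓞 M)) ^ 2 = 1 := fun c => c.2
  choose Ic ac bc ηc hI0 hIc ha0 hb0 hIab hηc using fun c : C2 => Q.two_tors hK c (hc2 c)
  have hηEN : ∀ c, ηc c ∈ EN := by
    intro c
    have hb : ((bc c : 𝓞 M) : M) ≠ 0 := by simpa using hb0 c
    have hgb : g ((bc c : 𝓞 M) : M) ≠ 0 := by simpa using hb0 c
    have ha : ((ac c : 𝓞 M) : M) ≠ 0 := by simpa using ha0 c
    refine ⟨(ac c : M) / (bc c : M), div_ne_zero ha hb, ?_⟩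
    have h1 := congrArg (algebraMap (𝓞 M) M) (hηc c)
    simp only [map_mul] at h1
    change (ac c : M) * g (ac c : M) = _ * ((bc c : M) * g (bc c : M)) at h1
    rw [map_div₀]
    field_simp
    rw [h1]
    exact mul_assoc _ _ _
  have hsame : ∀ c c' : C2, (ηc c / ηc c') ∈ N.range →
      ∃ V : Ideal (𝓞 M), V ≠ ⊥ ∧ act g V = V ∧ cl V = c * c' := by
    rintro c c' ⟨e, he⟩
    have h1 : ηc c = ηc c' * (e * gu e) := by rw [← hN, he]; simp
    obtain ⟨V, h2, h3, h4⟩ := Q.two_tors_same (e := e) (hI0 c) (hI0 c') (hb0 c) (hb0 c') (hIab c) (hηc c)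
      (hIab c') (hηc c') (by rw [h1]; rfl)
      (congrArg Units.val ((hEK _).1 (hENK (hηEN c'))))
    exact ⟨V, h2, h3, by rw [h4, hIc, hIc]⟩
  -- the two quotients
  let QN := EN ⧸ (N.range.subgroupOf EN)
  let QD := Em ⧸ (D.range.subgroupOf Em)
  let f : C2 → QN := fun c => QuotientGroup.mk ⟨ηc c, hηEN c⟩
  have hf : ∀ c c', f c = f c' → (ηc c / ηc c') ∈ N.range := by
    intro c c' h
    have := QuotientGroup.eq.1 h.symm
    rw [Subgroup.mem_subgroupOf] at this
    rw [div_eq_mul_inv, mul_comm]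
    exact this
  have href : ∀ c : C2, ∃ V : Ideal (𝓞 M), V ≠ ⊥ ∧ act g V = V ∧
      cl V = c * ((Function.invFun f (f c) : C2) : ClassGroup (𝓞 M)) := by
    intro c
    apply hsame
    apply hf
    exact (Function.invFun_eq ⟨c, rfl⟩).symm
  choose V hV0 hVg hVcl using href
  have hz : ∀ q : QD, ∃ z : 𝓞 M, z ≠ 0 ∧ ((q.out : Em) : (𝓞 M)ˣ) * oi g z = z := by
    intro q
    have h1 := (hEm _).1 (q.out : Em).2
    have h2 : (((q.out : Em) : (𝓞 M)ˣ) : 𝓞 M) * oi g (((q.out : Em) : (𝓞 M)ˣ) : 𝓞 M) = 1 * oi g 1 := by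
      rw [map_one, one_mul]; exact congrArg Units.val h1
    obtain ⟨w, hw, hw'⟩ := Q.hilbert90 one_ne_zero h2
    exact ⟨w, hw, by rw [hw', one_mul]⟩
  choose z hz0 hz using hz
  have hzg : ∀ q, act g (Ideal.span {z q}) = Ideal.span {z q} := by
    intro q
    rw [act_span, Ideal.span_singleton_eq_span_singleton]
    exact ⟨((q.out : Em) : (𝓞 M)ˣ), by rw [mul_comm]; exact hz q⟩
  have hzs : ∀ q, Ideal.span {z q} ≠ ⊥ := fun q => by simpa using hz0 q
  let Φ : QD × C2 → (T' → ZMod 2) × QN := fun x => (par T' (Ideal.span {z x.1} * V x.2), f x.2)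
  set h := Nat.card (ClassGroup (𝓞 K)) with hh
  have hΦ : Function.Injective Φ := by
    rintro ⟨q, c⟩ ⟨q', c'⟩ hqc
    have h1 : par T' (Ideal.span {z q} * V c) = par T' (Ideal.span {z q'} * V c') :=
      congrArg Prod.fst hqc
    have h2 : f c = f c' := congrArg Prod.snd hqc
    have h3 := Q.inv_par T' hTi hTT (mul_ne_zero (hzs q) (hV0 c)) (mul_ne_zero (hzs q') (hV0 c'))
      (by rw [act_mul, hzg, hVg]) (by rw [act_mul, hzg, hVg]) h1
    rw [cl_mul (hzs q) (hV0 c), cl_mul (hzs q') (hV0 c'), cl_span, cl_span, one_mul, one_mul,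
      hVcl, hVcl, ← h2, mul_pow, mul_pow] at h3
    have h4 := mul_right_cancel h3
    have h5 : ∀ c : C2, (c : ClassGroup (𝓞 M)) ^ h = c := by
      intro c
      obtain ⟨r, hr⟩ := hK
      rw [hr, pow_succ, pow_mul, hc2, one_pow, one_mul]
    rw [h5, h5] at h4
    have h6 : c = c' := Subtype.ext h4
    subst h6
    rw [par_mul T' (hzs q) (hV0 c), par_mul T' (hzs q') (hV0 c)] at h1
    have h7 := add_right_cancel h1
    obtain ⟨x, hx⟩ := Q.unit_par hK T' hTi hTT (hz0 q) (hz0 q') (hz q) (hz q')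
      (congrArg Units.val ((hEm _).1 (q.out : Em).2))
      (congrArg Units.val ((hEm _).1 (q'.out : Em).2)) h7
    have h8 : q = q' := by
      rw [← QuotientGroup.out_eq' q, ← QuotientGroup.out_eq' q', eq_comm, QuotientGroup.eq,
        Subgroup.mem_subgroupOf]
      refine ⟨x, ?_⟩
      rw [hD]
      push_cast
      rw [inv_mul_eq_div, div_eq_div_iff_mul_eq_mul, mul_comm, hx]
    rw [h8]
  -- counting
  obtain ⟨eqv, heqv⟩ := Q.unitEK_equiv EK (fun x => by
    rw [hEK]; exact ⟨fun h => congrArg Units.val h, fun h => Units.ext h⟩)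
  have hKi : (powMonoidHom 2 : EK →* EK).range.index = 2 ^ (Units.rank K + 1) := by
    rw [← index_sq_congr eqv, units_index_sq]
  have hNK0 : N.range.relIndex EK ≠ 0 := by
    have hle : (powMonoidHom 2 : EK →* EK).range ≤ N.range.subgroupOf EK := by
      rintro _ ⟨x, rfl⟩
      rw [Subgroup.mem_subgroupOf]
      refine ⟨x, ?_⟩
      rw [hN, (hEK _).1 x.2]
      simp [pow_two]
    have h1 := Subgroup.index_dvd_of_le hle
    rw [hKi] at h1
    intro h0
    rw [Subgroup.relIndex] at h0
    rw [h0, zero_dvd_iff] at h1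
    exact absurd h1 (by positivity)
  have hmul := Subgroup.relIndex_mul_relIndex _ _ _ hNEN hENK
  have hB0 : N.range.relIndex EN ≠ 0 := fun h0 => hNK0 (by rw [← hmul, h0, zero_mul])
  have hA0' : EN.relIndex EK ≠ 0 := fun h0 => hNK0 (by rw [← hmul, h0, mul_zero])
  haveI : Finite QN := (Nat.finite_of_card_ne_zero hB0)
  haveI : Finite (QD × C2) := Finite.of_injective Φ hΦ
  haveI : Finite QD := Finite.of_injective (fun q : QD => (q, (1 : C2)))
    (fun a b h => congrArg Prod.fst h)
  have hD0 : D.range.relIndex Em ≠ 0 := (Nat.card_pos (α := QD)).ne'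
  have hle := Nat.card_le_card_of_injective Φ hΦ
  rw [Nat.card_prod, Nat.card_prod] at hle
  have hp : Nat.card (T' → ZMod 2) = 2 ^ T'.card := by
    simp [Nat.card_eq_fintype_card, ZMod.card]
  rw [hp] at hle
  have hle' : D.range.relIndex Em * Nat.card C2 ≤ 2 ^ T'.card * N.range.relIndex EN := hle
  obtain ⟨hH, -⟩ := herbrand_ineq gu hgg EK Em hEK hEm N D hN hD (-1)
    (by
      intro h0
      have h1 : (-1 : 𝓞 M) = 1 := congrArg Units.val h0
      norm_num at h1)
    (Units.ext (by rw [hguc]; simp)) units_sq_eq_one_iff (Units.rank M) (Units.rank K)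
    (units_index_sq M) hKi hD0
  have hda : d ≤ EN.relIndex EK := by
    rcases hd with rfl | ⟨rfl, ε, hε⟩
    · omega
    · have : EN.relIndex EK ≠ 1 := by
        rw [Ne, Subgroup.relIndex_eq_one]
        intro h0
        obtain ⟨y, -, hy⟩ := h0 (eqv ε).2
        have h1 : algebraMap (𝓞 M) M (((eqv ε : EK) : (𝓞 M)ˣ) : 𝓞 M) = y * g y := hy
        rw [heqv] at h1
        exact hε y h1
      omega
  rw [← hmul] at hH
  have h2T : 2 ^ T'.card ≤ 2 ^ T.card := Nat.pow_le_pow_right (by norm_num) hcard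
  generalize N.range.relIndex EN = B at *
  generalize EN.relIndex EK = a at *
  generalize D.range.relIndex Em = A at *
  generalize Nat.card C2 = n at *
  refine le_of_mul_le_mul_left (a := B) ?_ (Nat.pos_of_ne_zero hB0)
  calc B * (n * d * 2 ^ Units.rank M) ≤ B * (n * a * 2 ^ Units.rank M) := by gcongr
    _ = n * (B * a * 2 ^ Units.rank M) := by ring
    _ ≤ n * (A * 2 ^ (2 * Units.rank K)) := by gcongr
    _ = (A * n) * 2 ^ (2 * Units.rank K) := by ring
    _ ≤ (2 ^ T.card * B) * 2 ^ (2 * Units.rank K) := by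
      exact Nat.mul_le_mul_right _ (hle'.trans (Nat.mul_le_mul_right _ h2T))
    _ = _ := by rw [pow_add]; ring
end QuadExt

set_option linter.unusedSectionVars false

/-! ### Constructing quadratic extensions -/

theorem quadExt_of_finrank {K M : Type*} [Field K] [NumberField K] [Field M] [NumberField M]
    [Algebra K M] (h : Module.finrank K M = 2) : ∃ g : M ≃+* M, QuadExt K M g := by
  have : Algebra.IsQuadraticExtension K M := ⟨h⟩
  have hfd : FiniteDimensional K M := Module.finite_of_finrank_pos (by omega)
  have hc : Nat.card Gal(M/K) = 2 := by rw [IsGalois.card_aut_eq_finrank, h]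
  have hnt : Nontrivial Gal(M/K) := Finite.one_lt_card_iff_nontrivial.1 (by omega)
  obtain ⟨g, hg⟩ := exists_ne (1 : Gal(M/K))
  have hall : ∀ f : Gal(M/K), f = 1 ∨ f = g := by
    intro f
    by_contra hcon
    push Not at hcon
    have h3 : Function.Injective ![1, g, f] := by
      intro i j hij
      fin_cases i <;> fin_cases j <;> simp_all [eq_comm]
    have := Nat.card_le_card_of_injective _ h3
    rw [hc] at this
    simp at this
  refine ⟨g.toRingEquiv, ⟨?_, ?_, ?_⟩⟩
  · intro x
    constructor
    · intro hx
      rw [IsGalois.mem_range_algebraMap_iff_fixed]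
      intro f
      rcases hall f with rfl | rfl
      · rfl
      · exact hx
    · rintro ⟨y, rfl⟩
      exact g.commutes y
  · intro x
    have : g * g = 1 := by
      rw [← sq, ← hc]; exact pow_card_eq_one'
    exact congrArg (fun f : Gal(M/K) => f x) this
  · by_contra hcon
    push Not at hcon
    exact hg (AlgEquiv.ext hcon)

namespace QuadExt
variable {K M : Type*} [Field K] [NumberField K] [Field M] [NumberField M] [Algebra K M]
  {g : M ≃+* M}

theorem neg (Q : QuadExt K M g) {x : M} (h2 : x ^ 2 ∈ Set.range (algebraMap K M))
    (hx : x ∉ Set.range (algebraMap K M)) : g x = -x := by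
  have h1 : g (x ^ 2) = x ^ 2 := (Q.fix _).2 h2
  rw [map_pow] at h1
  rcases sq_eq_sq_iff_eq_or_eq_neg.1 h1 with h | h
  · exact absurd ((Q.fix x).1 h) hx
  · exact h

theorem decomp (Q : QuadExt K M g) {x : M} (hx0 : x ≠ 0) (hx : g x = -x) (y : M) :
    ∃ a b : K, y = algebraMap K M a + algebraMap K M b * x := by
  obtain ⟨a, ha⟩ := (Q.fix ((y + g y) / 2)).1 (by
    rw [map_div₀, map_add, Q.inv, map_ofNat, add_comm])
  obtain ⟨b, hb⟩ := (Q.fix ((y - g y) / (2 * x))).1 (by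
    rw [map_div₀, map_sub, Q.inv, map_mul, hx, map_ofNat]
    field_simp
    ring)
  refine ⟨a, b, ?_⟩
  rw [ha, hb]
  field_simp
  ring

theorem norm_decomp (Q : QuadExt K M g) {x : M} (hx0 : x ≠ 0) (hx : g x = -x) (y : M) :
    ∃ a b : K, y = algebraMap K M a + algebraMap K M b * x ∧
      y * g y = algebraMap K M a ^ 2 - algebraMap K M b ^ 2 * x ^ 2 := by
  obtain ⟨a, b, h⟩ := Q.decomp hx0 hx y
  refine ⟨a, b, h, ?_⟩
  have h1 := (Q.fix (algebraMap K M a)).2 ⟨a, rfl⟩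
  have h2 := (Q.fix (algebraMap K M b)).2 ⟨b, rfl⟩
  rw [h, map_add, map_mul, h1, h2, hx]
  ring

end QuadExt

/-! ### Intermediate fields -/

theorem adjoin_coe_top {M : Type*} [Field M] [NumberField M] (S : Set M)
    (S' : Set (adjoin ℚ S)) (h : (fun x : adjoin ℚ S => (x : M)) '' S' = S) :
    adjoin ℚ S' = ⊤ := by
  have key : ∀ y, y ∈ adjoin ℚ S → ∃ y' : adjoin ℚ S, (y' : M) = y ∧ y' ∈ adjoin ℚ S' := by
    intro y hy
    induction hy using adjoin_induction with
    | mem x hx =>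
      rw [← h] at hx
      obtain ⟨x', hx', rfl⟩ := hx
      exact ⟨x', rfl, subset_adjoin _ _ hx'⟩
    | algebraMap x => exact ⟨algebraMap ℚ _ x, by simp, (adjoin ℚ S').algebraMap_mem x⟩
    | add x y _ _ hx hy =>
      obtain ⟨x', rfl, hx'⟩ := hx
      obtain ⟨y', rfl, hy'⟩ := hy
      exact ⟨x' + y', rfl, add_mem hx' hy'⟩
    | inv x _ hx =>
      obtain ⟨x', rfl, hx'⟩ := hx
      exact ⟨x'⁻¹, rfl, inv_mem hx'⟩
    | mul x y _ _ hx hy =>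
      obtain ⟨x', rfl, hx'⟩ := hx
      obtain ⟨y', rfl, hy'⟩ := hy
      exact ⟨x' * y', rfl, mul_mem hx' hy'⟩
  rw [eq_top_iff]
  intro y _
  obtain ⟨y', h1, h2⟩ := key y y.2
  rwa [← Subtype.ext h1]

theorem ringHom_ext_top {M L : Type*} [Field M] [NumberField M] [Field L] {S : Set M}
    (hS : adjoin ℚ S = ⊤) (φ ψ : M →+* L) (h : ∀ y ∈ S, φ y = ψ y) (x : M) : φ x = ψ x := by
  have hy : x ∈ adjoin ℚ S := by rw [hS]; trivial
  induction hy using adjoin_induction with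
  | mem x hx => exact h x hx
  | algebraMap x =>
    rw [eq_ratCast]
    exact (map_ratCast φ x).trans (map_ratCast ψ x).symm
  | add x y _ _ hx hy => rw [map_add, map_add, hx, hy]
  | inv x _ hx => rw [map_inv₀, map_inv₀, hx]
  | mul x y _ _ hx hy => rw [map_mul, map_mul, hx, hy]

theorem mem_range_iff {M : Type*} [Field M] [NumberField M] (K : IntermediateField ℚ M) (x : M) :
    x ∈ Set.range (algebraMap K M) ↔ x ∈ K := by
  constructor
  · rintro ⟨y, rfl⟩; exact y.2
  · intro h; exact ⟨⟨x, h⟩, rfl⟩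

/-- If `M` is generated over `K` by one element with a quadratic relation, outside `K`. -/
theorem finrank_two_of' {K M : Type*} [Field K] [NumberField K] [Field M] [NumberField M]
    [Algebra K M]
    (S : Set M) (hS : adjoin ℚ S = ⊤) (x : M) (hx2 : x ^ 2 ∈ Set.range (algebraMap K M))
    (hx : x ∉ Set.range (algebraMap K M))
    (hSx : ∀ y ∈ S, ∃ a b : K, y = algebraMap K M a + algebraMap K M b * x) :
    Module.finrank K M = 2 := by
  have htop : adjoin K {x} = ⊤ := by
    rw [eq_top_iff]
    intro y _
    have hy : y ∈ adjoin ℚ S := by rw [hS]; trivial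
    induction hy using adjoin_induction with
    | mem y hy =>
      obtain ⟨a, b, rfl⟩ := hSx y hy
      have hxm : x ∈ adjoin K {x} := mem_adjoin_simple_self K x
      exact add_mem ((adjoin K {x}).algebraMap_mem a)
        (mul_mem ((adjoin K {x}).algebraMap_mem b) hxm)
    | algebraMap q =>
      rw [eq_ratCast, ← map_ratCast (algebraMap K M)]
      exact (adjoin K {x}).algebraMap_mem _
    | add x y _ _ hx hy => exact add_mem (hx trivial) (hy trivial)
    | inv x _ hx => exact inv_mem (hx trivial)
    | mul x y _ _ hx hy => exact mul_mem (hx trivial) (hy trivial)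
  obtain ⟨q, hq⟩ := hx2
  have hr : Polynomial.aeval x (Polynomial.X ^ 2 - Polynomial.C q) = 0 := by
    simp only [map_sub, map_pow, Polynomial.aeval_X, Polynomial.aeval_C]
    rw [hq, sub_self]
  have hint : IsIntegral K x :=
    ⟨Polynomial.X ^ 2 - Polynomial.C q, Polynomial.monic_X_pow_sub_C q (by norm_num), hr⟩
  have h1 : Module.finrank K (adjoin K {x}) = (minpoly K x).natDegree :=
    adjoin.finrank hint
  rw [htop, finrank_top'] at h1
  rw [h1]
  apply le_antisymm
  · have : (Polynomial.X ^ 2 - Polynomial.C q).natDegree = 2 :=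
      Polynomial.natDegree_X_pow_sub_C
    rw [← this]
    apply Polynomial.natDegree_le_of_dvd
    · exact minpoly.dvd _ _ hr
    · exact Polynomial.X_pow_sub_C_ne_zero (by norm_num) _
  · rw [minpoly.two_le_natDegree_iff hint]
    exact hx

theorem finrank_two_of {M : Type*} [Field M] [NumberField M] (K : IntermediateField ℚ M)
    (S : Set M) (hS : adjoin ℚ S = ⊤) (x : M) (hx2 : x ^ 2 ∈ K) (hx : x ∉ K)
    (hSx : ∀ y ∈ S, ∃ a b : M, a ∈ K ∧ b ∈ K ∧ y = a + b * x) : Module.finrank K M = 2 := by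
  refine finrank_two_of' S hS x ((mem_range_iff K _).2 hx2) (fun h => hx ((mem_range_iff K _).1 h)) ?_
  intro y hy
  obtain ⟨a, b, ha, hb, h⟩ := hSx y hy
  exact ⟨⟨a, ha⟩, ⟨b, hb⟩, h⟩

/-- Integers of a subfield. -/
theorem exists_int {M : Type*} [Field M] [NumberField M] (K : IntermediateField ℚ M) (x : 𝓞 M)
    (hx : (x : M) ∈ K) : ∃ y : 𝓞 K, algebraMap (𝓞 K) (𝓞 M) y = x := by
  have h1 : IsIntegral ℤ (⟨x, hx⟩ : K) := by
    have h2 := RingOfIntegers.isIntegral_coe x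
    rw [← isIntegral_algHom_iff (f := (algebraMap K M).toIntAlgHom) (algebraMap K M).injective]
    exact h2
  refine ⟨⟨⟨x, hx⟩, h1⟩, ?_⟩
  apply RingOfIntegers.coe_injective
  rfl

theorem mul_finrank_two {M : Type*} [Field M] [NumberField M] (K : IntermediateField ℚ M)
    (h : Module.finrank K M = 2) : Module.finrank ℚ M = 2 * Module.finrank ℚ K := by
  rw [← Module.finrank_mul_finrank ℚ K M, h, mul_comm]

/-! ### Unit ranks -/

theorem rank_real {M : Type*} [Field M] [NumberField M] (S : Set M) (hS : adjoin ℚ S = ⊤)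
    (h : ∀ φ : M →+* ℂ, ∀ y ∈ S, (φ y).im = 0) :
    Units.rank M + 1 = Module.finrank ℚ M := by
  have hreal : ∀ φ : M →+* ℂ, ComplexEmbedding.IsReal φ := by
    intro φ
    have key : ∀ y : M, (starRingEnd ℂ) (φ y) = φ y := fun y =>
      ringHom_ext_top hS ((starRingEnd ℂ).comp φ) φ
        (fun x hx => Complex.conj_eq_iff_im.2 (h φ x hx)) y
    ext y
    exact key y
  have htr : IsTotallyReal M := by
    constructor
    intro v
    rw [← InfinitePlace.mk_embedding v]
    exact InfinitePlace.isReal_mk_iff.2 (hreal _)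
  rw [Units.rank, InfinitePlace.card_eq_nrRealPlaces_add_nrComplexPlaces,
    IsTotallyReal.nrComplexPlaces_eq_zero, IsTotallyReal.finrank]
  have : 0 < InfinitePlace.nrRealPlaces M := by
    rw [← IsTotallyReal.finrank]; exact Module.finrank_pos
  omega

theorem rank_cpx {M : Type*} [Field M] [NumberField M]
    (h : InfinitePlace.nrRealPlaces M = 0) :
    2 * (Units.rank M + 1) = Module.finrank ℚ M := by
  have h1 := InfinitePlace.card_add_two_mul_card_eq_rank M
  rw [Units.rank, InfinitePlace.card_eq_nrRealPlaces_add_nrComplexPlaces]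
  have : 0 < Module.finrank ℚ M := Module.finrank_pos
  omega

theorem nrReal_zero_of_sq {M : Type*} [Field M] [NumberField M] (w : M) (d : ℤ) (hd : d < 0)
    (hw : w ^ 2 = d) : InfinitePlace.nrRealPlaces M = 0 := by
  rw [nrRealPlaces_eq_zero_iff]
  constructor
  intro v
  rw [← InfinitePlace.mk_embedding v]
  rw [InfinitePlace.isComplex_mk_iff]
  intro hr
  have h1 : (v.embedding w) ^ 2 = (d : ℂ) := by rw [← map_pow, hw, map_intCast]
  have h2 : (v.embedding w).im = 0 := by
    rw [← Complex.conj_eq_iff_im]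
    exact RingHom.congr_fun hr w
  have h3 : (v.embedding w) = (((v.embedding w).re : ℝ) : ℂ) := Complex.ext rfl (by simp [h2])
  rw [h3] at h1
  have h4 : ((v.embedding w).re) ^ 2 = (d : ℝ) := by exact_mod_cast h1
  have h5 : (d : ℝ) < 0 := by exact_mod_cast hd
  nlinarith [sq_nonneg (v.embedding w).re]

/-- A step of `lemmaU` with exactly one ramified prime. -/
theorem QuadExt.odd_step {K M : Type*} [Field K] [NumberField K] [Field M] [NumberField M]
    [Algebra K M] {g : M ≃+* M} (Q : QuadExt K M g) (hK : Odd (Nat.card (ClassGroup (𝓞 K))))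
    (x w : 𝓞 M) (hx : (Ideal.span {x}).absNorm = 2)
    (hw : ∀ P : Ideal (𝓞 M), P.IsPrime → w - oi g w ∈ P → x ∈ P)
    (d : ℕ) (hd : d = 1 ∨ (d = 2 ∧ ∃ ε : (𝓞 K)ˣ, ∀ y : M, algebraMap K M ε ≠ y * g y))
    (hr : 2 ^ (1 + 2 * Units.rank K) ≤ d * 2 ^ Units.rank M) :
    Odd (Nat.card (ClassGroup (𝓞 M))) := by
  apply odd_card_of_ker
  have h := Q.lemmaU hK {Ideal.span {x}} (by
    intro P hP hP0 hPw
    rw [Finset.mem_singleton]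
    have h1 : Ideal.span {x} ≤ P := by
      rw [Ideal.span_singleton_le_iff_mem]; exact hw P hP (hPw w)
    have h2 : (Ideal.span {x}).IsPrime := Ideal.isPrime_of_irreducible_absNorm (by
      rw [hx]; exact Nat.prime_two)
    have h3 : Ideal.span {x} ≠ ⊥ := by
      intro h0; rw [h0] at hx; simp at hx
    exact ((h2.isMaximal h3).eq_of_le hP.ne_top h1).symm) d hd
  rw [Finset.card_singleton, mul_assoc] at h
  by_contra hcon
  push Not at hcon
  have h2 := Nat.mul_le_mul hcon (le_refl (d * 2 ^ Units.rank M))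
  have : 0 < 2 ^ (1 + 2 * Units.rank K) := by positivity
  omega

set_option linter.unusedSectionVars false

theorem one_sub_assoc {R : Type*} [CommRing R] [IsDomain R] [CharZero R] : ∀ (k : ℕ) (z : R),
    IsPrimitiveRoot z (2 ^ (k + 1)) → Associated ((1 - z) ^ (2 ^ k)) 2
  | 0, z, h => by
    have h' : z = -1 := h.eq_neg_one_of_two_right
    rw [h']
    norm_num
  | k + 1, z, h => by
    have h2 : IsPrimitiveRoot (z ^ 2) (2 ^ (k + 1)) :=
      h.pow (by positivity) (by rw [pow_succ, mul_comm])
    have ih := one_sub_assoc k (z ^ 2) h2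
    have hm : z ^ 2 ^ (k + 1) = -1 := by
      have h3 : IsPrimitiveRoot (z ^ 2 ^ (k + 1)) 2 :=
        h.pow (by positivity) (by rw [pow_succ _ (k + 1)])
      exact h3.eq_neg_one_of_two_right
    have ha : Associated (z - 1) (z ^ (2 ^ (k + 1) + 1) - 1) :=
      h.associated_sub_one_pow_sub_one_of_coprime (by
        apply Nat.Coprime.pow_right
        rw [Nat.coprime_two_right, pow_succ]
        exact ⟨2 ^ k, by ring⟩)
    have hb : z ^ (2 ^ (k + 1) + 1) - 1 = -(1 + z) := by rw [pow_succ, hm]; ring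
    have hc : Associated (1 - z) (1 + z) := by
      rw [hb] at ha
      have := ha.neg_left.neg_right
      simpa using this
    have hd : Associated ((1 - z) ^ 2) (1 - z ^ 2) := by
      have : 1 - z ^ 2 = (1 - z) * (1 + z) := by ring
      rw [this, sq]
      exact (Associated.refl _).mul_mul hc
    have he : (1 - z) ^ 2 ^ (k + 1) = ((1 - z) ^ 2) ^ 2 ^ k := by
      rw [← pow_mul, pow_succ, mul_comm]
    rw [he]
    exact (hd.pow_pow).trans ih

section
variable {M : Type*} [Field M] [NumberField M]

theorem absNorm_assoc {x y : 𝓞 M} (h : Associated x y) :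
    (Ideal.span {x}).absNorm = (Ideal.span {y}).absNorm := by
  rw [Ideal.span_singleton_eq_span_singleton.2 h]

theorem absNorm_pow_span (x : 𝓞 M) (n : ℕ) :
    (Ideal.span {x ^ n}).absNorm = (Ideal.span {x}).absNorm ^ n := by
  rw [← Ideal.span_singleton_pow, map_pow]

theorem absNorm_two : (Ideal.span {(2 : 𝓞 M)}).absNorm = 2 ^ Module.finrank ℚ M := by
  have h := Ideal.absNorm_span_natCast (S := 𝓞 M) 2
  rw [RingOfIntegers.rank] at h
  exact_mod_cast h

theorem absNorm_one_sub {k : ℕ} {z : 𝓞 M} (h : IsPrimitiveRoot z (2 ^ (k + 1))) (e : ℕ)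
    (he : Module.finrank ℚ M = 2 ^ k * e) : (Ideal.span {1 - z}).absNorm = 2 ^ e := by
  have h1 := absNorm_assoc (one_sub_assoc k z h)
  rw [absNorm_pow_span, absNorm_two, he, mul_comm, pow_mul] at h1
  exact Nat.pow_left_injective (n := 2 ^ k) (by positivity) h1

theorem one_sub_mem {k : ℕ} {z : 𝓞 M} (h : IsPrimitiveRoot z (2 ^ (k + 1))) {P : Ideal (𝓞 M)}
    (hP : P.IsPrime) (h2 : (2 : 𝓞 M) ∈ P) : 1 - z ∈ P := by
  obtain ⟨u, hu⟩ := (one_sub_assoc k z h).symm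
  refine hP.mem_of_pow_mem (2 ^ k) ?_
  rw [← hu]
  exact P.mul_mem_right _ h2

theorem prim_neg_one {k : ℕ} {R : Type*} [CommRing R] [IsDomain R] {z : R}
    (h : IsPrimitiveRoot z (2 ^ (k + 1))) : z ^ 2 ^ k = -1 := by
  have h3 : IsPrimitiveRoot (z ^ 2 ^ k) 2 := h.pow (by positivity) (by rw [pow_succ])
  exact h3.eq_neg_one_of_two_right

theorem unit_not_mem {P : Ideal (𝓞 M)} (hP : P.IsPrime) {x : 𝓞 M} (hx : IsUnit x) : x ∉ P :=
  fun h => hP.ne_top (P.eq_top_of_isUnit_mem h hx)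

theorem nrReal_zero_of_prim {m : ℕ} {z : 𝓞 M} (h : IsPrimitiveRoot z (2 ^ (m + 2))) :
    InfinitePlace.nrRealPlaces M = 0 := by
  have h' : IsPrimitiveRoot (z : M) (2 ^ (m + 2)) :=
    h.map_of_injective (f := algebraMap (𝓞 M) M) RingOfIntegers.coe_injective
  exact InfinitePlace.IsPrimitiveRoot.nrRealPlaces_eq_zero_of_two_lt (by
    have : 2 ^ 2 ≤ 2 ^ (m + 2) := Nat.pow_le_pow_right (by norm_num) (by omega)
    omega) h'
end

/-- `F = ℚ(ζ_{2^{m+2}})`. -/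
structure IsF (m : ℕ) (F : Type*) [Field F] [NumberField F] (z : 𝓞 F) : Prop where
  prim : IsPrimitiveRoot z (2 ^ (m + 2))
  top : adjoin ℚ {(z : F)} = ⊤

namespace IsF
variable {m : ℕ} {F : Type*} [Field F] [NumberField F] {z : 𝓞 F}

theorem primF (h : IsF m F z) : IsPrimitiveRoot (z : F) (2 ^ (m + 2)) :=
    h.prim.map_of_injective (f := algebraMap (𝓞 F) F) RingOfIntegers.coe_injective

theorem cyc (h : IsF m F z) : IsCyclotomicExtension {2 ^ (m + 2)} ℚ F := by
  rw [IsCyclotomicExtension.iff_singleton]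
  refine ⟨⟨_, h.primF⟩, ?_⟩
  intro x
  have hx : x ∈ adjoin ℚ {(z : F)} := by rw [h.top]; trivial
  rw [← IntermediateField.mem_toSubalgebra, adjoin_simple_toSubalgebra_of_isAlgebraic
    (Algebra.IsAlgebraic.isAlgebraic _)] at hx
  refine Algebra.adjoin_mono ?_ hx
  rw [Set.singleton_subset_iff]
  exact h.primF.pow_eq_one

theorem finrank (h : IsF m F z) : Module.finrank ℚ F = 2 ^ (m + 1) := by
  have := h.cyc
  rw [IsCyclotomicExtension.Rat.finrank (2 ^ (m + 2)) F, Nat.totient_prime_pow Nat.prime_two (by omega)]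
  simp

theorem rank (h : IsF m F z) : Units.rank F + 1 = 2 ^ m := by
  have h1 := rank_cpx (nrReal_zero_of_prim h.prim)
  rw [h.finrank, pow_succ] at h1
  omega

theorem absNorm (h : IsF m F z) : (Ideal.span {1 - z}).absNorm = 2 := by
  have := absNorm_one_sub (k := m + 1) h.prim 1 (by rw [h.finrank, mul_one])
  simpa using this
end IsF

/-- The subfield generated by the square of a root of unity. -/
theorem exists_isF_sub {M : Type*} [Field M] [NumberField M] {m : ℕ} {z : 𝓞 M}
    (h : IsPrimitiveRoot z (2 ^ (m + 2))) :
    ∃ (K : IntermediateField ℚ M) (z' : 𝓞 K), K = adjoin ℚ {(z : M)} ∧ IsF m K z' ∧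
      algebraMap (𝓞 K) (𝓞 M) z' = z := by
  obtain ⟨z', hz'⟩ := exists_int (adjoin ℚ {(z : M)}) z (mem_adjoin_simple_self _ _)
  refine ⟨_, z', rfl, ⟨?_, ?_⟩, hz'⟩
  · apply IsPrimitiveRoot.of_map_of_injective (f := algebraMap (𝓞 (adjoin ℚ {(z : M)})) (𝓞 M))
    · rw [hz']; exact h
    · exact FaithfulSMul.algebraMap_injective _ _
  · apply adjoin_coe_top
    rw [Set.image_singleton]
    congr 1
    exact congrArg (algebraMap (𝓞 M) M) hz'

/-- imaginary (or any) quadratic fields over `ℚ` -/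
theorem quad_over_Q {M : Type*} [Field M] [NumberField M] {w : 𝓞 M} {d : ℤ} (hw : w ^ 2 = d)
    (hd : ∀ a : ℚ, a ^ 2 ≠ d) (htop : adjoin ℚ {(w : M)} = ⊤) :
    Module.finrank ℚ M = 2 ∧ ∃ g : M ≃+* M, QuadExt ℚ M g ∧ oi g w = -w := by
  have hw' : (w : M) ^ 2 = d := by
    have := congrArg (algebraMap (𝓞 M) M) hw
    simpa using this
  have hn : (w : M) ∉ Set.range (algebraMap ℚ M) := by
    rintro ⟨a, ha⟩
    rw [← ha] at hw'
    apply hd a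
    apply (algebraMap ℚ M).injective
    rw [map_pow, hw']; simp
  have h2 : (w : M) ^ 2 ∈ Set.range (algebraMap ℚ M) := ⟨d, by rw [hw']; simp⟩
  have hf : Module.finrank ℚ M = 2 := finrank_two_of' {(w : M)} htop w h2 hn (by
    intro y hy
    exact ⟨0, 1, by rw [Set.mem_singleton_iff.1 hy]; simp⟩)
  obtain ⟨g, hg⟩ := quadExt_of_finrank hf
  refine ⟨hf, g, hg, ?_⟩
  apply RingOfIntegers.coe_injective
  rw [map_neg]
  exact hg.neg h2 hn

theorem odd_card_Q : Odd (Nat.card (ClassGroup (𝓞 ℚ))) := by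
  have := Rat.classNumber_eq
  rw [classNumber, ← Nat.card_eq_fintype_card] at this
  rw [this]; exact odd_one

theorem rank_Q : Units.rank ℚ = 0 := by
  have := rank_real (M := ℚ) ∅ (by
    rw [eq_top_iff]; intro x _
    exact (adjoin ℚ ∅).algebraMap_mem x) (by simp)
  rw [Module.finrank_self] at this
  omega

theorem imag_nonnorm {M : Type*} [Field M] [NumberField M] {w : 𝓞 M} {d : ℤ} (hd : d < 0)
    (hw : w ^ 2 = d) {g : M ≃+* M} (Q : QuadExt ℚ M g) (hg : oi g w = -w) :
    ∃ ε : (𝓞 ℚ)ˣ, ∀ y : M, algebraMap ℚ M ε ≠ y * g y := by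
  refine ⟨-1, fun y hy => ?_⟩
  have hw' : (w : M) ^ 2 = d := by
    have := congrArg (algebraMap (𝓞 M) M) hw
    simpa using this
  have hw0 : (w : M) ≠ 0 := by
    intro h0
    rw [h0] at hw'
    have : d = 0 := by
      have : (d : M) = 0 := by rw [← hw']; ring
      exact_mod_cast this
    omega
  obtain ⟨a, b, -, h⟩ := Q.norm_decomp hw0 (by
    have := congrArg (algebraMap (𝓞 M) M) hg
    rw [map_neg] at this
    exact this) y
  rw [← hy, hw'] at h
  have h1 : (-1 : ℚ) = a ^ 2 - b ^ 2 * d := by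
    apply (algebraMap ℚ M).injective
    simpa using h
  have h2 : (d : ℚ) < 0 := by exact_mod_cast hd
  nlinarith [sq_nonneg a, sq_nonneg b, mul_nonneg (sq_nonneg b) (neg_nonneg.2 h2.le)]

theorem imag_not_sq {d : ℤ} (hd : d < 0) (a : ℚ) : a ^ 2 ≠ d := by
  intro h
  have h2 : (d : ℚ) < 0 := by exact_mod_cast hd
  nlinarith [sq_nonneg a]

theorem imag_rank {M : Type*} [Field M] [NumberField M] {w : 𝓞 M} {d : ℤ} (hd : d < 0)
    (hw : w ^ 2 = d) (hf : Module.finrank ℚ M = 2) : Units.rank M = 0 := by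
  have := rank_cpx (nrReal_zero_of_sq (w : M) d hd (by
    have := congrArg (algebraMap (𝓞 M) M) hw
    simpa using this))
  omega

/-- imaginary quadratic fields with one ramified prime have odd class number -/
theorem imag_odd {M : Type*} [Field M] [NumberField M] {w : 𝓞 M} {d : ℤ} (hd : d < 0)
    (hw : w ^ 2 = d) (htop : adjoin ℚ {(w : M)} = ⊤) (x : 𝓞 M)
    (hx : (Ideal.span {x}).absNorm = 2)
    (hP : ∀ P : Ideal (𝓞 M), P.IsPrime → 2 * w ∈ P → x ∈ P) :
    Odd (Nat.card (ClassGroup (𝓞 M))) := by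
  obtain ⟨hf, g, Q, hg⟩ := quad_over_Q hw (imag_not_sq hd) htop
  refine Q.odd_step odd_card_Q x w hx ?_ 2 (Or.inr ⟨rfl, imag_nonnorm hd hw Q hg⟩) ?_
  · intro P hPP h
    apply hP P hPP
    rw [hg] at h
    convert h using 1
    ring
  · rw [rank_Q, imag_rank hd hw hf]
    norm_num

theorem clF_odd : ∀ (m : ℕ) (F : Type) [Field F] [NumberField F] (z : 𝓞 F), IsF m F z →
    Odd (Nat.card (ClassGroup (𝓞 F)))
  | 0, F, _, _, z, h => by
    have hz : z ^ 2 = -1 := by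
      have := prim_neg_one (k := 1) h.prim
      simpa using this
    refine imag_odd (d := -1) (by norm_num) (w := z) (by rw [hz]; simp) h.top (1 - z) h.absNorm ?_
    intro P hP h2
    refine one_sub_mem (k := 1) h.prim hP ?_
    have : (2 : 𝓞 F) = -(2 * z * z) := by linear_combination 2 * hz
    rw [this]
    exact P.neg_mem (P.mul_mem_right _ h2)
  | m + 1, F, _, _, z, h => by
    have h2 : IsPrimitiveRoot (z ^ 2) (2 ^ (m + 2)) :=
      h.prim.pow (by positivity) (by rw [pow_succ, mul_comm])
    obtain ⟨K, z', hKdef, hz', hzz⟩ := exists_isF_sub h2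
    have ih := clF_odd m K z' hz'
    have hf : Module.finrank K F = 2 := by
      have h1 := Module.finrank_mul_finrank ℚ K F
      rw [hz'.finrank, h.finrank, pow_succ _ (m + 1)] at h1
      exact Nat.eq_of_mul_eq_mul_left (by positivity) h1
    obtain ⟨g, Q⟩ := quadExt_of_finrank hf
    have hzK : (z : F) ^ 2 ∈ K := by
      rw [← map_pow, hKdef]
      exact mem_adjoin_simple_self _ _
    have hzn : (z : F) ∉ K := by
      intro hz
      have h3 : K = ⊤ := by
        rw [eq_top_iff, ← h.top, adjoin_le_iff, Set.singleton_subset_iff]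
        exact hz
      have h5 : Module.finrank ℚ (⊤ : IntermediateField ℚ F) = Module.finrank ℚ F :=
        IntermediateField.finrank_top'
      rw [← h3, hz'.finrank, h.finrank] at h5
      have := Nat.pow_right_injective (le_refl 2) h5
      omega
    have hgz : oi g z = -z := by
      apply RingOfIntegers.coe_injective
      rw [map_neg]
      exact Q.neg ((mem_range_iff K _).2 hzK) (fun hc => hzn ((mem_range_iff K _).1 hc))
    refine Q.odd_step ih (1 - z) z h.absNorm ?_ 1 (Or.inl rfl) ?_
    · intro P hP hPz
      refine one_sub_mem (k := m + 2) h.prim hP ?_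
      rw [hgz] at hPz
      have h3 : z - -z = 2 * z := by ring
      rw [h3] at hPz
      exact (hP.mem_or_mem hPz).resolve_right
        (unit_not_mem hP (h.prim.isUnit (by positivity)))
    · have h4 := h.rank
      have h5 := hz'.rank
      rw [one_mul]
      apply Nat.pow_le_pow_right (by norm_num)
      rw [pow_succ] at h4
      omega

set_option linter.unusedSectionVars false

/-- the map `y ↦ y² - 2` -/
def tf {R : Type*} [CommRing R] (y : R) : R := y ^ 2 - 2

theorem tf_map {R S : Type*} [CommRing R] [CommRing S] (f : R →+* S) (m : ℕ) (x : R) :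
    f (tf^[m] x) = tf^[m] (f x) := by
  induction m generalizing x with
  | zero => rfl
  | succ m ih =>
    rw [Function.iterate_succ_apply, ih, Function.iterate_succ_apply]
    congr 1
    rw [tf, tf, map_sub, map_pow, map_ofNat]

open Polynomial in
/-- the minimal polynomial of `2cos(2π/2^{m+2})` -/
noncomputable def fp (m : ℕ) : ℤ[X] := tf^[m] X

open Polynomial in
theorem fp_succ (m : ℕ) : fp (m + 1) = fp m ^ 2 - C 2 := by
  rw [fp, Function.iterate_succ_apply']; rfl

open Polynomial in
theorem fp_deg (m : ℕ) : (fp m).Monic ∧ (fp m).natDegree = 2 ^ m := by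
  induction m with
  | zero => exact ⟨monic_X, natDegree_X⟩
  | succ m ih =>
    have h1 : (fp m ^ 2).Monic := ih.1.pow 2
    have h2 : (fp m ^ 2).natDegree = 2 ^ (m + 1) := by rw [ih.1.natDegree_pow, ih.2, pow_succ, mul_comm]
    rw [fp_succ]
    constructor
    · apply h1.sub_of_left
      apply lt_of_le_of_lt degree_C_le
      rw [← natDegree_pos_iff_degree_pos, h2]
      positivity
    · rw [natDegree_sub_C, h2]

open Polynomial in
theorem fp_mod (m : ℕ) : (fp m).map (Int.castRingHom (ZMod 2)) = X ^ 2 ^ m := by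
  induction m with
  | zero => simp [fp]
  | succ m ih =>
    rw [fp_succ, Polynomial.map_sub, Polynomial.map_pow, ih, map_C]
    have : (Int.castRingHom (ZMod 2)) 2 = 0 := by decide
    rw [this, C_0, sub_zero, ← pow_mul, pow_succ]

open Polynomial in
theorem fp_zero (m : ℕ) : (fp (m + 1)).coeff 0 = 2 ∨ (fp (m + 1)).coeff 0 = -2 := by
  induction m with
  | zero => rw [fp_succ]; simp [fp]
  | succ m ih =>
    left
    rw [fp_succ, coeff_sub, coeff_zero_eq_eval_zero, eval_pow, ← coeff_zero_eq_eval_zero, coeff_C_zero]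
    rcases ih with h | h <;> rw [h] <;> norm_num

open Polynomial in
theorem fp_irr (m : ℕ) : Irreducible ((fp (m + 1)).map (algebraMap ℤ ℚ)) := by
  rw [← (fp_deg (m + 1)).1.irreducible_iff_irreducible_map_fraction_map]
  have h2 : (Ideal.span {(2 : ℤ)}).IsPrime :=
    (Ideal.span_singleton_prime (by norm_num)).2 Int.prime_two
  refine IsEisensteinAt.irreducible (𝓟 := Ideal.span {(2 : ℤ)}) ⟨?_, ?_, ?_⟩ h2
    (fp_deg _).1.isPrimitive (by rw [(fp_deg _).2]; positivity)
  · rw [(fp_deg _).1.leadingCoeff, Ideal.mem_span_singleton]; norm_num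
  · intro n hn
    rw [(fp_deg _).2] at hn
    have := congrArg (fun q => q.coeff n) (fp_mod (m + 1))
    simp only [coeff_map, coeff_X_pow, if_neg hn.ne] at this
    rw [Ideal.mem_span_singleton]
    exact (ZMod.intCast_zmod_eq_zero_iff_dvd _ 2).1 this
  · rw [Ideal.span_singleton_pow, Ideal.mem_span_singleton]
    rcases fp_zero m with h | h <;> rw [h] <;> norm_num

open Polynomial in
theorem fp_aeval {R : Type*} [CommRing R] (m : ℕ) (x : R) : aeval x (fp m) = tf^[m] x := by
  have := tf_map ((aeval x : ℤ[X] →ₐ[ℤ] R) : ℤ[X] →+* R) m X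
  simpa [fp] using this

theorem tf_real : ∀ (m : ℕ) (x : ℂ), (tf^[m] x).im = 0 → |(tf^[m] x).re| ≤ 2 →
    x.im = 0 ∧ |x.re| ≤ 2
  | 0, x, h1, h2 => ⟨h1, h2⟩
  | m + 1, x, h1, h2 => by
    rw [Function.iterate_succ_apply] at h1 h2
    obtain ⟨h3, h4⟩ := tf_real m (tf x) h1 h2
    have h5 : (tf x).re = x.re ^ 2 - x.im ^ 2 - 2 := by simp [tf, pow_two]
    have h6 : (tf x).im = 2 * x.re * x.im := by simp [tf, pow_two]; ring
    rw [h5, abs_le] at h4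
    rw [h6] at h3
    have h7 : x.im = 0 := by
      rcases mul_eq_zero.1 h3 with h | h
      · have h8 : x.re = 0 := by linarith
        rw [h8] at h4
        have : x.im ^ 2 ≤ 0 := by linarith [h4.1]
        nlinarith
      · exact h
    refine ⟨h7, ?_⟩
    rw [h7] at h4
    apply abs_le_of_sq_le_sq _ (by norm_num)
    linarith [h4.2]

theorem tf_mem {R : Type*} [CommRing R] {P : Ideal R} (hP : P.IsPrime) (h2 : (2 : R) ∈ P) :
    ∀ (m : ℕ) (x : R), tf^[m] x ∈ P → x ∈ P
  | 0, x, h => h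
  | m + 1, x, h => by
    rw [Function.iterate_succ_apply] at h
    have h3 := tf_mem hP h2 m (tf x) h
    apply hP.mem_of_pow_mem 2
    have : x ^ 2 = tf x + 2 := by simp [tf]
    rw [this]
    exact P.add_mem h3 h2

/-- `N = ℚ(2cos(2π/2^{m+2}))`. -/
structure IsR (m : ℕ) (N : Type*) [Field N] [NumberField N] (t : 𝓞 N) : Prop where
  it : tf^[m] t = 0
  top : adjoin ℚ {(t : N)} = ⊤

namespace IsR
variable {m : ℕ} {N : Type*} [Field N] [NumberField N] {t : 𝓞 N}

theorem itN (h : IsR m N t) : tf^[m] (t : N) = 0 := by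
  have := congrArg (algebraMap (𝓞 N) N) h.it
  rw [tf_map, map_zero] at this
  exact this

open Polynomial in
theorem minpoly (h : IsR (m + 1) N t) : _root_.minpoly ℚ (t : N) = (fp (m + 1)).map (algebraMap ℤ ℚ) := by
  symm
  apply minpoly.eq_of_irreducible_of_monic (fp_irr m)
  · rw [aeval_map_algebraMap, fp_aeval, h.itN]
  · exact (fp_deg _).1.map _

theorem adj (h : IsR m N t) : Algebra.adjoin ℚ {(t : N)} = ⊤ := by
  rw [← adjoin_simple_toSubalgebra_of_isAlgebraic (Algebra.IsAlgebraic.isAlgebraic _), h.top]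
  rfl

theorem finrank (h : IsR (m + 1) N t) : Module.finrank ℚ N = 2 ^ (m + 1) := by
  have h1 := (PowerBasis.ofAdjoinEqTop' (Algebra.IsIntegral.isIntegral (R := ℚ) (t : N)) h.adj).finrank
  rw [h1, PowerBasis.ofAdjoinEqTop'_dim, h.minpoly,
    (fp_deg _).1.natDegree_map, (fp_deg _).2]

theorem absNorm (h : IsR (m + 1) N t) : (Ideal.span {t}).absNorm = 2 := by
  have h1 := Algebra.PowerBasis.norm_gen_eq_coeff_zero_minpoly
    (PowerBasis.ofAdjoinEqTop' (Algebra.IsIntegral.isIntegral (R := ℚ) (t : N)) h.adj)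
  rw [PowerBasis.ofAdjoinEqTop'_gen, h.minpoly, PowerBasis.ofAdjoinEqTop'_dim, h.minpoly,
    (fp_deg _).1.natDegree_map, (fp_deg _).2, Polynomial.coeff_map] at h1
  rw [Ideal.absNorm_span_singleton]
  have h2 : ((Algebra.norm ℤ t : ℤ) : ℚ) = Algebra.norm ℚ (t : N) := Algebra.coe_norm_int t
  rw [h1, pow_succ 2 m, pow_mul', neg_one_sq, one_pow, one_mul] at h2
  norm_num at h2
  rcases fp_zero m with h | h <;> rw [h] at h2
  · have : Algebra.norm ℤ t = 2 := by exact_mod_cast h2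
    rw [this]; rfl
  · have : Algebra.norm ℤ t = -2 := by exact_mod_cast h2
    rw [this]; rfl

theorem rank (h : IsR (m + 1) N t) : Units.rank N + 1 = 2 ^ (m + 1) := by
  rw [← h.finrank]
  apply rank_real _ h.top
  intro φ y hy
  rw [Set.mem_singleton_iff.1 hy]
  have h1 := congrArg φ h.itN
  rw [tf_map, map_zero] at h1
  exact (tf_real (m + 1) _ (by rw [h1]; rfl) (by rw [h1]; simp)).1
end IsR

theorem exists_isR_sub {M : Type*} [Field M] [NumberField M] {m : ℕ} {t : 𝓞 M}
    (h : tf^[m] t = 0) :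
    ∃ (K : IntermediateField ℚ M) (t' : 𝓞 K), K = adjoin ℚ {(t : M)} ∧ IsR m K t' ∧
      algebraMap (𝓞 K) (𝓞 M) t' = t := by
  obtain ⟨t', ht'⟩ := exists_int (adjoin ℚ {(t : M)}) t (mem_adjoin_simple_self _ _)
  refine ⟨_, t', rfl, ⟨?_, ?_⟩, ht'⟩
  · apply FaithfulSMul.algebraMap_injective (𝓞 (adjoin ℚ {(t : M)})) (𝓞 M)
    rw [tf_map, ht', h, map_zero]
  · apply adjoin_coe_top
    rw [Set.image_singleton]
    congr 1
    exact congrArg (algebraMap (𝓞 M) M) ht'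

theorem clR_odd : ∀ (m : ℕ) (N : Type) [Field N] [NumberField N] (t : 𝓞 N), IsR (m + 1) N t →
    Odd (Nat.card (ClassGroup (𝓞 N)))
  | 0, N, _, _, t, h => by
    have ht : t ^ 2 = (2 : ℤ) := by
      have := h.it
      simp only [zero_add, Function.iterate_one, tf] at this
      push_cast
      linear_combination this
    obtain ⟨hf, g, Q, hg⟩ := quad_over_Q ht (by
      intro a ha
      have h2 : Irrational (√2) := irrational_sqrt_two
      apply h2
      refine ⟨|a|, ?_⟩
      have : (a : ℝ) ^ 2 = 2 := by exact_mod_cast ha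
      rw [← this, Real.sqrt_sq_eq_abs]
      simp) h.top
    refine Q.odd_step odd_card_Q t t h.absNorm ?_ 1 (Or.inl rfl) ?_
    · intro P hP hPt
      rw [hg] at hPt
      have h3 : t - -t = 2 * t := by ring
      rw [h3] at hPt
      rcases hP.mem_or_mem hPt with h2 | h2
      · exact tf_mem hP h2 1 t (by rw [h.it]; exact P.zero_mem)
      · exact h2
    · have := h.rank
      rw [rank_Q]
      rw [zero_add, pow_one] at this
      have : Units.rank N = 1 := by omega
      rw [this]; norm_num
  | m + 1, N, _, _, t, h => by
    have h2 : tf^[m + 1] (tf t) = 0 := h.it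
    obtain ⟨K, t', hKdef, ht', htt⟩ := exists_isR_sub h2
    have ih := clR_odd m K t' ht'
    have hf : Module.finrank K N = 2 := by
      have h1 := Module.finrank_mul_finrank ℚ K N
      rw [ht'.finrank, h.finrank, pow_succ _ (m + 1)] at h1
      exact Nat.eq_of_mul_eq_mul_left (by positivity) h1
    obtain ⟨g, Q⟩ := quadExt_of_finrank hf
    have hzK : (t : N) ^ 2 ∈ K := by
      have h1 : ((tf t : 𝓞 N) : N) ∈ K := by
        rw [hKdef]; exact mem_adjoin_simple_self _ _
      have h3 : (t : N) ^ 2 = ((tf t : 𝓞 N) : N) + 2 := by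
        change algebraMap (𝓞 N) N t ^ 2 = algebraMap (𝓞 N) N (t ^ 2 - 2) + 2
        rw [map_sub, map_pow, map_ofNat]; ring
      rw [h3]
      exact K.add_mem h1 (ofNat_mem K 2)
    have hzn : (t : N) ∉ K := by
      intro hz
      have h3 : K = ⊤ := by
        rw [eq_top_iff, ← h.top, adjoin_le_iff, Set.singleton_subset_iff]
        exact hz
      have h5 : Module.finrank ℚ (⊤ : IntermediateField ℚ N) = Module.finrank ℚ N :=
        IntermediateField.finrank_top'
      rw [← h3, ht'.finrank, h.finrank] at h5
      have := Nat.pow_right_injective (le_refl 2) h5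
      omega
    have hgz : oi g t = -t := by
      apply RingOfIntegers.coe_injective
      rw [map_neg]
      exact Q.neg ((mem_range_iff K _).2 hzK) (fun hc => hzn ((mem_range_iff K _).1 hc))
    refine Q.odd_step ih t t h.absNorm ?_ 1 (Or.inl rfl) ?_
    · intro P hP hPt
      rw [hgz] at hPt
      have h3 : t - -t = 2 * t := by ring
      rw [h3] at hPt
      rcases hP.mem_or_mem hPt with h2 | h2
      · exact tf_mem hP h2 _ t (by rw [h.it]; exact P.zero_mem)
      · exact h2
    · have h4 := h.rank
      have h5 := ht'.rank
      rw [one_mul]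
      apply Nat.pow_le_pow_right (by norm_num)
      rw [pow_succ] at h4
      omega

set_option linter.unusedSectionVars false

theorem int_cast_coe {M : Type*} [Field M] [NumberField M] (x y : 𝓞 M) (h : x = y) :
    algebraMap (𝓞 M) M x = algebraMap (𝓞 M) M y := by rw [h]

theorem IsF.ringHom_ext {m : ℕ} {F : Type*} [Field F] [NumberField F] {z : 𝓞 F} (h : IsF m F z)
    {A : Type*} [CommRing A] (φ ψ : 𝓞 F →+* A) (hz : φ z = ψ z) : φ = ψ := by
  have hcyc := h.cyc
  have hpr : Fact (Nat.Prime 2) := ⟨Nat.prime_two⟩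
  let pb := h.primF.integralPowerBasisOfPrimePow
  have hgen : pb.gen = z := by
    rw [IsPrimitiveRoot.integralPowerBasisOfPrimePow_gen]
    apply RingOfIntegers.coe_injective
    rfl
  have h1 : φ.toIntAlgHom = ψ.toIntAlgHom := pb.algHom_ext (by rw [hgen]; exact hz)
  ext x
  exact congrArg (fun f : 𝓞 F →ₐ[ℤ] A => f x) h1

theorem sqrt_not_F {m : ℕ} {F : Type*} [Field F] [NumberField F] {z : 𝓞 F} (h : IsF m F z)
    {p : ℕ} (hp : p.Prime) (hp2 : p ≠ 2) (s : 𝓞 F) : s ^ 2 ≠ p := by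
  intro hs
  have hpf : Fact p.Prime := ⟨hp⟩
  set I : Ideal (𝓞 F) := Ideal.span {(p : 𝓞 F)} with hI
  have hIn : I.absNorm ≠ 1 := by
    rw [hI, Ideal.absNorm_span_natCast]
    have hpos : 0 < Module.finrank ℤ (𝓞 F) := by
      rw [RingOfIntegers.rank]; exact Module.finrank_pos
    exact (Nat.one_lt_pow hpos.ne' hp.one_lt).ne'
  have hIt : I ≠ ⊤ := fun h0 => hIn (Ideal.absNorm_eq_one_iff.2 h0)
  have : Nontrivial (𝓞 F ⧸ I) := Ideal.Quotient.nontrivial_iff.2 hIt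
  have hch : CharP (𝓞 F ⧸ I) p := by
    apply (CharP.charP_iff_prime_eq_zero hp).2
    have : Ideal.Quotient.mk I (p : 𝓞 F) = 0 :=
      Ideal.Quotient.eq_zero_iff_mem.2 (Ideal.mem_span_singleton_self _)
    simpa using this
  set f := Nat.totient (2 ^ (m + 2)) with hf
  have hfpos : 0 < f := Nat.totient_pos.2 (by positivity)
  have hpodd : Odd p := hp.odd_of_ne_two hp2
  have hmod : p ^ f ≡ 1 [MOD 2 ^ (m + 2)] := Nat.ModEq.pow_totient
    (Nat.Coprime.pow_right _ hpodd.coprime_two_right)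
  have hle : 1 ≤ p ^ f := Nat.one_le_pow _ _ hp.pos
  obtain ⟨k, hk⟩ := (Nat.modEq_iff_dvd' hle).1 hmod.symm
  have hk' : p ^ f = 2 ^ (m + 2) * k + 1 := by omega
  have heq := h.ringHom_ext ((iterateFrobenius (𝓞 F ⧸ I) p f).comp (Ideal.Quotient.mk I))
    (Ideal.Quotient.mk I) (by
      rw [RingHom.comp_apply, iterateFrobenius_def, ← map_pow, hk', pow_succ, pow_mul,
        h.prim.pow_eq_one, one_pow, one_mul])
  have hs1 := RingHom.congr_fun heq s
  rw [RingHom.comp_apply, iterateFrobenius_def, ← map_pow] at hs1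
  obtain ⟨r, hr⟩ := hpodd.pow (n := f)
  have hr0 : r ≠ 0 := by
    rintro rfl
    have := Nat.one_lt_pow hfpos.ne' hp.one_lt
    omega
  rw [hr, pow_succ, pow_mul, hs, map_mul, map_pow] at hs1
  have hp0 : Ideal.Quotient.mk I (p : 𝓞 F) = 0 :=
      Ideal.Quotient.eq_zero_iff_mem.2 (Ideal.mem_span_singleton_self _)
  rw [hp0, zero_pow hr0, zero_mul] at hs1
  have hsI : s ∈ I := Ideal.Quotient.eq_zero_iff_mem.1 hs1.symm
  obtain ⟨t, ht⟩ := Ideal.mem_span_singleton.1 hsI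
  have hp00 : (p : 𝓞 F) ≠ 0 := by exact_mod_cast hp.ne_zero
  have h1 : (p : 𝓞 F) * t ^ 2 = 1 := by
    apply mul_left_cancel₀ hp00
    rw [ht] at hs
    linear_combination hs
  exact hIt (Ideal.span_singleton_eq_top.2 (IsUnit.of_mul_eq_one _ h1))

/-- `M = ℚ(ζ_{2^{m+2}}, √p)`. -/
structure IsL (p m : ℕ) (M : Type*) [Field M] [NumberField M] (z s : 𝓞 M) : Prop where
  prim : IsPrimitiveRoot z (2 ^ (m + 2))
  sq : s ^ 2 = p
  top : adjoin ℚ {(z : M), (s : M)} = ⊤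

/-- `N = ℚ(2cos(2π/2^{m+2}), √p)`. -/
structure IsLp (p m : ℕ) (N : Type*) [Field N] [NumberField N] (t s : 𝓞 N) : Prop where
  it : tf^[m] t = 0
  sq : s ^ 2 = p
  top : adjoin ℚ {(t : N), (s : N)} = ⊤
  fr : Module.finrank ℚ N = 2 ^ (m + 1)

/-- subfields generated by two integers -/
theorem exists_sub2 {M : Type*} [Field M] [NumberField M] (x y : 𝓞 M) :
    ∃ (K : IntermediateField ℚ M) (x' y' : 𝓞 K), K = adjoin ℚ {(x : M), (y : M)} ∧
      algebraMap (𝓞 K) (𝓞 M) x' = x ∧ algebraMap (𝓞 K) (𝓞 M) y' = y ∧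
      adjoin ℚ {(x' : K), (y' : K)} = ⊤ := by
  obtain ⟨x', hx'⟩ := exists_int (adjoin ℚ {(x : M), (y : M)}) x
    (subset_adjoin _ _ (by simp))
  obtain ⟨y', hy'⟩ := exists_int (adjoin ℚ {(x : M), (y : M)}) y
    (subset_adjoin _ _ (by simp))
  refine ⟨_, x', y', rfl, hx', hy', ?_⟩
  apply adjoin_coe_top
  rw [Set.image_pair]
  congr 1
  · exact congrArg (algebraMap (𝓞 M) M) hx'
  · congr 1
    exact congrArg (algebraMap (𝓞 M) M) hy'

theorem alg_coe {M : Type*} [Field M] [NumberField M] {K : IntermediateField ℚ M} {x' : 𝓞 K}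
    {x : 𝓞 M} (h : algebraMap (𝓞 K) (𝓞 M) x' = x) : algebraMap K M (x' : K) = (x : M) :=
  congrArg (algebraMap (𝓞 M) M) h

namespace IsL
variable {p m : ℕ} {M : Type*} [Field M] [NumberField M] {z s : 𝓞 M}

theorem sqM (h : IsL p m M z s) : (s : M) ^ 2 = p := by
  have := congrArg (algebraMap (𝓞 M) M) h.sq
  rw [map_pow, map_natCast] at this
  exact this

theorem unit (h : IsL p m M z s) : IsUnit z := h.prim.isUnit (by positivity)

theorem ext (h : IsL p m M z s) {L : Type*} [Field L] (φ ψ : M →+* L) (hz : φ (z : M) = ψ (z : M))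
    (hs : φ (s : M) = ψ (s : M)) (x : M) : φ x = ψ x :=
  ringHom_ext_top h.top φ ψ (by
    rintro y (rfl | rfl)
    · exact hz
    · exact hs) x

theorem ext_oi (h : IsL p m M z s) (g g' : M ≃+* M) (hz : oi g z = oi g' z)
    (hs : oi g s = oi g' s) (x : M) : g x = g' x :=
  h.ext (g : M →+* M) (g' : M →+* M) (congrArg (algebraMap (𝓞 M) M) hz)
    (congrArg (algebraMap (𝓞 M) M) hs) x

theorem quadF (h : IsL p m M z s) (hp : p.Prime) (hp2 : p ≠ 2) :
    ∃ (K : IntermediateField ℚ M) (z' : 𝓞 K) (g : M ≃+* M), IsF m K z' ∧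
      algebraMap (𝓞 K) (𝓞 M) z' = z ∧ QuadExt K M g ∧ oi g z = z ∧ oi g s = -s := by
  obtain ⟨K, z', hK, hz', hzz⟩ := exists_isF_sub h.prim
  have hs2 : (s : M) ^ 2 ∈ K := by rw [h.sqM]; exact _root_.natCast_mem K p
  have hsK : (s : M) ∉ K := by
    intro hs
    obtain ⟨s', hs'⟩ := exists_int K s hs
    apply sqrt_not_F hz' hp hp2 s'
    apply FaithfulSMul.algebraMap_injective (𝓞 K) (𝓞 M)
    rw [map_pow, hs', h.sq, map_natCast]
  have hzK : (z : M) ∈ K := by rw [hK]; exact mem_adjoin_simple_self _ _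
  have hf : Module.finrank K M = 2 := by
    refine finrank_two_of K _ h.top s hs2 hsK ?_
    rintro y (rfl | rfl)
    · exact ⟨z, 0, hzK, K.zero_mem, by ring⟩
    · exact ⟨0, 1, K.zero_mem, K.one_mem, by ring⟩
  obtain ⟨g, Q⟩ := quadExt_of_finrank hf
  refine ⟨K, z', g, hz', hzz, Q, ?_, ?_⟩
  · apply RingOfIntegers.coe_injective
    exact (Q.fix _).2 ((mem_range_iff K _).2 hzK)
  · apply RingOfIntegers.coe_injective
    rw [map_neg]
    exact Q.neg ((mem_range_iff K _).2 hs2) (fun hc => hsK ((mem_range_iff K _).1 hc))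

theorem finrank (h : IsL p m M z s) (hp : p.Prime) (hp2 : p ≠ 2) :
    Module.finrank ℚ M = 2 ^ (m + 2) := by
  obtain ⟨K, z', g, hz', -, Q, -⟩ := h.quadF hp hp2
  rw [mul_finrank_two K Q.finrank, hz'.finrank, ← pow_succ']

theorem rank (h : IsL p m M z s) (hp : p.Prime) (hp2 : p ≠ 2) :
    Units.rank M + 1 = 2 ^ (m + 1) := by
  have h1 := rank_cpx (nrReal_zero_of_prim h.prim)
  rw [h.finrank hp hp2, pow_succ] at h1
  omega

theorem absNorm (h : IsL p m M z s) (hp : p.Prime) (hp2 : p ≠ 2) :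
    (Ideal.span {1 - z}).absNorm = 4 :=
  absNorm_one_sub (k := m + 1) h.prim 2 (by rw [h.finrank hp hp2, ← pow_succ])

theorem sub (h : IsL p (m + 1) M z s) (hp : p.Prime) (hp2 : p ≠ 2) :
    ∃ (K : IntermediateField ℚ M) (z' s' : 𝓞 K) (g : M ≃+* M), IsL p m K z' s' ∧
      algebraMap (𝓞 K) (𝓞 M) z' = z ^ 2 ∧ algebraMap (𝓞 K) (𝓞 M) s' = s ∧
      QuadExt K M g ∧ oi g z = -z ∧ oi g s = s := by
  obtain ⟨K, z', s', hK, hz', hs', htop⟩ := exists_sub2 (z ^ 2) s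
  have hinj := FaithfulSMul.algebraMap_injective (𝓞 K) (𝓞 M)
  have hL : IsL p m K z' s' := by
    refine ⟨?_, ?_, htop⟩
    · apply IsPrimitiveRoot.of_map_of_injective (f := algebraMap (𝓞 K) (𝓞 M)) _ hinj
      rw [hz']
      exact h.prim.pow (by positivity) (by rw [pow_succ, mul_comm])
    · apply hinj
      rw [map_pow, hs', h.sq, map_natCast]
  have hzK : (z : M) ^ 2 ∈ K := by
    have : (z : M) ^ 2 = algebraMap K M (z' : K) := by
      rw [alg_coe hz']; exact (map_pow (algebraMap (𝓞 M) M) z 2).symm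
    rw [this]; exact (z' : K).2
  have hsK : (s : M) ∈ K := by
    rw [← alg_coe hs']; exact (s' : K).2
  have hf : Module.finrank K M = 2 := by
    have h1 := Module.finrank_mul_finrank ℚ K M
    rw [hL.finrank hp hp2, h.finrank hp hp2, pow_succ _ (m + 2)] at h1
    exact Nat.eq_of_mul_eq_mul_left (by positivity) h1
  have hzn : (z : M) ∉ K := by
    intro hz
    have h3 : K = ⊤ := by
      rw [eq_top_iff, ← h.top, adjoin_le_iff]
      rintro y (rfl | rfl)
      · exact hz
      · exact hsK
    have h5 : Module.finrank ℚ (⊤ : IntermediateField ℚ M) = Module.finrank ℚ M :=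
      IntermediateField.finrank_top'
    rw [← h3, hL.finrank hp hp2, h.finrank hp hp2] at h5
    have := Nat.pow_right_injective (le_refl 2) h5
    omega
  obtain ⟨g, Q⟩ := quadExt_of_finrank hf
  refine ⟨K, z', s', g, hL, hz', hs', Q, ?_, ?_⟩
  · apply RingOfIntegers.coe_injective
    rw [map_neg]
    exact Q.neg ((mem_range_iff K _).2 hzK) (fun hc => hzn ((mem_range_iff K _).1 hc))
  · apply RingOfIntegers.coe_injective
    exact (Q.fix _).2 ((mem_range_iff K _).2 hsK)

end IsL

theorem tf_inv {R : Type*} [CommRing R] : ∀ (m : ℕ) (x y : R), x * y = 1 →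
    tf^[m] (x + y) = x ^ 2 ^ m + y ^ 2 ^ m
  | 0, x, y, _ => by simp
  | m + 1, x, y, h => by
    rw [Function.iterate_succ_apply]
    have h1 : tf (x + y) = x ^ 2 + y ^ 2 := by rw [tf]; linear_combination 2 * h
    rw [h1, tf_inv m (x ^ 2) (y ^ 2) (by rw [← mul_pow, h, one_pow]), ← pow_mul, ← pow_mul, pow_succ,
      mul_comm 2]

theorem tf_prim {R : Type*} [CommRing R] [IsDomain R] {m : ℕ} {x y : R}
    (hx : IsPrimitiveRoot x (2 ^ (m + 2))) (h : x * y = 1) : tf^[m] (x + y) = 0 := by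
  rw [tf_inv m x y h]
  have h1 : x ^ 2 ^ (m + 1) = -1 := prim_neg_one hx
  have h2 : x ^ 2 ^ m * y ^ 2 ^ m = 1 := by rw [← mul_pow, h, one_pow]
  have h3 : x ^ 2 ^ m * x ^ 2 ^ m = -1 := by rw [← pow_add, ← two_mul, ← pow_succ', h1]
  have h4 : x ^ 2 ^ m ≠ 0 := pow_ne_zero _ (left_ne_zero_of_mul_eq_one h)
  apply mul_left_cancel₀ h4
  linear_combination h3 + h2

theorem IsL.real {p m : ℕ} {M : Type*} [Field M] [NumberField M] {z s : 𝓞 M}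
    (h : IsL p m M z s) (hp : p.Prime) (hp2 : p ≠ 2) :
    ∃ (K : IntermediateField ℚ M) (t s' : 𝓞 K) (g : M ≃+* M), IsLp p m K t s' ∧
      algebraMap (𝓞 K) (𝓞 M) t = z + oi g z ∧ algebraMap (𝓞 K) (𝓞 M) s' = s ∧
      QuadExt K M g ∧ z * oi g z = 1 ∧ oi g s = s := by
  obtain ⟨y, hy⟩ : ∃ y, z * y = 1 := h.unit.exists_right_inv
  obtain ⟨K, t, s', hK, ht, hs', htop⟩ := exists_sub2 (z + y) s
  have hinj := FaithfulSMul.algebraMap_injective (𝓞 K) (𝓞 M)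
  have hit : tf^[m] t = 0 := by
    apply hinj
    rw [tf_map, ht, map_zero, tf_prim h.prim hy]
  have hsq : s' ^ 2 = p := by
    apply hinj
    rw [map_pow, hs', h.sq, map_natCast]
  have htK : (z : M) + (y : M) ∈ K := by
    have : (z : M) + (y : M) = algebraMap K M (t : K) := by
      rw [alg_coe ht]; exact (map_add (algebraMap (𝓞 M) M) z y).symm
    rw [this]; exact (t : K).2
  have hsK : (s : M) ∈ K := by
    rw [← alg_coe hs']; exact (s' : K).2
  have hy' : (z : M) * (y : M) = 1 := by
    have := congrArg (algebraMap (𝓞 M) M) hy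
    rw [map_mul, map_one] at this
    exact this
  have h2K : (2 : M) ∈ K := ofNat_mem K 2
  have hx2 : ((z : M) - y) ^ 2 ∈ K := by
    have : ((z : M) - y) ^ 2 = (z + y) ^ 2 - 2 * 2 := by linear_combination (-4) * hy'
    rw [this]
    exact K.sub_mem (_root_.pow_mem htK 2) (K.mul_mem h2K h2K)
  -- elements of `K` are real
  have hx : ((z : M) - y) ∉ K := by
    intro hc
    obtain ⟨φ⟩ : Nonempty (M →+* ℂ) := inferInstance
    have hzK : (z : M) ∈ K := by
      have : (z : M) = ((z + y) + (z - y)) / 2 := by ring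
      rw [this]
      exact K.div_mem (K.add_mem htK hc) h2K
    have key := ringHom_ext_top htop ((starRingEnd ℂ).comp (φ.comp (algebraMap K M)))
      (φ.comp (algebraMap K M)) (by
        rintro w (rfl | rfl)
        · rw [RingHom.comp_apply, Complex.conj_eq_iff_im]
          have h1 := congrArg (algebraMap (𝓞 K) K) hit
          rw [tf_map, map_zero] at h1
          have h2 := congrArg (φ.comp (algebraMap K M)) h1
          rw [tf_map, map_zero] at h2
          exact (tf_real m _ (by rw [h2]; rfl) (by rw [h2]; simp)).1
        · rw [RingHom.comp_apply, Complex.conj_eq_iff_im]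
          have h1 := congrArg (algebraMap (𝓞 K) K) hsq
          have h2 := congrArg (φ.comp (algebraMap K M)) h1
          rw [map_pow, map_pow, map_natCast, map_natCast] at h2
          set a := (φ.comp (algebraMap K M)) ((s' : K))
          have h3 : a ^ 2 = p := h2
          have h4 : (a ^ 2).im = 0 := by rw [h3]; simp
          have h5 : 0 ≤ (a ^ 2).re := by rw [h3]; simp
          have h6 : (a ^ 2).re = a.re ^ 2 - a.im ^ 2 := by simp [pow_two]
          have h7 : (a ^ 2).im = 2 * a.re * a.im := by simp [pow_two]; ring
          rw [h7] at h4
          rcases mul_eq_zero.1 h4 with h8 | h8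
          · have h9 : a.re = 0 := by linarith
            rw [h6, h9] at h5
            nlinarith [sq_nonneg a.im]
          · exact h8) ⟨(z : M), hzK⟩
    have hre : (starRingEnd ℂ) (φ (z : M)) = φ (z : M) := key
    rw [Complex.conj_eq_iff_im] at hre
    have hpr : IsPrimitiveRoot (φ (z : M)) (2 ^ (m + 2)) :=
      (h.prim.map_of_injective (f := algebraMap (𝓞 M) M) RingOfIntegers.coe_injective).map_of_injective
        φ.injective
    have h3 : IsPrimitiveRoot ((φ (z : M)) ^ 2 ^ m) 4 :=
      hpr.pow (by positivity) (by rw [pow_add]; norm_num)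
    have h4 : (((φ (z : M)) ^ 2 ^ m)) = (((φ (z : M)).re ^ 2 ^ m : ℝ) : ℂ) := by
      have : φ (z : M) = ((φ (z : M)).re : ℂ) := Complex.ext rfl (by simp [hre])
      conv_lhs => rw [this]
      push_cast; rfl
    have h5 : ((φ (z : M)) ^ 2 ^ m) ^ 2 = -1 := by
      have := prim_neg_one (k := 1) (z := (φ (z : M)) ^ 2 ^ m) (by norm_num; exact h3)
      simpa using this
    rw [h4] at h5
    have h6 : ((φ (z : M)).re ^ 2 ^ m) ^ 2 = (-1 : ℝ) := by exact_mod_cast h5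
    nlinarith [sq_nonneg ((φ (z : M)).re ^ 2 ^ m)]
  have hf : Module.finrank K M = 2 := by
    refine finrank_two_of K _ h.top ((z : M) - y) hx2 hx ?_
    rintro w (rfl | rfl)
    · exact ⟨(z + y) / 2, 1 / 2, K.div_mem htK h2K, K.div_mem K.one_mem h2K, by ring⟩
    · exact ⟨s, 0, hsK, K.zero_mem, by ring⟩
  obtain ⟨g, Q⟩ := quadExt_of_finrank hf
  have hg1 : g ((z : M) - y) = -((z : M) - y) :=
    Q.neg ((mem_range_iff K _).2 hx2) (fun hc => hx ((mem_range_iff K _).1 hc))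
  have hg2 : g ((z : M) + y) = ((z : M) + y) := (Q.fix _).2 ((mem_range_iff K _).2 htK)
  have hgz : oi g z = y := by
    apply RingOfIntegers.coe_injective
    change g (z : M) = (y : M)
    rw [map_add] at hg2
    rw [map_sub] at hg1
    linear_combination (1 / 2 : M) * hg1 + (1 / 2 : M) * hg2
  refine ⟨K, t, s', g, ⟨hit, hsq, htop, ?_⟩, by rw [hgz]; exact ht, hs', Q, by rw [hgz]; exact hy, ?_⟩
  · have h1 := Module.finrank_mul_finrank ℚ K M
    rw [hf, h.finrank hp hp2, pow_succ _ (m + 1)] at h1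
    exact Nat.eq_of_mul_eq_mul_right (by norm_num) h1
  · apply RingOfIntegers.coe_injective
    exact (Q.fix _).2 ((mem_range_iff K _).2 hsK)

set_option linter.unusedSectionVars false

section padic
variable {p : ℕ} [hpf : Fact p.Prime]

theorem tz_iff (x : ℤ_[p]) : PadicInt.toZMod x = 0 ↔ ‖x‖ < 1 := by
  rw [← RingHom.mem_ker, PadicInt.ker_toZMod, IsLocalRing.mem_maximalIdeal, mem_nonunits_iff,
    PadicInt.not_isUnit_iff]

theorem tz_norm {x : ℤ_[p]} (h : PadicInt.toZMod x ≠ 0) : ‖x‖ = 1 := by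
  rw [Ne, tz_iff, not_lt] at h
  exact le_antisymm (PadicInt.norm_le_one x) h

theorem padic_sq (hp2 : p ≠ 2) (a : ℤ_[p]) (h0 : PadicInt.toZMod a ≠ 0)
    (h : IsSquare (PadicInt.toZMod a)) : ∃ b : ℤ_[p], b ^ 2 = a := by
  obtain ⟨y, hy⟩ := h
  obtain ⟨c, hc⟩ := ZMod.ringHom_surjective (PadicInt.toZMod (p := p)) y
  have hy0 : y ≠ 0 := by rintro rfl; apply h0; rw [hy, mul_zero]
  have h2 : (2 : ZMod p) ≠ 0 := by
    intro h
    have h' : ((2 : ℕ) : ZMod p) = 0 := by exact_mod_cast h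
    rw [ZMod.natCast_eq_zero_iff] at h'
    exact hp2 ((Nat.prime_dvd_prime_iff_eq hpf.out Nat.prime_two).1 h')
  have hnorm : ‖(Polynomial.X ^ 2 - Polynomial.C a : Polynomial ℤ_[p]).aeval c‖ <
      ‖(Polynomial.derivative (Polynomial.X ^ 2 - Polynomial.C a : Polynomial ℤ_[p])).aeval c‖ ^ 2 := by
    have h3 : (Polynomial.derivative (Polynomial.X ^ 2 - Polynomial.C a : Polynomial ℤ_[p])).aeval c
        = 2 * c := by
      simp; left; norm_num
    have h4 : (Polynomial.X ^ 2 - Polynomial.C a : Polynomial ℤ_[p]).aeval c = c ^ 2 - a := by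
      simp
    rw [h3, h4, tz_norm (x := 2 * c), one_pow, ← tz_iff]
    · rw [map_sub, map_pow, hc, hy]; ring
    · rw [map_mul, hc, map_ofNat]; exact mul_ne_zero h2 hy0
  obtain ⟨z, hz, -⟩ := hensels_lemma hnorm
  refine ⟨z, ?_⟩
  rw [map_sub, map_pow, Polynomial.aeval_X, Polynomial.aeval_C] at hz
  exact sub_eq_zero.1 hz

theorem exists_padicInt {y : ℚ_[p]} (h : ‖y‖ ≤ 1) : ∃ c : ℤ_[p], (c : ℚ_[p]) = y := ⟨⟨y, h⟩, rfl⟩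

/-- local norms from `ℚ_p(√p)` (for `p ≡ 1 mod 4`) -/
def NN (p : ℕ) [Fact p.Prime] (x : ℚ_[p]) : Prop := ∃ y : ℚ_[p], y ≠ 0 ∧ (x = y ^ 2 ∨ x = p * y ^ 2)

theorem pcast_ne : (p : ℚ_[p]) ≠ 0 := by exact_mod_cast hpf.out.ne_zero

theorem NN.ne {x : ℚ_[p]} (h : NN p x) : x ≠ 0 := by
  obtain ⟨y, hy, rfl | rfl⟩ := h
  · exact pow_ne_zero _ hy
  · exact mul_ne_zero pcast_ne (pow_ne_zero _ hy)

theorem NN.sq {y : ℚ_[p]} (hy : y ≠ 0) : NN p (y ^ 2) := ⟨y, hy, Or.inl rfl⟩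

theorem NN.one : NN p (1 : ℚ_[p]) := ⟨1, one_ne_zero, Or.inl (by ring)⟩

theorem NN.mul {x y : ℚ_[p]} (h : NN p x) (h' : NN p y) : NN p (x * y) := by
  obtain ⟨a, ha, rfl | rfl⟩ := h <;> obtain ⟨b, hb, rfl | rfl⟩ := h'
  · exact ⟨a * b, mul_ne_zero ha hb, Or.inl (by ring)⟩
  · exact ⟨a * b, mul_ne_zero ha hb, Or.inr (by ring)⟩
  · exact ⟨a * b, mul_ne_zero ha hb, Or.inr (by ring)⟩
  · exact ⟨p * a * b, mul_ne_zero (mul_ne_zero pcast_ne ha) hb, Or.inl (by ring)⟩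

theorem NN.inv {x : ℚ_[p]} (h : NN p x) : NN p x⁻¹ := by
  have hx := h.ne
  have := h.mul (NN.sq (inv_ne_zero hx))
  have e : x * x⁻¹ ^ 2 = x⁻¹ := by field_simp
  rwa [e] at this

theorem NN.of_mul {x y : ℚ_[p]} (h : NN p (x * y)) (h' : NN p y) : NN p x := by
  have := h.mul h'.inv
  rwa [mul_assoc, mul_inv_cancel₀ h'.ne, mul_one] at this

theorem NN.of_unit {a : ℤ_[p]} (ha : PadicInt.toZMod a ≠ 0) (h : NN p (a : ℚ_[p])) :
    IsSquare (PadicInt.toZMod a) := by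
  have hn : ‖(a : ℚ_[p])‖ = 1 := tz_norm ha
  obtain ⟨y, hy, h | h⟩ := h
  · have hy1 : ‖y‖ = 1 := by
      rw [h, norm_pow] at hn
      exact (pow_eq_one_iff_of_nonneg (norm_nonneg _) two_ne_zero).1 hn
    obtain ⟨c, rfl⟩ := exists_padicInt hy1.le
    refine ⟨PadicInt.toZMod c, ?_⟩
    rw [← map_mul]
    congr 1
    apply Subtype.ext
    rw [PadicInt.coe_mul, h]
    exact pow_two _
  · exfalso
    have hv := congrArg Padic.valuation h
    rw [Padic.valuation_mul pcast_ne (pow_ne_zero _ hy), Padic.valuation_pow, Padic.valuation_p] at hv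
    have ha0 : (a : ℚ_[p]) ≠ 0 := by
      intro h0; rw [h0, norm_zero] at hn; exact zero_ne_one hn
    have h1 := Padic.norm_eq_zpow_neg_valuation ha0
    rw [hn] at h1
    have hp1 : (1 : ℝ) < p := by exact_mod_cast hpf.out.one_lt
    have h2 : (a : ℚ_[p]).valuation = 0 := by
      by_contra hne
      have := zpow_eq_one_iff_right₀ (by positivity : (0 : ℝ) ≤ p) hp1.ne' |>.1 h1.symm
      omega
    omega

/-- `√p ∉ ℚ_p` -/
theorem padic_sqrt_p (y : ℚ_[p]) : y ^ 2 ≠ p := by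
  intro h
  have hy : y ≠ 0 := by
    rintro rfl
    exact pcast_ne (p := p) (by rw [← h]; ring)
  have hv := congrArg Padic.valuation h
  rw [Padic.valuation_pow, Padic.valuation_p] at hv
  omega

theorem NN.one_sub (hp2 : p ≠ 2) {e : ℚ_[p]} (he : ‖e‖ < 1) : NN p (1 - e) := by
  obtain ⟨e, rfl⟩ := exists_padicInt he.le
  have h1 : PadicInt.toZMod (1 - e : ℤ_[p]) = 1 := by
    rw [map_sub, map_one, (tz_iff _).2 he, sub_zero]
  obtain ⟨b, hb⟩ := padic_sq hp2 (1 - e : ℤ_[p]) (by rw [h1]; exact one_ne_zero)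
    (by rw [h1]; exact IsSquare.one)
  have hb' : (b : ℚ_[p]) ^ 2 = 1 - e := by
    rw [← PadicInt.coe_pow, hb, PadicInt.coe_sub, PadicInt.coe_one]
  refine ⟨b, ?_, Or.inl hb'.symm⟩
  rintro h0
  rw [h0] at hb'
  have : (e : ℚ_[p]) = 1 := by linear_combination hb'
  rw [this, norm_one] at he
  exact lt_irrefl _ he

theorem NN.form (hp4 : p % 4 = 1) {a b : ℚ_[p]} (h : a ^ 2 - p * b ^ 2 ≠ 0) : NN p (a ^ 2 - p * b ^ 2) := by
  have hp2 : p ≠ 2 := by rintro rfl; omega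
  have hpn : ‖(p : ℚ_[p])‖ = (p : ℝ)⁻¹ := Padic.norm_p
  have hp1 : (1 : ℝ) < p := by exact_mod_cast hpf.out.one_lt
  have hm1 : ∃ i : ℚ_[p], i ^ 2 = -1 := by
    obtain ⟨b, hb⟩ := padic_sq hp2 (-1 : ℤ_[p]) (by simp) (by
      rw [map_neg, map_one]
      exact ZMod.exists_sq_eq_neg_one_iff.2 (by omega))
    exact ⟨b, by rw [← PadicInt.coe_pow, hb]; simp⟩
  obtain ⟨i, hi⟩ := hm1
  have hi0 : i ≠ 0 := by rintro rfl; norm_num at hi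
  by_cases hab : ‖b‖ ≤ ‖a‖
  · have ha : a ≠ 0 := by
      rintro rfl
      rw [norm_zero, norm_le_zero_iff] at hab
      apply h; rw [hab]; ring
    have he : ‖(p : ℚ_[p]) * (b / a) ^ 2‖ < 1 := by
      rw [norm_mul, norm_pow, norm_div, hpn]
      have h1 : ‖b‖ / ‖a‖ ≤ 1 := div_le_one_of_le₀ hab (norm_nonneg _)
      have h2 : (‖b‖ / ‖a‖) ^ 2 ≤ 1 := pow_le_one₀ (by positivity) h1
      have h3 : (p : ℝ)⁻¹ < 1 := inv_lt_one_of_one_lt₀ hp1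
      have h4 : 0 < (p : ℝ)⁻¹ := by positivity
      nlinarith [sq_nonneg (‖b‖ / ‖a‖)]
    have := (NN.sq ha).mul (NN.one_sub hp2 he)
    have e : a ^ 2 * (1 - p * (b / a) ^ 2) = a ^ 2 - p * b ^ 2 := by field_simp
    rwa [e] at this
  · push Not at hab
    have hb : b ≠ 0 := by
      rintro rfl
      rw [norm_zero] at hab
      exact absurd hab (not_lt.2 (norm_nonneg _))
    have hpb : (0 : ℝ) < p := by positivity
    have he : ‖a ^ 2 / (p * b ^ 2)‖ < 1 := by
      by_cases ha : a = 0
      · rw [ha]; simp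
      -- strict inequality of norms gives a factor p
      rw [Padic.norm_eq_zpow_neg_valuation ha, Padic.norm_eq_zpow_neg_valuation hb,
        zpow_lt_zpow_iff_right₀ hp1] at hab
      have hne : a ^ 2 / (p * b ^ 2) ≠ 0 :=
        div_ne_zero (pow_ne_zero _ ha) (mul_ne_zero pcast_ne (pow_ne_zero _ hb))
      rw [Padic.norm_eq_zpow_neg_valuation hne]
      have hv : (a ^ 2 / (p * b ^ 2) : ℚ_[p]).valuation = 2 * a.valuation - (1 + 2 * b.valuation) := by
        rw [div_eq_mul_inv, Padic.valuation_mul (pow_ne_zero _ ha)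
          (inv_ne_zero (mul_ne_zero pcast_ne (pow_ne_zero _ hb))), Padic.valuation_inv,
          Padic.valuation_mul pcast_ne (pow_ne_zero _ hb), Padic.valuation_pow, Padic.valuation_pow,
          Padic.valuation_p]
        push_cast; ring
      rw [hv]
      apply zpow_lt_one_of_neg₀ hp1
      omega
    have h1 : NN p ((p : ℚ_[p]) * (i * b) ^ 2) := ⟨i * b, mul_ne_zero hi0 hb, Or.inr rfl⟩
    have := h1.mul (NN.one_sub hp2 he)
    have e : (p : ℚ_[p]) * (i * b) ^ 2 * (1 - a ^ 2 / (p * b ^ 2)) = a ^ 2 - p * b ^ 2 := by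
      have := pcast_ne (p := p)
      rw [mul_pow, hi]
      field_simp
      ring
    rwa [e] at this

end padic

set_option linter.unusedSectionVars false

section padic2
variable {p : ℕ} [hpf : Fact p.Prime]

/-- the standard hypotheses -/
structure Hyp (p : ℕ) : Prop where
  mod : p % 16 = 9
  two : ∃ x : ZMod p, x ^ 4 = 2

theorem NN.neg_one (hp4 : p % 4 = 1) : NN p (-1 : ℚ_[p]) := by
  have hp2 : p ≠ 2 := by rintro rfl; omega
  obtain ⟨b, hb⟩ := padic_sq hp2 (-1 : ℤ_[p]) (by simp) (by
      rw [map_neg, map_one]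
      exact ZMod.exists_sq_eq_neg_one_iff.2 (by omega))
  have hb' : (b : ℚ_[p]) ^ 2 = -1 := by rw [← PadicInt.coe_pow, hb]; simp
  exact ⟨b, by intro h; rw [h] at hb'; norm_num at hb', Or.inl hb'.symm⟩

theorem padic_data (h : Hyp p) : ∃ ζ ρ : ℚ_[p], ζ ^ 4 = -1 ∧ ¬ NN p ζ ∧ ρ ^ 4 = 2 := by
  have h16 := h.mod
  have hp2 : p ≠ 2 := by rintro rfl; omega
  have h2 : (2 : ZMod p) ≠ 0 := by
    intro h
    have h' : ((2 : ℕ) : ZMod p) = 0 := by exact_mod_cast h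
    rw [ZMod.natCast_eq_zero_iff] at h'
    exact hp2 ((Nat.prime_dvd_prime_iff_eq hpf.out Nat.prime_two).1 h')
  have hm1 : IsSquare (-1 : ZMod p) := ZMod.exists_sq_eq_neg_one_iff.2 (by omega)
  obtain ⟨k, hk⟩ : ∃ k, p / 2 = 8 * k + 4 := ⟨p / 16, by omega⟩
  obtain ⟨i, hi⟩ := padic_sq hp2 (-1 : ℤ_[p]) (by simp) (by rw [map_neg, map_one]; exact hm1)
  have hi' : PadicInt.toZMod i ^ 2 = -1 := by rw [← map_pow, hi, map_neg, map_one]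
  have hi0 : PadicInt.toZMod i ≠ 0 := by intro h; rw [h] at hi'; norm_num at hi'
  obtain ⟨ζ, hζ⟩ := padic_sq hp2 i hi0 (by
    rw [ZMod.euler_criterion p hi0, hk, pow_add, pow_mul,
      show PadicInt.toZMod i ^ 8 = (PadicInt.toZMod i ^ 2) ^ 4 by ring,
      show PadicInt.toZMod i ^ 4 = (PadicInt.toZMod i ^ 2) ^ 2 by ring, hi']
    norm_num)
  have hζ4 : ζ ^ 4 = -1 := by rw [show ζ ^ 4 = (ζ ^ 2) ^ 2 by ring, hζ, hi]
  have hζ' : PadicInt.toZMod ζ ^ 4 = -1 := by rw [← map_pow, hζ4, map_neg, map_one]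
  have hζ0 : PadicInt.toZMod ζ ≠ 0 := by intro h; rw [h] at hζ'; norm_num at hζ'
  obtain ⟨x, hx⟩ := h.two
  obtain ⟨r, hr⟩ := padic_sq hp2 (2 : ℤ_[p]) (by rw [map_ofNat]; exact h2)
    ⟨x ^ 2, by rw [map_ofNat, ← hx]; ring⟩
  have hr' : PadicInt.toZMod r ^ 2 = 2 := by rw [← map_pow, hr, map_ofNat]
  have hr0 : PadicInt.toZMod r ≠ 0 := by intro h; rw [h] at hr'; apply h2; rw [← hr']; ring
  obtain ⟨ρ, hρ⟩ := padic_sq hp2 r hr0 (by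
    have h1 : PadicInt.toZMod r ^ 2 = (x ^ 2) ^ 2 := by rw [hr', ← hx]; ring
    rcases sq_eq_sq_iff_eq_or_eq_neg.1 h1 with h | h
    · rw [h]; exact IsSquare.sq x
    · rw [h, neg_eq_neg_one_mul]; exact hm1.mul (IsSquare.sq x))
  refine ⟨ζ, ρ, ?_, ?_, ?_⟩
  · rw [← PadicInt.coe_pow, hζ4]; simp
  · intro hN
    have := NN.of_unit hζ0 hN
    rw [ZMod.euler_criterion p hζ0, hk, pow_add, pow_mul,
      show PadicInt.toZMod ζ ^ 8 = (PadicInt.toZMod ζ ^ 4) ^ 2 by ring, hζ'] at this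
    norm_num at this
    have h3 : (2 : ZMod p) = 0 := by linear_combination -this
    exact h2 h3
  · rw [← PadicInt.coe_pow, show ρ ^ 4 = (ρ ^ 2) ^ 2 by ring, hρ, hr]; rfl

theorem Hyp.four (h : Hyp p) : p % 4 = 1 := by have := h.mod; omega
theorem Hyp.ne2 (h : Hyp p) : p ≠ 2 := by have := h.mod; omega

theorem not_NN_zeta8 (h : Hyp p) {η : ℚ_[p]} (hη : η ^ 4 = -1) : ¬ NN p η := by
  obtain ⟨ζ, ρ, hζ, hN, -⟩ := padic_data h
  have hζ0 : ζ ≠ 0 := by rintro rfl; norm_num at hζ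
  have hη0 : η ≠ 0 := by rintro rfl; norm_num at hη
  intro hc
  apply hN
  have h1 : (η ^ 2) ^ 2 = (ζ ^ 2) ^ 2 := by linear_combination hη - hζ
  have h2 : η ^ 2 = ζ ^ 2 ∨ η ^ 2 = (ζ ^ 3) ^ 2 := by
    rcases sq_eq_sq_iff_eq_or_eq_neg.1 h1 with h | h
    · exact Or.inl h
    · right; rw [h]; linear_combination (-ζ ^ 2) * hζ
  have hneg : ∀ y : ℚ_[p], η = -y → NN p y := by
    intro y hy
    have := (NN.neg_one h.four).mul hc
    rw [hy] at this; simpa using this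
  have h3 : NN p (ζ ^ 3) → NN p ζ := by
    intro h
    rw [pow_succ'] at h
    exact h.of_mul (NN.sq hζ0)
  rcases h2 with h2 | h2 <;> rcases sq_eq_sq_iff_eq_or_eq_neg.1 h2 with h4 | h4
  · rwa [← h4]
  · exact hneg _ h4
  · apply h3; rwa [← h4]
  · exact h3 (hneg _ h4)

theorem NN_sqrt_two (h : Hyp p) {r : ℚ_[p]} (hr : r ^ 2 = 2) : NN p r := by
  obtain ⟨ζ, ρ, hζ, hN, hρ⟩ := padic_data h
  have hρ0 : ρ ≠ 0 := by rintro rfl; norm_num at hρ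
  have h1 : r ^ 2 = (ρ ^ 2) ^ 2 := by linear_combination hr - hρ
  rcases sq_eq_sq_iff_eq_or_eq_neg.1 h1 with h4 | h4
  · rw [h4]; exact NN.sq hρ0
  · rw [h4, neg_eq_neg_one_mul]; exact (NN.neg_one h.four).mul (NN.sq hρ0)

theorem NN_sqrt_neg_two (h : Hyp p) {r : ℚ_[p]} (hr : r ^ 2 = -2) : NN p r := by
  obtain ⟨ζ, ρ, hζ, hN, hρ⟩ := padic_data h
  have hζ0 : ζ ≠ 0 := by rintro rfl; norm_num at hζ
  have h1 : NN p (r * ζ ^ 2) := NN_sqrt_two h (by linear_combination hr * ζ ^ 4 - 2 * hζ)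
  exact h1.of_mul (NN.sq hζ0)

theorem not_NN_one_add_i (h : Hyp p) {i : ℚ_[p]} (hi : i ^ 2 = -1) : ¬ NN p (1 + i) := by
  obtain ⟨ζ, ρ, hζ, hN, hρ⟩ := padic_data h
  have hρ0 : ρ ≠ 0 := by rintro rfl; norm_num at hρ
  intro hc
  -- `(1+i)/ρ^2` has fourth power -1
  refine not_NN_zeta8 h (η := (1 + i) * (ρ⁻¹) ^ 2) ?_ (hc.mul (NN.sq (inv_ne_zero hρ0)))
  have e : (1 + i) ^ 4 = -4 := by linear_combination (i ^ 2 + 4 * i + 5) * hi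
  rw [mul_pow, e, ← pow_mul, show 2 * 4 = 4 * 2 from rfl, pow_mul, inv_pow, hρ]
  norm_num

theorem not_NN_one_add_sqrt_two (h : Hyp p) {r : ℚ_[p]} (hr : r ^ 2 = 2) : ¬ NN p (1 + r) := by
  obtain ⟨ζ, ρ, hζ, hN, hρ⟩ := padic_data h
  intro hc
  have hr' := NN_sqrt_two h hr
  -- η with η^2 - r η + 1 = 0
  obtain ⟨η, h1⟩ : ∃ η : ℚ_[p], η ^ 2 = r * η - 1 := by
    have h1 : (ζ - ζ ^ 3) ^ 2 = r ^ 2 := by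
      linear_combination (-2 + ζ ^ 2) * hζ - hr
    rcases sq_eq_sq_iff_eq_or_eq_neg.1 h1 with h4 | h4
    · exact ⟨ζ, by linear_combination ζ * h4 + hζ⟩
    · exact ⟨-ζ, by linear_combination ζ * h4 + hζ⟩
  have h2 : η ^ 4 = -1 := by linear_combination (η ^ 2 + r * η + 1) * h1 + (- 1 + r * η) * 0 + η ^ 2 * hr
  have hη := not_NN_zeta8 h h2
  have h3 : (1 + η) ^ 2 = η * (r * (1 + r)) := by linear_combination h1 - η * hr
  have h4 : 1 + η ≠ 0 := by
    intro h0
    have : η = -1 := by linear_combination h0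
    rw [this] at h2; norm_num at h2
  apply hη
  have h5 := NN.sq h4
  rw [h3] at h5
  exact h5.of_mul (hr'.mul hc)

theorem not_NN_nat {q : ℕ} (hq : ¬ IsSquare (q : ZMod p)) : ¬ NN p (q : ℚ_[p]) := by
  intro h
  have h0 : (q : ZMod p) ≠ 0 := by intro h0; rw [h0] at hq; exact hq IsSquare.zero
  apply hq
  have := NN.of_unit (a := (q : ℤ_[p])) (by rw [map_natCast]; exact h0) (by exact_mod_cast h)
  rwa [map_natCast] at this

theorem exists_embed {K : Type*} [Field K] [NumberField K] (x : K) (hx : adjoin ℚ {x} = ⊤)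
    (P : Polynomial ℚ) (hP : P ≠ 0) (hxP : Polynomial.aeval x P = 0)
    (hs : (P.map (algebraMap ℚ ℚ_[p])).Splits) : Nonempty (K →+* ℚ_[p]) := by
  have h : Nonempty (K →ₐ[ℚ] ℚ_[p]) := by
    refine nonempty_algHom_of_adjoin_splits (S := {x}) ?_ hx
    rintro y rfl
    refine ⟨Algebra.IsIntegral.isIntegral _, hs.of_dvd ?_ ?_⟩
    · exact (Polynomial.map_ne_zero_iff (algebraMap ℚ ℚ_[p]).injective).2 hP
    · exact Polynomial.map_dvd _ (minpoly.dvd _ _ hxP)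
  exact ⟨h.some.toRingHom⟩

theorem exists_embed_sq {K : Type*} [Field K] [NumberField K] (x : K) (hx : adjoin ℚ {x} = ⊤)
    (d : ℤ) (hd : x ^ 2 = d) (r : ℚ_[p]) (hr : r ^ 2 = d) : Nonempty (K →+* ℚ_[p]) := by
  refine exists_embed x hx (Polynomial.X ^ 2 - Polynomial.C (d : ℚ)) ?_ ?_ ?_
  · exact Polynomial.X_pow_sub_C_ne_zero (by norm_num) _
  · simp [hd]
  · have e : (Polynomial.X ^ 2 - Polynomial.C (d : ℚ)).map (algebraMap ℚ ℚ_[p]) =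
        (Polynomial.X - Polynomial.C r) * (Polynomial.X - Polynomial.C (-r)) := by
      have : Polynomial.C (d : ℚ_[p]) = Polynomial.C r ^ 2 := by rw [← hr, Polynomial.C_pow]
      simp only [Polynomial.map_sub, Polynomial.map_pow, Polynomial.map_X, Polynomial.map_C]
      rw [show algebraMap ℚ ℚ_[p] (d : ℚ) = (d : ℚ_[p]) by simp, this, Polynomial.C_neg]
      ring
    rw [e]
    exact (Polynomial.Splits.X_sub_C _).mul (Polynomial.Splits.X_sub_C _)

theorem exists_embed_zeta {K : Type*} [Field K] [NumberField K] (x : K) (hx : adjoin ℚ {x} = ⊤)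
    (hd : x ^ 4 = -1) (r : ℚ_[p]) (hr : r ^ 4 = -1) : Nonempty (K →+* ℚ_[p]) := by
  refine exists_embed x hx (Polynomial.X ^ 4 - Polynomial.C (-1 : ℚ)) ?_ ?_ ?_
  · exact Polynomial.X_pow_sub_C_ne_zero (by norm_num) _
  · simp [hd]
  · have e : (Polynomial.X ^ 4 - Polynomial.C (-1 : ℚ)).map (algebraMap ℚ ℚ_[p]) =
        (Polynomial.X - Polynomial.C r) * (Polynomial.X - Polynomial.C (-r)) *
        ((Polynomial.X - Polynomial.C (r ^ 3)) * (Polynomial.X - Polynomial.C (-r ^ 3))) := by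
      have h4 : Polynomial.C r ^ 4 = -1 := by rw [← Polynomial.C_pow, hr]; simp
      simp only [Polynomial.map_sub, Polynomial.map_pow, Polynomial.map_X, Polynomial.map_C,
        Polynomial.C_neg, Polynomial.C_pow, map_one, Polynomial.map_neg, Polynomial.map_one]
      linear_combination (Polynomial.X ^ 2 * Polynomial.C r ^ 2 - Polynomial.C r ^ 4 + 1) * h4
    rw [e]
    exact ((Polynomial.Splits.X_sub_C _).mul (Polynomial.Splits.X_sub_C _)).mul
      ((Polynomial.Splits.X_sub_C _).mul (Polynomial.Splits.X_sub_C _))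

/-- norms to a subfield of `ℚ_p` from a field containing `√p` -/
theorem norm_NN (hp4 : p % 4 = 1) {K M : Type*} [Field K] [NumberField K] [Field M] [NumberField M]
    [Algebra K M] (φ : K →+* ℚ_[p]) (s : M) (hs : s ^ 2 = p) (x : M) (hx : x ≠ 0) :
    NN p (φ (Algebra.norm K x)) := by
  have hfd : FiniteDimensional K M := Module.Finite.of_restrictScalars_finite ℚ K M
  have hsr : s ∉ Set.range (algebraMap K M) := by
    rintro ⟨a, ha⟩
    apply padic_sqrt_p (φ a)
    have : a ^ 2 = p := by
      apply (algebraMap K M).injective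
      rw [map_pow, ha, hs, map_natCast]
    rw [← map_pow, this, map_natCast]
  let B := adjoin K {s}
  have : NumberField B := NumberField.of_module_finite K B
  let s' : B := ⟨s, mem_adjoin_simple_self K s⟩
  have hs' : s' ^ 2 = p := Subtype.ext (by simpa using hs)
  have hsr' : s' ∉ Set.range (algebraMap K B) := by
    rintro ⟨a, ha⟩
    apply hsr
    exact ⟨a, congrArg (algebraMap B M) ha⟩
  have hf : Module.finrank K B = 2 := by
    have hmin : minpoly K s = Polynomial.X ^ 2 - Polynomial.C (p : K) := by
      symm
      apply minpoly.eq_of_irreducible_of_monic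
      · rw [Polynomial.irreducible_iff_roots_eq_zero_of_degree_le_three]
        · rw [Multiset.eq_zero_iff_forall_notMem]
          intro a ha
          rw [Polynomial.mem_roots (Polynomial.X_pow_sub_C_ne_zero (by norm_num) _)] at ha
          simp only [Polynomial.IsRoot, Polynomial.eval_sub, Polynomial.eval_pow,
            Polynomial.eval_X, Polynomial.eval_C] at ha
          apply padic_sqrt_p (φ a)
          rw [← map_pow, sub_eq_zero.1 ha, map_natCast]
        · rw [Polynomial.natDegree_X_pow_sub_C]
        · rw [Polynomial.natDegree_X_pow_sub_C]; norm_num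
      · simp [hs]
      · exact Polynomial.monic_X_pow_sub_C _ (by norm_num)
    rw [adjoin.finrank (Algebra.IsIntegral.isIntegral s), hmin, Polynomial.natDegree_X_pow_sub_C]
  obtain ⟨g, Q⟩ := quadExt_of_finrank hf
  have hs0 : s' ≠ 0 := by
    intro h0; apply hsr'; rw [h0]; exact ⟨0, map_zero _⟩
  have hg : g s' = -s' := Q.neg ⟨p, by rw [hs', map_natCast]⟩ hsr'
  rw [← Algebra.norm_norm (S := B)]
  set y := Algebra.norm B x with hy
  have hy0 : y ≠ 0 := Algebra.norm_ne_zero_iff.2 hx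
  obtain ⟨a, b, -, hab⟩ := Q.norm_decomp hs0 hg y
  have h1 : Algebra.norm K y = a ^ 2 - p * b ^ 2 := by
    apply (algebraMap K B).injective
    rw [Q.norm_eq, hab, hs']
    simp only [map_sub, map_mul, map_pow, map_natCast]
    ring
  have h2 : Algebra.norm K y ≠ 0 := Algebra.norm_ne_zero_iff.2 hy0
  have h3 : φ (Algebra.norm K y) ≠ 0 := (map_ne_zero φ).2 h2
  rw [h1] at h3 ⊢
  rw [map_sub, map_mul, map_pow, map_pow, map_natCast] at h3 ⊢
  exact NN.form hp4 h3

end padic2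

theorem norm_of_poly {K M : Type*} [Field K] [NumberField K] [Field M] [NumberField M]
    [Algebra K M] (x : M) (hx : adjoin ℚ {x} = ⊤) (P : Polynomial K) (hP : P.Monic)
    (hd : P.natDegree = Module.finrank K M) (h0 : Polynomial.aeval x P = 0) :
    Algebra.norm K x = (-1) ^ Module.finrank K M * P.coeff 0 := by
  have hfd : FiniteDimensional K M := Module.Finite.of_restrictScalars_finite ℚ K M
  have htop : adjoin K {x} = ⊤ := by
    rw [eq_top_iff]
    intro y _
    have hy : y ∈ adjoin ℚ {x} := by rw [hx]; trivial
    induction hy using adjoin_induction with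
    | mem y hy => rw [hy]; exact mem_adjoin_simple_self K x
    | algebraMap y => rw [eq_ratCast]; exact SubfieldClass.ratCast_mem _ _
    | add a b _ _ ha hb => exact add_mem (ha trivial) (hb trivial)
    | inv a _ ha => exact inv_mem (ha trivial)
    | mul a b _ _ ha hb => exact mul_mem (ha trivial) (hb trivial)
  have hint : IsIntegral K x := Algebra.IsIntegral.isIntegral x
  have htop' : Algebra.adjoin K {x} = ⊤ := by
    have := adjoin_simple_toSubalgebra_of_isAlgebraic (F := K) hint.isAlgebraic
    rw [htop] at this
    rw [← this, IntermediateField.top_toSubalgebra]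
  have hdeg : (minpoly K x).natDegree = Module.finrank K M := by
    rw [← adjoin.finrank hint, htop, IntermediateField.finrank_top']
  have hmin : P = minpoly K x := by
    apply Polynomial.eq_of_monic_of_dvd_of_natDegree_le (minpoly.monic hint) hP (minpoly.dvd _ _ h0)
    rw [hd, hdeg]
  have h1 := Algebra.PowerBasis.norm_gen_eq_coeff_zero_minpoly (PowerBasis.ofAdjoinEqTop hint htop')
  rw [PowerBasis.ofAdjoinEqTop_gen, PowerBasis.ofAdjoinEqTop_dim] at h1
  rw [h1, hdeg, hmin]

set_option linter.unusedSectionVars false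

section nonnorm
variable {p : ℕ} [hpf : Fact p.Prime]

theorem nonnorm_gen (hp4 : p % 4 = 1) {K F M : Type*} [Field K] [NumberField K] [Field F]
    [NumberField F] [Field M] [NumberField M] [Algebra K F] [Algebra F M] {g : M ≃+* M}
    (Q : QuadExt F M g) (φ : K →+* ℚ_[p]) (s : M) (hs : s ^ 2 = p) (e : F) (he0 : e ≠ 0)
    (he : ¬ NN p (φ (Algebra.norm K e))) (y : M) : algebraMap F M e ≠ y * g y := by
  intro h
  letI : Algebra K M := ((algebraMap F M).comp (algebraMap K F)).toAlgebra
  haveI : IsScalarTower K F M := IsScalarTower.of_algebraMap_eq (fun _ => rfl)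
  have hfd : FiniteDimensional K F := Module.Finite.of_restrictScalars_finite ℚ K F
  have hfd : FiniteDimensional F M := Module.Finite.of_restrictScalars_finite ℚ F M
  have h1 : Algebra.norm F y = e := by
    apply (algebraMap F M).injective
    rw [Q.norm_eq, h]
  have hy0 : y ≠ 0 := by
    rintro rfl
    rw [zero_mul, map_eq_zero] at h
    exact he0 h
  apply he
  rw [← h1, Algebra.norm_norm]
  exact norm_NN hp4 φ s hs y hy0

theorem nonnorm_F (hy : Hyp p) {m : ℕ} {F M : Type*} [Field F]
    [NumberField F] [Field M] [NumberField M] [Algebra F M] {g : M ≃+* M} {z : 𝓞 F}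
    (h : IsF (m + 1) F z)
    (Q : QuadExt F M g) (s : M) (hs : s ^ 2 = p) (y : M) : algebraMap F M (z : F) ≠ y * g y := by
  obtain ⟨ζ, ρ, hζ, -⟩ := padic_data hy
  obtain ⟨K, z', hK, hz', hzz⟩ := exists_isF_sub (m := 1) (z := z ^ 2 ^ m)
    (h.prim.pow (by positivity) (by ring))
  have hz4 : (z' : K) ^ 4 = -1 := by
    have : (z' : 𝓞 K) ^ 2 ^ 2 = -1 := prim_neg_one hz'.prim
    have := congrArg (algebraMap (𝓞 K) K) this
    rw [map_pow, map_neg, map_one] at this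
    exact this
  obtain ⟨φ⟩ := exists_embed_zeta (z' : K) hz'.top hz4 ζ hζ
  have hz0 : (z : F) ≠ 0 := by
    intro h0
    have : z = 0 := RingOfIntegers.coe_injective h0
    have h2 := h.prim.pow_eq_one
    rw [this, zero_pow (by positivity)] at h2
    exact zero_ne_one h2
  have hfr : Module.finrank K F = 2 ^ m := by
    have h1 := Module.finrank_mul_finrank ℚ K F
    rw [hz'.finrank, h.finrank] at h1
    apply Nat.eq_of_mul_eq_mul_left (by positivity : 0 < 2 ^ (1 + 1))
    rw [h1]; ring
  refine nonnorm_gen hy.four Q φ s hs _ hz0 ?_ y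
  have hz1 : (z : F) ^ 2 ^ m = algebraMap K F (z' : K) := by
    rw [alg_coe hzz]; exact (map_pow (algebraMap (𝓞 F) F) z (2 ^ m)).symm
  rw [norm_of_poly (z : F) h.top (Polynomial.X ^ 2 ^ m - Polynomial.C (z' : K))
    (Polynomial.monic_X_pow_sub_C _ (by positivity)) (by rw [Polynomial.natDegree_X_pow_sub_C, hfr])
    (by rw [map_sub, map_pow, Polynomial.aeval_X, Polynomial.aeval_C, hz1, sub_self])]
  have hc : (Polynomial.X ^ 2 ^ m - Polynomial.C (z' : K)).coeff 0 = -(z' : K) := by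
    rw [Polynomial.coeff_sub, Polynomial.coeff_C_zero, Polynomial.coeff_X_pow,
      if_neg (by positivity), zero_sub]
  rw [hc]
  apply not_NN_zeta8 hy
  rw [← map_pow, mul_pow, ← pow_mul, mul_comm _ 4, pow_mul, neg_pow (z' : K), hz4]
  norm_num

theorem tf_neg_one {R : Type*} [CommRing R] : ∀ m : ℕ, tf^[m] (-1 : R) = -1
  | 0 => rfl
  | m + 1 => by
    rw [Function.iterate_succ_apply]
    have : tf (-1 : R) = -1 := by rw [tf]; ring
    rw [this, tf_neg_one m]

theorem nonnorm_R (hy : Hyp p) {m : ℕ} {F M : Type*} [Field F]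
    [NumberField F] [Field M] [NumberField M] [Algebra F M] {g : M ≃+* M} {t : 𝓞 F}
    (h : IsR (m + 1) F t)
    (Q : QuadExt F M g) (s : M) (hs : s ^ 2 = p) (y : M) :
    algebraMap F M (1 + t : F) ≠ y * g y := by
  obtain ⟨ζ, ρ, hζ, -, hρ⟩ := padic_data hy
  obtain ⟨K, t', hK, ht', htt⟩ := exists_isR_sub (m := 1) (t := tf^[m] t)
    (by rw [← Function.iterate_add_apply, add_comm, h.it])
  have ht2 : (t' : K) ^ 2 = 2 := by
    have h1 := ht'.itN
    rw [Function.iterate_one, tf] at h1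
    linear_combination h1
  obtain ⟨φ⟩ := exists_embed_sq (t' : K) ht'.top 2 (by push_cast; exact ht2) (ρ ^ 2)
    (by push_cast; linear_combination hρ)
  have hfr : Module.finrank K F = 2 ^ m := by
    have h1 := Module.finrank_mul_finrank ℚ K F
    rw [IsR.finrank ht', h.finrank] at h1
    apply Nat.eq_of_mul_eq_mul_left (by positivity : 0 < 2 ^ (0 + 1))
    rw [h1]; ring
  have ht1 : tf^[m] (t : F) = algebraMap K F (t' : K) := by
    rw [alg_coe htt, ← tf_map]
  set P : Polynomial K := ((fp m).map (algebraMap ℤ K)).comp (Polynomial.X - Polynomial.C 1) -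
    Polynomial.C (t' : K) with hP
  have hmon : (((fp m).map (algebraMap ℤ K)).comp (Polynomial.X - Polynomial.C 1)).Monic :=
    ((fp_deg m).1.map _).comp_X_sub_C 1
  have hdeg : (((fp m).map (algebraMap ℤ K)).comp (Polynomial.X - Polynomial.C 1)).natDegree = 2 ^ m := by
    rw [Polynomial.natDegree_comp, Polynomial.natDegree_X_sub_C, mul_one, (fp_deg m).1.natDegree_map,
      (fp_deg m).2]
  have hdlt : (Polynomial.C (t' : K)).degree <
      (((fp m).map (algebraMap ℤ K)).comp (Polynomial.X - Polynomial.C 1)).degree := by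
    refine lt_of_le_of_lt Polynomial.degree_C_le ?_
    rw [← Polynomial.natDegree_pos_iff_degree_pos, hdeg]
    positivity
  have hPm : P.Monic := hmon.sub_of_left hdlt
  have hPd : P.natDegree = 2 ^ m := by
    rw [hP, Polynomial.natDegree_sub_C, hdeg]
  have hgen : adjoin ℚ {(1 + t : F)} = ⊤ := by
    rw [eq_top_iff, ← h.top, adjoin_le_iff, Set.singleton_subset_iff]
    have h1 : (1 + t : F) ∈ adjoin ℚ {(1 + t : F)} := mem_adjoin_simple_self _ _
    have h2 := sub_mem h1 (one_mem (adjoin ℚ {(1 + t : F)}))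
    rw [add_sub_cancel_left] at h2
    exact h2
  have haev : Polynomial.aeval (1 + t : F) P = 0 := by
    rw [hP, map_sub, Polynomial.aeval_comp, Polynomial.aeval_C, map_sub, Polynomial.aeval_X,
      Polynomial.aeval_C, map_one, add_sub_cancel_left, Polynomial.aeval_map_algebraMap, fp_aeval,
      ht1, sub_self]
  have hc : P.coeff 0 = -(1 + (t' : K)) := by
    rw [hP, Polynomial.coeff_zero_eq_eval_zero, Polynomial.eval_sub, Polynomial.eval_comp,
      Polynomial.eval_C, Polynomial.eval_sub, Polynomial.eval_X, Polynomial.eval_C, zero_sub,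
      Polynomial.eval_map_algebraMap, fp_aeval, tf_neg_one]
    ring
  have hn := norm_of_poly (K := K) (1 + t : F) hgen P hPm (by rw [hPd, hfr]) haev
  have hNN : ¬ NN p (φ (Algebra.norm K (1 + t : F))) := by
    rw [hn, hc, mul_neg, ← neg_mul, map_mul]
    have h1 : NN p (φ (-(-1) ^ Module.finrank K F)) := by
      rw [map_neg, map_pow, map_neg, map_one]
      rcases neg_one_pow_eq_or ℚ_[p] (Module.finrank K F) with h | h <;> rw [h]
      · exact NN.neg_one hy.four
      · rw [neg_neg]; exact NN.one
    intro h2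
    rw [mul_comm] at h2
    have h3 := h2.of_mul h1
    rw [map_add, map_one] at h3
    exact not_NN_one_add_sqrt_two hy (by rw [← map_pow, ht2, map_ofNat]) h3
  refine nonnorm_gen hy.four Q φ s hs _ ?_ hNN y
  intro h0
  rw [h0] at hn
  rw [Algebra.norm_zero, hc] at hn
  have : (1 + (t' : K)) = 0 := by
    rcases mul_eq_zero.1 hn.symm with h | h
    · exact absurd h (pow_ne_zero _ (by norm_num))
    · exact neg_eq_zero.1 h
  have h4 : (t' : K) = -1 := by linear_combination this
  rw [h4] at ht2
  norm_num at ht2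

end nonnorm

set_option linter.unusedSectionVars false

theorem pow_two_pow_mod {p : ℕ} (hp : p % 16 = 9) : ∀ m : ℕ, ∃ a, p ^ 2 ^ m = 1 + 2 ^ (m + 3) * (2 * a + 1)
  | 0 => ⟨p / 16, by norm_num; omega⟩
  | m + 1 => by
    obtain ⟨a, ha⟩ := pow_two_pow_mod hp m
    refine ⟨a + 2 ^ (m + 1) * (2 * a + 1) ^ 2, ?_⟩
    rw [pow_succ 2 m, pow_mul, ha]
    ring

theorem size_arith {p : ℕ} (hp : p % 16 = 9) {e : ℕ} : ∀ m : ℕ, p ^ e ≡ 1 [MOD 2 ^ (m + 3)] → 2 ^ m ∣ e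
  | 0, _ => by simp
  | m + 1, h => by
    have h1 : p ^ e ≡ 1 [MOD 2 ^ (m + 3)] := h.of_dvd ⟨2, by ring⟩
    obtain ⟨f, rfl⟩ := size_arith hp m h1
    rcases Nat.even_or_odd' f with ⟨j, rfl | rfl⟩
    · exact ⟨j, by ring⟩
    · exfalso
      obtain ⟨a, ha⟩ := pow_two_pow_mod hp m
      obtain ⟨b, hb⟩ := pow_two_pow_mod hp (m + 1)
      have h2 : p ^ 2 ^ (m + 1) ≡ 1 [MOD 2 ^ (m + 4)] := by
        rw [hb]
        exact (Nat.ModEq.refl 1).add (Nat.modEq_zero_iff_dvd.2 ⟨_, rfl⟩)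
      have h3 : p ^ (2 ^ m * (2 * j + 1)) = p ^ 2 ^ m * (p ^ 2 ^ (m + 1)) ^ j := by
        rw [← pow_mul, ← pow_add]; congr 1; ring
      rw [h3] at h
      have h4 : p ^ 2 ^ m * (p ^ 2 ^ (m + 1)) ^ j ≡ p ^ 2 ^ m * 1 ^ j [MOD 2 ^ (m + 4)] :=
        (Nat.ModEq.refl _).mul (h2.pow j)
      have h5 := h4.symm.trans h
      rw [one_pow, mul_one, ha] at h5
      have h6 : 2 ^ (m + 3) * (2 * a + 1) ≡ 0 [MOD 2 ^ (m + 4)] :=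
        Nat.ModEq.add_left_cancel' 1 (by simpa using h5)
      obtain ⟨c, hc⟩ := Nat.modEq_zero_iff_dvd.1 h6
      have h7 : 2 * a + 1 = 2 * c := by
        apply Nat.eq_of_mul_eq_mul_left (by positivity : 0 < 2 ^ (m + 3))
        rw [hc]; ring
      omega

theorem order_pow_two {G : Type*} [Monoid G] {x : G} {k : ℕ} (h1 : x ^ 2 ^ k ≠ 1) (h2 : x ^ 2 ^ (k + 1) = 1) :
    orderOf x = 2 ^ (k + 1) := orderOf_eq_prime_pow h1 h2

theorem res_size_z {k : Type*} [Field k] [Fintype k] {m : ℕ} (h2 : (2 : k) ≠ 0) (z : k)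
    (hz : z ^ 2 ^ (m + 1) = -1) : Fintype.card k ≡ 1 [MOD 2 ^ (m + 2)] := by
  have hz0 : z ≠ 0 := by
    rintro rfl
    rw [zero_pow (by positivity)] at hz
    apply h2; linear_combination (2) * hz
  have ho : orderOf z = 2 ^ (m + 2) := by
    apply order_pow_two
    · rw [hz]; intro h; apply h2; linear_combination -h
    · rw [pow_succ, pow_mul, hz]; ring
  have h3 := FiniteField.pow_card_sub_one_eq_one z hz0
  have h4 := orderOf_dvd_of_pow_eq_one h3
  rw [ho] at h4
  exact ((Nat.modEq_iff_dvd' Fintype.card_pos).2 h4).symm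

theorem res_size_t {k : Type*} [Field k] [Fintype k] {m : ℕ} (h2 : (2 : k) ≠ 0) (t : k)
    (ht : tf^[m + 1] t = 0) (h8 : Fintype.card k % 4 = 1) : Fintype.card k ≡ 1 [MOD 2 ^ (m + 3)] := by
  let A := AlgebraicClosure k
  let i := algebraMap k A
  have h2A : (2 : A) ≠ 0 := by
    intro h; apply h2; apply i.injective; rw [map_ofNat, map_zero]; exact h
  obtain ⟨z, hz⟩ : ∃ z : A, z ^ 2 = i t * z - 1 := by
    obtain ⟨r, hr⟩ := IsAlgClosed.exists_pow_nat_eq (i t ^ 2 - 4) (n := 2) (by norm_num)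
    obtain ⟨c, hc⟩ : ∃ c : A, 2 * c = i t + r := ⟨(i t + r) / 2, mul_div_cancel₀ _ h2A⟩
    refine ⟨c, mul_left_cancel₀ (mul_ne_zero h2A h2A) ?_⟩
    linear_combination (2 * c - i t + r) * hc + hr
  have hz0 : z ≠ 0 := by
    rintro rfl
    have : (0 : A) = -1 := by linear_combination hz
    exact one_ne_zero (by linear_combination this : (1 : A) = 0)
  have hy : z * (i t - z) = 1 := by linear_combination -hz
  have h1 := tf_inv (m + 1) z (i t - z) hy
  rw [add_sub_cancel, ← tf_map, ht, map_zero] at h1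
  have h3 : z ^ 2 ^ (m + 1) * (i t - z) ^ 2 ^ (m + 1) = 1 := by rw [← mul_pow, hy, one_pow]
  have h4 : z ^ 2 ^ (m + 2) = -1 := by
    rw [pow_succ 2, pow_mul]; linear_combination (-z ^ 2 ^ (m + 1)) * h1 - h3
  have ho : orderOf z = 2 ^ (m + 3) := by
    apply order_pow_two
    · rw [h4]; intro h; apply h2A; linear_combination -h
    · rw [pow_succ, pow_mul, h4]; ring
  set q := Fintype.card k with hq
  obtain ⟨p, hc⟩ := CharP.exists k
  have hcA : CharP A p := charP_of_injective_algebraMap i.injective p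
  obtain ⟨n, hp, hqn⟩ := FiniteField.card k p
  have : Fact p.Prime := ⟨hp⟩
  have hfr : (z ^ q) ^ 2 = i t * z ^ q - 1 := by
    have := congrArg (iterateFrobenius A p n) hz
    rw [map_sub, map_mul, map_pow, map_one, iterateFrobenius_def, iterateFrobenius_def, ← hqn,
      ← map_pow, FiniteField.pow_card] at this
    exact this
  have hprod : (z ^ q - z) * (z ^ q * z - 1) = 0 := by
    linear_combination z * hfr - z ^ q * hz
  have hq1 : 1 ≤ q := Fintype.card_pos
  rcases mul_eq_zero.1 hprod with h | h
  · have h5 : z ^ (q - 1) = 1 := by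
      apply mul_right_cancel₀ hz0
      rw [← pow_succ, Nat.sub_add_cancel hq1, one_mul]
      linear_combination h
    have h6 := orderOf_dvd_of_pow_eq_one h5
    rw [ho] at h6
    exact ((Nat.modEq_iff_dvd' Fintype.card_pos).2 h6).symm
  · exfalso
    have h5 : z ^ (q + 1) = 1 := by rw [pow_succ]; linear_combination h
    have h6 := orderOf_dvd_of_pow_eq_one h5
    rw [ho] at h6
    have h7 : 4 ∣ q + 1 := dvd_trans ⟨2 ^ (m + 1), by ring⟩ h6
    omega

section counting
universe u
variable {M : Type u} [Field M] [NumberField M]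

theorem exists_T {x : 𝓞 M} (hx : x ≠ 0) : ∃ T : Finset (Ideal (𝓞 M)),
    ∀ P, P ∈ T ↔ P.IsPrime ∧ P ≠ ⊥ ∧ x ∈ P := by
  classical
  have hx0 : Ideal.span {x} ≠ ⊥ := by rwa [Ne, Ideal.span_singleton_eq_bot]
  refine ⟨(UniqueFactorizationMonoid.normalizedFactors (Ideal.span {x})).toFinset, fun P => ?_⟩
  rw [Multiset.mem_toFinset, Ideal.mem_normalizedFactors_iff hx0]
  constructor
  · rintro ⟨h1, h2⟩
    refine ⟨h1, ?_, h2 (Ideal.mem_span_singleton_self x)⟩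
    rintro rfl
    exact hx0 (le_bot_iff.1 h2)
  · rintro ⟨h1, h2, h3⟩
    exact ⟨h1, (Ideal.span_singleton_le_iff_mem _).2 h3⟩

theorem card_T {x : 𝓞 M} (hx : x ≠ 0) (T : Finset (Ideal (𝓞 M)))
    (hT : ∀ P ∈ T, P.IsPrime ∧ P ≠ ⊥ ∧ x ∈ P) (B : ℕ) (hB : ∀ P ∈ T, B ≤ P.absNorm) :
    B ^ T.card ≤ (Ideal.span {x}).absNorm := by
  have hx0 : Ideal.span {x} ≠ ⊥ := by rwa [Ne, Ideal.span_singleton_eq_bot]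
  have h1 : ∏ P ∈ T, P ∣ Ideal.span {x} := by
    apply Finset.prod_primes_dvd
    · intro P hP; exact Ideal.prime_of_isPrime (hT P hP).2.1 (hT P hP).1
    · intro P hP; rw [Ideal.dvd_span_singleton]; exact (hT P hP).2.2
  have h2 : Ideal.absNorm (∏ P ∈ T, P) ∣ (Ideal.span {x}).absNorm :=
    Ideal.absNorm_dvd_absNorm_of_le (Ideal.le_of_dvd h1)
  refine le_trans ?_ (Nat.le_of_dvd (Nat.pos_of_ne_zero (by rwa [Ne, Ideal.absNorm_eq_zero_iff])) h2)
  rw [map_prod]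
  exact Finset.pow_card_le_prod _ _ _ hB

theorem absNorm_sqrt {p : ℕ} {s : 𝓞 M} (hs : s ^ 2 = p) {D : ℕ} (hD : Module.finrank ℚ M = 2 * D) :
    (Ideal.span {s}).absNorm = p ^ D := by
  have h1 := absNorm_pow_span s 2
  rw [hs, Ideal.absNorm_span_natCast, RingOfIntegers.rank, hD, mul_comm 2 D, pow_mul] at h1
  exact (Nat.pow_left_injective (n := 2) (by norm_num) h1).symm

/-- The residue field of a prime containing `p`. -/
theorem res_field {p : ℕ} (hp : p.Prime) {P : Ideal (𝓞 M)} (hP : P.IsPrime) (hP0 : P ≠ ⊥)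
    (hpP : (p : 𝓞 M) ∈ P) : ∃ (k : Type u) (_ : Field k) (_ : Fintype k) (φ : 𝓞 M →+* k) (e : ℕ),
      Function.Surjective φ ∧ (∀ x, φ x = 0 ↔ x ∈ P) ∧
      Fintype.card k = P.absNorm ∧ P.absNorm = p ^ e ∧ 0 < e ∧ CharP k p := by
  have : P.IsMaximal := hP.isMaximal hP0
  letI : Field (𝓞 M ⧸ P) := Ideal.Quotient.field P
  have hfin : Finite (𝓞 M ⧸ P) := Ideal.finiteQuotientOfFreeOfNeBot P hP0
  letI : Fintype (𝓞 M ⧸ P) := Fintype.ofFinite _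
  have hch : CharP (𝓞 M ⧸ P) p := by
    apply (CharP.charP_iff_prime_eq_zero hp).2
    have : Ideal.Quotient.mk P (p : 𝓞 M) = 0 := Ideal.Quotient.eq_zero_iff_mem.2 hpP
    simpa using this
  obtain ⟨n, -, hn⟩ := FiniteField.card (𝓞 M ⧸ P) p
  have hc : Fintype.card (𝓞 M ⧸ P) = P.absNorm := by
    rw [Ideal.absNorm_apply, Submodule.cardQuot_apply, Nat.card_eq_fintype_card]
  exact ⟨𝓞 M ⧸ P, inferInstance, inferInstance, Ideal.Quotient.mk P, n, Ideal.Quotient.mk_surjective,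
    fun x => Ideal.Quotient.eq_zero_iff_mem, hc, by rw [← hc, hn], n.pos, hch⟩

theorem exists_half {p : ℕ} (hp4 : p % 4 = 1) {s : 𝓞 M} (hs : s ^ 2 = p) :
    ∃ w : 𝓞 M, 2 * w = 1 + s ∧ w * (1 - w) = -((p / 4 : ℕ) : 𝓞 M) := by
  have hsM : (s : M) ^ 2 = p := by
    have := congrArg (algebraMap (𝓞 M) M) hs
    rw [map_pow, map_natCast] at this
    exact this
  have hpp : (p : M) = 4 * ((p / 4 : ℕ) : M) + 1 := by
    have : p = 4 * (p / 4) + 1 := by omega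
    exact_mod_cast this
  have hint : IsIntegral ℤ ((1 + (s : M)) / 2) := by
    refine ⟨Polynomial.X ^ 2 - Polynomial.X - Polynomial.C ((p / 4 : ℕ) : ℤ), ?_, ?_⟩
    · monicity!
    · simp only [Polynomial.eval₂_sub, Polynomial.eval₂_pow, Polynomial.eval₂_X, Polynomial.eval₂_C]
      rw [map_natCast]
      linear_combination (1 / 4 : M) * hsM + (1 / 4 : M) * hpp
  obtain ⟨w, hw⟩ : ∃ w : 𝓞 M, algebraMap (𝓞 M) M w = (1 + algebraMap (𝓞 M) M s) / 2 := ⟨⟨_, hint⟩, rfl⟩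
  change algebraMap (𝓞 M) M s ^ 2 = p at hsM
  refine ⟨w, ?_, ?_⟩
  · apply RingOfIntegers.coe_injective
    change algebraMap (𝓞 M) M (2 * _) = algebraMap (𝓞 M) M (1 + s)
    rw [map_mul, map_add, map_ofNat, map_one, hw]
    ring
  · apply RingOfIntegers.coe_injective
    change algebraMap (𝓞 M) M (_ * _) = algebraMap (𝓞 M) M _
    rw [map_mul, map_sub, map_neg, map_natCast, map_one, hw]
    linear_combination (-1 / 4 : M) * hsM - (1 / 4 : M) * hpp

theorem Tset {p : ℕ} (hp : p.Prime) (hp4 : p % 4 = 1) {s : 𝓞 M} (hs : s ^ 2 = p) {g : M ≃+* M}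
    (hg : oi g s = -s) (b c : ℕ) (hb : 0 < b) (hf : Module.finrank ℚ M = 2 * (b * c))
    (hB : ∀ P : Ideal (𝓞 M), P.IsPrime → P ≠ ⊥ → (p : 𝓞 M) ∈ P → p ^ b ≤ P.absNorm) :
    ∃ T : Finset (Ideal (𝓞 M)), (∀ P : Ideal (𝓞 M), P.IsPrime → P ≠ ⊥ → (∀ w, w - oi g w ∈ P) → P ∈ T) ∧
      T.card ≤ c := by
  have hs0 : s ≠ 0 := by
    rintro rfl
    have : (p : 𝓞 M) = 0 := by rw [← hs]; ring
    exact hp.ne_zero (by exact_mod_cast this)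
  obtain ⟨T, hT⟩ := exists_T hs0
  obtain ⟨w, hw, -⟩ := exists_half hp4 hs
  refine ⟨T, ?_, ?_⟩
  · intro P hP hP0 h
    refine (hT P).2 ⟨hP, hP0, ?_⟩
    have h1 : w - oi g w = s := by
      have h2 := congrArg (oi g) hw
      rw [map_mul, map_add, map_ofNat, map_one, hg] at h2
      apply mul_left_cancel₀ (two_ne_zero' (𝓞 M))
      linear_combination hw - h2
    rw [← h1]; exact h w
  · have h1 := card_T hs0 T (fun P hP => (hT P).1 hP) (p ^ b) (fun P hP => by
      obtain ⟨h1, h2, h3⟩ := (hT P).1 hP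
      exact hB P h1 h2 (by rw [← hs]; exact Ideal.pow_mem_of_mem _ h3 2 (by norm_num)))
    rw [absNorm_sqrt hs hf, ← pow_mul] at h1
    have := (Nat.pow_le_pow_iff_right hp.one_lt).1 h1
    exact Nat.le_of_mul_le_mul_left this hb

theorem absNorm_ge_z {p : ℕ} (hp : p.Prime) (h16 : p % 16 = 9) {m : ℕ} {z : 𝓞 M}
    (hz : IsPrimitiveRoot z (2 ^ (m + 3))) (P : Ideal (𝓞 M)) (hP : P.IsPrime) (hP0 : P ≠ ⊥)
    (hpP : (p : 𝓞 M) ∈ P) : p ^ 2 ^ m ≤ P.absNorm := by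
  obtain ⟨k, _, _, φ, e, -, -, hc, he, he0, hch⟩ := res_field hp hP hP0 hpP
  have h2 : (2 : k) ≠ 0 := by
    intro h
    have h' : ((2 : ℕ) : k) = 0 := by exact_mod_cast h
    rw [CharP.cast_eq_zero_iff k p, Nat.prime_dvd_prime_iff_eq hp Nat.prime_two] at h'
    omega
  have h3 := res_size_z (m := m + 1) h2 (φ z) (by
    rw [← map_pow, prim_neg_one hz, map_neg, map_one])
  rw [hc, he] at h3
  have h4 := size_arith h16 m h3
  rw [he]
  exact Nat.pow_le_pow_right hp.pos (Nat.le_of_dvd he0 h4)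

theorem absNorm_ge_t {p : ℕ} (hp : p.Prime) (h16 : p % 16 = 9) {m : ℕ} {t : 𝓞 M}
    (ht : tf^[m + 1] t = 0) (P : Ideal (𝓞 M)) (hP : P.IsPrime) (hP0 : P ≠ ⊥)
    (hpP : (p : 𝓞 M) ∈ P) : p ^ 2 ^ m ≤ P.absNorm := by
  obtain ⟨k, _, _, φ, e, -, -, hc, he, he0, hch⟩ := res_field hp hP hP0 hpP
  have h2 : (2 : k) ≠ 0 := by
    intro h
    have h' : ((2 : ℕ) : k) = 0 := by exact_mod_cast h
    rw [CharP.cast_eq_zero_iff k p, Nat.prime_dvd_prime_iff_eq hp Nat.prime_two] at h'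
    omega
  have h3 := res_size_t (m := m) h2 (φ t) (by rw [← tf_map, ht, map_zero]) (by
    rw [hc, he, Nat.pow_mod, show p % 4 = 1 by omega, one_pow]; rfl)
  rw [hc, he] at h3
  have h4 := size_arith h16 m h3
  rw [he]
  exact Nat.pow_le_pow_right hp.pos (Nat.le_of_dvd he0 h4)

end counting

set_option linter.unusedSectionVars false

/-- the size of `Cl[2]` -/
noncomputable def c2 (M : Type*) [Field M] [NumberField M] : ℕ :=
  Nat.card (powMonoidHom 2 : ClassGroup (𝓞 M) →* ClassGroup (𝓞 M)).ker

theorem pow_le_aux {c d r rK t T : ℕ} (h : c * d * 2 ^ r ≤ 2 ^ (t + 2 * rK)) (hr : r = 2 * rK + 1)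
    (hT : t ≤ T) : c * d * 2 ≤ 2 ^ T := by
  have h1 : c * d * 2 * 2 ^ (2 * rK) ≤ 2 ^ T * 2 ^ (2 * rK) := by
    calc c * d * 2 * 2 ^ (2 * rK) = c * d * 2 ^ r := by rw [hr, pow_succ]; ring
      _ ≤ _ := h
      _ ≤ _ := by
        rw [← pow_add]; exact Nat.pow_le_pow_right (by norm_num) (by omega)
  exact Nat.le_of_mul_le_mul_right h1 (by positivity)

section
variable {p : ℕ} [hpf : Fact p.Prime]

theorem c2_L (hy : Hyp p) {m : ℕ} {M : Type} [Field M] [NumberField M] {z s : 𝓞 M}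
    (h : IsL p (m + 1) M z s) : c2 M ≤ 4 := by
  have hp := hpf.out
  obtain ⟨K, z', g, hz', hzz, Q, hgz, hgs⟩ := h.quadF hp hy.ne2
  obtain ⟨T, hT, hTc⟩ := Tset hp hy.four h.sq hgs (2 ^ m) 4 (by positivity)
    (by rw [h.finrank hp hy.ne2]; ring) (absNorm_ge_z hp hy.mod h.prim)
  have h1 := Q.lemmaU (clF_odd _ _ _ hz') T hT 2 (Or.inr ⟨rfl, (hz'.prim.isUnit (by positivity)).unit,
    fun y => nonnorm_F hy hz' Q (s : M) h.sqM y⟩)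
  have h2 := pow_le_aux h1 (by
    have := h.rank hp hy.ne2
    have := hz'.rank
    have : 2 ^ (m + 1 + 1) = 2 * 2 ^ (m + 1) := by ring
    omega) hTc
  unfold c2; omega

theorem c2_L0 (hy : Hyp p) {M : Type} [Field M] [NumberField M] {z s : 𝓞 M}
    (h : IsL p 0 M z s) : c2 M ≤ 2 := by
  have hp := hpf.out
  obtain ⟨K, z', g, hz', hzz, Q, hgz, hgs⟩ := h.quadF hp hy.ne2
  obtain ⟨T, hT, hTc⟩ := Tset hp hy.four h.sq hgs 1 2 (by positivity)
    (by rw [h.finrank hp hy.ne2]; norm_num) (by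
      intro P hP hP0 hpP
      obtain ⟨k, _, _, φ, e, -, -, hc, he, he0, hch⟩ := res_field hp hP hP0 hpP
      rw [he]; exact Nat.pow_le_pow_right hp.pos he0)
  have h1 := Q.lemmaU (clF_odd _ _ _ hz') T hT 1 (Or.inl rfl)
  have h2 := pow_le_aux h1 (by
    have := h.rank hp hy.ne2
    have := hz'.rank
    omega) hTc
  unfold c2; omega

theorem one_add_t_unit {R : Type*} [CommRing R] : ∀ (m : ℕ) (t : R), tf^[m + 1] t = 0 → IsUnit (1 + t)
  | 0, t, h => by
    apply IsUnit.of_mul_eq_one (t - 1)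
    simp only [zero_add, Function.iterate_one, tf] at h
    linear_combination h
  | m + 1, t, h => by
    have h1 := one_add_t_unit m (tf t) h
    have h2 : 1 + tf t = (1 + t) * (t - 1) := by rw [tf]; ring
    rw [h2] at h1
    exact isUnit_of_mul_isUnit_left h1

theorem IsLp.sqM {m : ℕ} {N : Type*} [Field N] [NumberField N] {t s : 𝓞 N}
    (h : IsLp p m N t s) : (s : N) ^ 2 = p := by
  have := congrArg (algebraMap (𝓞 N) N) h.sq
  rw [map_pow, map_natCast] at this
  exact this

theorem IsLp.rank {m : ℕ} {N : Type*} [Field N] [NumberField N] {t s : 𝓞 N}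
    (h : IsLp p m N t s) : Units.rank N + 1 = 2 ^ (m + 1) := by
  rw [← h.fr]
  apply rank_real _ h.top
  intro φ y hy
  rcases hy with rfl | hy
  · have h1 := congrArg φ (congrArg (algebraMap (𝓞 N) N) h.it)
    rw [tf_map, tf_map, map_zero, map_zero] at h1
    exact (tf_real m _ (by rw [h1]; rfl) (by rw [h1]; simp)).1
  · rw [Set.mem_singleton_iff.1 hy]
    have h1 := congrArg φ h.sqM
    rw [map_pow, map_natCast] at h1
    have h2 : ((Real.sqrt p : ℝ) : ℂ) ^ 2 = p := by
      rw [← Complex.ofReal_pow, Real.sq_sqrt (by positivity)]; simp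
    rw [← h2] at h1
    rcases sq_eq_sq_iff_eq_or_eq_neg.1 h1 with h3 | h3 <;> rw [h3] <;> simp

theorem clLp_odd (hy : Hyp p) {m : ℕ} {N : Type} [Field N] [NumberField N] {t s : 𝓞 N}
    (h : IsLp p (m + 1) N t s) : Odd (Nat.card (ClassGroup (𝓞 N))) := by
  have hp := hpf.out
  obtain ⟨K, t', hK, ht', htt⟩ := exists_isR_sub h.it
  have hf : Module.finrank K N = 2 := by
    have h1 := Module.finrank_mul_finrank ℚ K N
    rw [ht'.finrank, h.fr, pow_succ _ (m + 1)] at h1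
    exact Nat.eq_of_mul_eq_mul_left (by positivity) h1
  obtain ⟨g, Q⟩ := quadExt_of_finrank hf
  have hsn : (s : N) ∉ K := by
    intro hz
    have h3 : K = ⊤ := by
      rw [eq_top_iff, ← h.top, adjoin_le_iff, Set.insert_subset_iff, Set.singleton_subset_iff]
      refine ⟨?_, hz⟩
      rw [hK]; exact mem_adjoin_simple_self _ _
    have h5 : Module.finrank ℚ (⊤ : IntermediateField ℚ N) = Module.finrank ℚ N :=
      IntermediateField.finrank_top'
    rw [← h3, ht'.finrank, h.fr] at h5
    have := Nat.pow_right_injective (le_refl 2) h5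
    omega
  have hgs : oi g s = -s := by
    apply RingOfIntegers.coe_injective
    rw [map_neg]
    exact Q.neg ((mem_range_iff K _).2 (by
      change (s : N) ^ 2 ∈ K
      rw [h.sqM]; exact _root_.natCast_mem K p)) (fun hc => hsn ((mem_range_iff K _).1 hc))
  obtain ⟨T, hT, hTc⟩ := Tset hp hy.four h.sq hgs (2 ^ m) 2 (by positivity)
    (by rw [h.fr]; ring) (absNorm_ge_t hp hy.mod h.it)
  have h1 := Q.lemmaU (clR_odd _ _ _ ht') T hT 2 (Or.inr ⟨rfl, (one_add_t_unit m t' ht'.it).unit,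
    fun y => by
      have := nonnorm_R hy ht' Q (s : N) h.sqM y
      intro hc
      apply this
      rw [← hc]
      congr 1⟩)
  have h2 := pow_le_aux h1 (by
    have := h.rank
    have := ht'.rank
    have : 2 ^ (m + 1 + 1) = 2 * 2 ^ (m + 1) := by ring
    omega) hTc
  exact odd_card_of_ker (by omega)

end

theorem prime_eq_span {M : Type*} [Field M] [NumberField M] {w : 𝓞 M} {r N : ℕ} (hr : r.Prime)
    (hw : (Ideal.span {w}).absNorm = N) (hf : Module.finrank ℚ M = 2) (hN : ¬ r ^ 2 ∣ N)
    {P : Ideal (𝓞 M)} (hP : P ≠ ⊤) (h1 : (r : 𝓞 M) ∈ P) (h2 : w ∈ P) :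
    P = Ideal.span {(r : 𝓞 M), w} ∧ P.absNorm = r := by
  set A : Ideal (𝓞 M) := Ideal.span {(r : 𝓞 M), w} with hA
  have hAP : A ≤ P := by
    rw [hA, Ideal.span_le]; rintro x (rfl | rfl) <;> assumption
  have d1 : A.absNorm ∣ r ^ 2 := by
    rw [← hf, ← RingOfIntegers.rank M, ← Ideal.absNorm_span_natCast]
    exact Ideal.absNorm_dvd_absNorm_of_le (Ideal.span_mono (by simp))
  have d2 : A.absNorm ∣ N := by
    rw [← hw]
    exact Ideal.absNorm_dvd_absNorm_of_le (Ideal.span_mono (by simp))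
  have hA1 : A.absNorm = r := by
    obtain ⟨k, hk, hk'⟩ := (Nat.dvd_prime_pow hr).1 d1
    interval_cases k
    · rw [pow_zero, Ideal.absNorm_eq_one_iff] at hk'
      rw [hk', top_le_iff] at hAP; exact absurd hAP hP
    · rw [hk', pow_one]
    · rw [hk'] at d2; exact absurd d2 hN
  have hAm : A.IsMaximal := by
    have : A.IsPrime := Ideal.isPrime_of_irreducible_absNorm (by rw [hA1]; exact hr)
    apply this.isMaximal
    intro h0
    rw [h0, Ideal.absNorm_bot] at hA1
    exact hr.ne_zero hA1.symm
  have h3 := hAm.eq_of_le hP hAP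
  exact ⟨h3.symm, by rw [← h3, hA1]⟩

theorem absNorm_imag {M : Type*} [Field M] [NumberField M] {w : 𝓞 M} {d : ℕ} (hw : w ^ 2 = -(d : 𝓞 M))
    (hf : Module.finrank ℚ M = 2) : (Ideal.span {w}).absNorm = d := by
  have h1 := absNorm_pow_span w 2
  rw [hw, Ideal.span_singleton_neg, Ideal.absNorm_span_natCast, RingOfIntegers.rank, hf] at h1
  exact (Nat.pow_left_injective (n := 2) (by norm_num) h1).symm

theorem E_basic {p : ℕ} (hp : p.Prime) (hp2 : p ≠ 2) {M : Type*} [Field M] [NumberField M] {w : 𝓞 M}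
    (hw : w ^ 2 = -((2 * p : ℕ) : 𝓞 M)) (htop : adjoin ℚ {(w : M)} = ⊤) :
    Module.finrank ℚ M = 2 ∧ (∃ g : M ≃+* M, QuadExt ℚ M g ∧ oi g w = -w) ∧ c2 M ≤ 2 := by
  have hd : (-(2 * p : ℕ) : ℤ) < 0 := by have := hp.pos; push_cast; linarith
  have hw' : w ^ 2 = ((-(2 * p : ℕ) : ℤ) : 𝓞 M) := by rw [hw]; push_cast; ring
  obtain ⟨hf, g, Q, hg⟩ := quad_over_Q hw' (imag_not_sq hd) htop
  refine ⟨hf, ⟨g, Q, hg⟩, ?_⟩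
  classical
  have hN := absNorm_imag hw hf
  have h1 := Q.lemmaU odd_card_Q {Ideal.span {((2 : ℕ) : 𝓞 M), w}, Ideal.span {(p : 𝓞 M), w}} (by
    intro P hP hP0 h
    have h1 := h w
    rw [hg, show w - -w = 2 * w by ring] at h1
    have h2 : ((2 : ℕ) : 𝓞 M) ∈ P ∨ (p : 𝓞 M) ∈ P := by
      rcases hP.mem_or_mem h1 with h2 | h2
      · left; exact_mod_cast h2
      · have h3 : w ^ 2 ∈ P := Ideal.pow_mem_of_mem _ h2 2 (by norm_num)
        rw [hw, neg_mem_iff, Nat.cast_mul] at h3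
        exact hP.mem_or_mem h3
    have h3 : w ∈ P := by
      apply hP.mem_of_pow_mem 2
      rw [hw, neg_mem_iff, Nat.cast_mul]
      rcases h2 with h2 | h2
      · exact P.mul_mem_right _ h2
      · exact P.mul_mem_left _ h2
    rw [Finset.mem_insert, Finset.mem_singleton]
    rcases h2 with h2 | h2
    · left
      refine (prime_eq_span Nat.prime_two hN hf ?_ hP.ne_top h2 h3).1
      rw [pow_two]
      intro h4
      have := Nat.dvd_of_mul_dvd_mul_left (by norm_num) h4
      exact hp2 ((Nat.prime_dvd_prime_iff_eq Nat.prime_two hp).1 this).symm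
    · right
      refine (prime_eq_span hp hN hf ?_ hP.ne_top h2 h3).1
      rw [pow_two, mul_comm 2]
      intro h4
      have := Nat.dvd_of_mul_dvd_mul_left hp.pos h4
      exact hp2 ((Nat.prime_dvd_prime_iff_eq hp Nat.prime_two).1 this)) 2
      (Or.inr ⟨rfl, imag_nonnorm hd hw' Q hg⟩)
  rw [rank_Q, imag_rank hd hw' hf] at h1
  have h2 : 2 ^ (Finset.card {Ideal.span {((2 : ℕ) : 𝓞 M), w}, Ideal.span {(p : 𝓞 M), w}} + 2 * 0) ≤ 2 ^ 2 :=
    Nat.pow_le_pow_right (by norm_num) (by simpa using Finset.card_le_two)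
  unfold c2
  omega

theorem odd_neg_two {M : Type*} [Field M] [NumberField M] {w : 𝓞 M}
    (hw : w ^ 2 = -2) (htop : adjoin ℚ {(w : M)} = ⊤) : Odd (Nat.card (ClassGroup (𝓞 M))) := by
  have hw' : w ^ 2 = ((-2 : ℤ) : 𝓞 M) := by rw [hw]; push_cast; ring
  obtain ⟨hf, -⟩ := quad_over_Q hw' (imag_not_sq (by norm_num)) htop
  refine imag_odd (by norm_num) hw' htop w (absNorm_imag (by rw [hw]; norm_cast) hf) ?_
  intro P hP h
  rcases hP.mem_or_mem h with h | h
  · apply hP.mem_of_pow_mem 2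
    rw [hw, neg_mem_iff]; exact h
  · exact h

set_option linter.unusedSectionVars false

section groups
variable {C D : Type*} [CommGroup C] [Finite C] [CommGroup D]

theorem sq_quot_eq {x y : C} (χ : C →* D) (hD : ∀ d : D, d ^ 2 = 1)
    (h : (QuotientGroup.mk x : C ⧸ (powMonoidHom 2 : C →* C).range) = QuotientGroup.mk y) :
    χ x = χ y := by
  rw [QuotientGroup.eq] at h
  obtain ⟨w, hw⟩ := h
  have h1 : χ (x⁻¹ * y) = 1 := by rw [← hw, powMonoidHom_apply, map_pow, hD]
  rw [map_mul, map_inv, inv_mul_eq_one] at h1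
  exact h1

theorem gen1 (h : Nat.card (powMonoidHom 2 : C →* C).ker ≤ 2) (χ : C →* D) (hD : ∀ d : D, d ^ 2 = 1)
    (c : C) (hc : χ c ≠ 1) (x : C) : ∃ n : ℕ, OddOrd (x / c ^ n) := by
  classical
  let S := (powMonoidHom 2 : C →* C).range
  have hcard : Nat.card (C ⧸ S) ≤ 2 := by
    have := index_sq_eq (C := C)
    change S.index ≤ 2
    rw [this]; exact h
  letI : Fintype (C ⧸ S) := Fintype.ofFinite _
  rw [Nat.card_eq_fintype_card] at hcard
  have h1 : ((1 : C) : C ⧸ S) ≠ (c : C ⧸ S) := fun h => hc (by rw [← sq_quot_eq χ hD h, map_one])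
  have huniv : ({((1 : C) : C ⧸ S), (c : C ⧸ S)} : Finset (C ⧸ S)) = Finset.univ := by
    apply Finset.eq_univ_of_card
    apply le_antisymm (Finset.card_le_univ _)
    rw [Finset.card_pair h1]; exact hcard
  obtain ⟨y, hy, hxy⟩ := oddOrd_gen (Subgroup.zpowers c) (by
    intro x
    have hx := Finset.mem_univ (x : C ⧸ S)
    rw [← huniv, Finset.mem_insert, Finset.mem_singleton] at hx
    rcases hx with hx | hx
    · obtain ⟨w, hw⟩ := QuotientGroup.eq.1 hx.symm
      exact ⟨1, one_mem _, w, by rw [powMonoidHom_apply] at hw; rw [hw]; group⟩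
    · obtain ⟨w, hw⟩ := QuotientGroup.eq.1 hx.symm
      exact ⟨c, Subgroup.mem_zpowers c, w, by rw [powMonoidHom_apply] at hw; rw [hw]; group⟩) x
  obtain ⟨n, rfl⟩ := (mem_zpowers_iff_mem_range_orderOf (x := c)).1 hy |> Finset.mem_image.1 |>.imp (fun _ h => h.2)
  exact ⟨n, hxy⟩

theorem gen2 {D' : Type*} [CommGroup D'] (h : Nat.card (powMonoidHom 2 : C →* C).ker ≤ 4) (χa : C →* D)
    (hD : ∀ d : D, d ^ 2 = 1) (χb : C →* D') (hD' : ∀ d : D', d ^ 2 = 1)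
    (l c : C) (hal : χa l ≠ 1) (hbl : χb l = 1) (hbc : χb c ≠ 1)
    (x : C) : ∃ a b : ℕ, OddOrd (x / (l ^ a * c ^ b)) := by
  classical
  let S := (powMonoidHom 2 : C →* C).range
  have hcard : Nat.card (C ⧸ S) ≤ 4 := by
    have := index_sq_eq (C := C)
    change S.index ≤ 4
    rw [this]; exact h
  letI : Fintype (C ⧸ S) := Fintype.ofFinite _
  rw [Nat.card_eq_fintype_card] at hcard
  have h1 : ((1 : C) : C ⧸ S) ≠ (l : C ⧸ S) := fun h => hal (by rw [← sq_quot_eq χa hD h, map_one])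
  have h2 : ((1 : C) : C ⧸ S) ≠ (c : C ⧸ S) := fun h => hbc (by rw [← sq_quot_eq χb hD' h, map_one])
  have h3 : ((1 : C) : C ⧸ S) ≠ ((l * c : C) : C ⧸ S) := fun h => hbc (by
    have := sq_quot_eq χb hD' h
    rw [map_one, map_mul, hbl, one_mul] at this; exact this.symm)
  have h4 : (l : C ⧸ S) ≠ (c : C ⧸ S) := fun h => hbc (by rw [← sq_quot_eq χb hD' h, hbl])
  have h5 : (l : C ⧸ S) ≠ ((l * c : C) : C ⧸ S) := fun h => hbc (by
    have := sq_quot_eq χb hD' h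
    rw [map_mul, hbl, one_mul] at this; exact this.symm)
  have h6 : (c : C ⧸ S) ≠ ((l * c : C) : C ⧸ S) := fun h => hal (by
    have := sq_quot_eq χa hD h
    rw [map_mul, eq_comm, mul_eq_right] at this; exact this)
  have huniv : ({((1 : C) : C ⧸ S), (l : C ⧸ S), (c : C ⧸ S), ((l * c : C) : C ⧸ S)} : Finset (C ⧸ S)) = Finset.univ := by
    apply Finset.eq_univ_of_card
    apply le_antisymm (Finset.card_le_univ _)
    rw [Finset.card_insert_of_notMem, Finset.card_insert_of_notMem, Finset.card_pair h6]
    · exact hcard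
    · simp only [Finset.mem_insert, Finset.mem_singleton, not_or]; exact ⟨h4, h5⟩
    · simp only [Finset.mem_insert, Finset.mem_singleton, not_or]; exact ⟨h1, h2, h3⟩
  obtain ⟨y, hy, hxy⟩ := oddOrd_gen (Subgroup.zpowers l ⊔ Subgroup.zpowers c) (by
    have hl : l ∈ Subgroup.zpowers l ⊔ Subgroup.zpowers c :=
      Subgroup.mem_sup_left (Subgroup.mem_zpowers l)
    have hc : c ∈ Subgroup.zpowers l ⊔ Subgroup.zpowers c :=
      Subgroup.mem_sup_right (Subgroup.mem_zpowers c)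
    intro x
    have hx := Finset.mem_univ (x : C ⧸ S)
    rw [← huniv, Finset.mem_insert, Finset.mem_insert, Finset.mem_insert, Finset.mem_singleton] at hx
    have key : ∀ y : C, y ∈ Subgroup.zpowers l ⊔ Subgroup.zpowers c → (x : C ⧸ S) = (y : C ⧸ S) →
        ∃ y ∈ Subgroup.zpowers l ⊔ Subgroup.zpowers c, ∃ w : C, x = y * w ^ 2 := by
      intro y hy hx
      obtain ⟨w, hw⟩ := QuotientGroup.eq.1 hx.symm
      exact ⟨y, hy, w, by rw [powMonoidHom_apply] at hw; rw [hw]; group⟩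
    rcases hx with hx | hx | hx | hx
    · exact key _ (one_mem _) hx
    · exact key _ hl hx
    · exact key _ hc hx
    · exact key _ (mul_mem hl hc) hx) x
  obtain ⟨y1, hy1, y2, hy2, rfl⟩ := Subgroup.mem_sup.1 hy
  obtain ⟨a, rfl⟩ := (mem_zpowers_iff_mem_range_orderOf (x := l)).1 hy1 |> Finset.mem_image.1 |>.imp (fun _ h => h.2)
  obtain ⟨b, rfl⟩ := (mem_zpowers_iff_mem_range_orderOf (x := c)).1 hy2 |> Finset.mem_image.1 |>.imp (fun _ h => h.2)
  exact ⟨a, b, hxy⟩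

theorem exp2_odd (hD : ∀ d : D, d ^ 2 = 1) {k : ℕ} (hk : Odd k) (d : D) : d ^ k = d := by
  obtain ⟨j, rfl⟩ := hk
  rw [pow_succ, pow_mul, hD, one_pow, one_mul]

theorem OddOrd.char (hD : ∀ d : D, d ^ 2 = 1) (χ : C →* D) {x : C} (hx : OddOrd x) : χ x = 1 :=
  (hx.map χ).eq_one' (hD _)

theorem exp2_even (hD : ∀ d : D, d ^ 2 = 1) {d : D} (hd : d ≠ 1) {k : ℕ} (h : d ^ k = 1) : Even k := by
  by_contra hk
  rw [Nat.not_even_iff_odd] at hk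
  exact hd (by rw [← exp2_odd hD hk d, h])

theorem primary_iff (x : C) : x ∈ CommGroup.primaryComponent C 2 ↔ ∃ n, x ^ 2 ^ n = 1 := by
  exact Iff.rfl

theorem G2 {D' : Type*} [CommGroup D'] (h : Nat.card (powMonoidHom 2 : C →* C).ker ≤ 4) (χa : C →* D)
    (hD : ∀ d : D, d ^ 2 = 1) (χb : C →* D') (hD' : ∀ d : D', d ^ 2 = 1)
    (l c : C) (hal : χa l ≠ 1) (hbl : χb l = 1) (hbc : χb c ≠ 1) (hl2 : OddOrd (l ^ 2)) (n : ℕ)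
    (hc0 : ¬ OddOrd (c ^ 2 ^ n)) :
    Nonempty (CommGroup.primaryComponent C 2 ≃* Multiplicative (ZMod 2 × ZMod (2 ^ (n + 1)))) ↔
      OddOrd (c ^ 2 ^ (n + 1)) := by
  constructor
  · rintro ⟨e⟩
    obtain ⟨N, k, hk, h1⟩ := oddOrd_exists_pow c
    have hm : c ^ k ∈ CommGroup.primaryComponent C 2 :=
      (primary_iff _).2 ⟨N, by rw [← pow_mul, mul_comm, pow_mul, h1]⟩
    have h2 : (⟨c ^ k, hm⟩ : CommGroup.primaryComponent C 2) ^ 2 ^ (n + 1) = 1 := by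
      apply e.injective
      rw [map_pow, map_one]
      apply Multiplicative.toAdd.injective
      rw [toAdd_pow, toAdd_one]
      ext
      · rw [Prod.smul_fst, nsmul_eq_mul, Prod.fst_zero]
        have : ((2 ^ (n + 1) : ℕ) : ZMod 2) = 0 := by
          rw [ZMod.natCast_eq_zero_iff]; exact dvd_pow_self 2 (by omega)
        rw [this, zero_mul]
      · rw [Prod.smul_snd, nsmul_eq_mul, Prod.snd_zero, ZMod.natCast_self, zero_mul]
    refine ⟨k, hk, ?_⟩
    have h3 := congrArg Subtype.val h2
    rw [← pow_mul, mul_comm, pow_mul]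
    exact h3
  · intro hc1
    obtain ⟨k1, hk1, e1⟩ := hl2
    obtain ⟨k2, hk2, e2⟩ := hc1
    have hl' : l ^ k1 ∈ CommGroup.primaryComponent C 2 :=
      (primary_iff _).2 ⟨1, by rw [pow_one, ← pow_mul, mul_comm, pow_mul, e1]⟩
    have hc' : c ^ k2 ∈ CommGroup.primaryComponent C 2 :=
      (primary_iff _).2 ⟨n + 1, by rw [← pow_mul, mul_comm, pow_mul, e2]⟩
    set P := CommGroup.primaryComponent C 2 with hP
    let x : P := ⟨l ^ k1, hl'⟩
    let y : P := ⟨c ^ k2, hc'⟩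
    have hx2 : x ^ 2 = 1 := Subtype.ext (by
      change (l ^ k1) ^ 2 = 1; rw [← pow_mul, mul_comm, pow_mul, e1])
    have hy2 : y ^ 2 ^ (n + 1) = 1 := Subtype.ext (by
      change (c ^ k2) ^ 2 ^ (n + 1) = 1; rw [← pow_mul, mul_comm, pow_mul, e2])
    have hordy : orderOf y = 2 ^ (n + 1) := by
      apply order_pow_two _ hy2
      intro h3
      apply hc0
      refine ⟨k2, hk2, ?_⟩
      have := congrArg Subtype.val h3
      rw [← pow_mul, mul_comm, pow_mul]
      exact this
    let f1 : ZMod 2 →+ Additive P := ZMod.lift 2 ⟨zmultiplesHom _ (Additive.ofMul x), by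
      rw [zmultiplesHom_apply, natCast_zsmul, ← ofMul_pow, hx2, ofMul_one]⟩
    let f2 : ZMod (2 ^ (n + 1)) →+ Additive P := ZMod.lift _ ⟨zmultiplesHom _ (Additive.ofMul y), by
      rw [zmultiplesHom_apply, natCast_zsmul, ← ofMul_pow, hy2, ofMul_one]⟩
    have hf1 : ∀ a : ℕ, f1 (a : ZMod 2) = Additive.ofMul (x ^ a) := by
      intro a
      have := ZMod.lift_coe 2 ⟨zmultiplesHom _ (Additive.ofMul x), by
        rw [zmultiplesHom_apply, natCast_zsmul, ← ofMul_pow, hx2, ofMul_one]⟩ (a : ℤ)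
      rw [Int.cast_natCast] at this
      refine this.trans ?_
      rw [zmultiplesHom_apply, natCast_zsmul, ← ofMul_pow]
    have hf2 : ∀ a : ℕ, f2 (a : ZMod (2 ^ (n + 1))) = Additive.ofMul (y ^ a) := by
      intro a
      have := ZMod.lift_coe (2 ^ (n + 1)) ⟨zmultiplesHom _ (Additive.ofMul y), by
        rw [zmultiplesHom_apply, natCast_zsmul, ← ofMul_pow, hy2, ofMul_one]⟩ (a : ℤ)
      rw [Int.cast_natCast] at this
      refine this.trans ?_
      rw [zmultiplesHom_apply, natCast_zsmul, ← ofMul_pow]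
    let f : ZMod 2 × ZMod (2 ^ (n + 1)) →+ Additive P := AddMonoidHom.coprod f1 f2
    have hf : ∀ a b : ℕ, f ((a : ZMod 2), (b : ZMod (2 ^ (n + 1)))) = Additive.ofMul (x ^ a * y ^ b) := by
      intro a b
      rw [AddMonoidHom.coprod_apply, hf1, hf2, ofMul_mul]
    have hbij : Function.Bijective f := by
      constructor
      · rw [injective_iff_map_eq_zero]
        rintro ⟨a, b⟩ hab
        obtain ⟨a, rfl⟩ := ZMod.natCast_zmod_surjective a
        obtain ⟨b, rfl⟩ := ZMod.natCast_zmod_surjective b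
        rw [hf, ← ofMul_one] at hab
        have hab := Additive.ofMul.injective hab
        have h3 : (l ^ k1) ^ a * (c ^ k2) ^ b = 1 := congrArg Subtype.val hab
        have h4 := congrArg χb h3
        rw [map_mul, map_pow, map_pow, map_pow, map_pow, hbl, one_pow, one_pow, one_mul, map_one,
          exp2_odd hD' hk2] at h4
        have hbe := exp2_even hD' hbc h4
        have h5 := congrArg χa h3
        rw [map_mul, map_pow, map_pow, map_pow, map_pow, map_one,
          exp2_odd hD hk2, exp2_odd hD hk1] at h5
        obtain ⟨b', rfl⟩ := hbe
        rw [← two_mul, pow_mul, hD, one_pow, mul_one] at h5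
        have hae := exp2_even hD hal h5
        have ha0 : x ^ a = 1 := by
          obtain ⟨a', rfl⟩ := hae
          rw [← two_mul, pow_mul, hx2, one_pow]
        rw [ha0, one_mul] at hab
        have hd := orderOf_dvd_of_pow_eq_one hab
        rw [hordy] at hd
        rw [Prod.mk_eq_zero]
        exact ⟨(ZMod.natCast_eq_zero_iff _ _).2 (even_iff_two_dvd.1 hae), (ZMod.natCast_eq_zero_iff _ _).2 hd⟩
      · intro w
        obtain ⟨w, rfl⟩ := Additive.ofMul.surjective w
        obtain ⟨w, hw⟩ := w
        obtain ⟨N, hN⟩ := (primary_iff _).1 hw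
        obtain ⟨a, b, k3, hk3, e3⟩ := gen2 h χa hD χb hD' l c hal hbl hbc w
        set K := k1 * k2 * k3 with hK
        have hKo : Odd K := (hk1.mul hk2).mul hk3
        have e4 : w ^ K = (l ^ k1) ^ (k2 * k3 * a) * (c ^ k2) ^ (k1 * k3 * b) := by
          have h6 : w ^ k3 = (l ^ a * c ^ b) ^ k3 := by
            rw [_root_.div_pow, div_eq_one] at e3; exact e3
          rw [hK, mul_comm, pow_mul, h6, ← pow_mul, mul_pow, ← pow_mul, ← pow_mul, ← pow_mul, ← pow_mul]
          congr 2 <;> ring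
        have hcop : Nat.Coprime K (orderOf w) :=
          Nat.Coprime.coprime_dvd_right (orderOf_dvd_of_pow_eq_one hN)
            (Nat.Coprime.pow_right _ (Nat.coprime_two_right.2 hKo))
        obtain ⟨j, hj⟩ := exists_pow_eq_self_of_coprime hcop
        refine ⟨(((k2 * k3 * a * j : ℕ) : ZMod 2), ((k1 * k3 * b * j : ℕ) : ZMod (2 ^ (n + 1)))), ?_⟩
        rw [hf]
        congr 1
        apply Subtype.ext
        change (l ^ k1) ^ (k2 * k3 * a * j) * (c ^ k2) ^ (k1 * k3 * b * j) = w
        rw [pow_mul _ (k2 * k3 * a) j, pow_mul _ (k1 * k3 * b) j, ← mul_pow, ← e4, hj]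
    exact ⟨(AddEquiv.toMultiplicativeLeft (AddEquiv.ofBijective f hbij)).symm⟩
end groups

set_option linter.unusedSectionVars false

section chars
variable {p : ℕ} [hpf : Fact p.Prime]

/-- subgroup of local norms -/
def NNsub (p : ℕ) [Fact p.Prime] : Subgroup (ℚ_[p])ˣ where
  carrier := {x | NN p (x : ℚ_[p])}
  one_mem' := NN.one
  mul_mem' := fun {a b} ha hb => by
    change NN p ((a * b : (ℚ_[p])ˣ) : ℚ_[p])
    rw [Units.val_mul]; exact NN.mul ha hb
  inv_mem' := fun {a} ha => by
    change NN p ((a⁻¹ : (ℚ_[p])ˣ) : ℚ_[p])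
    rw [Units.val_inv_eq_inv_val]; exact NN.inv ha

/-- local norm residue group -/
def Dp (p : ℕ) [Fact p.Prime] : Type := (ℚ_[p])ˣ ⧸ NNsub p

noncomputable instance : CommGroup (Dp p) := inferInstanceAs (CommGroup ((ℚ_[p])ˣ ⧸ NNsub p))

/-- projection to the norm residue group -/
noncomputable def mkD : (ℚ_[p])ˣ →* Dp p := QuotientGroup.mk' (NNsub p)

theorem mkD_surj : Function.Surjective (mkD : (ℚ_[p])ˣ →* Dp p) := QuotientGroup.mk'_surjective (NNsub p)

theorem mkD_iff (x : (ℚ_[p])ˣ) : mkD x = 1 ↔ NN p (x : ℚ_[p]) :=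
  QuotientGroup.eq_one_iff (N := NNsub p) x

theorem Dp_sq (d : Dp p) : d ^ 2 = 1 := by
  obtain ⟨x, rfl⟩ := mkD_surj d
  rw [← map_pow, mkD_iff, Units.val_pow_eq_pow_val]
  exact NN.sq x.ne_zero

open Classical in
/-- the class of a `p`-adic number -/
noncomputable def dcl (x : ℚ_[p]) : Dp p := if h : x = 0 then 1 else mkD (Units.mk0 x h)

theorem dcl_mul {x y : ℚ_[p]} (hx : x ≠ 0) (hy : y ≠ 0) : dcl (x * y) = dcl x * dcl y := by
  rw [dcl, dcl, dcl, dif_neg hx, dif_neg hy, dif_neg (mul_ne_zero hx hy), ← map_mul]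
  congr 1
  ext; rfl

theorem dcl_iff {x : ℚ_[p]} (hx : x ≠ 0) : dcl x = 1 ↔ NN p x := by
  rw [dcl, dif_neg hx, mkD_iff]; rfl

theorem dcl_one : dcl (1 : ℚ_[p]) = 1 := (dcl_iff one_ne_zero).2 NN.one

theorem dcl_pow {x : ℚ_[p]} (hx : x ≠ 0) (n : ℕ) : dcl (x ^ n) = dcl x ^ n := by
  induction n with
  | zero => rw [pow_zero, pow_zero, dcl_one]
  | succ n ih => rw [pow_succ, pow_succ, dcl_mul (pow_ne_zero n hx) hx, ih]

theorem exists_char {K M : Type*} [Field K] [NumberField K] [Field M] [NumberField M] [Algebra K M]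
    (φ : K →+* ℚ_[p]) (hK : Odd (Nat.card (ClassGroup (𝓞 K))))
    (hU : ∀ ε : (𝓞 K)ˣ, NN p (φ (ε : 𝓞 K)))
    (hn : ∀ x : M, x ≠ 0 → NN p (φ (Algebra.norm K x))) :
    ∃ χ : ClassGroup (𝓞 M) →* Dp p, ∀ J : Ideal (𝓞 M), J ≠ ⊥ → ∀ γ : 𝓞 K, nm K J = Ideal.span {γ} →
      (χ (cl J) = 1 ↔ NN p (φ γ)) := by
  set h := Nat.card (ClassGroup (𝓞 K)) with hh
  have hex : ∀ J : Ideal (𝓞 M), J ≠ ⊥ → ∃ γ : 𝓞 K, γ ≠ 0 ∧ nm K J ^ h = Ideal.span {γ} := by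
    intro J hJ
    apply (cl_eq_one_iff (pow_ne_zero _ (nm_ne_bot hJ))).1
    rw [cl_pow (nm_ne_bot hJ), hh, pow_card_eq_one']
  have hne : ∀ γ : 𝓞 K, γ ≠ 0 → φ γ ≠ 0 := by
    intro γ hγ h0
    apply hγ
    apply RingOfIntegers.coe_injective
    exact (map_eq_zero φ).1 h0
  have hun : ∀ a b : 𝓞 K, a ≠ 0 → b ≠ 0 → Ideal.span {a} = Ideal.span {b} → dcl (φ a) = dcl (φ b) := by
    intro a b ha hb hab
    obtain ⟨u, hu⟩ := Ideal.span_singleton_eq_span_singleton.1 hab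
    have h1 : φ b = φ a * φ (u : 𝓞 K) := by
      rw [← map_mul, ← hu]; rfl
    have h2 := hU u
    rw [h1, dcl_mul (hne a ha) h2.ne, (dcl_iff h2.ne).2 h2, mul_one]
  classical
  let F : Ideal (𝓞 M) → Dp p := fun J => if hJ : J ≠ ⊥ then dcl (φ (hex J hJ).choose) else 1
  have hF : ∀ J : Ideal (𝓞 M), J ≠ ⊥ → ∀ γ : 𝓞 K, nm K J ^ h = Ideal.span {γ} → F J = dcl (φ γ) := by
    intro J hJ γ hγ
    have hγ0 : γ ≠ 0 := by
      rintro rfl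
      rw [Ideal.span_singleton_eq_bot.2 rfl] at hγ
      exact pow_ne_zero _ (nm_ne_bot hJ) hγ
    change (if hJ : J ≠ ⊥ then dcl (φ (hex J hJ).choose) else 1) = _
    rw [dif_pos hJ]
    obtain ⟨h1, h2⟩ := (hex J hJ).choose_spec
    exact hun _ _ h1 hγ0 (h2.symm.trans hγ)
  have hF1 : ∀ I J, I ≠ ⊥ → J ≠ ⊥ → F (I * J) = F I * F J := by
    intro I J hI hJ
    obtain ⟨a, ha, ha'⟩ := hex I hI
    obtain ⟨b, hb, hb'⟩ := hex J hJ
    rw [hF I hI a ha', hF J hJ b hb', hF (I * J) (mul_ne_zero hI hJ) (a * b)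
      (by rw [nm_mul, mul_pow, ha', hb', Ideal.span_singleton_mul_span_singleton]),
      ← dcl_mul (hne a ha) (hne b hb), ← map_mul]
    rfl
  have hF2 : ∀ x, x ≠ 0 → F (Ideal.span {x}) = 1 := by
    intro x hx
    have hx' : (x : M) ≠ 0 := by
      intro h0; apply hx; apply RingOfIntegers.coe_injective; exact h0
    rw [hF _ (by simpa using hx) (RingOfIntegers.norm K x ^ h)
      (by rw [nm_span, Ideal.span_singleton_pow])]
    have h1 := hn (x : M) hx'
    change dcl (φ (algebraMap (𝓞 K) K (RingOfIntegers.norm K x ^ h))) = 1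
    rw [map_pow, map_pow]
    change dcl (φ (Algebra.norm K (x : M)) ^ h) = 1
    rw [dcl_pow h1.ne, (dcl_iff h1.ne).2 h1, one_pow]
  refine ⟨clHom F hF1 hF2, fun J hJ γ hγ => ?_⟩
  rw [clHom_cl _ _ _ hJ]
  have hγ0 : γ ≠ 0 := by
    rintro rfl
    rw [Ideal.span_singleton_eq_bot.2 rfl] at hγ
    exact (nm_ne_bot hJ) hγ
  rw [hF J hJ (γ ^ h) (by rw [hγ, Ideal.span_singleton_pow])]
  change dcl (φ (algebraMap (𝓞 K) K (γ ^ h))) = 1 ↔ _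
  rw [map_pow, map_pow]
  change dcl (φ (γ : K) ^ h) = 1 ↔ _
  rw [dcl_pow (hne γ hγ0), exp2_odd Dp_sq hK, dcl_iff (hne γ hγ0)]

theorem units_torsion {K : Type*} [Field K] [NumberField K] (h : Units.rank K = 0) (ε : (𝓞 K)ˣ) :
    ∃ n, 0 < n ∧ ε ^ n = 1 := by
  obtain ⟨⟨ζ, e⟩, h1, -⟩ := Units.exist_unique_eq_mul_prod K ε
  have : IsEmpty (Fin (Units.rank K)) := by rw [h]; infer_instance
  rw [Finset.univ_eq_empty, Finset.prod_empty, mul_one] at h1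
  rw [h1]
  exact ⟨Units.torsionOrder K, (Units.torsionOrder_pos K), by
    have := Units.rootsOfUnity_eq_torsion K
    have h2 : (ζ : (𝓞 K)ˣ) ∈ rootsOfUnity (Units.torsionOrder K) (𝓞 K) := by
      rw [this]; exact ζ.2
    exact h2⟩

theorem imag_units_NN (hy : Hyp p) {K : Type*} [Field K] [NumberField K] (hr : Units.rank K = 0)
    (hf : Module.finrank ℚ K = 2) (φ : K →+* ℚ_[p]) (ε : (𝓞 K)ˣ) : NN p (φ (ε : 𝓞 K)) := by
  obtain ⟨n, hn, hε⟩ := units_torsion hr ε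
  obtain ⟨a, k, hk, rfl⟩ := Nat.exists_eq_two_pow_mul_odd hn.ne'
  have hne : φ (ε : 𝓞 K) ≠ 0 := by
    intro h0
    have h1 := (map_eq_zero φ).1 h0
    exact ε.ne_zero (RingOfIntegers.coe_injective h1)
  have key : ∀ η : 𝓞 K, η ^ 2 ^ a = 1 → η ^ 4 = 1 := by
    intro η hη
    by_contra h4
    obtain ⟨b, hb, hb'⟩ := (Nat.dvd_prime_pow Nat.prime_two).1 (orderOf_dvd_of_pow_eq_one hη)
    have hb3 : 3 ≤ b := by
      by_contra hc
      apply h4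
      have : η ^ 2 ^ b = 1 := by rw [← hb', pow_orderOf_eq_one]
      have hd : 2 ^ b ∣ 4 := by
        rw [show 4 = 2 ^ 2 by norm_num]; exact Nat.pow_dvd_pow 2 (by omega)
      exact orderOf_dvd_iff_pow_eq_one.1 (by rw [hb']; exact hd)
    obtain ⟨c, rfl⟩ := Nat.exists_eq_add_of_le hb3
    have hprim : IsPrimitiveRoot η (2 ^ (3 + c)) := by rw [← hb']; exact IsPrimitiveRoot.orderOf η
    have h8 : IsPrimitiveRoot (η ^ 2 ^ c) (2 ^ (1 + 2)) := hprim.pow (by positivity) (by ring)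
    obtain ⟨K', z', hK, hz', hzz⟩ := exists_isF_sub h8
    have h1 := Module.finrank_mul_finrank ℚ K' K
    rw [hz'.finrank, hf] at h1
    omega
  have h4 := key ((ε : 𝓞 K) ^ k) (by
    rw [← pow_mul, mul_comm, ← Units.val_pow_eq_pow_val, hε, Units.val_one])
  obtain ⟨x, hx⟩ : ∃ x, x = φ (ε : 𝓞 K) := ⟨_, rfl⟩
  have hx4 : (x ^ k) ^ 4 = 1 := by
    have := congrArg φ (congrArg (algebraMap (𝓞 K) K) h4)
    rw [map_pow, map_pow, map_pow, map_pow, map_one, map_one] at this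
    rw [hx]; exact this
  rw [← hx] at hne ⊢
  have hk' : NN p (x ^ k) := by
    have h5 : ((x ^ k) ^ 2 - 1) * ((x ^ k) ^ 2 + 1) = 0 := by linear_combination hx4
    rcases mul_eq_zero.1 h5 with h5 | h5
    · rcases mul_self_eq_one_iff.1 ((pow_two _).symm.trans (sub_eq_zero.1 h5)) with h6 | h6
      · rw [h6]; exact NN.one
      · rw [h6]; exact NN.neg_one hy.four
    · obtain ⟨ζ, ρ, hζ, -, -⟩ := padic_data hy
      have hζ0 : ζ ≠ 0 := by rintro rfl; norm_num at hζ
      have h6 : (x ^ k) ^ 2 = (ζ ^ 2) ^ 2 := by linear_combination h5 - hζ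
      rcases sq_eq_sq_iff_eq_or_eq_neg.1 h6 with h7 | h7
      · rw [h7]; exact NN.sq hζ0
      · rw [h7, neg_eq_neg_one_mul]; exact (NN.neg_one hy.four).mul (NN.sq hζ0)
  rw [← dcl_iff (pow_ne_zero k hne), dcl_pow hne, exp2_odd Dp_sq hk, dcl_iff hne] at hk'
  exact hk'

theorem char_gen (hy : Hyp p) {M : Type} [Field M] [NumberField M] (w s : 𝓞 M) (d : ℤ) (hd : d < 0)
    (hw : w ^ 2 = d) (hs : s ^ 2 = p) (r : ℚ_[p]) (hr : r ^ 2 = d)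
    (hodd : ∀ (K : IntermediateField ℚ M) (w' : 𝓞 K), w' ^ 2 = d → adjoin ℚ {(w' : K)} = ⊤ →
      Odd (Nat.card (ClassGroup (𝓞 K)))) :
    ∃ (K : IntermediateField ℚ M) (w' : 𝓞 K) (φ : K →+* ℚ_[p]) (χ : ClassGroup (𝓞 M) →* Dp p),
      algebraMap (𝓞 K) (𝓞 M) w' = w ∧ w' ^ 2 = d ∧ Module.finrank ℚ K = 2 ∧
      ∀ J : Ideal (𝓞 M), J ≠ ⊥ → ∀ γ : 𝓞 K, nm K J = Ideal.span {γ} →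
      (χ (cl J) = 1 ↔ NN p (φ γ)) := by
  obtain ⟨w', hw'⟩ := exists_int (adjoin ℚ {(w : M)}) w (mem_adjoin_simple_self _ _)
  have htop : adjoin ℚ {(w' : adjoin ℚ {(w : M)})} = ⊤ := by
    apply adjoin_coe_top
    rw [Set.image_singleton]
    congr 1
    exact alg_coe hw'
  have hsq : w' ^ 2 = d := by
    apply FaithfulSMul.algebraMap_injective (𝓞 (adjoin ℚ {(w : M)})) (𝓞 M)
    rw [map_pow, hw', hw, map_intCast]
  have hsq' : (w' : adjoin ℚ {(w : M)}) ^ 2 = d := by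
    have := congrArg (algebraMap (𝓞 (adjoin ℚ {(w : M)})) (adjoin ℚ {(w : M)})) hsq
    rw [map_pow, map_intCast] at this
    exact this
  obtain ⟨hf, -⟩ := quad_over_Q hsq (imag_not_sq hd) htop
  have hrk := imag_rank hd hsq hf
  obtain ⟨φ⟩ := exists_embed_sq (w' : adjoin ℚ {(w : M)}) htop d hsq' r hr
  have hsM : (s : M) ^ 2 = p := by
    have := congrArg (algebraMap (𝓞 M) M) hs
    rw [map_pow, map_natCast] at this
    exact this
  obtain ⟨χ, hχ⟩ := exists_char (M := M) φ (hodd _ w' hsq htop) (imag_units_NN hy hrk hf φ)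
    (norm_NN hy.four φ (s : M) hsM)
  exact ⟨_, w', φ, χ, hw', hsq, hf, hχ⟩

end chars

theorem inert {K : Type*} [Field K] [NumberField K] {w : 𝓞 K} {d : ℤ} (hw : w ^ 2 = d)
    (hf : Module.finrank ℚ K = 2) {q : ℕ} (hq : q.Prime) (hd : ¬ IsSquare (d : ZMod q))
    {a : Ideal (𝓞 K)} (ha : a.absNorm = q ^ 2) : a = Ideal.span {(q : 𝓞 K)} := by
  have : Fact q.Prime := ⟨hq⟩
  have hqn : (Ideal.span {(q : 𝓞 K)}).absNorm = q ^ 2 := by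
    rw [Ideal.absNorm_span_natCast, RingOfIntegers.rank, hf]
  have ha1 : a ≠ ⊤ := by
    rintro rfl
    rw [Ideal.absNorm_top] at ha
    have := Nat.one_lt_pow two_ne_zero hq.one_lt
    omega
  have ha0 : a ≠ ⊥ := by
    rintro rfl
    rw [Ideal.absNorm_bot] at ha
    exact absurd ha.symm (pow_ne_zero 2 hq.ne_zero)
  obtain ⟨P, hPm, hP⟩ := Ideal.exists_le_maximal a ha1
  have hqP : (q : 𝓞 K) ∈ P := by
    have h1 := hP (Ideal.absNorm_mem a)
    rw [ha, Nat.cast_pow] at h1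
    exact hPm.isPrime.mem_of_pow_mem 2 h1
  have hP0 : P ≠ ⊥ := fun h => ha0 (le_bot_iff.1 (h ▸ hP))
  obtain ⟨k, _, _, φ, e, hsur, -, hc, he, he0, hch⟩ := res_field hq hPm.isPrime hP0 hqP
  have hd1 : P.absNorm ∣ q ^ 2 := by
    rw [← hqn]
    exact Ideal.absNorm_dvd_absNorm_of_le ((Ideal.span_singleton_le_iff_mem _).2 hqP)
  have he2 : e = 2 := by
    rw [he, Nat.pow_dvd_pow_iff_le_right hq.one_lt] at hd1
    by_contra hne
    have he1 : e = 1 := by omega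
    rw [he, he1, pow_one] at hc
    have hbij : Function.Bijective (ZMod.castHom (dvd_refl q) k) := by
      rw [Fintype.bijective_iff_injective_and_card]
      exact ⟨(ZMod.castHom (dvd_refl q) k).injective, by rw [ZMod.card, hc]⟩
    obtain ⟨y, hy⟩ := hbij.2 (φ w)
    apply hd
    refine ⟨y, hbij.1 ?_⟩
    rw [map_intCast, map_mul, hy, ← pow_two, ← map_pow, hw, map_intCast]
  rw [he2] at he
  have h1 : a = P := ideal_eq_of_le_of_absNorm hP ha0 (by rw [ha, he])
  rw [h1]
  symm
  apply ideal_eq_of_le_of_absNorm ((Ideal.span_singleton_le_iff_mem _).2 hqP)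
  · rw [Ne, Ideal.span_singleton_eq_bot, Nat.cast_eq_zero]; exact hq.ne_zero
  · rw [hqn, he]

theorem absNorm_two_eq {K : Type*} [Field K] [NumberField K] {x : 𝓞 K}
    (hx : (Ideal.span {x}).absNorm = 2) (n : ℕ) (hx2 : (2 : 𝓞 K) ∣ x ^ n)
    {a : Ideal (𝓞 K)} (ha : a.absNorm = 2) : a = Ideal.span {x} := by
  have hp : a.IsPrime := Ideal.isPrime_of_irreducible_absNorm (by rw [ha]; exact Nat.prime_two)
  have h1 : x ∈ a := by
    apply hp.mem_of_pow_mem n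
    obtain ⟨y, hy⟩ := hx2
    rw [hy]
    have := Ideal.absNorm_mem a
    rw [ha] at this
    exact a.mul_mem_right _ (by exact_mod_cast this)
  symm
  apply ideal_eq_of_le_of_absNorm ((Ideal.span_singleton_le_iff_mem _).2 h1)
  · intro h
    rw [h, Ideal.absNorm_bot] at hx; omega
  · rw [hx, ha]

section chars
variable {p : ℕ} [hpf : Fact p.Prime]

theorem ne_bot_of_absNorm {M : Type*} [Field M] [NumberField M] {J : Ideal (𝓞 M)} {n : ℕ}
    (h : J.absNorm = n) (hn : n ≠ 0) : J ≠ ⊥ := by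
  rintro rfl
  rw [Ideal.absNorm_bot] at h; exact hn h.symm

theorem char_a (hy : Hyp p) {m : ℕ} {M : Type} [Field M] [NumberField M] {z s : 𝓞 M}
    (h : IsL p m M z s) : ∃ χ : ClassGroup (𝓞 M) →* Dp p,
      (∀ J : Ideal (𝓞 M), J.absNorm = 2 → χ (cl J) ≠ 1) ∧
      (∀ J : Ideal (𝓞 M), ∀ q : ℕ, q.Prime → q % 8 = 7 → ¬ IsSquare (q : ZMod p) → J.absNorm = q ^ 2 →
        χ (cl J) ≠ 1) := by
  obtain ⟨ζ, ρ, hζ, -, hρ⟩ := padic_data hy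
  have hw : (z ^ 2 ^ m) ^ 2 = ((-1 : ℤ) : 𝓞 M) := by
    rw [← pow_mul, ← pow_succ, prim_neg_one h.prim]; simp
  obtain ⟨K, w, φ, χ, -, hw2, hf, hχ⟩ := char_gen hy (z ^ 2 ^ m) s (-1) (by norm_num) hw h.sq (ζ ^ 2)
    (by push_cast; linear_combination hζ) (by
      intro K w' hw' htop
      refine clF_odd 0 K w' ⟨?_, htop⟩
      rw [IsPrimitiveRoot.iff_orderOf]
      push_cast at hw'
      apply order_pow_two (k := 1)
      · rw [pow_one, hw']
        intro h1
        have : (2 : 𝓞 K) = 0 := by linear_combination -h1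
        exact two_ne_zero this
      · norm_num
        rw [show 4 = 2 * 2 by norm_num, pow_mul, hw']; ring)
  push_cast at hw2
  have hwK : φ w ^ 2 = -1 := by
    have := congrArg φ (congrArg (algebraMap (𝓞 K) K) hw2)
    rw [map_pow, map_pow, map_neg, map_neg, map_one, map_one] at this
    exact this
  refine ⟨χ, ?_, ?_⟩
  · intro J hJ
    have h1 : (Ideal.span {1 + w}).absNorm = 2 := by
      have h3 := absNorm_pow_span (1 + w) 2
      have h4 : (1 + w) ^ 2 = w * ((2 : ℕ) : 𝓞 K) := by push_cast; linear_combination hw2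
      have h5 : IsUnit w := IsUnit.of_mul_eq_one (-w) (by linear_combination -hw2)
      rw [h4, Ideal.span_singleton_mul_left_unit h5, Ideal.absNorm_span_natCast, RingOfIntegers.rank, hf] at h3
      exact (Nat.pow_left_injective (n := 2) (by norm_num) h3).symm
    have h2 := absNorm_two_eq h1 2 ⟨w, by linear_combination hw2⟩ ((nm_absNorm (K := K) J).trans hJ)
    rw [Ne, hχ J (ne_bot_of_absNorm hJ (by norm_num)) _ h2]
    change ¬ NN p (φ (algebraMap (𝓞 K) K (1 + w)))
    rw [map_add, map_add, map_one, map_one]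
    exact not_NN_one_add_i hy hwK
  · intro J q hq hq8 hqp hJ
    have : Fact q.Prime := ⟨hq⟩
    have h2 := inert (by rw [hw2]; norm_cast : w ^ 2 = ((-1 : ℤ) : 𝓞 K)) hf hq (by
      push_cast
      rw [ZMod.exists_sq_eq_neg_one_iff]; omega) ((nm_absNorm (K := K) J).trans hJ)
    rw [Ne, hχ J (ne_bot_of_absNorm hJ (pow_ne_zero 2 hq.ne_zero)) _ h2]
    change ¬ NN p (φ (algebraMap (𝓞 K) K (q : 𝓞 K)))
    rw [map_natCast, map_natCast]
    exact not_NN_nat hqp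

theorem char_b (hy : Hyp p) {m : ℕ} {M : Type} [Field M] [NumberField M] {z s : 𝓞 M}
    (h : IsL p (m + 1) M z s) : ∃ χ : ClassGroup (𝓞 M) →* Dp p,
      (∀ J : Ideal (𝓞 M), J.absNorm = 2 → χ (cl J) = 1) ∧
      (∀ J : Ideal (𝓞 M), ∀ q : ℕ, q.Prime → q % 8 = 7 → ¬ IsSquare (q : ZMod p) → J.absNorm = q ^ 2 →
        χ (cl J) ≠ 1) := by
  obtain ⟨ζ, ρ, hζ, -, hρ⟩ := padic_data hy
  have hy4 : (z ^ 2 ^ m) ^ 4 = -1 := by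
    rw [← pow_mul, show 2 ^ m * 4 = 2 ^ (m + 1 + 1) by ring, prim_neg_one h.prim]
  have hw : (z ^ 2 ^ m + (z ^ 2 ^ m) ^ 3) ^ 2 = ((-2 : ℤ) : 𝓞 M) := by
    push_cast; linear_combination (2 + (z ^ 2 ^ m) ^ 2) * hy4
  obtain ⟨K, w, φ, χ, -, hw2, hf, hχ⟩ := char_gen hy _ s (-2) (by norm_num) hw h.sq (ζ ^ 2 * ρ ^ 2)
    (by push_cast; linear_combination hζ * ρ ^ 4 - hρ) (by
      intro K w' hw' htop
      exact odd_neg_two (by rw [hw']; norm_cast) htop)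
  push_cast at hw2
  have hwK : φ w ^ 2 = -2 := by
    have := congrArg φ (congrArg (algebraMap (𝓞 K) K) hw2)
    rw [map_pow, map_pow, map_neg, map_neg, map_ofNat, map_ofNat] at this
    exact this
  refine ⟨χ, ?_, ?_⟩
  · intro J hJ
    have h1 : (Ideal.span {w}).absNorm = 2 := absNorm_imag (by rw [hw2]; norm_cast) hf
    have h2 := absNorm_two_eq h1 2 ⟨-1, by linear_combination hw2⟩ ((nm_absNorm (K := K) J).trans hJ)
    rw [hχ J (ne_bot_of_absNorm hJ (by norm_num)) _ h2]
    exact NN_sqrt_neg_two hy hwK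
  · intro J q hq hq8 hqp hJ
    have : Fact q.Prime := ⟨hq⟩
    have h2 := inert (by rw [hw2]; norm_cast : w ^ 2 = ((-2 : ℤ) : 𝓞 K)) hf hq (by
      push_cast
      rw [ZMod.exists_sq_eq_neg_two_iff (by omega)]; omega) ((nm_absNorm (K := K) J).trans hJ)
    rw [Ne, hχ J (ne_bot_of_absNorm hJ (pow_ne_zero 2 hq.ne_zero)) _ h2]
    change ¬ NN p (φ (algebraMap (𝓞 K) K (q : 𝓞 K)))
    rw [map_natCast, map_natCast]
    exact not_NN_nat hqp
end chars

set_option linter.unusedSectionVars false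

section ell
variable {p m : ℕ} {M : Type*} [Field M] [NumberField M] {z s : 𝓞 M}

theorem IsL.oi_pow (h : IsL p m M z s) (g : M ≃+* M) : ∃ a : ℕ, oi g z = z ^ a := by
  obtain ⟨i, -, hi⟩ := h.prim.eq_pow_of_pow_eq_one (ξ := oi g z) (by
    rw [← map_pow, h.prim.pow_eq_one, map_one])
  exact ⟨i, hi.symm⟩

theorem oi_half {w s : 𝓞 M} (hw : 2 * w = 1 + s) {g : M ≃+* M} (hg : oi g s = s) : oi g w = w := by
  have h1 := congrArg (oi g) hw
  rw [map_mul, map_add, map_one, hg, map_ofNat, ← hw] at h1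
  exact mul_left_cancel₀ two_ne_zero h1

theorem oi_half' {w s : 𝓞 M} (hw : 2 * w = 1 + s) {g : M ≃+* M} (hg : oi g s = -s) :
    oi g w = 1 - w := by
  have h1 := congrArg (oi g) hw
  rw [map_mul, map_add, map_one, hg, map_ofNat] at h1
  apply mul_left_cancel₀ (two_ne_zero : (2 : 𝓞 M) ≠ 0)
  linear_combination h1 + hw

/-- the two primes above `2` -/
theorem exists_l (hp : p.Prime) (hp8 : p % 8 = 1) (h : IsL p m M z s) :
    ∃ (l : Ideal (𝓞 M)) (g : M ≃+* M), l.absNorm = 2 ∧ oi g z = z ∧ oi g s = -s ∧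
      l * act g l = Ideal.span {1 - z} ∧
      (∀ f : M ≃+* M, oi f s = s → act f l = l) ∧ (∀ f : M ≃+* M, oi f s = s → act f (act g l) = act g l) ∧
      (∀ P : Ideal (𝓞 M), P.IsPrime → 2 ∈ P → P = l ∨ P = act g l) := by
  have hp2 : p ≠ 2 := by rintro rfl; omega
  obtain ⟨F, z', g, -, -, Q, hgz, hgs⟩ := h.quadF hp hp2
  obtain ⟨w, hw1, hw2⟩ := exists_half (by omega : p % 4 = 1) h.sq
  obtain ⟨d, hd⟩ : ∃ d, p / 4 = 2 * d := ⟨p / 8, by omega⟩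
  have h2z : ∃ y, (1 - z) * y = 2 := by
    obtain ⟨ε, hε⟩ := one_sub_assoc _ z h.prim
    refine ⟨(1 - z) ^ (2 ^ (m + 1) - 1) * ε, ?_⟩
    rw [← hε, ← mul_assoc, ← pow_succ']
    congr 2
    have := Nat.one_le_two_pow (n := m + 1)
    omega
  obtain ⟨y, hy⟩ := h2z
  have h4 := h.absNorm hp hp2
  have hz0 : Ideal.span {1 - z} ≠ (⊥ : Ideal (𝓞 M)) := by
    intro h0; rw [h0, Ideal.absNorm_bot] at h4; omega
  have hgw := oi_half' hw1 hgs
  have hact : act g (Ideal.span {1 - z, w}) = Ideal.span {1 - z, 1 - w} := by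
    rw [act_span_set, Set.image_pair, map_sub, map_one, hgz, hgw]
  have hmul : Ideal.span {1 - z, w} * act g (Ideal.span {1 - z, w}) = Ideal.span {1 - z} := by
    rw [hact, Ideal.span_pair_mul_span_pair]
    apply le_antisymm
    · rw [Ideal.span_le]
      intro x hx
      rw [SetLike.mem_coe, Ideal.mem_span_singleton]
      simp only [Set.mem_insert_iff, Set.mem_singleton_iff] at hx
      rcases hx with rfl | rfl | rfl | rfl
      · exact dvd_mul_right _ _
      · exact dvd_mul_right _ _
      · exact dvd_mul_left _ _
      · rw [hw2, hd]; exact ⟨-y * d, by push_cast; linear_combination (d : 𝓞 M) * hy⟩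
    · rw [Ideal.span_singleton_le_iff_mem]
      have h5 : (1 - z : 𝓞 M) = (1 - z) * (1 - w) + w * (1 - z) := by ring
      have h6 := Ideal.add_mem (Ideal.span {(1 - z) * (1 - z), (1 - z) * (1 - w), w * (1 - z), w * (1 - w)})
        (Ideal.subset_span (Or.inr (Or.inl rfl))) (Ideal.subset_span (Or.inr (Or.inr (Or.inl rfl))))
      rwa [← h5] at h6
  have hnorm : (Ideal.span {1 - z, w}).absNorm = 2 := by
    have h5 := congrArg Ideal.absNorm hmul
    rw [map_mul, act_absNorm, h4] at h5
    nlinarith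
  have hl0 := ne_bot_of_absNorm hnorm two_ne_zero
  have hinv : ∀ f : M ≃+* M, oi f s = s → act f (Ideal.span {1 - z, w}) = Ideal.span {1 - z, w} := by
    intro f hf
    apply ideal_eq_of_le_of_absNorm _ (act_ne_bot f hl0) (act_absNorm f _)
    obtain ⟨a, ha⟩ := h.oi_pow f
    rw [act_span_set, Set.image_pair, map_sub, map_one, ha, oi_half hw1 hf, Ideal.span_le]
    intro x hx
    simp only [Set.mem_insert_iff, Set.mem_singleton_iff] at hx
    rcases hx with rfl | rfl
    · obtain ⟨c, hc⟩ := sub_dvd_pow_sub_pow (1 : 𝓞 M) z a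
      rw [one_pow] at hc
      rw [hc]
      exact Ideal.mul_mem_right _ _ (Ideal.subset_span (by simp))
    · exact Ideal.subset_span (by simp)
  refine ⟨_, g, hnorm, hgz, hgs, hmul, hinv, ?_, ?_⟩
  · intro f hf
    rw [hact]
    apply ideal_eq_of_le_of_absNorm _ (act_ne_bot f (by rw [← hact]; exact act_ne_bot g hl0)) (act_absNorm f _)
    obtain ⟨a, ha⟩ := h.oi_pow f
    rw [act_span_set, Set.image_pair, map_sub, map_sub, map_one, ha, oi_half hw1 hf, Ideal.span_le]
    intro x hx
    simp only [Set.mem_insert_iff, Set.mem_singleton_iff] at hx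
    rcases hx with rfl | rfl
    · obtain ⟨c, hc⟩ := sub_dvd_pow_sub_pow (1 : 𝓞 M) z a
      rw [one_pow] at hc
      rw [hc]
      exact Ideal.mul_mem_right _ _ (Ideal.subset_span (by simp))
    · exact Ideal.subset_span (by simp)
  · intro P hP h2P
    have h5 := one_sub_mem h.prim hP h2P
    have hl1 : (Ideal.span {1 - z, w}).IsMaximal :=
      (Ideal.isPrime_of_irreducible_absNorm (by rw [hnorm]; exact Nat.prime_two)).isMaximal hl0
    have hl2 : (act g (Ideal.span {1 - z, w})).IsMaximal :=
      (act_isPrime g hl1.isPrime).isMaximal (act_ne_bot g hl0)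
    have h6 : Ideal.span {1 - z, w} * act g (Ideal.span {1 - z, w}) ≤ P := by
      rw [hmul, Ideal.span_singleton_le_iff_mem]; exact h5
    rcases hP.mul_le.1 h6 with h7 | h7
    · left; exact (hl1.eq_of_le hP.ne_top h7).symm
    · right; exact (hl2.eq_of_le hP.ne_top h7).symm

theorem IsL.gal (h : IsL p m M z s) : IsGalois ℚ M := by
  have hzM : IsPrimitiveRoot (z : M) (2 ^ (m + 2)) :=
    h.prim.map_of_injective (f := algebraMap (𝓞 M) M) RingOfIntegers.coe_injective
  let P : Polynomial ℚ := (Polynomial.X ^ 2 ^ (m + 2) - Polynomial.C 1) * (Polynomial.X ^ 2 - Polynomial.C (p : ℚ))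
  have hP0 : P ≠ 0 := mul_ne_zero (Polynomial.X_pow_sub_C_ne_zero (by positivity) 1)
    (Polynomial.X_pow_sub_C_ne_zero (by positivity) _)
  have hsp : P.IsSplittingField ℚ M := by
    rw [isSplittingField_iff_intermediateField]
    constructor
    · rw [Polynomial.map_mul]
      apply Polynomial.Splits.mul
      · rw [Polynomial.map_sub, Polynomial.map_pow, Polynomial.map_X, Polynomial.map_C, map_one,
          Polynomial.C_1]
        exact Polynomial.X_pow_sub_one_splits hzM
      · rw [Polynomial.map_sub, Polynomial.map_pow, Polynomial.map_X, Polynomial.map_C, map_natCast,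
          ← h.sqM, Polynomial.C_pow, sq_sub_sq]
        exact ((Polynomial.Splits.X_add_C _)).mul (Polynomial.Splits.X_sub_C _)
    · rw [← top_le_iff, ← h.top]
      apply adjoin.mono
      intro x hx
      rw [Polynomial.mem_rootSet]
      refine ⟨hP0, ?_⟩
      rcases hx with rfl | rfl
      · simp [P, hzM.pow_eq_one]
      · simp [P, h.sqM]
  have := Normal.of_isSplittingField (F := ℚ) (E := M) P
  exact IsGalois.mk

/-- automorphisms -/
theorem IsL.exists_aut (h : IsL p m M z s) (hp : p.Prime) (hp2 : p ≠ 2) (a : ℕ) (ha : Odd a) :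
    ∃ g : M ≃+* M, oi g z = z ^ a ∧ oi g s = s := by
  have := h.gal
  have hzM : IsPrimitiveRoot (z : M) (2 ^ (m + 2)) :=
    h.prim.map_of_injective (f := algebraMap (𝓞 M) M) RingOfIntegers.coe_injective
  have hcop : Nat.Coprime a (2 ^ (m + 2)) := Nat.Coprime.pow_right _ (Nat.coprime_two_right.2 ha)
  have h1 : Polynomial.aeval ((z : M) ^ a) (minpoly ℚ (z : M)) = 0 := by
    rw [← Polynomial.cyclotomic_eq_minpoly_rat hzM (by positivity),
      Polynomial.cyclotomic_eq_minpoly_rat (hzM.pow_of_coprime a hcop) (by positivity)]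
    exact minpoly.aeval _ _
  obtain ⟨f, hf⟩ := minpoly.exists_algEquiv_of_root (Algebra.IsAlgebraic.isAlgebraic (z : M)) h1
  obtain ⟨f, hf⟩ : ∃ f' : Gal(M/ℚ), f' (z : M) = (z : M) ^ a :=
    ⟨f.symm, f.symm_apply_eq.2 hf.symm⟩
  have hfz : oi f.toRingEquiv z = z ^ a := by
    apply RingOfIntegers.coe_injective
    rw [map_pow]; exact hf
  have hfs : oi f.toRingEquiv s = s ∨ oi f.toRingEquiv s = -s := by
    apply sq_eq_sq_iff_eq_or_eq_neg.1
    rw [← map_pow, h.sq, map_natCast]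
  rcases hfs with hfs | hfs
  · exact ⟨_, hfz, hfs⟩
  · obtain ⟨F, z', g, -, -, Q, hgz, hgs⟩ := h.quadF hp hp2
    refine ⟨f.toRingEquiv.trans g, ?_, ?_⟩
    · change oi g (oi f.toRingEquiv z) = _
      rw [hfz, map_pow, hgz]
    · change oi g (oi f.toRingEquiv s) = _
      rw [hfs, map_neg, hgs, neg_neg]
end ell

theorem l_sq_odd {p m : ℕ} [Fact p.Prime] (hy : Hyp p) {M : Type} [Field M] [NumberField M] {z s : 𝓞 M}
    (h : IsL p (m + 1) M z s) {l : Ideal (𝓞 M)} (hl0 : l ≠ ⊥)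
    (hl : ∀ f : M ≃+* M, oi f s = s → act f l = l) : OddOrd (cl l ^ 2) := by
  obtain ⟨K, t, s', g, hK, -, -, Q, -, hgs⟩ := h.real Fact.out hy.ne2
  have := Q.cl_mul_act (clLp_odd hy hK) (cl l)
  rwa [clAct_cl g hl0, hl g hgs, ← pow_two] at this

set_option linter.unusedSectionVars false

theorem QuadExt.inv_ind {K M : Type*} [Field K] [NumberField K] [Field M] [NumberField M] [Algebra K M]
    {g : M ≃+* M} (Q : QuadExt K M g) (hK : Odd (Nat.card (ClassGroup (𝓞 K))))
    (S : Submonoid (ClassGroup (𝓞 M))) (hodd : ∀ c, OddOrd c → c ∈ S)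
    (hS : ∀ P : Ideal (𝓞 M), P.IsPrime → P ≠ ⊥ → act g P = P → cl P ∈ S) (n : ℕ) :
    ∀ I : Ideal (𝓞 M), I ≠ ⊥ → Ideal.absNorm I ≤ n → act g I = I → cl I ∈ S := by
  induction n with
  | zero =>
    intro I hI hn
    exact absurd (Ideal.absNorm_eq_zero_iff.1 (Nat.le_zero.1 hn)) hI
  | succ n ih =>
    intro I hI hn hg
    by_cases hIt : I = ⊤
    · rw [hIt, cl_top]; exact S.one_mem
    suffices h : ∃ A : Ideal (𝓞 M), A ≠ ⊥ ∧ A ≠ ⊤ ∧ A ∣ I ∧ act g A = A ∧ cl A ∈ S by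
      obtain ⟨A, hA, hat, ⟨J, hJ⟩, hag, hap⟩ := h
      have hJ0 : J ≠ ⊥ := fun h => hI (by rw [hJ, h]; simp)
      have hJg : act g J = J := by
        have h1 : A * act g J = A * J := by
          rw [← hJ, ← hg, hJ, act_mul, hag]
        exact mul_left_cancel₀ hA h1
      have hJn : Ideal.absNorm J ≤ n := by
        rw [hJ, map_mul] at hn
        have h1 : Ideal.absNorm A ≠ 0 := by rwa [Ne, Ideal.absNorm_eq_zero_iff]
        have h2 : Ideal.absNorm A ≠ 1 := by rwa [Ne, Ideal.absNorm_eq_one_iff]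
        have h3 : Ideal.absNorm J ≠ 0 := by rwa [Ne, Ideal.absNorm_eq_zero_iff]
        have : 2 * Ideal.absNorm J ≤ Ideal.absNorm A * Ideal.absNorm J :=
          Nat.mul_le_mul_right _ (by omega)
        omega
      rw [hJ, cl_mul hA hJ0]
      exact S.mul_mem hap (ih J hJ0 hJn hJg)
    obtain ⟨P, hPm, hIP⟩ := Ideal.exists_le_maximal I hIt
    have hP := hPm.isPrime
    have hP0 : P ≠ ⊥ := fun h => hI (le_bot_iff.1 (h ▸ hIP))
    have hPd : P ∣ I := Ideal.dvd_iff_le.2 hIP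
    by_cases hgP : act g P = P
    · exact ⟨P, hP0, hP.ne_top, hPd, hgP, hS P hP hP0 hgP⟩
    · refine ⟨P * act g P, mul_ne_zero hP0 (act_ne_bot g hP0),
        fun h => hP.ne_top (top_le_iff.1 (h ▸ Ideal.mul_le_left)), ?_, ?_, ?_⟩
      · obtain ⟨J, hJ⟩ := hPd
        have h2 : act g P ∣ I := by rw [← hg, hJ, act_mul]; exact Dvd.intro _ rfl
        have hpr := Ideal.prime_of_isPrime (act_ne_bot g hP0) (act_isPrime g hP)
        rw [hJ] at h2 ⊢
        rcases hpr.dvd_or_dvd h2 with h3 | h3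
        · exfalso
          have h4 := Ideal.dvd_iff_le.1 h3
          exact hgP (hPm.eq_of_le (act_isPrime g hP).ne_top h4).symm
        · exact mul_dvd_mul_left _ h3
      · rw [act_mul, Q.act_inv, mul_comm]
      · apply hodd
        rw [cl_mul hP0 (act_ne_bot g hP0), ← clAct_cl g hP0]
        exact Q.cl_mul_act hK _

section units
variable {p m : ℕ} {M : Type*} [Field M] [NumberField M] {z s : 𝓞 M}

theorem IsL.conj (h : IsL p m M z s) {j : M ≃+* M} (hj : z * oi j z = 1) (hjs : oi j s = s)
    (φ : M →+* ℂ) (x : M) : φ (j x) = (starRingEnd ℂ) (φ x) := by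
  have h1 : φ (z : M) ^ 2 ^ (m + 2) = 1 := by
    have := congrArg φ (congrArg (algebraMap (𝓞 M) M) h.prim.pow_eq_one)
    rw [map_pow, map_pow, map_one, map_one] at this
    exact this
  have hn : ‖φ (z : M)‖ = 1 := Complex.norm_eq_one_of_pow_eq_one h1 (by positivity)
  have hz0 : φ (z : M) ≠ 0 := by intro h0; rw [h0, norm_zero] at hn; exact zero_ne_one hn
  have hz : (z : M) * j (z : M) = 1 := by
    have := congrArg (algebraMap (𝓞 M) M) hj
    rw [map_mul, map_one] at this
    exact this
  have hs : j (s : M) = s := congrArg (algebraMap (𝓞 M) M) hjs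
  have := h.ext (φ.comp (j : M →+* M)) ((starRingEnd ℂ).comp φ) (by
    change φ (j z) = (starRingEnd ℂ) (φ z)
    apply mul_left_cancel₀ hz0
    rw [← map_mul, hz, map_one, Complex.mul_conj, Complex.normSq_eq_norm_sq, hn]; simp) (by
    change φ (j s) = (starRingEnd ℂ) (φ s)
    rw [hs]
    symm
    rw [Complex.conj_eq_iff_im]
    have h2 : φ (s : M) ^ 2 = (p : ℂ) := by rw [← map_pow, h.sqM, map_natCast]
    have h3 := congrArg Complex.re h2
    have h4 := congrArg Complex.im h2
    simp only [pow_two, Complex.mul_re, Complex.mul_im, Complex.natCast_re, Complex.natCast_im] at h3 h4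
    have h5 : (φ (s : M)).re * (φ (s : M)).im = 0 := by linarith
    rcases mul_eq_zero.1 h5 with h6 | h6
    · rw [h6] at h3
      have := Nat.cast_nonneg (α := ℝ) p
      nlinarith [sq_nonneg (φ (s : M)).im]
    · exact h6) x
  exact this

/-- `2`-power roots of unity -/
theorem IsL.root (h : IsL p m M z s) (hp : p.Prime) (hp2 : p ≠ 2) {η : 𝓞 M} {b : ℕ}
    (hη : η ^ 2 ^ b = 1) : ∃ a : ℕ, η = z ^ a := by
  obtain ⟨c, -, hc⟩ := (Nat.dvd_prime_pow Nat.prime_two).1 (orderOf_dvd_of_pow_eq_one hη)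
  have hcm : c ≤ m + 2 := by
    by_contra hlt
    obtain ⟨d, rfl⟩ := Nat.exists_eq_add_of_le (not_le.1 hlt)
    have hprim : IsPrimitiveRoot η (2 ^ (m + 2 + 1 + d)) := by rw [← hc]; exact IsPrimitiveRoot.orderOf η
    have h8 : IsPrimitiveRoot (η ^ 2 ^ d) (2 ^ (m + 1 + 2)) := hprim.pow (by positivity) (by ring)
    obtain ⟨K, z', -, hK, -⟩ := exists_isF_sub h8
    have h1 := Module.finrank_mul_finrank ℚ K M
    rw [hK.finrank, h.finrank hp hp2] at h1
    have h2 : Module.finrank K M = 1 := by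
      have : 0 < 2 ^ (m + 1 + 1) := by positivity
      exact Nat.eq_of_mul_eq_mul_left this (by rw [h1, mul_one])
    have hs : (s : M) ∈ K := by
      rw [finrank_eq_one_iff_eq_top.1 h2]; exact mem_top
    obtain ⟨s', hs'⟩ := exists_int K s hs
    apply sqrt_not_F hK hp hp2 s'
    apply FaithfulSMul.algebraMap_injective (𝓞 K) (𝓞 M)
    rw [map_pow, hs', h.sq, map_natCast]
  have h1 : η ^ 2 ^ (m + 2) = 1 := by
    apply orderOf_dvd_iff_pow_eq_one.1
    rw [hc]; exact Nat.pow_dvd_pow 2 hcm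
  obtain ⟨i, -, hi⟩ := h.prim.eq_pow_of_pow_eq_one h1
  exact ⟨i, hi.symm⟩

theorem IsL.kron (h : IsL p m M z s) (hp : p.Prime) (hp2 : p ≠ 2) {j : M ≃+* M}
    (hj : z * oi j z = 1) (hjs : oi j s = s) (hj2 : ∀ x, oi j (oi j x) = x) (ε : (𝓞 M)ˣ) :
    ∃ k a : ℕ, Odd k ∧ (ε : 𝓞 M) ^ k = z ^ a * oi j (ε : 𝓞 M) ^ k := by
  obtain ⟨ε', hε'⟩ : ∃ x : 𝓞 M, oi j (ε : 𝓞 M) * x = 1 := by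
    refine ⟨oi j ((ε⁻¹ : (𝓞 M)ˣ) : 𝓞 M), ?_⟩
    rw [← map_mul, Units.mul_inv, map_one]
  obtain ⟨n, hn, hx⟩ := Embeddings.pow_eq_one_of_norm_eq_one M ℂ (x := ((ε * ε' : 𝓞 M) : M))
    (RingOfIntegers.isIntegral_coe _) (by
      intro φ
      have h1 : φ ((ε * ε' : 𝓞 M) : M) * (starRingEnd ℂ) (φ (ε : 𝓞 M)) = φ (ε : 𝓞 M) := by
        rw [← h.conj hj hjs, ← map_mul]
        congr 1
        change algebraMap (𝓞 M) M (ε * ε' * oi j (ε : 𝓞 M)) = algebraMap (𝓞 M) M ε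
        congr 1
        linear_combination (ε : 𝓞 M) * hε'
      have h2 := congrArg norm h1
      rw [norm_mul, RCLike.norm_conj] at h2
      have h3 : ‖φ (ε : 𝓞 M)‖ ≠ 0 := by
        rw [norm_ne_zero_iff]
        intro h0
        exact ε.ne_zero (RingOfIntegers.coe_injective ((map_eq_zero φ).1 h0))
      exact mul_right_cancel₀ h3 (h2.trans (one_mul _).symm))
  have hx' : (ε * ε' : 𝓞 M) ^ n = 1 := by
    apply RingOfIntegers.coe_injective
    rw [map_pow, map_one]; exact hx
  obtain ⟨b, k, hk, rfl⟩ := Nat.exists_eq_two_pow_mul_odd hn.ne'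
  obtain ⟨a, ha⟩ := h.root hp hp2 (η := (ε * ε') ^ k) (b := b) (by rw [← pow_mul, mul_comm k, hx'])
  refine ⟨k, a, hk, ?_⟩
  rw [← ha, ← mul_pow]
  congr 1
  linear_combination -(ε : 𝓞 M) * hε'

/-- the unit lemma -/
theorem IsL.unit_even (h : IsL p m M z s) (hp : p.Prime) (hp2 : p ≠ 2) (hp4 : p % 4 = 1)
    {K : IntermediateField ℚ M} {s' : 𝓞 K} (hs' : algebraMap (𝓞 K) (𝓞 M) s' = s) {j : M ≃+* M}
    (Q : QuadExt K M j)
    (hj : z * oi j z = 1) {ε : 𝓞 M} (hε : IsUnit ε) {a : ℕ}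
    (ha : ε = z ^ a * oi j ε) : Even a := by
  by_contra hodd
  obtain ⟨c, hc⟩ : ∃ c, a + 1 = 2 * c := by
    obtain ⟨r, hr⟩ := Nat.not_even_iff_odd.1 hodd
    exact ⟨r + 1, by omega⟩
  have hzb : z ^ (a + 1 + 2 * (2 ^ m + c * (2 ^ (m + 1) - 1))) = -1 := by
    have h1 : a + 1 + 2 * (2 ^ m + c * (2 ^ (m + 1) - 1)) = 2 ^ (m + 1) + 2 ^ (m + 2) * c := by
      have := Nat.one_le_two_pow (n := m + 1)
      zify [this]
      have hc' : (a : ℤ) + 1 = 2 * c := by exact_mod_cast hc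
      rw [hc']; ring
    rw [h1, pow_add, pow_mul, h.prim.pow_eq_one, one_pow, mul_one, prim_neg_one h.prim]
  obtain ⟨b, hb⟩ : ∃ b, b = 2 ^ m + c * (2 ^ (m + 1) - 1) := ⟨_, rfl⟩
  rw [← hb] at hzb
  obtain ⟨y, hy⟩ : ∃ y, y = oi j z := ⟨_, rfl⟩
  have hf : oi j (ε * (1 - z) * z ^ b) = ε * (1 - z) * z ^ b := by
    rw [map_mul, map_mul, map_sub, map_one, map_pow, ← hy]
    rw [← hy] at hj
    have hyb : z ^ b * y ^ b = 1 := by rw [← mul_pow, hj, one_pow]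
    have h2 : z ^ (a + 1 + 2 * b) = z ^ a * z * (z ^ b * z ^ b) := by ring
    rw [h2] at hzb
    have hu : IsUnit (z ^ a * z * z ^ b) := ((h.unit.pow a).mul h.unit).mul (h.unit.pow b)
    apply hu.mul_left_cancel
    calc z ^ a * z * z ^ b * (oi j ε * (1 - y) * y ^ b)
        = (z ^ a * oi j ε) * (z - z * y) * (z ^ b * y ^ b) := by ring
      _ = ε * (z - 1) := by rw [← ha, hj, hyb, mul_one]
      _ = (z ^ a * z * (z ^ b * z ^ b)) * (ε * (1 - z)) := by rw [hzb]; ring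
      _ = _ := by ring
  obtain ⟨f, hf'⟩ := Q.fix_int hf
  have hass : Associated (1 - z) (algebraMap (𝓞 K) (𝓞 M) f) := by
    rw [hf']
    obtain ⟨ε', rfl⟩ := hε
    obtain ⟨z', hz'⟩ := h.unit
    exact ⟨ε' * z' ^ b, by rw [Units.val_mul, Units.val_pow_eq_pow_val, hz']; ring⟩
  have hn : (Ideal.span {f}).absNorm = 2 := by
    have h1 := Q.absNorm_exi' (Ideal.span {f})
    rw [exi_span, ← absNorm_assoc hass, h.absNorm hp hp2] at h1
    nlinarith
  have hsK : s' ^ 2 = p := by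
    apply FaithfulSMul.algebraMap_injective (𝓞 K) (𝓞 M)
    rw [map_pow, hs', h.sq, map_natCast]
  obtain ⟨w, hw1, hw2⟩ := exists_half hp4 hsK
  have hww : 2 * algebraMap (𝓞 K) (𝓞 M) w = 1 + s := by
    have := congrArg (algebraMap (𝓞 K) (𝓞 M)) hw1
    rwa [map_mul, map_add, map_one, hs', map_ofNat] at this
  obtain ⟨F, z', g, -, -, -, hgz, hgs⟩ := h.quadF hp hp2
  have hgw := oi_half' hww hgs
  have hnu : ¬ IsUnit (1 - z) := by
    intro hu
    have h1 := h.absNorm hp hp2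
    rw [Ideal.span_singleton_eq_top.2 hu, Ideal.absNorm_top] at h1
    omega
  have hcon : ¬ ((1 - z) ∣ algebraMap (𝓞 K) (𝓞 M) w ∨ (1 - z) ∣ 1 - algebraMap (𝓞 K) (𝓞 M) w) := by
    rintro (h1 | h1)
    · have h2 := map_dvd (oi g) h1
      rw [map_sub, map_one, hgz, hgw] at h2
      exact hnu (isUnit_of_dvd_one (by simpa using dvd_add h1 h2))
    · have h2 := map_dvd (oi g) h1
      rw [map_sub, map_sub, map_one, hgz, hgw] at h2
      exact hnu (isUnit_of_dvd_one (by simpa using dvd_add h1 h2))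
  apply hcon
  have hprime : (Ideal.span {f}).IsPrime := Ideal.isPrime_of_irreducible_absNorm (by rw [hn]; exact Nat.prime_two)
  have h2 : (2 : 𝓞 K) ∈ Ideal.span {f} := by
    have := Ideal.absNorm_mem (Ideal.span {f})
    rw [hn] at this; exact_mod_cast this
  have hf0 : Ideal.span {f} ≠ (⊥ : Ideal (𝓞 K)) := ne_bot_of_absNorm hn two_ne_zero
  obtain ⟨k, _, _, φ, e, hsur, hker, hcard, -, -, hch⟩ := res_field Nat.prime_two hprime hf0 (by exact_mod_cast h2)
  rw [hn] at hcard
  have h5 : φ w * (1 - φ w) = 0 := by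
    have h6 := FiniteField.pow_card (φ w)
    rw [hcard] at h6
    linear_combination -h6
  rcases mul_eq_zero.1 h5 with h6 | h6
  · left
    have h7 := (hker w).1 h6
    rw [Ideal.mem_span_singleton] at h7
    exact hass.dvd.trans (map_dvd _ h7)
  · right
    have h7 := (hker (1 - w)).1 (by rw [map_sub, map_one, h6])
    rw [Ideal.mem_span_singleton] at h7
    have h8 := map_dvd (algebraMap (𝓞 K) (𝓞 M)) h7
    rw [map_sub, map_one] at h8
    exact hass.dvd.trans h8
end units

set_option linter.unusedSectionVars false

section
variable {p m : ℕ} [hpf : Fact p.Prime]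

theorem inv_class {M : Type} [Field M] [NumberField M] {z s : 𝓞 M}
    (h : IsL p (m + 1) M z s) {K : Type} [Field K] [NumberField K] [Algebra K M] {j : M ≃+* M}
    (Q : QuadExt K M j) (hK : Odd (Nat.card (ClassGroup (𝓞 K)))) (hj : z * oi j z = 1)
    {l : Ideal (𝓞 M)} {g : M ≃+* M} (hl0 : l ≠ ⊥) (hl2 : OddOrd (cl l ^ 2))
    (hlg : l * act g l = Ideal.span {1 - z})
    (hall : ∀ P : Ideal (𝓞 M), P.IsPrime → 2 ∈ P → P = l ∨ P = act g l)
    {V : Ideal (𝓞 M)} (hV : V ≠ ⊥) (hVj : act j V = V) : ∃ a : ℕ, OddOrd (cl V / cl l ^ a) := by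
  let S : Submonoid (ClassGroup (𝓞 M)) :=
    { carrier := {c | ∃ a : ℕ, OddOrd (c / cl l ^ a)}
      one_mem' := ⟨0, by simpa using OddOrd.one⟩
      mul_mem' := by
        rintro x y ⟨a, ha⟩ ⟨b, hb⟩
        refine ⟨a + b, ?_⟩
        rw [pow_add, mul_div_mul_comm]
        exact ha.mul hb }
  refine Q.inv_ind hK S (fun c hc => ⟨0, by simpa using hc⟩) ?_ _ V hV le_rfl hVj
  intro P hP hP0 hPj
  by_cases hz : z - oi j z ∈ P
  · have h1 : z ^ 2 - 1 ∈ P := by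
      have := P.mul_mem_left z hz
      rwa [mul_sub, hj, ← pow_two] at this
    have h2 : (2 : 𝓞 M) ∈ P := by
      have h3 := prim_neg_one (k := m + 2) h.prim
      have h4 : (z ^ 2) ^ 2 ^ (m + 1) - 1 ∈ P := by
        obtain ⟨y, hy⟩ := sub_one_dvd_pow_sub_one (z ^ 2) (2 ^ (m + 1))
        rw [hy]; exact P.mul_mem_right _ h1
      rw [← pow_mul, ← pow_succ', h3] at h4
      have := P.neg_mem h4
      convert this using 1; ring
    rcases hall P hP h2 with rfl | rfl
    · exact ⟨1, by rw [pow_one, div_self']; exact OddOrd.one⟩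
    · refine ⟨1, ?_⟩
      have h5 : cl l * cl (act g l) = 1 := by
        rw [← cl_mul hl0 (act_ne_bot g hl0), hlg, cl_span]
      rw [eq_inv_of_mul_eq_one_right h5, pow_one]
      have := hl2.inv
      convert this using 1
      rw [pow_two, mul_inv, div_eq_mul_inv]
  · obtain ⟨a, ha, rfl⟩ := Q.prime_ext hP hP0 hPj z hz
    refine ⟨0, ?_⟩
    rw [pow_zero, div_one, ← lft_cl ha]
    exact (OddOrd.of_card hK).map _

theorem lift_inj (hy : Hyp p) {K M : Type} [Field K] [NumberField K] [Field M] [NumberField M]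
    [Algebra K M] {z' s' : 𝓞 K} {z s : 𝓞 M} (hK : IsL p (m + 1) K z' s') (hM : IsL p (m + 2) M z s)
    {τ : M ≃+* M} (Q : QuadExt K M τ) (hz : algebraMap (𝓞 K) (𝓞 M) z' = z ^ 2)
    (hs : algebraMap (𝓞 K) (𝓞 M) s' = s) (hτ : oi τ z = -z)
    {l : Ideal (𝓞 K)} {g : K ≃+* K} (hl0 : l ≠ ⊥) (hl2 : OddOrd (cl l ^ 2))
    (hlg : l * act g l = Ideal.span {1 - z'})
    (hall : ∀ P : Ideal (𝓞 K), P.IsPrime → 2 ∈ P → P = l ∨ P = act g l)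
    (c : ClassGroup (𝓞 K)) (hc : c ^ 2 = 1) (hcM : lft M c = 1) : ∃ a : ℕ, OddOrd (c / cl l ^ a) := by
  have hp := hpf.out
  have hp2 := hy.ne2
  have hp4 := hy.four
  have hinj := FaithfulSMul.algebraMap_injective (𝓞 K) (𝓞 M)
  obtain ⟨K1, t1, s1, j1, hLp1, -, hs1, Q1, hj1, hjs1⟩ := hK.real hp hp2
  obtain ⟨M1, t2, s2, j, hLp2, -, hs2, Q2, hj, hjs⟩ := hM.real hp hp2
  have hodd := clLp_odd hy hLp1
  have hjz : algebraMap (𝓞 K) (𝓞 M) (oi j1 z') = oi j (z ^ 2) := by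
    apply mul_left_cancel₀ (pow_ne_zero 2 hM.unit.ne_zero)
    rw [map_pow, ← mul_pow, hj, ← hz, ← map_mul, hj1, map_one, one_pow]
  have compat : ∀ y : 𝓞 K, algebraMap (𝓞 K) (𝓞 M) (oi j1 y) = oi j (algebraMap (𝓞 K) (𝓞 M) y) := by
    intro y
    apply RingOfIntegers.coe_injective
    refine hK.ext ((algebraMap K M).comp (j1 : K →+* K)) ((j : M →+* M).comp (algebraMap K M)) ?_ ?_ y
    · have := congrArg (algebraMap (𝓞 M) M) hjz
      rw [← hz] at this
      exact this
    · have : algebraMap (𝓞 K) (𝓞 M) (oi j1 s') = oi j (algebraMap (𝓞 K) (𝓞 M) s') := by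
        rw [hjs1, hs, hjs]
      exact congrArg (algebraMap (𝓞 M) M) this
  obtain ⟨I, a, b, η, hI, hIc, ha, hb, h1, h2⟩ := Q1.two_tors hodd c hc
  have hactI : exi M (act j1 I) = act j (exi M I) := by
    change Ideal.map (algebraMap (𝓞 K) (𝓞 M)) (Ideal.map (oi j1 : 𝓞 K →+* 𝓞 K) I) =
      Ideal.map (oi j : 𝓞 M →+* 𝓞 M) (Ideal.map (algebraMap (𝓞 K) (𝓞 M)) I)
    rw [Ideal.map_map, Ideal.map_map]
    congr 1
    ext1 y
    exact compat y
  rw [← hIc, lft_cl hI, cl_eq_one_iff (exi_ne_bot hI)] at hcM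
  obtain ⟨x, hx0, hx⟩ := hcM
  set A := algebraMap (𝓞 K) (𝓞 M) a with hA
  set B := algebraMap (𝓞 K) (𝓞 M) b with hB
  have hA0 : A ≠ 0 := fun h0 => ha (hinj (by rw [← hA, h0, map_zero]))
  have hB0 : B ≠ 0 := fun h0 => hb (hinj (by rw [← hB, h0, map_zero]))
  have h3 := congrArg (exi M) h1
  rw [exi_mul, exi_mul, exi_span, exi_span, hactI, hx, act_span, ← hA, ← hB,
    Ideal.span_singleton_mul_span_singleton, Ideal.span_singleton_mul_span_singleton,
    Ideal.span_singleton_eq_span_singleton] at h3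
  obtain ⟨ε, hε⟩ := h3.symm
  have hjx0 : oi j x ≠ 0 := by simpa using hx0
  have h4 : A * oi j A = algebraMap (𝓞 K) (𝓞 M) η * (B * oi j B) := by
    rw [hA, hB, ← compat, ← compat, ← map_mul, ← map_mul, ← map_mul, h2]
  have hjB0 : oi j B ≠ 0 := by simpa using hB0
  have h5 : algebraMap (𝓞 K) (𝓞 M) η = (ε : 𝓞 M) * oi j (ε : 𝓞 M) := by
    have h6 := congrArg (oi j) hε
    rw [map_mul, map_mul, map_mul, Q2.inv_int] at h6
    apply mul_right_cancel₀ (mul_ne_zero (mul_ne_zero hB0 hjB0) (mul_ne_zero hx0 hjx0))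
    linear_combination (-(x * oi j x)) * h4 - (B * oi j x * ε) * h6 - (oi j A * oi j x) * hε
  obtain ⟨k, a', hk, hka⟩ := hM.kron hp hp2 hj hjs Q2.inv_int ε
  obtain ⟨r, rfl⟩ := hM.unit_even hp hp2 hp4 hs2 Q2 hj (ε.isUnit.pow k) (a := a') (by
    rw [map_pow]; exact hka)
  set e : 𝓞 M := (ε : 𝓞 M) ^ k * oi j z ^ r with he
  have hzr : z ^ r * oi j z ^ r = 1 := by rw [← mul_pow, hj, one_pow]
  have hje : oi j e = e := by
    rw [he, map_mul, map_pow, map_pow, Q2.inv_int]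
    rw [pow_add] at hka
    linear_combination (-(oi j z ^ r)) * hka - z ^ r * oi j (ε : 𝓞 M) ^ k * hzr
  have hη : algebraMap (𝓞 K) (𝓞 M) η ^ k = e * e := by
    nth_rw 2 [← hje]
    rw [h5, he, map_mul, map_pow, map_pow, Q2.inv_int]
    linear_combination (-(ε : 𝓞 M) ^ k * oi j (ε : 𝓞 M) ^ k) * hzr
  have heu : IsUnit e := (ε.isUnit.pow k).mul ((hM.unit.map (oi j)).pow r)
  have hτe : oi τ e = e ∨ oi τ e = -e := by
    have h7 := congrArg (oi τ) hη
    rw [map_pow, Q.alg_int, hη, map_mul] at h7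
    exact mul_self_eq_mul_self_iff.1 h7.symm
  have unit_desc : ∀ y : 𝓞 K, IsUnit (algebraMap (𝓞 K) (𝓞 M) y) → IsUnit y := by
    intro y hyu
    rw [← Ideal.span_singleton_eq_top, ← Ideal.absNorm_eq_one_iff] at hyu ⊢
    rw [← exi_span, Q.absNorm_exi'] at hyu
    simpa using hyu
  rcases hτe with hτe | hτe
  · obtain ⟨e', he'⟩ := Q.fix_int hτe
    have hue : IsUnit e' := unit_desc e' (by rw [he']; exact heu)
    obtain ⟨e1, rfl⟩ := hue
    have hj1e : oi j1 (e1 : 𝓞 K) = e1 := hinj (by rw [compat, he', hje])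
    obtain ⟨V, hV0, hV, hVc⟩ := Q1.two_tors_same (I := I ^ k) (I' := ⊤) (a := a ^ k) (b := b ^ k) (a' := 1)
      (b' := 1) (η := η ^ k) (η' := 1) (e := e1) (pow_ne_zero k hI) top_ne_bot (pow_ne_zero k hb) one_ne_zero
      (by rw [← Ideal.span_singleton_pow, ← Ideal.span_singleton_pow, act_pow, ← mul_pow, ← mul_pow, h1])
      (by rw [map_pow, map_pow, ← mul_pow, ← mul_pow, h2, Units.val_pow_eq_pow_val, mul_pow])
      (by rw [act_top]) (by simp)
      (by
        rw [hj1e, Units.val_one, one_mul, Units.val_pow_eq_pow_val]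
        apply hinj
        rw [map_pow, hη, map_mul, he'])
      (by simp)
    rw [cl_top, mul_one, cl_pow hI, hIc] at hVc
    obtain ⟨a0, ha0⟩ := inv_class hK Q1 hodd hj1 hl0 hl2 hlg hall hV0 hV
    refine ⟨a0, ?_⟩
    have hck : c ^ k = c := by
      obtain ⟨k', rfl⟩ := hk
      rw [pow_succ, pow_mul, hc, one_pow, one_mul]
    rwa [hVc, hck] at ha0
  · exfalso
    obtain ⟨κ, hκ⟩ := Q.fix_int (x := e * z) (by rw [map_mul, hτe, hτ]; ring)
    have hku : IsUnit κ := unit_desc κ (by rw [hκ]; exact heu.mul hM.unit)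
    have := hK.unit_even hp hp2 hp4 hs1 Q1 hj1 hku (a := 1) (by
      apply hinj
      rw [map_mul, map_pow, compat, hκ, hz, map_mul, hje]
      linear_combination (-(e * z)) * hj)
    exact absurd this (by decide)
end

set_option linter.unusedSectionVars false

theorem exp2_of_even {D : Type*} [CommGroup D] (hD : ∀ d : D, d ^ 2 = 1) {k : ℕ} (hk : Even k) (d : D) :
    d ^ k = 1 := by
  obtain ⟨r, rfl⟩ := hk
  rw [← two_mul, pow_mul, hD, one_pow]

theorem OddOrd.pow_even {C : Type*} [CommGroup C] {l : C} (hl : OddOrd (l ^ 2)) {k : ℕ} (hk : Even k) :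
    OddOrd (l ^ k) := by
  obtain ⟨r, rfl⟩ := hk
  rw [← two_mul, pow_mul]; exact hl.pow r

theorem inj_grp {C C' D : Type*} [CommGroup C] [Finite C] [CommGroup C'] [CommGroup D] (f : C →* C')
    (χa χb : C →* D) (hD : ∀ d : D, d ^ 2 = 1) {l c : C} (hl2 : OddOrd (l ^ 2)) (hal : χa l ≠ 1)
    (hbl : χb l = 1) (hbc : χb c ≠ 1)
    (H : ∀ x, x ^ 2 = 1 → f x = 1 → ∃ a : ℕ, OddOrd (x / l ^ a)) (e : ℕ)
    (h : OddOrd (f (c ^ 2 ^ e))) : OddOrd (c ^ 2 ^ e) := by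
  classical
  by_contra hn
  obtain ⟨k, hk, hk1⟩ := h
  have hn' : ¬ OddOrd ((c ^ 2 ^ e) ^ k) := fun h' => hn (h'.of_pow hk)
  have hN := oddOrd_exists_pow ((c ^ 2 ^ e) ^ k)
  obtain ⟨N, hN1, hN2⟩ : ∃ N, ¬ OddOrd (((c ^ 2 ^ e) ^ k) ^ 2 ^ N) ∧ OddOrd (((c ^ 2 ^ e) ^ k) ^ 2 ^ (N + 1)) := by
    have h1 := Nat.find_spec hN
    rcases h2 : Nat.find hN with _ | N
    · rw [h2, pow_zero, pow_one] at h1; exact absurd h1 hn'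
    · exact ⟨N, Nat.find_min hN (by omega), h2 ▸ h1⟩
  obtain ⟨k', hk', hk1'⟩ := hN2
  set w := ((c ^ 2 ^ e) ^ k) ^ 2 ^ N with hw
  have hx2 : (w ^ k') ^ 2 = 1 := by
    rw [← hk1', hw]; simp only [← pow_mul]; congr 1; ring
  have hfx : f (w ^ k') = 1 := by
    rw [hw, map_pow, map_pow, map_pow, hk1, one_pow, one_pow]
  obtain ⟨a, ha⟩ := H _ hx2 hfx
  have hxn : w ^ k' = c ^ (2 ^ e * k * 2 ^ N * k') := by rw [hw]; simp only [← pow_mul]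
  have h3 := ha.char hD χb
  rw [map_div, map_pow χb l, hbl, one_pow, div_one, hxn, map_pow] at h3
  have h4 := exp2_even hD hbc h3
  have h5 := ha.char hD χa
  rw [map_div, hxn, map_pow, exp2_of_even hD h4, one_div, inv_eq_one, map_pow] at h5
  have h6 := exp2_even hD hal h5
  have h7 : OddOrd (w ^ k') := ha.of_div (hl2.pow_even h6)
  exact hN1 (h7.of_pow hk')

section
variable {p m : ℕ} [hpf : Fact p.Prime]

theorem S1 (hy : Hyp p) {K M : Type} [Field K] [NumberField K] [Field M] [NumberField M]
    [Algebra K M] {z' s' : 𝓞 K} {z s : 𝓞 M} (hK : IsL p (m + 1) K z' s') (hM : IsL p (m + 2) M z s)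
    {τ : M ≃+* M} (Q : QuadExt K M τ) (hz : algebraMap (𝓞 K) (𝓞 M) z' = z ^ 2)
    (hs : algebraMap (𝓞 K) (𝓞 M) s' = s) (hτ : oi τ z = -z) (hτs : oi τ s = s)
    {J : Ideal (𝓞 M)} {q : ℕ} (hq : q.Prime) (hq8 : q % 8 = 7) (hqp : ¬ IsSquare (q : ZMod p))
    (hJ : J.absNorm = q ^ 2) (e : ℕ) :
    OddOrd (cl J ^ 2 ^ (e + 1)) ↔ OddOrd (cl (nm K J) ^ 2 ^ e) := by
  have hp := hpf.out
  have hp2 := hy.ne2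
  have hp8 : p % 8 = 1 := by have := hy.mod; omega
  have hJ0 : J ≠ ⊥ := ne_bot_of_absNorm hJ (pow_ne_zero 2 hq.ne_zero)
  -- the relation `lft c_K ~ c^(2*odd)`
  have key : ∃ o : ℕ, Odd o ∧ OddOrd (lft M (cl (nm K J)) / cl J ^ (2 * o)) := by
    obtain ⟨l, g, hl, -, -, -, hlf, -, -⟩ := exists_l hp hp8 hM
    have hl0 : l ≠ ⊥ := ne_bot_of_absNorm hl two_ne_zero
    have hl2 : OddOrd (cl l ^ 2) := l_sq_odd hy hM hl0 hlf
    obtain ⟨χa, ha1, ha2⟩ := char_a hy hM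
    obtain ⟨χb, hb1, hb2⟩ := char_b hy hM
    obtain ⟨τ0, hτ0, hsτ⟩ := hM.exists_aut hp hp2 (1 + 2 ^ (m + 2)) (by
      rw [pow_succ]; exact ⟨2 ^ (m + 1), by ring⟩)
    obtain ⟨a, b, hab⟩ := gen2 (c2_L hy hM) χa Dp_sq χb Dp_sq (cl l) (cl J) (ha1 l hl) (hb1 l hl)
      (hb2 J q hq hq8 hqp hJ) (cl (act τ0 J))
    have hb : Odd b := by
      by_contra hb
      rw [Nat.not_odd_iff_even] at hb
      have h1 := hab.char Dp_sq χb
      rw [map_div, map_mul, map_pow, map_pow, hb1 l hl, one_pow, one_mul, exp2_of_even Dp_sq hb, div_one] at h1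
      exact hb2 (act τ0 J) q hq hq8 hqp (by rw [act_absNorm, hJ]) h1
    have h2 := hab.map (clAct τ0)
    rw [map_div, map_mul, map_pow, map_pow, clAct_cl _ hJ0, clAct_cl _ (act_ne_bot _ hJ0), clAct_cl _ hl0,
      hlf τ0 hsτ, act_act] at h2
    have hττ : act (τ0.trans τ0) J = act τ J := by
      unfold act
      congr 1
      ext x
      refine hM.ext_oi (τ0.trans τ0) τ ?_ ?_ x
      · change oi τ0 (oi τ0 z) = oi τ z
        rw [hτ0, map_pow, hτ0, hτ, ← pow_mul,
          show (1 + 2 ^ (m + 2)) * (1 + 2 ^ (m + 2)) = 1 + 2 ^ (m + 2 + 1) + 2 ^ (m + 2 + 2) * 2 ^ m by ring,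
          pow_add, pow_add, pow_mul, hM.prim.pow_eq_one, prim_neg_one hM.prim]
        simp
      · change oi τ0 (oi τ0 s) = oi τ s
        rw [hsτ, hsτ, hτs]
    rw [hττ] at h2
    obtain ⟨b', rfl⟩ := hb
    refine ⟨2 * b' ^ 2 + 2 * b' + 1, ⟨b' ^ 2 + b', by ring⟩, ?_⟩
    rw [lft_cl (nm_ne_bot hJ0), ← Q.mul_act hJ0, cl_mul hJ0 (act_ne_bot _ hJ0)]
    have h3 := h2.mul (hab.div_pow (2 * b' + 1))
    have h4 := h3.mul (hl2.pow_even (k := a * (2 * b' + 2)) ((show Even (2 * b' + 2) from ⟨b' + 1, by ring⟩).mul_left a))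
    convert h4 using 1
    rw [show 2 * (2 * b' ^ 2 + 2 * b' + 1) = 1 + (2 * b' + 1) * (2 * b' + 1) by ring,
      show a * (2 * b' + 2) = a + a * (2 * b' + 1) by ring, mul_pow, ← pow_mul, ← pow_mul, pow_add (cl J) 1, pow_add (cl l) a, pow_one]
    generalize cl l ^ (a * (2 * b' + 1)) = x1
    generalize cl l ^ a = x2
    generalize cl J ^ ((2 * b' + 1) * (2 * b' + 1)) = x3
    generalize cl (act τ0 J) ^ (2 * b' + 1) = x4
    apply Additive.ofMul.injective
    simp only [ofMul_mul, ofMul_div]; abel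
  have h1 : OddOrd (cl J ^ 2 ^ (e + 1)) ↔ OddOrd (lft M (cl (nm K J) ^ 2 ^ e)) := by
    obtain ⟨o, ho, h2⟩ := key
    have h3 := h2.div_pow (2 ^ e)
    rw [← map_pow, ← pow_mul, show 2 * o * 2 ^ e = 2 ^ (e + 1) * o by ring, pow_mul] at h3
    constructor
    · intro h; exact h3.of_div (h.pow o)
    · intro h; exact (h3.of_div' h).of_pow ho
  rw [h1]
  refine ⟨fun h => ?_, fun h => h.map _⟩
  obtain ⟨l, g, hl, -, -, hlg, hlf, -, hall⟩ := exists_l hp hp8 hK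
  have hl0 : l ≠ ⊥ := ne_bot_of_absNorm hl two_ne_zero
  have hl2 : OddOrd (cl l ^ 2) := l_sq_odd hy hK hl0 hlf
  obtain ⟨χa, ha1, ha2⟩ := char_a hy hK
  obtain ⟨χb, hb1, hb2⟩ := char_b hy hK
  exact inj_grp (lft M) χa χb Dp_sq hl2 (ha1 l hl) (hb1 l hl)
    (hb2 (nm K J) q hq hq8 hqp (by rw [nm_absNorm, hJ]))
    (fun x => lift_inj hy hK hM Q hz hs hτ hl0 hl2 hlg hall x) e h
end

set_option linter.unusedSectionVars false

section
variable {M : Type*} [Field M] [NumberField M]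

theorem clAct_trans (f g : M ≃+* M) (c : ClassGroup (𝓞 M)) :
    clAct (g.trans f) c = clAct f (clAct g c) := by
  obtain ⟨I, hI, rfl⟩ := cl_surj c
  rw [clAct_cl _ hI, clAct_cl _ hI, clAct_cl _ (act_ne_bot _ hI), act_act]

theorem neg_neg_act {f g : M ≃+* M} (hf : ∀ c : ClassGroup (𝓞 M), OddOrd (c * clAct f c))
    (hg : ∀ c : ClassGroup (𝓞 M), OddOrd (c * clAct g c)) (c : ClassGroup (𝓞 M)) :
    OddOrd (clAct (g.trans f) c / c) := by
  rw [clAct_trans]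
  have := (hf (clAct g c)).mul (hg c).inv
  convert this using 1
  apply Additive.ofMul.injective
  simp only [ofMul_mul, ofMul_inv, ofMul_div]; abel
end

section
variable {p : ℕ} [hpf : Fact p.Prime]

/-- an ideal of norm `4` that contains `2` has odd class. -/
theorem odd_of_absNorm_four {M : Type*} [Field M] [NumberField M] {z : 𝓞 M}
    {l : Ideal (𝓞 M)} {g : M ≃+* M} (hl : l.absNorm = 2) (hl2 : OddOrd (cl l ^ 2))
    (hlg : l * act g l = Ideal.span {1 - z})
    (hall : ∀ P : Ideal (𝓞 M), P.IsPrime → 2 ∈ P → P = l ∨ P = act g l)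
    {I : Ideal (𝓞 M)} (hI : I.absNorm = 4) (h2 : (2 : 𝓞 M) ∈ I) : OddOrd (cl I) := by
  have hl0 : l ≠ ⊥ := ne_bot_of_absNorm hl two_ne_zero
  have hg0 := act_ne_bot g hl0
  have h5 : cl l * cl (act g l) = 1 := by
    rw [← cl_mul hl0 (act_ne_bot g hl0), hlg, cl_span]
  have h6 : cl (act g l) = (cl l)⁻¹ := eq_inv_of_mul_eq_one_right h5
  have hne : I ≠ ⊤ := by rintro rfl; simp at hI
  obtain ⟨P, hP, hIP⟩ := Ideal.exists_le_maximal I hne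
  have hPr := hP.isPrime
  have hP2 : (2 : 𝓞 M) ∈ P := hIP h2
  have hPc := hall P hPr hP2
  have hPn : P.absNorm = 2 := by
    rcases hPc with rfl | rfl
    · exact hl
    · rw [act_absNorm, hl]
  obtain ⟨P', rfl⟩ := Ideal.dvd_iff_le.2 hIP
  rw [map_mul, hPn] at hI
  have hPn' : P'.absNorm = 2 := by omega
  have hPr' : P'.IsPrime := Ideal.isPrime_of_irreducible_absNorm (by rw [hPn']; exact Nat.prime_two)
  have hP2' : (2 : 𝓞 M) ∈ P' := by
    have := Ideal.absNorm_mem P'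
    rw [hPn'] at this; exact_mod_cast this
  have hPc' := hall P' hPr' hP2'
  rw [cl_mul (ne_bot_of_absNorm hPn two_ne_zero) (ne_bot_of_absNorm hPn' two_ne_zero)]
  rcases hPc with rfl | rfl <;> rcases hPc' with rfl | rfl
  · rw [← pow_two]; exact hl2
  · rw [h5]; exact OddOrd.one
  · rw [mul_comm, h5]; exact OddOrd.one
  · rw [h6, ← pow_two, inv_pow]; exact hl2.inv

theorem act_triv (hy : Hyp p) {M : Type} [Field M] [NumberField M] {z s : 𝓞 M} (h : IsL p 1 M z s)
    (f : M ≃+* M) (hf : oi f ((z + z ^ 3) * s) = (z + z ^ 3) * s) (c : ClassGroup (𝓞 M)) :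
    OddOrd (clAct f c / c) := by
  have hp := hpf.out
  have hp2 := hy.ne2
  have hp8 : p % 8 = 1 := by have := hy.mod; omega
  have hz4 : z ^ 4 = -1 := prim_neg_one (k := 2) h.prim
  have hz8 : z ^ 8 = 1 := h.prim.pow_eq_one
  have h2 : (2 : 𝓞 M) ≠ 0 := two_ne_zero
  have hs0 : s ≠ 0 := by
    rintro rfl
    have := h.sq
    rw [zero_pow two_ne_zero] at this
    exact hp.ne_zero (by exact_mod_cast this.symm)
  have hw0 : z + z ^ 3 ≠ 0 := by
    intro h0
    have : (z + z ^ 3) ^ 2 = -2 := by linear_combination (2 + z ^ 2) * hz4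
    rw [h0] at this
    exact h2 (by linear_combination this)
  obtain ⟨KF, zF, σ, hF, -, Qσ, hσz, hσs⟩ := h.quadF hp hp2
  have Nσ := Qσ.cl_mul_act (clF_odd 1 KF zF hF)
  obtain ⟨KR, tR, sR, j, hR, -, -, Qj, hjz, hjs⟩ := h.real hp hp2
  have Nj := Qj.cl_mul_act (clLp_odd hy hR)
  have hjz' : oi j z = -z ^ 3 := by
    apply mul_left_cancel₀ h.unit.ne_zero
    rw [hjz]; linear_combination hz4
  obtain ⟨K0, z0, s0, γ, h0, hz0, hs0', Qγ, hγz, hγs⟩ := h.sub (m := 0) hp hp2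
  have Nγ : ∀ c : ClassGroup (𝓞 M), OddOrd (c * clAct γ c) := by
    intro c
    obtain ⟨l, g, hl, -, -, hlg, hlf, -, hall⟩ := exists_l hp hp8 h
    have hl2 : OddOrd (cl l ^ 2) := l_sq_odd hy h (ne_bot_of_absNorm hl two_ne_zero) hlf
    obtain ⟨l0, -, hl0, -⟩ := exists_l hp hp8 h0
    have hl00 : l0 ≠ ⊥ := ne_bot_of_absNorm hl0 two_ne_zero
    obtain ⟨χ, hχ, -⟩ := char_a hy h0
    obtain ⟨J, hJ, rfl⟩ := cl_surj c
    rw [clAct_cl _ hJ, ← cl_mul hJ (act_ne_bot _ hJ), Qγ.mul_act hJ, ← lft_cl (nm_ne_bot hJ)]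
    obtain ⟨n, hn⟩ := gen1 (c2_L0 hy h0) χ Dp_sq (cl l0) (hχ l0 hl0) (cl (nm K0 J))
    have h7 := hn.map (lft M)
    rw [map_div, map_pow, lft_cl hl00] at h7
    refine h7.of_div (OddOrd.pow ?_ n)
    refine odd_of_absNorm_four hl hl2 hlg hall (by rw [Qγ.absNorm_exi', hl0]; rfl) ?_
    have h8 := Ideal.absNorm_mem l0
    rw [hl0] at h8
    have h9 := Ideal.mem_map_of_mem (algebraMap (𝓞 K0) (𝓞 M)) h8
    rw [map_natCast] at h9
    exact_mod_cast h9
  obtain ⟨a, ha⟩ := h.oi_pow f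
  have ha' : oi f z = z ^ (a % 8) := by
    rw [ha]; conv_lhs => rw [← Nat.div_add_mod a 8, pow_add, pow_mul, hz8, one_pow, one_mul]
  have hlt : a % 8 < 8 := Nat.mod_lt _ (by norm_num)
  generalize a % 8 = b at ha' hlt
  have hodd : Odd b := by
    by_contra hb
    rw [Nat.not_odd_iff_even] at hb
    obtain ⟨r, rfl⟩ := hb
    have h3 := congrArg (oi f) hz4
    rw [map_pow, ha', map_neg, map_one, ← pow_mul, show (r + r) * 4 = 8 * r by ring, pow_mul, hz8, one_pow] at h3
    exact h2 (by linear_combination h3)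
  have hfs : oi f s = s ∨ oi f s = -s := by
    have h3 := congrArg (oi f) h.sq
    rw [map_pow, map_natCast, ← h.sq] at h3
    exact sq_eq_sq_iff_eq_or_eq_neg.1 h3
  rw [map_mul, map_add, map_pow, ha'] at hf
  have fin : ∀ f' : M ≃+* M, oi f z = oi f' z → oi f s = oi f' s → f = f' := fun f' h1 h2 =>
    RingEquiv.ext (h.ext_oi f f' h1 h2)
  have bad : -(z + z ^ 3) * s ≠ (z + z ^ 3) * s := by
    intro hb
    have : (2 * (z + z ^ 3)) * s = 0 := by linear_combination -hb
    exact mul_ne_zero (mul_ne_zero h2 hw0) hs0 this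
  have hT : ∀ (g g' : M ≃+* M) (x : 𝓞 M), oi (g.trans g') x = oi g' (oi g x) := fun _ _ _ => rfl
  rcases hfs with hfs | hfs <;> rw [hfs] at hf <;> interval_cases b
  all_goals first
    | exact absurd hodd (by decide)
    | skip
  · have : f = RingEquiv.refl M := fin _ (by rw [ha', pow_one]; rfl) (by rw [hfs]; rfl)
    obtain ⟨I, hI, rfl⟩ := cl_surj c
    rw [clAct_cl _ hI, act_refl (by rw [this]; intro x; rfl), div_self']
    exact OddOrd.one
  · have : f = γ.trans j := fin _ (by rw [ha', hT, hγz, map_neg, hjz', neg_neg]) (by rw [hfs, hT, hγs, hjs])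
    rw [this]; exact neg_neg_act Nj Nγ c
  · exact absurd (Eq.trans (by linear_combination (-z - z ^ 11 + z ^ 7 - z ^ 3) * s * hz4) hf) bad
  · exact absurd (Eq.trans (by linear_combination (-z ^ 3 - (z ^ 17 - z ^ 13 + z ^ 9 - z ^ 5 + z)) * s * hz4) hf) bad
  · exact absurd (Eq.trans (by ring) hf) bad
  · exact absurd (Eq.trans (by linear_combination (z ^ 5 - z) * s * hz4) hf) bad
  · have : f = γ.trans σ := fin _ (by rw [ha', hT, hγz, map_neg, hσz]; linear_combination z * hz4)
      (by rw [hfs, hT, hγs, hσs])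
    rw [this]; exact neg_neg_act Nσ Nγ c
  · have : f = j.trans σ := fin _ (by
        rw [ha', hT, hjz', map_neg, map_pow, hσz]; linear_combination z ^ 3 * hz4)
      (by rw [hfs, hT, hjs, hσs])
    rw [this]; exact neg_neg_act Nσ Nj c
end

set_option linter.unusedSectionVars false

/-- the arithmetic data -/
structure UV (p u v : ℕ) : Prop where
  eq : p + 2 * v ^ 2 = u ^ 2
  u8 : u % 8 = 1

section
variable {p u v : ℕ}

theorem UV.even (h : UV p u v) (hp : p % 16 = 9) : ∃ v', v = 2 * v' ∧ Odd v' := by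
  have h1 : u ^ 2 % 16 = 1 := by
    obtain ⟨k, hk⟩ : ∃ k, u = 8 * k + 1 := ⟨u / 8, by have := h.u8; omega⟩
    rw [hk, show (8 * k + 1) ^ 2 = 16 * (4 * k ^ 2 + k) + 1 by ring]
    omega
  have h2 := h.eq
  have h3 : v ^ 2 % 8 = 4 := by omega
  rcases Nat.even_or_odd' v with ⟨v', hv | hv⟩
  · refine ⟨v', hv, ?_⟩
    by_contra h4
    rw [Nat.not_odd_iff_even] at h4
    obtain ⟨r, hr⟩ := h4
    rw [hv, hr, show (2 * (r + r)) ^ 2 = 8 * (2 * r ^ 2) by ring] at h3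
    omega
  · rw [hv, show (2 * v' + 1) ^ 2 = 2 * (2 * v' ^ 2 + 2 * v') + 1 by ring] at h3
    omega

theorem UV.cop_of (h : UV p u v) (hp : p.Prime) (hp2 : p ≠ 2) {r : ℕ} (hr : r.Prime) (h1 : r ∣ u) :
    ¬ r ∣ p ∧ ¬ r ∣ v := by
  have hv : r ∣ v → False := by
    intro h2
    have h3 : r ^ 2 ∣ p := by
      have : r ^ 2 ∣ p + 2 * v ^ 2 := by rw [h.eq]; exact pow_dvd_pow_of_dvd h1 2
      exact (Nat.dvd_add_left ((pow_dvd_pow_of_dvd h2 2).mul_left 2)).1 this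
    have h4 := (Nat.Prime.eq_one_or_self_of_dvd hp (r ^ 2) h3)
    rcases h4 with h4 | h4
    · have := hr.two_le; nlinarith
    · rw [← h4, pow_two] at hp
      exact Nat.not_prime_mul hr.one_lt.ne' hr.one_lt.ne' hp
  refine ⟨fun h2 => ?_, hv⟩
  have h3 : r ∣ 2 * v ^ 2 := by
    have : r ∣ p + 2 * v ^ 2 := by rw [h.eq]; exact h1.trans (dvd_pow_self u two_ne_zero)
    exact (Nat.dvd_add_right h2).1 this
  rcases (Nat.Prime.dvd_mul hr).1 h3 with h4 | h4
  · have h5 := (Nat.prime_dvd_prime_iff_eq hr Nat.prime_two).1 h4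
    have := h.u8
    rw [h5] at h1; omega
  · exact hv (hr.dvd_of_dvd_pow h4)

theorem UV.cop_two (h : UV p u v) : Nat.Coprime u 2 := by
  rw [Nat.coprime_two_right, Nat.odd_iff]; have := h.u8; omega

theorem UV.cop_v (h : UV p u v) (hp : p.Prime) (hp2 : p ≠ 2) : Nat.Coprime u v := by
  rw [Nat.coprime_iff_gcd_eq_one]
  by_contra hne
  obtain ⟨r, hr, hd⟩ := Nat.exists_prime_and_dvd hne
  exact (h.cop_of hp hp2 hr (hd.trans (Nat.gcd_dvd_left _ _))).2 (hd.trans (Nat.gcd_dvd_right _ _))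

theorem UV.cop_p (h : UV p u v) (hp : p.Prime) (hp2 : p ≠ 2) : Nat.Coprime u p := by
  rw [Nat.coprime_iff_gcd_eq_one]
  by_contra hne
  obtain ⟨r, hr, hd⟩ := Nat.exists_prime_and_dvd hne
  exact (h.cop_of hp hp2 hr (hd.trans (Nat.gcd_dvd_left _ _))).1 (hd.trans (Nat.gcd_dvd_right _ _))

theorem bezout_ring {R : Type*} [CommRing R] {a b : ℕ} (h : Nat.Coprime a b) :
    ∃ x y : R, x * a + y * b = 1 := by
  have h1 := (Nat.isCoprime_iff_coprime.2 h)
  obtain ⟨x, y, hxy⟩ := h1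
  exact ⟨x, y, by exact_mod_cast congrArg (Int.cast : ℤ → R) hxy⟩
end

theorem ideal_sq_inj {R : Type*} [CommRing R] [IsDedekindDomain R] {I J : Ideal R} (h : I * I = J * J) : I = J := by
  have h1 : I ^ 2 = J ^ 2 := by rw [pow_two, pow_two, h]
  exact dvd_antisymm ((UniqueFactorizationMonoid.pow_dvd_pow_iff_dvd two_ne_zero).1 h1.dvd) ((UniqueFactorizationMonoid.pow_dvd_pow_iff_dvd two_ne_zero).1 h1.symm.dvd)

section
variable {p : ℕ} [hpf : Fact p.Prime]

theorem lift_U (hy : Hyp p) {u v : ℕ} (huv : UV p u v) {M : Type} [Field M] [NumberField M] {z s : 𝓞 M}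
    (h : IsL p 1 M z s) :
    Ideal.span {(u : 𝓞 M), 2 * v + (z + z ^ 3) * s} ≠ ⊥ ∧
    OddOrd (cl (Ideal.span {(u : 𝓞 M), 2 * v + (z + z ^ 3) * s})) := by
  have hp := hpf.out
  have hp2 := hy.ne2
  have hz4 : z ^ 4 = -1 := prim_neg_one (k := 2) h.prim
  have hu0 : (u : 𝓞 M) ≠ 0 := by
    have := huv.u8
    exact Nat.cast_ne_zero.2 (by omega)
  obtain ⟨v', hv, -⟩ := huv.even hy.mod
  obtain ⟨KR, t, s', j, hR, ht, hs', Qj, hjz, hjs⟩ := h.real hp hp2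
  have hodd := clLp_odd hy hR
  have ht2 : t ^ 2 = 2 := by
    have := hR.it
    exact sub_eq_zero.1 this
  have hinj := FaithfulSMul.algebraMap_injective (𝓞 KR) (𝓞 M)
  obtain ⟨w0, hw0, -⟩ := exists_half hy.four hR.sq
  obtain ⟨u1, hu1⟩ : ∃ u1, u = 2 * u1 + 1 := ⟨u / 2, by have := huv.u8; omega⟩
  have heq : (p : ℤ) + 8 * (v' : ℤ) ^ 2 = (2 * u1 + 1) ^ 2 := by
    have := huv.eq
    rw [hv, hu1] at this
    have h3 := congrArg (Nat.cast : ℕ → ℤ) this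
    push_cast at h3
    linear_combination h3
  have heqK : (p : 𝓞 KR) + 8 * (v' : 𝓞 KR) ^ 2 = (2 * u1 + 1) ^ 2 := by exact_mod_cast congrArg (Int.cast : ℤ → 𝓞 KR) heq
  have heqM : (p : 𝓞 M) + 8 * (v' : 𝓞 M) ^ 2 = (2 * u1 + 1) ^ 2 := by exact_mod_cast congrArg (Int.cast : ℤ → 𝓞 M) heq
  set a : 𝓞 KR := u1 + w0 with ha
  have h2a : 2 * a = (2 * u1 + 1) + s' := by rw [ha]; linear_combination hw0
  set r : 𝓞 KR := t * v' with hr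
  set b : 𝓞 KR := u1 + 1 - w0 with hb
  have h2b : 2 * b = (2 * u1 + 1) - s' := by rw [hb]; linear_combination -hw0
  have hab : a * b = r * r := by
    have h4 : (4 : 𝓞 KR) ≠ 0 := by norm_num
    apply mul_left_cancel₀ h4
    rw [hr]
    linear_combination 2 * b * h2a + (2 * u1 + 1 + s') * h2b - heqK - hR.sq - 4 * (v' : 𝓞 KR) ^ 2 * ht2
  have hcop : Nat.Coprime u (2 * v' * v') := by
    have h1 := huv.cop_v hp hp2
    rw [hv] at h1
    exact Nat.Coprime.mul_right h1 (Nat.Coprime.coprime_mul_left_right h1)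
  obtain ⟨x, y, hxy⟩ := bezout_ring (R := 𝓞 KR) hcop
  have hu1K : (u : 𝓞 KR) = 2 * u1 + 1 := by rw [hu1]; push_cast; ring
  have hu1M : (u : 𝓞 M) = 2 * u1 + 1 := by rw [hu1]; push_cast; ring
  have hvM : (v : 𝓞 M) = 2 * v' := by rw [hv]; push_cast; ring
  have habu : a + b = u := by rw [ha, hb, hu1K]; ring
  set Y : Ideal (𝓞 KR) := Ideal.span {a, r} with hY
  have haY : a ∈ Y := Ideal.subset_span (by simp)
  have hrY : r ∈ Y := Ideal.subset_span (by simp)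
  have ha0 : a ≠ 0 := by
    intro h0
    have h1 : s' = -(u : 𝓞 KR) := by rw [hu1K]; linear_combination (-h2a + 2 * h0)
    have h2 : (p : 𝓞 KR) = (u ^ 2 : ℕ) := by rw [← hR.sq, h1]; push_cast; ring
    have h3 : p = u ^ 2 := by exact_mod_cast h2
    rw [h3] at hp
    exact hp.prime.irreducible.not_isSquare ⟨u, by ring⟩
  have hY0 : Y ≠ ⊥ := fun h0 => ha0 (by rw [h0] at haY; exact haY)
  have hYY : Y * Y = Ideal.span {a} := by
    apply le_antisymm
    · rw [Ideal.mul_le]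
      intro c hc d hd
      obtain ⟨c1, c2, rfl⟩ := Ideal.mem_span_pair.1 hc
      obtain ⟨d1, d2, rfl⟩ := Ideal.mem_span_pair.1 hd
      rw [Ideal.mem_span_singleton]
      exact ⟨c1 * d1 * a + c1 * d2 * r + c2 * d1 * r + c2 * d2 * b, by linear_combination (-(c2 * d2)) * hab⟩
    · rw [Ideal.span_singleton_le_iff_mem]
      have h1 := Ideal.mul_mem_mul haY haY
      have h2 := Ideal.mul_mem_mul hrY hrY
      have h3 := (Y * Y).add_mem ((Y * Y).mul_mem_left x h1) ((Y * Y).mul_mem_left (x + y * a) h2)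
      convert h3 using 1
      push_cast at hxy
      rw [← habu] at hxy
      have h5 : r * r = 2 * v' * v' := by rw [hr]; linear_combination (v' : 𝓞 KR) ^ 2 * ht2
      linear_combination (-a) * hxy + x * hab - y * a * h5
  set w := z + z ^ 3 with hw
  have hw2 : w ^ 2 = -2 := by rw [hw]; linear_combination (2 + z ^ 2) * hz4
  set A := algebraMap (𝓞 KR) (𝓞 M) a with hA
  have h2A : 2 * A = u + s := by
    have := congrArg (algebraMap (𝓞 KR) (𝓞 M)) h2a
    rw [← hu1K] at this
    rw [map_mul, map_ofNat, map_add _ (u : 𝓞 KR) s', map_natCast, hs'] at this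
    exact this
  have hA0 : A ≠ 0 := fun h0 => ha0 (hinj (by rw [← hA, h0, map_zero]))
  set X := exi M Y with hX
  have hX0 : X ≠ ⊥ := exi_ne_bot hY0
  have hXX : X * X = Ideal.span {A} := by rw [hX, ← exi_mul, hYY, exi_span]
  have hXo : OddOrd (cl X) := by
    rw [hX, ← lft_cl hY0]; exact (OddOrd.of_card hodd).map _
  set β := s - v * w with hβ
  set U := Ideal.span {(u : 𝓞 M), 2 * v + w * s} with hU
  have huU : (u : 𝓞 M) ∈ U := Ideal.subset_span (by simp)
  have hαU : 2 * v + w * s ∈ U := Ideal.subset_span (by simp)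
  have hU0 : U ≠ ⊥ := fun h0 => hu0 (by rw [h0] at huU; exact huU)
  have heqM' : (u : 𝓞 M) ^ 2 = p + 2 * v ^ 2 := by rw [hu1M, hvM]; linear_combination -heqM
  have hβU : β ∈ U := by
    have h1 := U.mul_mem_right β huU
    have h2 := U.mul_mem_left (-w) hαU
    have h3 := U.sub_mem h1 (U.mul_mem_left (u1 : 𝓞 M) h2)
    convert h3 using 1
    rw [hβ, hu1M]
    linear_combination (-(u1 : 𝓞 M) * s) * hw2
  have hUU : U * U = Ideal.span {β} := by
    apply le_antisymm
    · rw [Ideal.mul_le]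
      intro c hc d hd
      obtain ⟨c1, c2, rfl⟩ := Ideal.mem_span_pair.1 hc
      obtain ⟨d1, d2, rfl⟩ := Ideal.mem_span_pair.1 hd
      rw [Ideal.mem_span_singleton]
      have h1 : 2 * v + w * s = w * β := by rw [hβ]; linear_combination (v : 𝓞 M) * hw2
      have h2 : (u : 𝓞 M) ^ 2 = β * (s + v * w) := by
        rw [hβ]; linear_combination heqM' - h.sq + (v : 𝓞 M) ^ 2 * hw2
      rw [h1]
      exact ⟨c1 * d1 * (s + v * w) + c1 * d2 * u * w + c2 * d1 * u * w + c2 * d2 * w ^ 2 * β, by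
        linear_combination (c1 * d1) * h2⟩
    · rw [Ideal.span_singleton_le_iff_mem]
      have hc4 : Nat.Coprime u (4 * p) := by
        refine Nat.Coprime.mul_right ?_ (huv.cop_p hp hp2)
        exact (huv.cop_two.pow_right 2)
      obtain ⟨x', y', hxy'⟩ := bezout_ring (R := 𝓞 M) hc4
      have h1 := (U * U).mul_mem_left x' (Ideal.mul_mem_mul huU hβU)
      have h2 := (U * U).mul_mem_left (2 * y' * s) ((U * U).add_mem (Ideal.mul_mem_mul hβU hβU) (Ideal.mul_mem_mul huU huU))
      convert (U * U).add_mem h1 h2 using 1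
      have h3 : β * β + u * u = 2 * s * β := by
        rw [hβ]; linear_combination heqM' + (v : 𝓞 M) ^ 2 * hw2 - h.sq
      rw [h3]
      push_cast at hxy'
      linear_combination (-β) * hxy' - 4 * y' * β * h.sq
  refine ⟨hU0, ?_⟩
  have hfin : Ideal.span {2 * A - v * w} = Ideal.span {2} * X * U := by
    apply ideal_sq_inj
    rw [show Ideal.span {(2 : 𝓞 M)} * X * U * (Ideal.span {2} * X * U) =
      Ideal.span {2} * Ideal.span {2} * (X * X) * (U * U) by ring, hXX, hUU]
    simp only [Ideal.span_singleton_mul_span_singleton]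
    congr 2
    have h1 : 2 * A - v * w = u + β := by rw [h2A, hβ]; ring
    rw [h1, show (2 : 𝓞 M) * 2 * A * β = 2 * (2 * A) * β by ring, h2A, hβ]
    linear_combination heqM' - h.sq + (v : 𝓞 M) ^ 2 * hw2
  have h2ne : Ideal.span {(2 : 𝓞 M)} ≠ ⊥ := by simp
  have h5 := cl_span (2 * A - (v : 𝓞 M) * w)
  rw [hfin, cl_mul (mul_ne_zero h2ne hX0) hU0, cl_mul h2ne hX0, cl_span, one_mul] at h5
  rw [eq_inv_of_mul_eq_one_right h5]
  exact hXo.inv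
end

set_option linter.unusedSectionVars false

section jacobi
open NumberTheorySymbols

theorem gcd_one_of {a b : ℤ} (h : ∀ r : ℕ, r.Prime → (r : ℤ) ∣ a → (r : ℤ) ∣ b → False) : a.gcd b = 1 := by
  by_contra hne
  obtain ⟨r, hr, hd⟩ := Nat.exists_prime_and_dvd hne
  exact h r hr ((Int.natCast_dvd_natCast.2 hd).trans (Int.gcd_dvd_left _ _))
    ((Int.natCast_dvd_natCast.2 hd).trans (Int.gcd_dvd_right _ _))

theorem sq_mod8 {w : ℤ} (h : Odd w) : w ^ 2 % 8 = 1 := by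
  obtain ⟨k, hk⟩ := h
  obtain ⟨j, hj⟩ := Int.even_mul_succ_self k
  rw [hk, show (2 * k + 1) ^ 2 = 4 * (k * (k + 1)) + 1 by ring, hj]
  omega

theorem jac_congr {a c : ℤ} {b : ℕ} (h : (b : ℤ) ∣ a - c) : J(a | b) = J(c | b) := by
  apply jacobiSym.mod_left'
  exact ((Int.modEq_iff_dvd).2 h).symm

theorem jac_neg {a : ℕ} (ha : a % 4 = 1) (m : ℤ) : J(-m | a) = J(m | a) := by
  rw [jacobiSym.neg m (Nat.odd_iff.2 (by omega)), ZMod.χ₄_nat_one_mod_four ha, one_mul]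

theorem jac_recip {a : ℕ} (ha : a % 4 = 1) {m : ℤ} (hm : Odd m) : J(a | m.natAbs) = J(m | a) := by
  rw [jacobiSym.quadratic_reciprocity_one_mod_four ha (Int.natAbs_odd.2 hm)]
  rcases Int.natAbs_eq m with h | h
  · rw [← h]
  · conv_rhs => rw [h, jac_neg ha]

theorem jac_two {a : ℕ} (ha : a % 8 = 1) : J(2 | a) = 1 := by
  rw [jacobiSym.at_two (Nat.odd_iff.2 (by omega)), ZMod.χ₈_nat_eq_if_mod_eight]
  rw [if_neg (by omega), if_pos (by omega)]

theorem jac_two_abs {m : ℤ} (hm : Odd m) : J(2 | m.natAbs) = if m % 8 = 1 ∨ m % 8 = 7 then 1 else -1 := by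
  rw [jacobiSym.at_two (Int.natAbs_odd.2 hm), ZMod.χ₈_nat_eq_if_mod_eight]
  have h1 : m % 2 = 1 := Int.odd_iff.1 hm
  rw [if_neg (by omega)]
  by_cases h : m % 8 = 1 ∨ m % 8 = 7
  · rw [if_pos h, if_pos (by omega)]
  · rw [if_neg h, if_neg (by omega)]

theorem jac_unit_cancel {a b : ℤ} (ha : a = 1 ∨ a = -1) (h : a * b = 1) : a = b := by
  rcases ha with rfl | rfl <;> omega

/-- cancel squares -/
theorem jac_sq_cancel {a b c : ℤ} {m : ℕ} (hb : b.gcd m = 1) (hc : c.gcd m = 1)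
    (h : (m : ℤ) ∣ a * b ^ 2 - c ^ 2) : J(a | m) = 1 := by
  have h1 := jac_congr h
  rwa [jacobiSym.mul_left, jacobiSym.sq_one' hb, jacobiSym.sq_one' hc, mul_one] at h1

theorem jac_y {u : ℕ} (hu8 : u % 8 = 1) (y t w : ℤ) (htu : ∀ r : ℕ, r.Prime → (r : ℤ) ∣ y → ¬ (r : ℤ) ∣ t)
    (hw : ∀ r : ℕ, r.Prime → (r : ℤ) ∣ y → ¬ (r : ℤ) ∣ w)
    (h : y ∣ u * t ^ 2 - w ^ 2) (hyu : y.gcd u = 1) : J(y | u) = 1 := by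
  have hu4 : u % 4 = 1 := by omega
  by_cases hy : y = 0
  · have : u = 1 := by simpa [hy] using hyu
    rw [this, jacobiSym.one_right]
  obtain ⟨e, y2, hy2, he⟩ := Nat.exists_eq_two_pow_mul_odd (Int.natAbs_ne_zero.2 hy)
  have h1 : J(y | u) = J((y2 : ℤ) | u) := by
    have h2 : J((y.natAbs : ℤ) | u) = J((y2 : ℤ) | u) := by
      rw [he, Nat.cast_mul, jacobiSym.mul_left, Nat.cast_pow, jacobiSym.pow_left, Nat.cast_ofNat,
        jac_two hu8, one_pow, one_mul]
    rw [← h2]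
    rcases Int.natAbs_eq y with h | h
    · rw [← h]
    · conv_lhs => rw [h, jac_neg hu4]
  have hd : (y2 : ℤ) ∣ y := by
    rw [← Int.dvd_natAbs, he]; exact_mod_cast Dvd.intro_left _ rfl
  have h3 : J((y2 : ℤ) | u) = J((u : ℤ) | y2) :=
    (jacobiSym.quadratic_reciprocity_one_mod_four hu4 hy2).symm
  rw [h1, h3]
  refine jac_sq_cancel (b := t) (c := w) ?_ ?_ (hd.trans h)
  · exact gcd_one_of fun r hr h1 h2 => htu r hr (h2.trans hd) h1
  · exact gcd_one_of fun r hr h1 h2 => hw r hr (h2.trans hd) h1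

/-- the key reciprocity computation -/
theorem key_jac {p u v q k : ℕ} (hp : p.Prime) (hp16 : p % 16 = 9) (huv : UV p u v) (hq : q.Prime)
    (hq2 : q ≠ 2) (hqp : q ≠ p) (hqu : u < q) {x y t : ℤ} (hx : x = u * t + 2 * v * y)
    (hN : (u : ℤ) * q ^ (2 * k) = x ^ 2 + 2 * p * y ^ 2)
    (hco : (q : ℤ) ∣ x → (q : ℤ) ∣ y → False) : J(x | p) = 1 := by
  have hp2 : p ≠ 2 := by rintro rfl; omega
  have hu8 := huv.u8
  have hu4 : u % 4 = 1 := by omega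
  have hu0 : (u : ℤ) ≠ 0 := by exact_mod_cast (by omega : u ≠ 0)
  obtain ⟨v', hv, hv'⟩ := huv.even hp16
  set w : ℤ := (q : ℤ) ^ k with hw
  have hE : (p : ℤ) + 2 * v ^ 2 = u ^ 2 := by exact_mod_cast huv.eq
  have hw2 : w ^ 2 = u * t ^ 2 + 4 * v * t * y + 2 * u * y ^ 2 := by
    apply mul_left_cancel₀ hu0
    have : (u : ℤ) * w ^ 2 = x ^ 2 + 2 * p * y ^ 2 := by rw [← hN, hw, ← pow_mul, mul_comm k 2]
    rw [this, hx]
    linear_combination 2 * y ^ 2 * hE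
  have hqodd : Odd q := hq.odd_of_ne_two hq2
  have hwodd : Odd w := by
    rw [hw]; exact Odd.pow (by exact_mod_cast hqodd)
  -- prime divisors
  have rw_q : ∀ r : ℕ, r.Prime → (r : ℤ) ∣ w → r = q := by
    intro r hr h
    have h1 : r ∣ q ^ k := by rw [hw] at h; exact_mod_cast h
    exact (Nat.prime_dvd_prime_iff_eq hr hq).1 (hr.dvd_of_dvd_pow h1)
  have rw_q2 : ∀ r : ℕ, r.Prime → (r : ℤ) ∣ w ^ 2 → r = q := fun r hr h =>
    rw_q r hr ((Nat.prime_iff_prime_int.1 hr).dvd_of_dvd_pow h)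
  have r_u : ∀ r : ℕ, r.Prime → (r : ℤ) ∣ u → r ≠ q := by
    intro r hr h h1
    have h2 : r ∣ u := by exact_mod_cast h
    have := Nat.le_of_dvd (by omega) h2
    omega
  have hty : ∀ r : ℕ, r.Prime → (r : ℤ) ∣ y → (r : ℤ) ∣ t → False := by
    intro r hr h1 h2
    have h3 : (r : ℤ) ∣ w ^ 2 := by
      rw [hw2, show (u : ℤ) * t ^ 2 + 4 * v * t * y + 2 * u * y ^ 2
        = (u * t + 4 * v * y) * t + (2 * u * y) * y by ring]
      exact dvd_add (h2.mul_left _) (h1.mul_left _)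
    have h4 := rw_q2 r hr h3
    rw [h4] at h1 h2
    exact hco (by rw [hx]; exact dvd_add (h2.mul_left _) (h1.mul_left _)) h1
  have hyu : ∀ r : ℕ, r.Prime → (r : ℤ) ∣ y → (r : ℤ) ∣ u → False := by
    intro r hr h1 h2
    refine r_u r hr h2 (rw_q2 r hr ?_)
    rw [hw2, show (u : ℤ) * t ^ 2 + 4 * v * t * y + 2 * u * y ^ 2
        = (4 * v * t) * y + (t ^ 2 + 2 * y ^ 2) * u by ring]
    exact dvd_add (h1.mul_left _) (h2.mul_left _)
  have htu : ∀ r : ℕ, r.Prime → (r : ℤ) ∣ t → (r : ℤ) ∣ u → False := by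
    intro r hr h1 h2
    refine r_u r hr h2 (rw_q2 r hr ?_)
    rw [hw2, show (u : ℤ) * t ^ 2 + 4 * v * t * y + 2 * u * y ^ 2
        = (4 * v * y) * t + (t ^ 2 + 2 * y ^ 2) * u by ring]
    exact dvd_add (h1.mul_left _) (h2.mul_left _)
  have hwt : ∀ r : ℕ, r.Prime → (r : ℤ) ∣ w → (r : ℤ) ∣ t → False := by
    intro r hr h1 h2
    have h4 := rw_q r hr h1
    have h3 : (r : ℤ) ∣ 2 * u * y ^ 2 := by
      have h5 : (2 * u * y ^ 2 : ℤ) = w * w - (u * t + 4 * v * y) * t := by linear_combination -hw2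
      rw [h5]
      exact dvd_sub (h1.mul_left _) (h2.mul_left _)
    have hrp := Nat.prime_iff_prime_int.1 hr
    rcases hrp.dvd_or_dvd h3 with h6 | h6
    · rcases hrp.dvd_or_dvd h6 with h7 | h7
      · have h8 : r ∣ 2 := by exact_mod_cast h7
        exact hq2 (h4.symm.trans ((Nat.prime_dvd_prime_iff_eq hr Nat.prime_two).1 h8))
      · exact r_u r hr h7 h4
    · exact hty r hr (hrp.dvd_of_dvd_pow h6) h2
  have hwy : ∀ r : ℕ, r.Prime → (r : ℤ) ∣ y → (r : ℤ) ∣ w → False := by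
    intro r hr h1 h2
    have h4 := rw_q r hr h2
    have h3 : (r : ℤ) ∣ u * t ^ 2 := by
      have h5 : (u * t ^ 2 : ℤ) = w * w - (4 * v * t + 2 * u * y) * y := by linear_combination -hw2
      rw [h5]
      exact dvd_sub (h2.mul_left _) (h1.mul_left _)
    have hrp := Nat.prime_iff_prime_int.1 hr
    rcases hrp.dvd_or_dvd h3 with h6 | h6
    · exact r_u r hr h6 h4
    · exact hty r hr h1 (hrp.dvd_of_dvd_pow h6)
  have hxu : ∀ r : ℕ, r.Prime → (r : ℤ) ∣ x → (r : ℤ) ∣ u → False := by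
    intro r hr h1 h2
    have hrp := Nat.prime_iff_prime_int.1 hr
    have h3 : (r : ℤ) ∣ 2 * v * y := by
      have h5 : (2 * v * y : ℤ) = x - t * u := by linear_combination -hx
      rw [h5]
      exact dvd_sub h1 (h2.mul_left _)
    have h2' : r ∣ u := by exact_mod_cast h2
    rcases hrp.dvd_or_dvd h3 with h6 | h6
    · rcases hrp.dvd_or_dvd h6 with h7 | h7
      · have h8 : r ∣ 2 := by exact_mod_cast h7
        have h9 := (Nat.prime_dvd_prime_iff_eq hr Nat.prime_two).1 h8
        rw [h9] at h2'; omega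
      · exact (huv.cop_of hp hp2 hr h2').2 (by exact_mod_cast h7)
    · exact hyu r hr h6 h2
  have hxw : ∀ r : ℕ, r.Prime → (r : ℤ) ∣ w → (r : ℤ) ∣ x → False := by
    intro r hr h1 h2
    have h4 := rw_q r hr h1
    have hrp := Nat.prime_iff_prime_int.1 hr
    have h3 : (r : ℤ) ∣ 2 * p * y ^ 2 := by
      have h5 : (2 * p * y ^ 2 : ℤ) = u * w * w - x * x := by
        have : (u : ℤ) * w ^ 2 = x ^ 2 + 2 * p * y ^ 2 := by rw [← hN, hw, ← pow_mul, mul_comm k 2]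
        linear_combination -this
      rw [h5]
      exact dvd_sub (h1.mul_left _) (h2.mul_left _)
    rcases hrp.dvd_or_dvd h3 with h6 | h6
    · rcases hrp.dvd_or_dvd h6 with h7 | h7
      · have h8 : r ∣ 2 := by exact_mod_cast h7
        exact hq2 (h4.symm.trans ((Nat.prime_dvd_prime_iff_eq hr Nat.prime_two).1 h8))
      · have h8 : r ∣ p := by exact_mod_cast h7
        exact hqp (h4.symm.trans ((Nat.prime_dvd_prime_iff_eq hr hp).1 h8))
    · rw [h4] at h2 h6
      exact hco h2 ((Nat.prime_iff_prime_int.1 hq).dvd_of_dvd_pow h6)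
  have hxy : ∀ r : ℕ, r.Prime → (r : ℤ) ∣ y → (r : ℤ) ∣ x → False := by
    intro r hr h1 h2
    have hrp := Nat.prime_iff_prime_int.1 hr
    have h3 : (r : ℤ) ∣ u * w ^ 2 := by
      have : (u : ℤ) * w ^ 2 = x * x + 2 * p * y * y := by
        rw [show x * x + 2 * p * y * y = x ^ 2 + 2 * p * y ^ 2 by ring, ← hN, hw, ← pow_mul, mul_comm k 2]
      rw [this]
      exact dvd_add (h2.mul_left _) (h1.mul_left _)
    rcases hrp.dvd_or_dvd h3 with h6 | h6
    · exact hxu r hr h2 h6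
    · exact hwy r hr h1 (hrp.dvd_of_dvd_pow h6)
  -- parity
  have hvz : (v : ℤ) = 2 * v' := by rw [hv]; push_cast; ring
  have hww : w ^ 2 % 8 = 1 := sq_mod8 hwodd
  have hut : ((u : ℤ)) % 8 = 1 := by omega
  have htodd : Odd t := by
    rw [← Int.not_even_iff_odd]
    rintro ⟨t', ht'⟩
    rw [hw2, ht', show (u : ℤ) * (t' + t') ^ 2 + 4 * v * (t' + t') * y + 2 * u * y ^ 2
      = 2 * (u * 2 * t' ^ 2 + 4 * v * t' * y + u * y ^ 2) by ring] at hww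
    omega
  have htt : t ^ 2 % 8 = 1 := sq_mod8 htodd
  obtain ⟨a, ha⟩ : ∃ a, t ^ 2 = 8 * a + 1 := ⟨t ^ 2 / 8, by omega⟩
  obtain ⟨b, hb⟩ : ∃ b : ℤ, (u : ℤ) = 8 * b + 1 := ⟨u / 8, by omega⟩
  have hyeven : Even y := by
    rw [← Int.not_odd_iff_even]
    intro hyo
    have hyy : y ^ 2 % 8 = 1 := sq_mod8 hyo
    obtain ⟨c, hc⟩ : ∃ c, y ^ 2 = 8 * c + 1 := ⟨y ^ 2 / 8, by omega⟩
    rw [hw2, ha, hc, hb, hvz, show (8 * b + 1) * (8 * a + 1) + 4 * (2 * (v' : ℤ)) * t * y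
      + 2 * (8 * b + 1) * (8 * c + 1) = 8 * (8 * a * b + a + b + v' * t * y + 2 * (8 * b * c + b + c)) + 3 by ring]
      at hww
    omega
  obtain ⟨y1, hy1⟩ := hyeven
  have hx8 : x = u * t + 8 * v' * y1 := by rw [hx, hvz, hy1]; ring
  have hxodd : Odd x := by
    rw [hx8, hb]
    rw [Int.odd_iff] at htodd ⊢
    rw [show (8 * b + 1) * t + 8 * v' * y1 = 8 * (b * t + v' * y1) + t by ring]; omega
  have hxt : x % 8 = t % 8 := by
    rw [hx8, hb, show (8 * b + 1) * t + 8 * v' * y1 = 8 * (b * t + v' * y1) + t by ring]; omega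
  have hy1y : y1 ∣ y := ⟨2, by rw [hy1]; ring⟩
  have hNw : (u : ℤ) * w ^ 2 = x ^ 2 + 2 * p * y ^ 2 := by rw [← hN, hw, ← pow_mul, mul_comm k 2]
  have hgcd : ∀ {a b : ℤ} (_ : ∀ r : ℕ, r.Prime → (r : ℤ) ∣ a → (r : ℤ) ∣ b → False),
    a.gcd ((b.natAbs : ℕ) : ℤ) = 1 := by
    intro a b h
    exact gcd_one_of fun r hr h1 h2 => h r hr h1 (by simpa using h2)
  -- the symbols
  have e1 : J(x | p) = J((p : ℤ) | x.natAbs) := (jac_recip (by omega) hxodd).symm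
  have e2 : J(2 * p | x.natAbs) = J((u : ℤ) | x.natAbs) := by
    have : J(2 * p * y ^ 2 | x.natAbs) = J(u * w ^ 2 | x.natAbs) := by
      apply jac_congr
      rw [Int.natAbs_dvd]
      exact ⟨-x, by linear_combination -hNw⟩
    rwa [jacobiSym.mul_left, jacobiSym.mul_left (u : ℤ), jacobiSym.sq_one' (hgcd hxy),
      jacobiSym.sq_one' (hgcd hxw), mul_one, mul_one] at this
  have e3 : J((u : ℤ) | x.natAbs) = J(x | u) := jac_recip hu4 hxodd
  have e4 : J(x | u) = J((v' : ℤ) | u) * J(y1 | u) := by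
    have : J(x | u) = J(2 ^ 3 * (v' * y1) | u) := by
      apply jac_congr; rw [hx8]; exact ⟨t, by ring⟩
    rw [this, jacobiSym.mul_left, jacobiSym.pow_left, jac_two hu8, one_pow, one_mul, jacobiSym.mul_left]
  have e5 : J(y1 | u) = 1 := by
    refine jac_y hu8 y1 t w (fun r hr h1 h2 => hty r hr (h1.trans hy1y) h2)
      (fun r hr h1 h2 => hwy r hr (h1.trans hy1y) h2) ?_
      (gcd_one_of fun r hr h1 h2 => hyu r hr (h1.trans hy1y) h2)
    rw [hw2, hy1]
    exact ⟨-(8 * v * t + 8 * u * y1), by ring⟩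
  have e6 : J(2 | x.natAbs) = J(2 | t.natAbs) := by
    rw [jac_two_abs hxodd, jac_two_abs htodd, hxt]
  have e7 : J(2 * u | t.natAbs) = 1 := by
    refine jac_sq_cancel (b := y) (c := w) (hgcd hty) (hgcd hwt) ?_
    rw [Int.natAbs_dvd, hw2]
    exact ⟨-(u * t + 4 * v * y), by ring⟩
  have e8 : J((u : ℤ) | t.natAbs) = J(t | u) := jac_recip hu4 htodd
  have e9 : J((v' : ℤ) * y1 * t | u) = 1 := by
    refine jac_sq_cancel (b := 4) (c := w) ?_ ?_ ?_
    · refine gcd_one_of fun r hr h1 h2 => ?_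
      have h3 : r ∣ 2 ^ 2 := by exact_mod_cast h1
      have h4 := (Nat.prime_dvd_prime_iff_eq hr Nat.prime_two).1 (hr.dvd_of_dvd_pow h3)
      rw [h4] at h2
      have : 2 ∣ u := by exact_mod_cast h2
      omega
    · exact gcd_one_of fun r hr h1 h2 => r_u r hr h2 (rw_q r hr h1)
    · rw [hw2, hvz, hy1]
      exact ⟨-(t ^ 2 + 8 * y1 ^ 2), by ring⟩
  rw [jacobiSym.mul_left, jacobiSym.mul_left, e5, mul_one] at e9
  rw [jacobiSym.mul_left, e8] at e7
  rw [jacobiSym.mul_left, e6, e3, e4, e5, mul_one] at e2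
  have tri : ∀ a b c d : ℤ, (a = 0 ∨ a = 1 ∨ a = -1) → (b = 0 ∨ b = 1 ∨ b = -1) → (c = 0 ∨ c = 1 ∨ c = -1) →
      a * b = 1 → b * c = 1 → c * d = a → d = 1 := by
    rintro a b c d (rfl | rfl | rfl) (rfl | rfl | rfl) (rfl | rfl | rfl) h1 h2 h3 <;> omega
  rw [e1]
  exact tri _ _ _ _ (jacobiSym.trichotomy _ _) (jacobiSym.trichotomy _ _) (jacobiSym.trichotomy _ _) e9
    (by rw [mul_comm]; exact e7) e2

/-- the quartic criterion -/
theorem key_quart {p u v q k : ℕ} [hpf : Fact p.Prime] (hp16 : p % 16 = 9) (huv : UV p u v) (hq : q.Prime)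
    (hq2 : q ≠ 2) (hqp : ¬ IsSquare (q : ZMod p)) (hqu : u < q) {x y t : ℤ} (hx : x = u * t + 2 * v * y)
    (hN : (u : ℤ) * q ^ (2 * k) = x ^ 2 + 2 * p * y ^ 2)
    (hco : (q : ℤ) ∣ x → (q : ℤ) ∣ y → False) : (∃ b : ZMod p, b ^ 4 = (u : ZMod p)) ↔ Even k := by
  have hp := hpf.out
  have hq0 : (q : ZMod p) ≠ 0 := by
    intro h; exact hqp (by rw [h]; exact ⟨0, by ring⟩)
  have hqp' : q ≠ p := by rintro rfl; exact hq0 (by simp)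
  have h1 := key_jac hp hp16 huv hq hq2 hqp' hqu hx hN hco
  obtain ⟨a, ha⟩ := ZMod.isSquare_of_jacobiSym_eq_one h1
  have hN' : (u : ZMod p) * (q : ZMod p) ^ (2 * k) = (x : ZMod p) ^ 2 := by
    have := congrArg (Int.cast : ℤ → ZMod p) hN
    push_cast at this
    rw [this]; simp
  rw [ha] at hN'
  constructor
  · rintro ⟨b, hb⟩
    rw [← Nat.not_odd_iff_even]
    intro hk
    have hb0 : b ≠ 0 := by
      rintro rfl
      have h2 : ((u : ℕ) : ZMod p) = 0 := by rw [← hb]; ring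
      rw [ZMod.natCast_eq_zero_iff] at h2
      have h3 : p ∣ 2 * v ^ 2 := by
        have : p ∣ p + 2 * v ^ 2 := by rw [huv.eq]; exact h2.trans (dvd_pow_self u two_ne_zero)
        exact (Nat.dvd_add_right (dvd_refl p)).1 this
      exact (huv.cop_of hp (by rintro rfl; omega) hp h2).1 (dvd_refl p)
    have h3 : ((q : ZMod p) ^ k - (a / b) ^ 2) * ((q : ZMod p) ^ k + (a / b) ^ 2) = 0 := by
      have : (b ^ 4) * ((q : ZMod p) ^ k) ^ 2 = a ^ 4 := by
        rw [hb, ← pow_mul, mul_comm k 2, hN']; ring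
      field_simp
      linear_combination this
    obtain ⟨i, hi⟩ : IsSquare (-1 : ZMod p) := ZMod.exists_sq_eq_neg_one_iff.2 (by omega)
    have h4 : IsSquare ((q : ZMod p) ^ k) := by
      rcases mul_eq_zero.1 h3 with h | h
      · exact ⟨a / b, by linear_combination h⟩
      · exact ⟨i * (a / b), by linear_combination h + (a / b) ^ 2 * hi⟩
    obtain ⟨c, hc⟩ := h4
    obtain ⟨j, hj⟩ := hk
    refine hqp ⟨c / q ^ j, ?_⟩
    field_simp
    rw [show (q : ZMod p) * (q ^ j) ^ 2 = q ^ k by rw [hj]; ring, hc]; ring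
  · rintro ⟨j, hj⟩
    refine ⟨a / (q : ZMod p) ^ j, ?_⟩
    field_simp
    rw [show ((q : ZMod p) ^ j) ^ 4 * u = u * q ^ (2 * k) by rw [hj]; ring, hN']; ring

/-- `u` is a square mod `p` -/
theorem UV.isSquare {p u v : ℕ} [hpf : Fact p.Prime] (huv : UV p u v) (hp16 : p % 16 = 9) :
    IsSquare (u : ZMod p) := by
  have hp := hpf.out
  have hu8 := huv.u8
  have hu4 : u % 4 = 1 := by omega
  obtain ⟨v', hv, hv'⟩ := huv.even hp16
  have hpo : Odd (p : ℤ) := by exact_mod_cast (hp.odd_of_ne_two (by rintro rfl; omega))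
  have h1 : J((u : ℤ) | p) = J((p : ℤ) | u) :=
    jacobiSym.quadratic_reciprocity_one_mod_four hu4 (by exact_mod_cast hpo)
  have h2 : J((p : ℤ) | u) = J(-(2 * v ^ 2) | u) := by
    apply jac_congr
    refine ⟨u, ?_⟩
    have : (p : ℤ) + 2 * v ^ 2 = u ^ 2 := by exact_mod_cast huv.eq
    linear_combination this
  have h3 : (v : ℤ).gcd u = 1 := by
    rw [Int.gcd_natCast_natCast]
    exact (huv.cop_v hp (by rintro rfl; omega)).symm
  rw [jac_neg hu4, jacobiSym.mul_left, jac_two hu8, jacobiSym.sq_one' h3] at h2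
  have := ZMod.isSquare_of_jacobiSym_eq_one (p := p) (a := (u : ℤ)) (by rw [h1, h2]; rfl)
  simpa using this
end jacobi

set_option linter.unusedSectionVars false

theorem rat_sq_int {N : ℕ} (hN : Squarefree N) {r : ℚ} {m : ℤ} (h : N * r ^ 2 = m) : ∃ c : ℤ, r = c := by
  have h1 : (N : ℤ) * r.num ^ 2 = m * (r.den : ℤ) ^ 2 := by
    have h2 := Rat.num_div_den r
    have h3 : (r.den : ℚ) ≠ 0 := by exact_mod_cast r.den_nz
    rw [← h2, div_pow, mul_div_assoc', div_eq_iff (pow_ne_zero 2 h3)] at h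
    exact_mod_cast h
  have h4 : IsCoprime ((r.den : ℤ) ^ 2) (r.num ^ 2) := by
    apply IsCoprime.pow
    rw [Int.isCoprime_iff_gcd_eq_one]
    have := r.reduced
    rw [Int.gcd_comm]
    exact this
  have h5 : ((r.den : ℤ) ^ 2) ∣ (N : ℤ) := h4.dvd_of_dvd_mul_right ⟨m, by rw [h1]; ring⟩
  have h6 : r.den * r.den ∣ N := by rw [← pow_two]; exact_mod_cast h5
  have h7 : r.den = 1 := Nat.isUnit_iff.1 (hN _ h6)
  exact ⟨r.num, by conv_lhs => rw [← Rat.num_div_den r, h7]; simp⟩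

/-- the field `ℚ(√(-2p))` -/
structure IsE (p : ℕ) (E : Type) [Field E] [NumberField E] (s0 : 𝓞 E) (g : E ≃+* E) : Prop where
  sq : s0 ^ 2 = -((2 * p : ℕ) : 𝓞 E)
  Q : QuadExt ℚ E g
  g : oi g s0 = -s0
  fr : Module.finrank ℚ E = 2

section E
variable {p : ℕ} {E : Type} [Field E] [NumberField E] {s0 : 𝓞 E} {g : E ≃+* E}

theorem ratInt (a : 𝓞 ℚ) : ∃ n : ℤ, a = (n : 𝓞 ℚ) :=
  ⟨Rat.ringOfIntegersEquiv a, by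
    apply Rat.ringOfIntegersEquiv.injective
    rw [map_intCast]; rfl⟩

theorem QuadExt.int_of_fix (Q : QuadExt ℚ E g) {x : 𝓞 E} (h : oi g x = x) : ∃ n : ℤ, x = (n : 𝓞 E) := by
  obtain ⟨a, ha⟩ := Q.fix_int h
  obtain ⟨n, hn⟩ := ratInt a
  exact ⟨n, by rw [← ha, hn, map_intCast]⟩

theorem IsE.s0_ne (h : IsE p E s0 g) (hp : p.Prime) : s0 ≠ 0 := by
  intro h0
  have h1 := h.sq
  rw [h0] at h1
  have h2 : ((2 * p : ℕ) : 𝓞 E) = 0 := by linear_combination h1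
  rw [Nat.cast_eq_zero] at h2
  have := hp.pos; omega

theorem IsE.form (h : IsE p E s0 g) (hp : p.Prime) (hp2 : p ≠ 2) (x : 𝓞 E) :
    ∃ a b : ℤ, x = a + b * s0 := by
  have hs := h.s0_ne hp
  have hsE : (algebraMap (𝓞 E) E s0) ≠ 0 := by
    intro h0; exact hs (RingOfIntegers.coe_injective (by rw [map_zero]; exact h0))
  have hg : g (algebraMap (𝓞 E) E s0) = -(algebraMap (𝓞 E) E s0) := by
    have := congrArg (algebraMap (𝓞 E) E) h.g
    rw [map_neg] at this
    exact this
  have hsq : (algebraMap (𝓞 E) E s0) ^ 2 = -((2 * p : ℕ) : E) := by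
    have := congrArg (algebraMap (𝓞 E) E) h.sq
    rw [map_pow, map_neg, map_natCast] at this
    exact this
  obtain ⟨a, b, hab, hN⟩ := h.Q.norm_decomp hsE hg (algebraMap (𝓞 E) E x)
  obtain ⟨A, hA⟩ := h.Q.int_of_fix (x := x + oi g x) (by rw [map_add, h.Q.inv_int, add_comm])
  obtain ⟨B, hB⟩ := h.Q.int_of_fix (x := x * oi g x) (by rw [map_mul, h.Q.inv_int, mul_comm])
  have hA1 : algebraMap (𝓞 E) E x + g (algebraMap (𝓞 E) E x) = (A : E) := by
    have := congrArg (algebraMap (𝓞 E) E) hA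
    rw [map_add, map_intCast] at this
    exact this
  have hB1 : algebraMap (𝓞 E) E x * g (algebraMap (𝓞 E) E x) = (B : E) := by
    have := congrArg (algebraMap (𝓞 E) E) hB
    rw [map_mul, map_intCast] at this
    exact this
  have hA2 : 2 * a = A := by
    apply (algebraMap ℚ E).injective
    rw [map_mul, map_intCast, map_ofNat, ← hA1, hab, map_add, map_mul, h.Q.alg, h.Q.alg, hg]
    ring
  have hB2 : a ^ 2 + 2 * p * b ^ 2 = B := by
    apply (algebraMap ℚ E).injective
    rw [map_add, map_mul, map_mul, map_pow, map_pow, map_intCast, map_ofNat, map_natCast, ← hB1, hN, hsq]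
    push_cast; ring
  have hsf : Squarefree (2 * p) :=
    (Nat.squarefree_mul (by rw [Nat.coprime_primes Nat.prime_two hp]; exact hp2.symm)).2
      ⟨Nat.prime_two.squarefree, hp.squarefree⟩
  obtain ⟨C, hC⟩ := rat_sq_int hsf (r := 2 * b) (m := 4 * B - A ^ 2) (by
    push_cast; rw [← hA2, ← hB2]; ring)
  have hABC : A ^ 2 + 2 * p * C ^ 2 = 4 * B := by
    have : (A : ℚ) ^ 2 + 2 * p * (C : ℚ) ^ 2 = 4 * B := by rw [← hA2, ← hB2, ← hC]; ring
    exact_mod_cast this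
  have hpo : Odd (p : ℤ) := by exact_mod_cast (hp.odd_of_ne_two hp2)
  have hAe : Even A := by
    have : Even (A ^ 2) := ⟨2 * B - p * C ^ 2, by linear_combination hABC⟩
    exact (Int.even_pow.1 this).1
  obtain ⟨a', ha'⟩ := hAe
  have hCe : Even C := by
    have h1 : Even (p * C ^ 2 : ℤ) := ⟨B - a' ^ 2, by
      apply mul_left_cancel₀ (two_ne_zero : (2 : ℤ) ≠ 0)
      rw [ha'] at hABC; linear_combination hABC⟩
    rcases Int.even_mul.1 h1 with h2 | h2
    · exact absurd hpo (Int.not_odd_iff_even.2 h2)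
    · exact (Int.even_pow.1 h2).1
  obtain ⟨b', hb'⟩ := hCe
  have ha2 : a = a' := by
    have : (2 : ℚ) * a = 2 * a' := by rw [hA2, ha']; push_cast; ring
    linarith
  have hb2 : b = b' := by
    have : (2 : ℚ) * b = 2 * b' := by rw [hC, hb']; push_cast; ring
    linarith
  refine ⟨a', b', RingOfIntegers.coe_injective ?_⟩
  rw [map_add, map_mul, map_intCast, map_intCast]
  refine hab.trans ?_
  rw [ha2, hb2, map_intCast, map_intCast]

theorem IsE.conj (h : IsE p E s0 g) (a b : ℤ) : oi g (a + b * s0) = a - b * s0 := by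
  rw [map_add, map_mul, map_intCast, map_intCast, h.g]; ring

theorem IsE.mul_conj (h : IsE p E s0 g) (a b : ℤ) :
    ((a : 𝓞 E) + b * s0) * oi g (a + b * s0) = ((a ^ 2 + 2 * p * b ^ 2 : ℤ) : 𝓞 E) := by
  have h1 := h.sq
  rw [h.conj]; push_cast at h1 ⊢
  linear_combination -(b : 𝓞 E) ^ 2 * h1

theorem IsE.inj (h : IsE p E s0 g) (hp : p.Prime) {a b a' b' : ℤ}
    (he : (a : 𝓞 E) + b * s0 = a' + b' * s0) : a = a' ∧ b = b' := by
  have h1 := congrArg (oi g) he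
  rw [h.conj, h.conj] at h1
  have h2 : (2 : 𝓞 E) * ((a - a' : ℤ) : 𝓞 E) = 0 := by push_cast; linear_combination he + h1
  have h3 : (a - a' : ℤ) = 0 := by
    rcases mul_eq_zero.1 h2 with h3 | h3
    · exact absurd h3 two_ne_zero
    · exact_mod_cast h3
  have h4 : ((b - b' : ℤ) : 𝓞 E) * s0 = 0 := by
    have : ((a - a' : ℤ) : 𝓞 E) = 0 := by rw [h3]; simp
    push_cast at this ⊢; linear_combination he - this
  have h5 : (b - b' : ℤ) = 0 := by
    rcases mul_eq_zero.1 h4 with h3 | h3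
    · exact_mod_cast h3
    · exact absurd h3 (h.s0_ne hp)
  omega

theorem IsE.absNorm (h : IsE p E s0 g) (a b : ℤ) :
    (((Ideal.span {(a : 𝓞 E) + b * s0}).absNorm : ℕ) : ℤ) = a ^ 2 + 2 * p * b ^ 2 := by
  have h1 : (Ideal.span {((a : 𝓞 E) + b * s0) * oi g (a + b * s0)}).absNorm
      = (Ideal.span {(a : 𝓞 E) + b * s0}).absNorm ^ 2 := by
    rw [← Ideal.span_singleton_mul_span_singleton, map_mul, ← act_span, act_absNorm, pow_two]
  have hnn : (0 : ℤ) ≤ a ^ 2 + 2 * p * b ^ 2 := by positivity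
  obtain ⟨n, hn⟩ := Int.eq_ofNat_of_zero_le hnn
  rw [h.mul_conj, hn] at h1
  rw [hn]
  rw [Int.cast_natCast, Ideal.absNorm_span_natCast, RingOfIntegers.rank, h.fr] at h1
  have := Nat.pow_left_injective (two_ne_zero) h1
  exact_mod_cast this.symm

/-- coefficients of multiples of an integer -/
theorem IsE.dvd_coeff (h : IsE p E s0 g) (hp : p.Prime) (hp2 : p ≠ 2) {n a b : ℤ}
    (hd : (n : 𝓞 E) ∣ a + b * s0) : n ∣ a ∧ n ∣ b := by
  obtain ⟨x, hx⟩ := hd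
  obtain ⟨c, d, hcd⟩ := h.form hp hp2 x
  have h1 : (a : 𝓞 E) + b * s0 = ((n * c : ℤ) : 𝓞 E) + ((n * d : ℤ) : 𝓞 E) * s0 := by
    rw [hx, hcd]; push_cast; ring
  obtain ⟨h2, h3⟩ := h.inj hp h1
  exact ⟨⟨c, h2⟩, ⟨d, h3⟩⟩

end E

set_option linter.unusedSectionVars false

section E
variable {p : ℕ} {E : Type} [Field E] [NumberField E] {s0 : 𝓞 E} {g : E ≃+* E}

theorem nmQ (J : Ideal (𝓞 E)) : nm ℚ J = Ideal.span {((J.absNorm : ℕ) : 𝓞 ℚ)} := by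
  have hpid : IsPrincipalIdealRing (𝓞 ℚ) :=
    IsPrincipalIdealRing.of_surjective Rat.ringOfIntegersEquiv.symm.toRingHom
      Rat.ringOfIntegersEquiv.symm.surjective
  obtain ⟨γ, hγ⟩ := (hpid.principal (nm ℚ J)).principal
  have hγ' : nm ℚ J = Ideal.span {γ} := hγ
  obtain ⟨n, hn⟩ := ratInt γ
  have h1 : J.absNorm = n.natAbs := by
    rw [← nm_absNorm (K := ℚ) J, hγ', hn]
    rcases Int.natAbs_eq n with h | h
    · conv_lhs => rw [h, Int.cast_natCast, Ideal.absNorm_span_natCast, RingOfIntegers.rank,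
        Module.finrank_self, pow_one]
    · conv_lhs => rw [h, Int.cast_neg, Ideal.span_singleton_neg, Int.cast_natCast, Ideal.absNorm_span_natCast,
        RingOfIntegers.rank, Module.finrank_self, pow_one]
  rw [hγ', hn, h1]
  rcases Int.natAbs_eq n with h | h
  · conv_lhs => rw [h, Int.cast_natCast]
  · conv_lhs => rw [h, Int.cast_neg, Ideal.span_singleton_neg, Int.cast_natCast]

theorem IsE.mul_act (h : IsE p E s0 g) {J : Ideal (𝓞 E)} (hJ : J ≠ ⊥) :
    J * act g J = Ideal.span {((J.absNorm : ℕ) : 𝓞 E)} := by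
  rw [h.Q.mul_act hJ, nmQ, exi_span, map_natCast]

theorem IsE.lH (h : IsE p E s0 g) (hp : p.Prime) (hp2 : p ≠ 2) :
    Ideal.span {(2 : 𝓞 E), s0} * Ideal.span {(2 : 𝓞 E), s0} = Ideal.span {(2 : 𝓞 E)} := by
  have hs := h.sq
  push_cast at hs
  obtain ⟨j, hj⟩ := hp.odd_of_ne_two hp2
  have hj' : (p : 𝓞 E) = 2 * j + 1 := by rw [hj]; push_cast; ring
  rw [Ideal.span_pair_mul_span_pair]
  apply le_antisymm
  · rw [Ideal.span_le]
    rintro x (rfl | rfl | rfl | rfl) <;> rw [SetLike.mem_coe, Ideal.mem_span_singleton]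
    · exact ⟨2, rfl⟩
    · exact ⟨s0, rfl⟩
    · exact ⟨s0, by ring⟩
    · exact ⟨-p, by rw [← pow_two, hs]; ring⟩
  · rw [Ideal.span_singleton_le_iff_mem]
    have e : (2 : 𝓞 E) = (-j) * (2 * 2) + (-1) * (s0 * s0) := by linear_combination hs - 2 * hj'
    have mem : (-j : 𝓞 E) * (2 * 2) + (-1) * (s0 * s0) ∈
        Ideal.span {(2 : 𝓞 E) * 2, 2 * s0, s0 * 2, s0 * s0} :=
      add_mem (Ideal.mul_mem_left _ _ (Ideal.subset_span (by simp)))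
        (Ideal.mul_mem_left _ _ (Ideal.subset_span (by simp)))
    rw [← e] at mem
    exact mem

theorem IsE.lH_norm (h : IsE p E s0 g) (hp : p.Prime) (hp2 : p ≠ 2) :
    (Ideal.span {(2 : 𝓞 E), s0}).absNorm = 2 := by
  have h1 := congrArg Ideal.absNorm (h.lH hp hp2)
  rw [map_mul, absNorm_two, h.fr, ← pow_two] at h1
  exact Nat.pow_left_injective two_ne_zero h1

theorem IsE.lH_cl (h : IsE p E s0 g) (hp : p.Prime) (hp2 : p ≠ 2) :
    cl (Ideal.span {(2 : 𝓞 E), s0}) ≠ 1 := by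
  have h1 := h.lH_norm hp hp2
  intro h2
  obtain ⟨x, -, hx⟩ := (cl_eq_one_iff (ne_bot_of_absNorm h1 two_ne_zero)).1 h2
  obtain ⟨a, b, hab⟩ := h.form hp hp2 x
  have h3 := h.absNorm a b
  rw [← hab, ← hx, h1] at h3
  push_cast at h3
  have hp3 : (3 : ℤ) ≤ p := by
    have := hp.two_le; exact_mod_cast (by omega : 3 ≤ p)
  have hb : b = 0 := by
    by_contra hb
    have : 1 ≤ b ^ 2 := by have := sq_pos_of_ne_zero hb; omega
    nlinarith [sq_nonneg a]
  rw [hb] at h3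
  have h4 : a ^ 2 = 2 := by linarith
  have h5 : a < 2 := by nlinarith
  have h6 : -2 < a := by nlinarith
  interval_cases a <;> omega

theorem IsE.U_eq (h : IsE p E s0 g) (hp : p.Prime) (hp2 : p ≠ 2) {u v : ℕ} (huv : UV p u v) :
    Ideal.span {(u : 𝓞 E), 2 * v + s0} * Ideal.span {(u : 𝓞 E), 2 * v + s0} * Ideal.span {(2 : 𝓞 E), s0}
      = Ideal.span {2 * (v : 𝓞 E) + s0} := by
  have hs := h.sq
  push_cast at hs
  have hE : (p : 𝓞 E) + 2 * v ^ 2 = u ^ 2 := by exact_mod_cast congrArg (Nat.cast : ℕ → 𝓞 E) huv.eq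
  apply le_antisymm
  · refine Ideal.mul_le.2 fun r hr t ht => ?_
    refine Submodule.mul_induction_on hr (fun a ha b hb => ?_) (fun x y hx hy => by
      rw [add_mul]; exact add_mem hx hy)
    obtain ⟨a1, a2, rfl⟩ := Ideal.mem_span_pair.1 ha
    obtain ⟨b1, b2, rfl⟩ := Ideal.mem_span_pair.1 hb
    obtain ⟨t1, t2, rfl⟩ := Ideal.mem_span_pair.1 ht
    rw [Ideal.mem_span_singleton]
    refine ⟨a1 * b1 * t1 * (2 * v - s0) + a1 * b1 * t2 * (v * s0 + p) +
      (t1 * 2 + t2 * s0) * (a1 * u * b2 + a2 * b1 * u + a2 * b2 * (2 * v + s0)), ?_⟩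
    linear_combination -(2 * a1 * b1 * t1 + a1 * b1 * t2 * s0) * hE +
      (a1 * b1 * t1 - a1 * b1 * t2 * v) * hs
  · rw [Ideal.span_singleton_le_iff_mem]
    have hc : Nat.Coprime u (8 * v) :=
      Nat.Coprime.mul_right (by simpa using Nat.Coprime.pow_right 3 huv.cop_two) (huv.cop_v hp hp2)
    obtain ⟨x, y, hxy⟩ := bezout_ring (R := 𝓞 E) hc
    push_cast at hxy
    obtain ⟨k, hk⟩ : ∃ k, u = 2 * k + 1 := ⟨u / 2, by have := huv.u8; omega⟩
    have hk' : (u : 𝓞 E) = 2 * k + 1 := by rw [hk]; push_cast; ring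
    set α : 𝓞 E := 2 * v + s0 with hα
    have hu : (u : 𝓞 E) ∈ Ideal.span {(u : 𝓞 E), α} := Ideal.subset_span (by simp)
    have ha : α ∈ Ideal.span {(u : 𝓞 E), α} := Ideal.subset_span (by simp)
    have h2 : (2 : 𝓞 E) ∈ Ideal.span {(2 : 𝓞 E), s0} := Ideal.subset_span (by simp)
    have h3 : s0 ∈ Ideal.span {(2 : 𝓞 E), s0} := Ideal.subset_span (by simp)
    have e : α = x * ((u * u) * s0) + (x * v + 2 * y) * ((u * u) * 2) + (- (x * k)) * ((u * α) * 2) +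
        y * ((α * α) * 2) := by
      have e1 : (u : 𝓞 E) ^ 2 * s0 = α * (v * s0 + p) := by
        rw [hα]; linear_combination -s0 * hE - v * hs
      have e2 : (u : 𝓞 E) ^ 2 * 2 = α * (2 * v - s0) := by
        rw [hα]; linear_combination -2 * hE + hs
      have e3 : α = α * (x * (v * s0 + p) + (x * v + 2 * y) * (2 * v - s0) - x * k * u * 2 + y * α * 2) := by
        rw [show α * (x * (v * s0 + p) + (x * v + 2 * y) * (2 * v - s0) - x * k * u * 2 + y * α * 2)
          = α * 1 by
            congr 1
            rw [hα]
            linear_combination hxy + x * hE + x * u * hk']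
        rw [mul_one]
      linear_combination e3 - x * e1 - (x * v + 2 * y) * e2
    have key : ∀ I : Ideal (𝓞 E), ((u : 𝓞 E) * u) * s0 ∈ I → ((u : 𝓞 E) * u) * 2 ∈ I → ((u : 𝓞 E) * α) * 2 ∈ I → (α * α) * 2 ∈ I →
        α ∈ I := by
      intro I m1 m2 m3 m4
      have mem := add_mem (add_mem (add_mem (I.mul_mem_left x m1) (I.mul_mem_left (x * v + 2 * y) m2))
        (I.mul_mem_left (-(x * k)) m3)) (I.mul_mem_left y m4)
      rw [← e] at mem
      exact mem
    apply key
    · exact Ideal.mul_mem_mul (Ideal.mul_mem_mul hu hu) h3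
    · exact Ideal.mul_mem_mul (Ideal.mul_mem_mul hu hu) h2
    · exact Ideal.mul_mem_mul (Ideal.mul_mem_mul hu ha) h2
    · exact Ideal.mul_mem_mul (Ideal.mul_mem_mul ha ha) h2

theorem IsE.U_norm (h : IsE p E s0 g) (hp : p.Prime) (hp2 : p ≠ 2) {u v : ℕ} (huv : UV p u v) :
    (Ideal.span {(u : 𝓞 E), 2 * v + s0}).absNorm = u := by
  have h1 := congrArg Ideal.absNorm (h.U_eq hp hp2 huv)
  have h2 := h.absNorm (2 * v) 1
  push_cast at h2
  rw [one_mul] at h2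
  rw [map_mul, map_mul, h.lH_norm hp hp2, ← pow_two] at h1
  have h3 : (((Ideal.span {(u : 𝓞 E), 2 * v + s0}).absNorm ^ 2 * 2 : ℕ) : ℤ) = (u ^ 2 * 2 : ℕ) := by
    rw [h1, h2, ← huv.eq]; push_cast; ring
  have h4 := Nat.eq_of_mul_eq_mul_right two_pos (Int.natCast_inj.1 h3)
  exact Nat.pow_left_injective two_ne_zero h4

theorem IsE.U_cl (h : IsE p E s0 g) (hp : p.Prime) (hp2 : p ≠ 2) {u v : ℕ} (huv : UV p u v) :
    Ideal.span {(u : 𝓞 E), 2 * v + s0} ≠ ⊥ ∧ cl (Ideal.span {(u : 𝓞 E), 2 * v + s0}) ^ 4 = 1 ∧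
      cl (Ideal.span {(u : 𝓞 E), 2 * v + s0}) ^ 2 ≠ 1 := by
  have hU : Ideal.span {(u : 𝓞 E), 2 * v + s0} ≠ ⊥ :=
    ne_bot_of_absNorm (h.U_norm hp hp2 huv) (by have := huv.u8; omega)
  have hl := ne_bot_of_absNorm (h.lH_norm hp hp2) two_ne_zero
  have h1 := congrArg cl (h.U_eq hp hp2 huv)
  have h2 := congrArg cl (h.lH hp hp2)
  rw [cl_span, cl_mul (mul_ne_zero hU hU) hl, cl_mul hU hU] at h1
  rw [cl_span, cl_mul hl hl] at h2
  have h3 := h.lH_cl hp hp2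
  refine ⟨hU, ?_, fun h4 => ?_⟩
  · have h5 := eq_inv_of_mul_eq_one_left h1
    rw [← pow_two] at h5
    rw [show 4 = 2 * 2 from rfl, pow_mul, h5, inv_pow, pow_two, h2, inv_one]
  · rw [← pow_two, h4, one_mul] at h1
    exact h3 h1

end E

set_option linter.unusedSectionVars false

section E
open NumberTheorySymbols
variable {p : ℕ} [hpf : Fact p.Prime] {E : Type} [Field E] [NumberField E] {s0 : 𝓞 E} {g : E ≃+* E}

theorem exists_r (hp4 : p % 4 = 1) {q : ℕ} (hq : q.Prime) (hq8 : q % 8 = 7) (hqp : ¬ IsSquare (q : ZMod p)) :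
    ∃ r : ℤ, (q : ℤ) ∣ r ^ 2 + 2 * p := by
  have : Fact q.Prime := ⟨hq⟩
  have hqo : Odd q := Nat.odd_iff.2 (by omega)
  have h1 : J((q : ℤ) | p) = -1 := by
    apply ZMod.nonsquare_iff_jacobiSym_eq_neg_one.2
    simpa using hqp
  have h2 : J((p : ℤ) | q) = -1 := by
    rw [jacobiSym.quadratic_reciprocity_one_mod_four hp4 hqo, h1]
  have h3 : J(2 | q) = 1 := by
    rw [jacobiSym.at_two hqo, ZMod.χ₈_nat_eq_if_mod_eight, if_neg (by omega), if_pos (by omega)]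
  have h4 : J(-(2 * p) | q) = 1 := by
    rw [jacobiSym.neg _ hqo, ZMod.χ₄_nat_three_mod_four (by omega), jacobiSym.mul_left, h2, h3]; rfl
  obtain ⟨c, hc⟩ := ZMod.isSquare_of_jacobiSym_eq_one h4
  obtain ⟨r, rfl⟩ := ZMod.intCast_surjective c
  refine ⟨r, ?_⟩
  rw [← ZMod.intCast_zmod_eq_zero_iff_dvd] 
  push_cast at hc ⊢
  linear_combination -hc

/-- primes over `q` -/
theorem IsE.prime_norm (h : IsE p E s0 g) (hp4 : p % 4 = 1) {q : ℕ} (hq : q.Prime) (hq8 : q % 8 = 7)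
    (hqp : ¬ IsSquare (q : ZMod p)) {P : Ideal (𝓞 E)} (hP : P.IsPrime) (hqP : (q : 𝓞 E) ∈ P) :
    P.absNorm = q ∧ ∃ r : ℤ, s0 - r ∈ P := by
  have hp := hpf.out
  have hp2 : p ≠ 2 := by rintro rfl; omega
  obtain ⟨r, hr⟩ := exists_r hp4 hq hq8 hqp
  have hs := h.sq
  push_cast at hs
  have hr' : ∃ r : ℤ, s0 - r ∈ P := by
    have h1 : (s0 - (r : 𝓞 E)) * (s0 - ((-r : ℤ) : 𝓞 E)) ∈ P := by
      obtain ⟨c, hc⟩ := hr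
      have hc' : (r : 𝓞 E) ^ 2 + 2 * p = q * c := by exact_mod_cast congrArg (Int.cast : ℤ → 𝓞 E) hc
      have : (s0 - (r : 𝓞 E)) * (s0 - ((-r : ℤ) : 𝓞 E)) = (-c : 𝓞 E) * q := by
        push_cast; linear_combination hs - hc'
      rw [this]
      exact P.mul_mem_left _ hqP
    rcases hP.mem_or_mem h1 with h2 | h2
    · exact ⟨r, h2⟩
    · exact ⟨-r, h2⟩
  refine ⟨?_, hr'⟩
  obtain ⟨r, hr⟩ := hr'
  have hle : Ideal.span {(q : 𝓞 E)} ≤ P := by rwa [Ideal.span_singleton_le_iff_mem]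
  have hNq : (Ideal.span {(q : 𝓞 E)}).absNorm = q ^ 2 := by
    rw [Ideal.absNorm_span_natCast, RingOfIntegers.rank, h.fr]
  have hd := Ideal.absNorm_dvd_absNorm_of_le hle
  rw [hNq] at hd
  obtain ⟨i, hi, hPi⟩ := (Nat.dvd_prime_pow hq).1 hd
  interval_cases i
  · rw [pow_zero, Ideal.absNorm_eq_one_iff] at hPi
    exact absurd hPi hP.ne_top
  · rw [hPi, pow_one]
  · exfalso
    have h1 := ideal_eq_of_le_of_absNorm hle (ne_bot_of_absNorm hNq (pow_ne_zero 2 hq.ne_zero))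
      (by rw [hNq, hPi])
    rw [← h1, Ideal.mem_span_singleton] at hr
    have h2 := (h.dvd_coeff hp hp2 (n := q) (a := -r) (b := 1) (by
      push_cast; rw [one_mul, neg_add_eq_sub]; exact hr)).2
    have h3 : q ∣ 1 := by exact_mod_cast h2
    exact hq.one_lt.ne' (Nat.dvd_one.1 h3)

theorem NN_nat_of_sq (hp2 : p ≠ 2) {u : ℕ} (h0 : (u : ZMod p) ≠ 0) (h : IsSquare (u : ZMod p)) :
    NN p (u : ℚ_[p]) := by
  obtain ⟨b, hb⟩ := padic_sq hp2 (u : ℤ_[p]) (by simpa using h0) (by simpa using h)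
  have hb' : (b : ℚ_[p]) ^ 2 = u := by rw [← PadicInt.coe_pow, hb]; simp
  refine ⟨b, ?_, Or.inl hb'.symm⟩
  intro h1
  rw [h1] at hb'
  apply h0
  have : (u : ℚ_[p]) = 0 := by rw [← hb']; ring
  have h2 : u = 0 := by exact_mod_cast this
  rw [h2]; simp

theorem IsE.char (h : IsE p E s0 g) (hy : Hyp p) : ∃ χ : ClassGroup (𝓞 E) →* Dp p,
    ∀ J : Ideal (𝓞 E), J ≠ ⊥ → (χ (cl J) = 1 ↔ NN p ((J.absNorm : ℕ) : ℚ_[p])) := by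
  obtain ⟨ζ, ρ, hζ, -, hρ⟩ := padic_data hy
  have hs := h.s0_ne hpf.out
  have hsE : (algebraMap (𝓞 E) E s0) ≠ 0 := by
    intro h0; exact hs (RingOfIntegers.coe_injective (by rw [map_zero]; exact h0))
  have hg : g (algebraMap (𝓞 E) E s0) = -(algebraMap (𝓞 E) E s0) := by
    have := congrArg (algebraMap (𝓞 E) E) h.g
    rw [map_neg] at this
    exact this
  have hsq : (algebraMap (𝓞 E) E s0) ^ 2 = -((2 * p : ℕ) : E) := by
    have := congrArg (algebraMap (𝓞 E) E) h.sq
    rw [map_pow, map_neg, map_natCast] at this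
    exact this
  obtain ⟨χ, hχ⟩ := exists_char (p := p) (K := ℚ) (M := E) (algebraMap ℚ ℚ_[p]) odd_card_Q (by
    intro ε
    have h1 : IsUnit (ε : 𝓞 ℚ) := ε.isUnit
    obtain ⟨n, hn⟩ := ratInt (ε : 𝓞 ℚ)
    have h2 : IsUnit n := by
      have := h1.map Rat.ringOfIntegersEquiv
      rw [hn, map_intCast] at this
      exact this
    rcases Int.isUnit_iff.1 h2 with h3 | h3
    · rw [hn, h3]; simpa using NN.one (p := p)
    · rw [hn, h3]; simpa using NN.neg_one hy.four) (by
    intro x hx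
    obtain ⟨a, b, -, hab⟩ := h.Q.norm_decomp hsE hg x
    have h1 : Algebra.norm ℚ x = a ^ 2 + 2 * p * b ^ 2 := by
      apply (algebraMap ℚ E).injective
      rw [h.Q.norm_eq, hab, hsq]; push_cast
      simp only [eq_ratCast]; ring
    have h0 : Algebra.norm ℚ x ≠ 0 := (Algebra.norm_ne_zero_iff).2 hx
    have h2 : algebraMap ℚ ℚ_[p] (Algebra.norm ℚ x)
        = (algebraMap ℚ ℚ_[p] a) ^ 2 - p * (ρ ^ 2 * ζ ^ 2 * algebraMap ℚ ℚ_[p] b) ^ 2 := by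
      rw [h1]; push_cast
      simp only [eq_ratCast]
      linear_combination (p : ℚ_[p]) * (b : ℚ_[p]) ^ 2 * (ζ ^ 4 * hρ + 2 * hζ)
    rw [h2]
    apply NN.form hy.four
    rw [← h2]
    exact (map_ne_zero _).2 h0)
  refine ⟨χ, fun J hJ => ?_⟩
  rw [hχ J hJ _ (nmQ J)]
  simp

theorem odd_sq_mod8 {k : ℕ} (h : Odd k) : ∃ j, k ^ 2 = 4 * j + 1 := by
  obtain ⟨i, hi⟩ := h
  exact ⟨i ^ 2 + i, by rw [hi]; ring⟩

/-- the main result on `ℚ(√(-2p))` -/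
theorem IsE.S3 (h : IsE p E s0 g) (hc2 : c2 E ≤ 2) (hy : Hyp p) {u v : ℕ} (huv : UV p u v)
    {q : ℕ} (hq : q.Prime) (hq8 : q % 8 = 7) (hqp : ¬ IsSquare (q : ZMod p)) (hqu : u < q)
    {P : Ideal (𝓞 E)} (hP : P.IsPrime) (hqP : (q : 𝓞 E) ∈ P) :
    ∃ k : ℕ, cl (Ideal.span {(u : 𝓞 E), 2 * v + s0}) = cl P ^ (2 * k) ∧
      ((∃ b : ZMod p, b ^ 4 = (u : ZMod p)) ↔ Even k) := by
  have hp := hpf.out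
  have hp2 := hy.ne2
  have hu0 : u ≠ 0 := by have := huv.u8; omega
  obtain ⟨hPn, r, hr⟩ := h.prime_norm hy.four hq hq8 hqp hP hqP
  have hP0 := ne_bot_of_absNorm hPn hq.ne_zero
  obtain ⟨hU, hU4, -⟩ := h.U_cl hp hp2 huv
  have hUn := h.U_norm hp hp2 huv
  obtain ⟨χ, hχ⟩ := h.char hy
  set U : Ideal (𝓞 E) := Ideal.span {(u : 𝓞 E), 2 * v + s0} with hUdef
  have hχP : χ (cl P) ≠ 1 := by
    rw [Ne, hχ P hP0, hPn]; exact not_NN_nat hqp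
  have hup : (u : ZMod p) ≠ 0 := by
    intro h1
    rw [ZMod.natCast_eq_zero_iff] at h1
    exact (huv.cop_of hp hp2 hp h1).1 dvd_rfl
  have hχU : χ (cl U) = 1 := by
    rw [hχ U hU, hUn]; exact NN_nat_of_sq hp2 hup (huv.isSquare hy.mod)
  obtain ⟨n, hn⟩ := gen1 hc2 χ Dp_sq (cl P) hχP (cl U)
  have hne : Even n := by
    have h1 := OddOrd.char Dp_sq χ hn
    rw [map_div, hχU, map_pow, div_eq_one] at h1
    exact exp2_even Dp_sq hχP h1.symm
  obtain ⟨κ, hκ, hκ1⟩ := hn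
  obtain ⟨j, hj⟩ := odd_sq_mod8 hκ
  obtain ⟨n', hn'⟩ := hne
  obtain ⟨k, hcl⟩ : ∃ k, cl U = cl P ^ (2 * k) := by
    refine ⟨n' * κ ^ 2, ?_⟩
    have h1 : (cl U / cl P ^ n) ^ (κ ^ 2) = 1 := by rw [pow_two, pow_mul, hκ1, one_pow]
    rw [_root_.div_pow, div_eq_one] at h1
    have h2 : cl U ^ κ ^ 2 = cl U := by rw [hj, pow_succ, pow_mul, hU4, one_pow, one_mul]
    rw [h2, ← pow_mul] at h1
    rw [h1, hn']; congr 1; ring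
  refine ⟨k, hcl, ?_⟩
  -- conjugate
  have hPb := act_ne_bot g hP0
  have hmul := congrArg cl (h.mul_act hP0)
  rw [cl_span, cl_mul hP0 hPb] at hmul
  have hI0 : U * act g P ^ (2 * k) ≠ ⊥ := mul_ne_zero hU (pow_ne_zero _ hPb)
  have hI : cl (U * act g P ^ (2 * k)) = 1 := by
    rw [cl_mul hU (pow_ne_zero _ hPb), cl_pow hPb, hcl, ← mul_pow, hmul, one_pow]
  obtain ⟨X, -, hX⟩ := (cl_eq_one_iff hI0).1 hI
  obtain ⟨x, y, hxy⟩ := h.form hp hp2 X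
  have hN := h.absNorm x y
  rw [← hxy, ← hX, map_mul, map_pow, act_absNorm, hPn, hUn] at hN
  push_cast at hN
  have hXU : X ∈ U := by
    have h1 : X ∈ U * act g P ^ (2 * k) := by rw [hX]; exact Ideal.mem_span_singleton_self X
    have hle' : ∀ V W : Ideal (𝓞 E), V * W ≤ V := fun V W => Ideal.mul_le_left
    exact hle' _ _ h1
  have hs := h.sq
  have hE : (p : 𝓞 E) + 2 * v ^ 2 = u ^ 2 := by exact_mod_cast congrArg (Nat.cast : ℕ → 𝓞 E) huv.eq
  push_cast at hs
  obtain ⟨A, B, hAB⟩ := Ideal.mem_span_pair.1 hXU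
  have hdiv : (u : ℤ) ∣ x - 2 * v * y := by
    have h1 : ((u : ℤ) : 𝓞 E) ∣ ((2 * v * (x - 2 * v * y) : ℤ) : 𝓞 E) + ((-(x - 2 * v * y) : ℤ) : 𝓞 E) * s0 := by
      refine ⟨A * (2 * v - s0) + (B - y) * 2 * u, ?_⟩
      push_cast
      rw [hxy] at hAB
      linear_combination (-(2 * (v : 𝓞 E) - s0)) * hAB + 2 * (B - y) * hE - (B - y) * hs
    exact (Int.dvd_neg).1 (h.dvd_coeff hp hp2 h1).2
  obtain ⟨t, ht⟩ := hdiv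
  refine key_quart (x := x) (y := y) (t := t) hy.mod huv hq (by rintro rfl; omega) hqp hqu (by linarith) hN ?_
  intro hqx hqy
  have hXP : X ∈ P := by
    obtain ⟨a, rfl⟩ := hqx
    obtain ⟨b, rfl⟩ := hqy
    rw [hxy]; push_cast
    rw [show (q : 𝓞 E) * a + q * b * s0 = (a + b * s0) * q by ring]
    exact P.mul_mem_left _ hqP
  have hle : U * act g P ^ (2 * k) ≤ P := by rw [hX, Ideal.span_singleton_le_iff_mem]; exact hXP
  have hnat : ∀ n : ℕ, (n : 𝓞 E) ∈ P → q ∣ n := by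
    intro n hn
    by_contra hnd
    obtain ⟨a, b, hab⟩ := bezout_ring (R := 𝓞 E) ((Nat.Prime.coprime_iff_not_dvd hq).2 hnd)
    exact hP.ne_top ((Ideal.eq_top_iff_one _).2 (hab ▸
      add_mem (P.mul_mem_left _ hqP) (P.mul_mem_left _ hn)))
  rcases hP.mul_le.1 hle with h1 | h1
  · have h2 : q ∣ u := hnat u (h1 (Ideal.subset_span (by simp)))
    have := Nat.le_of_dvd (Nat.pos_of_ne_zero hu0) h2
    omega
  · have h2 := hP.le_of_pow_le h1
    have h3 : oi g (s0 - r) ∈ P := h2 (mem_act g hr)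
    rw [map_sub, map_intCast, h.g] at h3
    have h4 : ((2 * p * 4 : ℕ) : 𝓞 E) ∈ P := by
      have h5 : ((2 * p * 4 : ℕ) : 𝓞 E) = -(2 * s0) * ((s0 - r) - (-s0 - r)) := by
        push_cast; linear_combination 4 * hs
      rw [h5]
      exact P.mul_mem_left _ (sub_mem hr h3)
    have h5 := hnat _ h4
    have hqpne : q ≠ p := by rintro rfl; exact hqp ⟨0, by simp⟩
    rcases (Nat.Prime.dvd_mul hq).1 h5 with h6 | h6
    · rcases (Nat.Prime.dvd_mul hq).1 h6 with h7 | h7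
      · have := Nat.le_of_dvd two_pos h7; omega
      · exact hqpne ((Nat.prime_dvd_prime_iff_eq hq hp).1 h7)
    · have := Nat.le_of_dvd four_pos h6; omega

end E

set_option linter.unusedSectionVars false

/-- the norm of a prime ideal is a power of the prime below. -/
theorem nm_prime {K M : Type*} [Field K] [NumberField K] [Field M] [NumberField M] [Algebra K M]
    {J : Ideal (𝓞 M)} (hJ : J.IsPrime) {q : ℕ} (hJn : J.absNorm = q ^ 2) :
    ∃ (P : Ideal (𝓞 K)) (f : ℕ), P.IsPrime ∧ (q : 𝓞 K) ∈ P ∧ nm K J = P ^ f ∧ P.absNorm ^ f = q ^ 2 := by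
  have h1 : (q : 𝓞 M) ∈ J := by
    have := Ideal.absNorm_mem J
    rw [hJn] at this
    push_cast at this
    exact hJ.mem_of_pow_mem 2 this
  have hP : (J.under (𝓞 K)).IsPrime := inferInstance
  obtain ⟨f, hf⟩ := Ideal.exists_relNorm_eq_pow_of_isPrime J (J.under (𝓞 K))
  refine ⟨J.under (𝓞 K), f, hP, ?_, hf, ?_⟩
  · rw [Ideal.under_def, Ideal.mem_comap, map_natCast]; exact h1
  · rw [← map_pow, ← hf, ← hJn]; exact nm_absNorm J

theorem cl_prod {M ι : Type*} [Field M] [NumberField M] (S : Finset ι) (I : ι → Ideal (𝓞 M))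
    (hI : ∀ i, I i ≠ ⊥) : ∏ i ∈ S, I i ≠ ⊥ ∧ cl (∏ i ∈ S, I i) = ∏ i ∈ S, cl (I i) := by
  classical
  induction S using Finset.induction_on with
  | empty => exact ⟨by simp, by simpa using cl_top⟩
  | insert a S ha ih =>
    rw [Finset.prod_insert ha, Finset.prod_insert ha]
    exact ⟨mul_ne_zero (hI a) ih.1, by rw [cl_mul (hI a) ih.1, ih.2]⟩

theorem oddOrd_prod {C ι : Type*} [CommGroup C] (S : Finset ι) (f : ι → C) (c : C)
    (h : ∀ i, OddOrd (f i / c)) : OddOrd ((∏ i ∈ S, f i) / c ^ S.card) := by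
  classical
  induction S using Finset.induction_on with
  | empty => simpa using OddOrd.one
  | insert a S ha ih =>
    rw [Finset.prod_insert ha, Finset.card_insert_of_notMem ha, pow_succ', mul_div_mul_comm]
    exact (h a).mul ih

section
variable {p : ℕ} [hpf : Fact p.Prime]

theorem exists_E (hp : p.Prime) (hp2 : p ≠ 2) {M : Type} [Field M] [NumberField M] {w : 𝓞 M}
    (hw : w ^ 2 = -((2 * p : ℕ) : 𝓞 M)) : ∃ (E : IntermediateField ℚ M) (s0 : 𝓞 E) (g : E ≃+* E),
      algebraMap (𝓞 E) (𝓞 M) s0 = w ∧ IsE p E s0 g ∧ c2 E ≤ 2 := by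
  obtain ⟨t', ht'⟩ := exists_int (adjoin ℚ {(w : M)}) w (mem_adjoin_simple_self _ _)
  have h1 : t' ^ 2 = -((2 * p : ℕ) : 𝓞 (adjoin ℚ {(w : M)})) := by
    apply FaithfulSMul.algebraMap_injective (𝓞 (adjoin ℚ {(w : M)})) (𝓞 M)
    rw [map_pow, ht', hw, map_neg, map_natCast]
  obtain ⟨h2, ⟨g, h3, h4⟩, h5⟩ := E_basic hp hp2 h1 (by
    apply adjoin_coe_top
    rw [Set.image_singleton]
    congr 1
    exact congrArg (algebraMap (𝓞 M) M) ht')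
  exact ⟨_, t', g, ht', ⟨h1, h3, h4, h2⟩, h5⟩

theorem S2 (hy : Hyp p) {u v : ℕ} (huv : UV p u v) {M : Type} [Field M] [NumberField M] {z s : 𝓞 M}
    (h : IsL p 1 M z s) {q : ℕ} (hq : q.Prime) (hq8 : q % 8 = 7) (hqp : ¬ IsSquare (q : ZMod p))
    (hqu : u < q) {J : Ideal (𝓞 M)} (hJ : J.IsPrime) (hJn : J.absNorm = q ^ 2) :
    ¬ OddOrd (cl J ^ 2 ^ 1) ∧ (OddOrd (cl J ^ 2 ^ 2) ↔ ¬ ∃ b : ZMod p, b ^ 4 = (u : ZMod p)) := by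
  have hp := hpf.out
  have hp2 := hy.ne2
  have hz4 : z ^ 4 = -1 := prim_neg_one (k := 2) h.prim
  have hw : ((z + z ^ 3) * s) ^ 2 = -((2 * p : ℕ) : 𝓞 M) := by
    push_cast
    linear_combination (z + z ^ 3) ^ 2 * h.sq + p * (2 + z ^ 2) * hz4
  obtain ⟨E, s0, g, hs0, hE, hc2⟩ := exists_E hp hp2 hw
  have hJ0 : J ≠ ⊥ := ne_bot_of_absNorm hJn (pow_ne_zero 2 hq.ne_zero)
  obtain ⟨P, f, hP, hqP, hnm, hPf⟩ := nm_prime (K := E) hJ hJn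
  have hPn := (hE.prime_norm hy.four hq hq8 hqp hP hqP).1
  have hP0 : P ≠ ⊥ := ne_bot_of_absNorm hPn hq.ne_zero
  have hf : f = 2 := by rw [hPn] at hPf; exact Nat.pow_right_injective hq.two_le hPf
  subst hf
  obtain ⟨k, hk, hkq⟩ := hE.S3 hc2 hy huv hq hq8 hqp hqu hP hqP
  obtain ⟨hU0, hU4, hU2⟩ := hE.U_cl hp hp2 huv
  obtain ⟨-, hUM⟩ := lift_U hy huv h
  have hUe : exi M (Ideal.span {(u : 𝓞 E), 2 * v + s0}) = Ideal.span {(u : 𝓞 M), 2 * v + (z + z ^ 3) * s} := by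
    rw [exi, Ideal.map_span, Set.image_pair, map_natCast, map_add, map_mul, map_ofNat, map_natCast, hs0]
  rw [← hUe, ← lft_cl hU0] at hUM
  generalize cl (Ideal.span {(u : 𝓞 E), 2 * v + s0}) = U at hk hU4 hU2 hUM
  have hN : clNm E (cl J) = cl P ^ 2 := by rw [clNm_cl hJ0, hnm, cl_pow hP0]
  have hU22 : (U ^ 2) ^ 2 = 1 := by rw [← pow_mul]; exact hU4
  have h4 : ¬ OddOrd (cl P ^ 4) := by
    intro h1
    have h2 := h1.pow k
    rw [show (cl P ^ 4) ^ k = U ^ 2 by rw [hk, ← pow_mul, ← pow_mul]; congr 1; ring] at h2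
    exact hU2 (h2.eq_one' hU22)
  have h8 : OddOrd (cl P ^ 8) → ¬ Even k := by
    rintro h1 ⟨j, hj⟩
    have h2 := h1.pow j
    rw [show (cl P ^ 8) ^ j = U ^ 2 by rw [hk, ← pow_mul, ← pow_mul]; congr 1; rw [hj]; ring] at h2
    exact hU2 (h2.eq_one' hU22)
  refine ⟨fun h1 => h4 ?_, fun h1 => ?_, fun h1 => ?_⟩
  · have := h1.map (clNm E)
    rw [map_pow, hN, ← pow_mul] at this; exact this
  · rw [hkq]
    apply h8
    have := h1.map (clNm E)
    rw [map_pow, hN, ← pow_mul] at this; exact this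
  · rw [hkq, Nat.not_even_iff_odd] at h1
    refine OddOrd.of_pow h1 ?_
    have := h.gal
    have : IsGalois E M := IsGalois.tower_top_of_isGalois ℚ E M
    have hcard : (Finset.univ : Finset Gal(M/E)).card = 2 ^ 2 := by
      rw [Finset.card_univ, ← Nat.card_eq_fintype_card, IsGalois.card_aut_eq_finrank]
      have h5 := Module.finrank_mul_finrank ℚ E M
      rw [hE.fr, h.finrank hp hp2] at h5
      omega
    have h5 : exi M (nm E J) = ∏ g : Gal(M/E), act g.toRingEquiv J := exi_nm hJ0
    obtain ⟨-, h6⟩ := cl_prod (Finset.univ : Finset Gal(M/E)) (fun g => act g.toRingEquiv J)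
      (fun g => act_ne_bot _ hJ0)
    rw [← h5, ← lft_cl (nm_ne_bot hJ0), hnm, cl_pow hP0] at h6
    have h7 := oddOrd_prod (Finset.univ : Finset Gal(M/E)) (fun g => cl (act g.toRingEquiv J)) (cl J)
      (fun g => by
        rw [← clAct_cl _ hJ0]
        apply act_triv hy h
        rw [← hs0]
        apply FaithfulSMul.algebraMap_injective (𝓞 M) M
        exact g.commutes (s0 : E))
    rw [← h6, hcard] at h7
    have h9 := h7.div_pow k
    refine h9.of_div' ?_
    rw [← map_pow, ← pow_mul, ← hk]
    exact hUM
end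

set_option linter.unusedSectionVars false

section
variable {p : ℕ} [hpf : Fact p.Prime]

/-- no prime of degree one over `q`. -/
theorem IsL.not_deg_one {m : ℕ} {M : Type*} [Field M] [NumberField M] {z s : 𝓞 M} (h : IsL p (m + 1) M z s)
    {q : ℕ} (hq : q.Prime) (hq8 : q % 8 = 7) {P : Ideal (𝓞 M)} (hP : P.IsPrime) (hqP : (q : 𝓞 M) ∈ P)
    (hP0 : P ≠ ⊥) : P.absNorm ≠ q := by
  obtain ⟨k, _, _, φ, e, -, hφ, hc, he, he0, hch⟩ := res_field hq hP hP0 hqP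
  intro h1
  have h2 : (2 : k) ≠ 0 := by
    intro h0
    have : ((2 : ℕ) : k) = 0 := by exact_mod_cast h0
    rw [CharP.cast_eq_zero_iff k q] at this
    have := Nat.le_of_dvd two_pos this
    omega
  have h3 := res_size_z (m := m + 1) h2 (φ z) (by
    rw [← map_pow, prim_neg_one (k := m + 2) h.prim, map_neg, map_one])
  rw [hc, h1] at h3
  have h4 : q ≡ 1 [MOD 8] := h3.of_dvd ⟨2 ^ m, by rw [pow_add]; ring⟩
  unfold Nat.ModEq at h4
  omega

theorem iter (hy : Hyp p) {u v : ℕ} (huv : UV p u v) {q : ℕ} (hq : q.Prime) (hq8 : q % 8 = 7)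
    (hqp : ¬ IsSquare (q : ZMod p)) (hqu : u < q) : ∀ (n : ℕ) (M : Type) [Field M] [NumberField M]
    (z s : 𝓞 M), IsL p (n + 1) M z s → ∀ J : Ideal (𝓞 M), J.IsPrime → J.absNorm = q ^ 2 →
    ¬ OddOrd (cl J ^ 2 ^ (n + 1)) ∧ (OddOrd (cl J ^ 2 ^ (n + 2)) ↔ ¬ ∃ b : ZMod p, b ^ 4 = (u : ZMod p))
  | 0, M, _, _, z, s, h, J, hJ, hJn => S2 hy huv h hq hq8 hqp hqu hJ hJn
  | n + 1, M, _, _, z, s, h, J, hJ, hJn => by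
    have hp := hpf.out
    have hp2 := hy.ne2
    obtain ⟨K, z', s', τ, hK, hz, hs, Q, hτ, hτs⟩ := h.sub hp hp2
    obtain ⟨P, f, hP, hqP, hnm, hPf⟩ := nm_prime (K := K) hJ hJn
    have hJ0 : J ≠ ⊥ := ne_bot_of_absNorm hJn (pow_ne_zero 2 hq.ne_zero)
    have hq2 : q ^ 2 ≠ 1 := by
      have := Nat.one_lt_pow two_ne_zero hq.one_lt; omega
    have hP0 : P ≠ ⊥ := by
      rintro rfl
      rcases Nat.eq_zero_or_pos f with rfl | hf
      · rw [pow_zero] at hPf; exact hq2 hPf.symm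
      · rw [Ideal.absNorm_bot, zero_pow hf.ne'] at hPf
        exact pow_ne_zero 2 hq.ne_zero hPf.symm
    have hne := hK.not_deg_one hq hq8 hP hqP hP0
    obtain ⟨k, _, _, φ, e, -, hφ, hc, he, he0, hch⟩ := res_field hq hP hP0 hqP
    rw [he, ← pow_mul] at hPf
    have hef : e * f = 2 := Nat.pow_right_injective hq.two_le hPf
    have hf1 : f = 1 := by
      have h1 : e ≤ 2 := Nat.le_of_dvd two_pos ⟨f, hef.symm⟩
      interval_cases e
      · rw [pow_one] at he; exact absurd he hne
      · omega
    rw [hf1, pow_one] at hnm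
    have hNn : (nm K J).absNorm = q ^ 2 := by rw [nm_absNorm, hJn]
    obtain ⟨i1, i2⟩ := iter hy huv hq hq8 hqp hqu n K z' s' hK (nm K J) (by rw [hnm]; exact hP) hNn
    have hS := fun e => S1 hy hK h Q hz hs hτ hτs hq hq8 hqp hJn e
    exact ⟨fun h1 => i1 ((hS _).1 h1), (hS _).trans i2⟩

/-- Dirichlet -/
theorem exists_q (hp2 : p ≠ 2) (n u : ℕ) : ∃ q : ℕ, q.Prime ∧ u < q ∧ 2 ^ (n + 3) ∣ q + 1 ∧
    ¬ IsSquare (q : ZMod p) := by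
  have hp := hpf.out
  obtain ⟨a, ha⟩ := FiniteField.exists_nonsquare (F := ZMod p) (by rwa [ZMod.ringChar_zmod_n])
  have hcop : Nat.Coprime (2 ^ (n + 3)) p :=
    Nat.Coprime.pow_left _ ((Nat.coprime_primes Nat.prime_two hp).2 (Ne.symm hp2))
  obtain ⟨k, hk1, hk2⟩ := Nat.chineseRemainder hcop (2 ^ (n + 3) - 1) a.val
  have hpos : 0 < 2 ^ (n + 3) := by positivity
  have hk1' : 2 ^ (n + 3) ∣ k + 1 := by
    have h1 := hk1.add_right 1
    rw [Nat.sub_add_cancel hpos] at h1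
    exact (Nat.modEq_zero_iff_dvd).1 (h1.trans (by simp [Nat.ModEq]))
  have hka : (k : ZMod p) = a := by
    rw [← ZMod.natCast_zmod_val a]
    exact (ZMod.natCast_eq_natCast_iff _ _ _).2 hk2
  have hkc : Nat.Coprime k (2 ^ (n + 3) * p) := by
    apply Nat.Coprime.mul_right
    · apply Nat.Coprime.pow_right
      rw [Nat.coprime_two_right, ← Nat.not_even_iff_odd]
      intro he
      have h2 : 2 ∣ k + 1 := dvd_trans (dvd_pow_self 2 (by omega)) hk1'
      obtain ⟨j, hj⟩ := he
      omega
    · rw [Nat.coprime_comm, Nat.Prime.coprime_iff_not_dvd hp]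
      intro hd
      rw [(ZMod.natCast_eq_zero_iff _ _).2 hd] at hka
      exact ha (hka ▸ ⟨0, by simp⟩)
  obtain ⟨q, hqu, hq, hqk⟩ := Nat.forall_exists_prime_gt_and_modEq u
    (mul_ne_zero hpos.ne' hp.ne_zero) hkc
  refine ⟨q, hq, hqu, ?_, ?_⟩
  · have h1 : q + 1 ≡ k + 1 [MOD 2 ^ (n + 3)] := (hqk.of_dvd ⟨p, rfl⟩).add_right 1
    exact (Nat.modEq_zero_iff_dvd).1 (h1.trans ((Nat.modEq_zero_iff_dvd).2 hk1'))
  · have h1 : (q : ZMod p) = a := by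
      rw [← hka]
      exact (ZMod.natCast_eq_natCast_iff _ _ _).2 (hqk.of_dvd ⟨2 ^ (n + 3), by ring⟩)
    rw [h1]; exact ha

theorem card_le_of_pow {k : Type*} [Field k] [Fintype k] {N : ℕ} (hN : 1 < N)
    (h : ∀ x : k, x ^ N = x) : Fintype.card k ≤ N := by
  classical
  obtain ⟨g, hg⟩ := IsCyclic.exists_generator (α := kˣ)
  have h1 := orderOf_eq_card_of_forall_mem_zpowers hg
  rw [Nat.card_eq_fintype_card, Fintype.card_units] at h1
  have h2 : g ^ (N - 1) = 1 := by
    apply mul_right_cancel (b := g)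
    rw [← pow_succ, Nat.sub_add_cancel hN.le, one_mul]
    ext; push_cast; exact h _
  have h3 := orderOf_le_of_pow_eq_one (by omega) h2
  omega

theorem exists_J {m : ℕ} {M : Type} [Field M] [NumberField M] {z s : 𝓞 M} (h : IsL p (m + 1) M z s)
    {q : ℕ} (hq : q.Prime) (hqm : 2 ^ (m + 3) ∣ q + 1) :
    ∃ J : Ideal (𝓞 M), J.IsPrime ∧ J.absNorm = q ^ 2 := by
  have hq8 : q % 8 = 7 := by
    have h1 : 8 ∣ q + 1 := dvd_trans ⟨2 ^ m, by rw [pow_add]; ring⟩ hqm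
    omega
  have hne : Ideal.span {(q : 𝓞 M)} ≠ ⊤ := by
    rw [Ne, ← Ideal.absNorm_eq_one_iff, Ideal.absNorm_span_natCast, RingOfIntegers.rank]
    exact (Nat.one_lt_pow Module.finrank_pos.ne' hq.one_lt).ne'
  obtain ⟨J, hJm, hJ⟩ := Ideal.exists_le_maximal _ hne
  have hqJ : (q : 𝓞 M) ∈ J := hJ (Ideal.mem_span_singleton_self _)
  have hJ0 : J ≠ ⊥ := by
    rintro rfl
    exact hq.ne_zero (by exact_mod_cast (Ideal.mem_bot.1 hqJ))
  have hJp := hJm.isPrime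
  refine ⟨J, hJp, ?_⟩
  have hfin : Finite (𝓞 M ⧸ J) := Ideal.finiteQuotientOfFreeOfNeBot J hJ0
  have := h.gal
  obtain ⟨σ, hσ⟩ := IsArithFrobAt.exists_of_isInvariant ℤ Gal(M/ℚ) J
  have hun : J.under ℤ = Ideal.span {(q : ℤ)} := by
    have h1 : (Ideal.span {(q : ℤ)}).IsMaximal :=
      PrincipalIdealRing.isMaximal_of_irreducible (Nat.prime_iff_prime_int.1 hq).irreducible
    refine (h1.eq_of_le (hJp.under ℤ).ne_top ?_).symm
    rw [Ideal.span_singleton_le_iff_mem, Ideal.under_def, Ideal.mem_comap]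
    simpa using hqJ
  have hcard : Nat.card (ℤ ⧸ J.under ℤ) = q := by rw [hun]; exact Int.card_ideal_quot q
  set g : M ≃+* M := σ.toRingEquiv with hg
  have hfr : ∀ x : 𝓞 M, oi g x - x ^ q ∈ J := by
    intro x
    have := hσ x
    rw [hcard] at this
    exact this
  have hz1 : z ^ 2 ^ (m + 3) = 1 := h.prim.pow_eq_one
  have hz : oi g z = z ^ q := by
    have h2 : ((2 ^ (m + 3) : ℕ) : 𝓞 M) ∉ J := by
      intro h3
      push_cast at h3
      have h4 : (2 : 𝓞 M) ∈ J := hJp.mem_of_pow_mem _ h3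
      obtain ⟨a, b, hab⟩ := bezout_ring (R := 𝓞 M) (a := q) (b := 2)
        (by rw [Nat.coprime_two_right, Nat.odd_iff]; omega)
      exact hJp.ne_top ((Ideal.eq_top_iff_one _).2 (hab ▸
        add_mem (J.mul_mem_left _ hqJ) (J.mul_mem_left _ (by exact_mod_cast h4))))
    have h3 := hσ.apply_of_pow_eq_one hz1 h2
    rw [hcard] at h3
    exact h3
  have hs : oi g s = s ∨ oi g s = -s := by
    have h3 := congrArg (oi g) h.sq
    rw [map_pow, map_natCast, ← h.sq] at h3
    exact sq_eq_sq_iff_eq_or_eq_neg.1 h3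
  have hT : ∀ x : 𝓞 M, oi (g.trans g) x = oi g (oi g x) := fun _ => rfl
  have hzq : z ^ (q * q) = z := by
    obtain ⟨j, hj⟩ := hqm
    have hq1 := hq.one_lt
    have h1 : q * q = 2 ^ (m + 3) * (j * (q - 1)) + 1 := by
      rw [← mul_assoc, ← hj]
      obtain ⟨r, rfl⟩ := Nat.exists_eq_add_of_lt hq1
      rw [show 1 + r + 1 - 1 = r + 1 by omega]; ring
    rw [h1, pow_succ, pow_mul, hz1, one_pow, one_mul]
  have hid : ∀ x : 𝓞 M, oi g (oi g x) = x := by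
    intro x
    have h1 := h.ext_oi (g.trans g) (RingEquiv.refl M)
      (by rw [hT, hz, map_pow, hz, ← pow_mul, hzq]; rfl)
      (by
        rw [hT]
        rcases hs with h1 | h1
        · rw [h1, h1]; rfl
        · rw [h1, map_neg, h1, neg_neg]; rfl) (x : M)
    apply FaithfulSMul.algebraMap_injective (𝓞 M) M
    exact h1
  obtain ⟨k, _, _, φ, e, hsur, hφ, hc, he, he0, hch⟩ := res_field hq hJp hJ0 hqJ
  have hk1 : ∀ x, φ (oi g x) = φ x ^ q := by
    intro x
    rw [← map_pow, ← sub_eq_zero, ← map_sub, hφ]; exact hfr x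
  have hle : Fintype.card k ≤ q ^ 2 := by
    refine card_le_of_pow (Nat.one_lt_pow two_ne_zero hq.one_lt) ?_
    intro y
    obtain ⟨x, rfl⟩ := hsur y
    conv_rhs => rw [← hid x, hk1, hk1]
    rw [← pow_mul, pow_two]
  have hne1 := h.not_deg_one hq hq8 hJp hqJ hJ0
  rw [hc, he] at hle
  have he2 : e ≤ 2 := (Nat.pow_le_pow_iff_right hq.one_lt).1 hle
  rw [he] at hne1 ⊢
  interval_cases e
  · rw [pow_one] at hne1; exact absurd rfl hne1
  · rfl

theorem main_L (hy : Hyp p) {u v : ℕ} (huv : UV p u v) {n : ℕ} {M : Type} [Field M] [NumberField M]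
    {z s : 𝓞 M} (h : IsL p (n + 1) M z s) :
    Nonempty (CommGroup.primaryComponent (ClassGroup (𝓞 M)) 2 ≃*
      Multiplicative (ZMod 2 × ZMod (2 ^ (n + 1 + 1)))) ↔ ¬ ∃ b : ZMod p, b ^ 4 = (u : ZMod p) := by
  have hp := hpf.out
  have hp8 : p % 8 = 1 := by have := hy.mod; omega
  obtain ⟨q, hq, hqu, hqm, hqp⟩ := exists_q hy.ne2 n u
  have hq8 : q % 8 = 7 := by
    have h1 : 8 ∣ q + 1 := dvd_trans ⟨2 ^ n, by rw [pow_add]; ring⟩ hqm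
    omega
  obtain ⟨J, hJ, hJn⟩ := exists_J h hq hqm
  obtain ⟨i1, i2⟩ := iter hy huv hq hq8 hqp hqu n M z s h J hJ hJn
  obtain ⟨l, -, hl, -, -, -, hlf, -, -⟩ := exists_l hp hp8 h
  have hl2 := l_sq_odd hy h (ne_bot_of_absNorm hl two_ne_zero) hlf
  obtain ⟨χa, ha, -⟩ := char_a hy h
  obtain ⟨χb, hb, hb'⟩ := char_b hy h
  rw [← i2]
  exact G2 (c2_L hy h) χa Dp_sq χb Dp_sq (cl l) (cl J) (ha l hl) (hb l hl)
    (hb' J q hq hq8 hqp hJn) hl2 (n + 1) i1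

end
set_option linter.unusedSectionVars false

theorem Lfield_eq {n p : ℕ} {ζ r : ℂ} (hζ : IsPrimitiveRoot ζ (2 ^ (n + 2))) (hr : r ^ 2 = p) :
    Lfield n (p : ℤ) = adjoin ℚ {ζ, r} := by
  apply le_antisymm
  · rw [Lfield, adjoin_le_iff]
    rintro x (hx | hx)
    · obtain ⟨i, -, rfl⟩ := hζ.eq_pow_of_pow_eq_one hx
      exact pow_mem (subset_adjoin ℚ {ζ, r} (by simp)) i
    · have hr' : r ∈ adjoin ℚ {ζ, r} := subset_adjoin ℚ {ζ, r} (by simp)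
      have h1 : x ^ 2 = r ^ 2 := by rw [hr]; simpa using hx
      rcases sq_eq_sq_iff_eq_or_eq_neg.1 h1 with h2 | h2
      · rw [h2]; exact hr'
      · rw [h2]; exact neg_mem hr'
  · rw [adjoin_le_iff]
    rintro x (rfl | hx)
    · exact subset_adjoin ℚ _ (Or.inl hζ.pow_eq_one)
    · rw [Set.mem_singleton_iff] at hx
      exact subset_adjoin ℚ _ (Or.inr (by rw [hx]; simpa using hr))

theorem top_aux {F L : Type*} [Field F] [Field L] [Algebra F L] (K : IntermediateField F L) (a b : L)
    (ha : a ∈ K) (hb : b ∈ K) (hK : K = adjoin F {a, b}) :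
    adjoin F {(⟨a, ha⟩ : K), (⟨b, hb⟩ : K)} = ⊤ := by
  apply lift_injective
  rw [lift_adjoin, lift_top, Set.image_pair]
  exact hK.symm

theorem exists_Lfield (n p : ℕ) : ∃ (_ : NumberField (Lfield n (p : ℤ))) (z s : 𝓞 (Lfield n (p : ℤ))),
    IsL p n (Lfield n (p : ℤ)) z s := by
  obtain ⟨ζ, hζ⟩ : ∃ ζ : ℂ, IsPrimitiveRoot ζ (2 ^ (n + 2)) :=
    ⟨_, Complex.isPrimitiveRoot_exp (2 ^ (n + 2)) (by positivity)⟩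
  obtain ⟨r, hr⟩ : ∃ r : ℂ, r ^ 2 = p := ⟨((Real.sqrt p : ℝ) : ℂ), by
    rw [← Complex.ofReal_pow, Real.sq_sqrt (Nat.cast_nonneg p)]; simp⟩
  have hK := Lfield_eq hζ hr
  generalize Lfield n (p : ℤ) = K at hK
  have hzi : IsIntegral ℤ ζ := hζ.isIntegral (by positivity)
  have hri : IsIntegral ℤ r := IsIntegral.of_pow two_pos (by rw [hr]; exact isIntegral_natCast p)
  have hfd : FiniteDimensional ℚ K := by
    rw [hK]
    apply finiteDimensional_adjoin
    rintro x (rfl | hx)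
    · exact hzi.tower_top
    · rw [Set.mem_singleton_iff] at hx
      rw [hx]; exact hri.tower_top
  have hN : NumberField K := { to_charZero := inferInstance, to_finiteDimensional := by convert hfd }
  have hzK : ζ ∈ K := by rw [hK]; exact subset_adjoin ℚ {ζ, r} (by simp)
  have hrK : r ∈ K := by rw [hK]; exact subset_adjoin ℚ {ζ, r} (by simp)
  have hint : ∀ (x : ℂ) (hx : x ∈ K), IsIntegral ℤ x → ∃ y : 𝓞 K, algebraMap (𝓞 K) K y = ⟨x, hx⟩ := by
    intro x hx h
    have h1 : IsIntegral ℤ (⟨x, hx⟩ : K) := by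
      rw [← isIntegral_algHom_iff (f := (algebraMap K ℂ).toIntAlgHom) (algebraMap K ℂ).injective]
      exact h
    exact ⟨⟨⟨x, hx⟩, h1⟩, rfl⟩
  obtain ⟨z, hz⟩ := hint ζ hzK hzi
  obtain ⟨s, hs⟩ := hint r hrK hri
  refine ⟨hN, z, s, ?_, ?_, ?_⟩
  · refine IsPrimitiveRoot.of_map_of_injective (f := (algebraMap K ℂ).comp (algebraMap (𝓞 K) K)) ?_ ?_
    · rw [RingHom.comp_apply, hz]; exact hζ
    · exact (algebraMap K ℂ).injective.comp (FaithfulSMul.algebraMap_injective (𝓞 K) K)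
  · apply FaithfulSMul.algebraMap_injective (𝓞 K) K
    rw [map_pow, map_natCast, hs]
    apply (algebraMap K ℂ).injective
    rw [map_natCast]
    exact hr
  · change adjoin ℚ {algebraMap (𝓞 K) K z, algebraMap (𝓞 K) K s} = ⊤
    rw [hz, hs]
    have h1 := top_aux K ζ r hzK hrK hK
    convert h1 <;> exact Subsingleton.elim _ _

/-- for a prime `p ≡ 9 (mod 16)` with `2` a fourth power residue mod `p`,
written as `p = u² - 2v²` with `u, v > 0` and `u ≡ 1 (mod 8)`, and any `n ≥ 1`:
the 2-class group of `L_{n,p}` is `ℤ/2ℤ × ℤ/2^{n+1}ℤ` iff `u` is a quadratic residue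
but not a fourth power residue mod `p`. -/
theorem twoClassGroup_Lfield_prime_iff_quartic
    (p : ℕ) (hp : p.Prime) (hp16 : p % 16 = 9)
    (h24 : ∃ x : ZMod p, x ^ 4 = 2)
    (u v : ℕ) (hu : 0 < u) (hv : 0 < v)
    (huv : (p : ℤ) = (u : ℤ) ^ 2 - 2 * (v : ℤ) ^ 2) (hu8 : u % 8 = 1)
    (n : ℕ) (hn : 1 ≤ n) :
    Nonempty ((twoClassGroup (Lfield n (p : ℤ))) ≃*
        Multiplicative (ZMod 2 × ZMod (2 ^ (n + 1)))) ↔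
      ((∃ x : ZMod p, x ^ 2 = (u : ZMod p)) ∧ ¬ ∃ x : ZMod p, x ^ 4 = (u : ZMod p)) := by

  have : Fact p.Prime := ⟨hp⟩
  have hy : Hyp p := ⟨hp16, h24⟩
  have hUV : UV p u v := ⟨by zify; rw [huv]; ring, hu8⟩
  obtain ⟨m, rfl⟩ : ∃ m, n = m + 1 := ⟨n - 1, by omega⟩
  obtain ⟨hN, z, s, hL⟩ := exists_Lfield (m + 1) p
  have h1 := main_L hy hUV hL
  have h2 : ∃ x : ZMod p, x ^ 2 = (u : ZMod p) := by
    obtain ⟨x, hx⟩ := hUV.isSquare hp16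
    exact ⟨x, by rw [hx, pow_two]⟩
  exact h1.trans ⟨fun h => ⟨h2, h⟩, fun h => h.2⟩
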